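/- The validity problem over the frame (ℝ², ≤) is decidable: the predicate on temporal formulas 'φ is valid over (ℝ², ≤)' is computable, where ≤ is the componentwise order on ℝ². -/

import Mathlib

namespace Temporal

/-- Temporal propositional formulas: `φ ::= q | ¬φ | φ∨φ' | Fφ | Pφ`. -/
inductive TForm : Type
  | prop : ℕ → TForm
  | neg : TForm → TForm
  | or : TForm → TForm → TForm
  | fut : TForm → TForm
  | past : TForm → TForm
  deriving DecidableEq

/-- Truth of a temporal formula at a point of a Kripke structure. -/
def TSat {X : Type*} (R : X → X → Prop) (v : ℕ → Set X) : TForm → X → Prop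
  | .prop n, x => x ∈ v n
  | .neg φ, x => ¬ TSat R v φ x
  | .or φ ψ, x => TSat R v φ x ∨ TSat R v ψ x
  | .fut φ, x => ∃ y, R x y ∧ TSat R v φ y
  | .past φ, x => ∃ y, R y x ∧ TSat R v φ y

/-- Validity of a temporal formula over a Kripke frame. -/
def TValid {X : Type*} (R : X → X → Prop) (φ : TForm) : Prop :=
  ∀ (v : ℕ → Set X) (x : X), TSat R v φ x

/-- Satisfiability of a temporal formula over a Kripke frame. -/
def TSatisfiable {X : Type*} (R : X → X → Prop) (φ : TForm) : Prop :=
  ∃ (v : ℕ → Set X) (x : X), TSat R v φ x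

/-- An explicit encoding of temporal formulas as natural numbers. -/
def encodeT : TForm → ℕ
  | .prop n => 5 * n
  | .neg φ => 5 * encodeT φ + 1
  | .or φ ψ => 5 * Nat.pair (encodeT φ) (encodeT ψ) + 2
  | .fut φ => 5 * encodeT φ + 3
  | .past φ => 5 * encodeT φ + 4

/-- The inverse decoding of natural numbers as temporal formulas. -/
def decodeT (n : ℕ) : TForm :=
  if h0 : n % 5 = 0 then .prop (n / 5)
  else
    have hn : 0 < n := Nat.pos_of_ne_zero (by rintro rfl; simp at h0)
    have hlt : n / 5 < n := Nat.div_lt_self hn (by norm_num)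
    have h1 : (n / 5).unpair.1 < n := lt_of_le_of_lt (Nat.unpair_left_le _) hlt
    have h2 : (n / 5).unpair.2 < n := lt_of_le_of_lt (Nat.unpair_right_le _) hlt
    if n % 5 = 1 then .neg (decodeT (n / 5))
    else if n % 5 = 2 then .or (decodeT (n / 5).unpair.1) (decodeT (n / 5).unpair.2)
    else if n % 5 = 3 then .fut (decodeT (n / 5))
    else .past (decodeT (n / 5))

theorem decodeT_encodeT (φ : TForm) : decodeT (encodeT φ) = φ := by
  induction φ with
  | prop n => rw [encodeT, decodeT]; simp [Nat.mul_div_cancel_left, Nat.mul_mod_right]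
  | neg φ ih => rw [encodeT, decodeT]; simp [Nat.mul_add_mod, Nat.mul_add_div, ih]
  | or φ ψ ih1 ih2 => rw [encodeT, decodeT]; simp [Nat.mul_add_mod, Nat.mul_add_div, ih1, ih2]
  | fut φ ih => rw [encodeT, decodeT]; simp [Nat.mul_add_mod, Nat.mul_add_div, ih]
  | past φ ih => rw [encodeT, decodeT]; simp [Nat.mul_add_mod, Nat.mul_add_div, ih]

theorem encodeT_decodeT (n : ℕ) : encodeT (decodeT n) = n := by
  induction n using Nat.strong_induction_on with
  | _ n ih =>
    rw [decodeT]
    by_cases h0 : n % 5 = 0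
    · simp only [h0, dif_pos]
      rw [encodeT]
      omega
    · have hn : 0 < n := Nat.pos_of_ne_zero (by rintro rfl; simp at h0)
      have hlt : n / 5 < n := Nat.div_lt_self hn (by norm_num)
      have h1 : (n / 5).unpair.1 < n := lt_of_le_of_lt (Nat.unpair_left_le _) hlt
      have h2 : (n / 5).unpair.2 < n := lt_of_le_of_lt (Nat.unpair_right_le _) hlt
      rw [dif_neg h0]
      by_cases e1 : n % 5 = 1
      · rw [if_pos e1, encodeT, ih _ hlt]
        omega
      · rw [if_neg e1]
        by_cases e2 : n % 5 = 2
        · rw [if_pos e2, encodeT, ih _ h1, ih _ h2, Nat.pair_unpair]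
          omega
        · rw [if_neg e2]
          by_cases e3 : n % 5 = 3
          · rw [if_pos e3, encodeT, ih _ hlt]
            omega
          · rw [if_neg e3, encodeT, ih _ hlt]
            omega

instance : Encodable TForm :=
  ⟨encodeT, fun n => some (decodeT n), fun φ => congrArg some (decodeT_encodeT φ)⟩

instance : Denumerable TForm :=
  ⟨fun n => ⟨decodeT n, rfl, encodeT_decodeT n⟩⟩

end Temporal

set_option linter.unusedVariables false
namespace Temporal

/-! ### Abstract labelled systems and traces -/

/-- Abstract systems of labels with demands and witnesses. -/
structure Sys (L ι : Type) where
  le : L → L → Prop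
  A : L → ι → Prop
  B : L → ι → Prop
  wF : L → ι → Prop
  wP : L → ι → Prop
  rfl' : ∀ l, le l l
  trans' : ∀ {l m k}, le l m → le m k → le l k
  axF : ∀ {l m k i}, le l m → le m k → A l i → (A k i ∨ wF k i) → A m i
  axP : ∀ {l m k i}, le l m → le m k → B k i → (B l i ∨ wP l i) → B m i

namespace Sys
variable {L ι : Type} (σ : Sys L ι)

def eqv (l m : L) : Prop := σ.le l m ∧ σ.le m l
def WF (l : L) (i : ι) : Prop := ∃ l', σ.eqv l l' ∧ σ.wF l' i
def WP (l : L) (i : ι) : Prop := ∃ l', σ.eqv l l' ∧ σ.wP l' i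

def dual : Sys L ι where
  le l m := σ.le m l
  A := σ.B
  B := σ.A
  wF := σ.wP
  wP := σ.wF
  rfl' := σ.rfl'
  trans' := fun h1 h2 => σ.trans' h2 h1
  axF := fun h1 h2 h3 h4 => σ.axP h2 h1 h3 h4
  axP := fun h1 h2 h3 h4 => σ.axF h2 h1 h3 h4

theorem dual_dual : σ.dual.dual = σ := rfl

variable {σ}
theorem eqv.refl (l : L) : σ.eqv l l := ⟨σ.rfl' l, σ.rfl' l⟩
theorem eqv.symm {l m : L} (h : σ.eqv l m) : σ.eqv m l := ⟨h.2, h.1⟩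
theorem eqv.trans {l m k : L} (h : σ.eqv l m) (h' : σ.eqv m k) : σ.eqv l k :=
  ⟨σ.trans' h.1 h'.1, σ.trans' h'.2 h.2⟩
theorem eqv_dual {l m : L} : σ.dual.eqv l m ↔ σ.eqv l m := And.comm
theorem WF_dual {l : L} {i : ι} : σ.dual.WF l i ↔ σ.WP l i := by
  unfold WF WP; simp only [eqv_dual]; rfl
theorem WP_dual {l : L} {i : ι} : σ.dual.WP l i ↔ σ.WF l i := by
  unfold WF WP; simp only [eqv_dual]; rfl
theorem eqv.A {l m : L} {i : ι} (h : σ.eqv l m) (hA : σ.A l i) : σ.A m i :=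
  σ.axF h.1 h.2 hA (Or.inl hA)
theorem eqv.B {l m : L} {i : ι} (h : σ.eqv l m) (hA : σ.B l i) : σ.B m i :=
  σ.axP h.1 h.2 hA (Or.inl hA)
theorem eqv.WF {l m : L} {i : ι} (h : σ.eqv l m) (hA : σ.WF l i) : σ.WF m i := by
  obtain ⟨l', h1, h2⟩ := hA; exact ⟨l', h.symm.trans h1, h2⟩
theorem eqv.WP {l m : L} {i : ι} (h : σ.eqv l m) (hA : σ.WP l i) : σ.WP m i := by
  obtain ⟨l', h1, h2⟩ := hA; exact ⟨l', h.symm.trans h1, h2⟩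
theorem WF_of {l : L} {i : ι} (h : σ.wF l i) : σ.WF l i := ⟨l, eqv.refl l, h⟩
theorem WP_of {l : L} {i : ι} (h : σ.wP l i) : σ.WP l i := ⟨l, eqv.refl l, h⟩
theorem eqv.le_right {l m k : L} (h : σ.eqv l m) (h' : σ.le k l) : σ.le k m := σ.trans' h' h.1
theorem eqv.le_left {l m k : L} (h : σ.eqv l m) (h' : σ.le l k) : σ.le m k := σ.trans' h.2 h'
theorem eqv_mid {l m k k' : L} (h1 : σ.le l m) (h2 : σ.le m k) (h : σ.eqv l k') (h' : σ.eqv k k') :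
    σ.eqv m k' :=
  ⟨σ.trans' h2 h'.1, σ.trans' h.2 h1⟩
end Sys

/-- Traces of one-dimensional monotone label functions. -/
@[ext] structure Tr (L : Type) where
  pres : L → Prop
  nd : L → Prop
  mn : L → Prop
  mx : L → Prop

namespace Tr
variable {L ι : Type}

def conc (S T : Tr L) : Tr L where
  pres l := S.pres l ∨ T.pres l
  nd l := S.nd l ∨ T.nd l
  mn l := S.mn l ∨ (T.mn l ∧ ¬ S.pres l)
  mx l := T.mx l ∨ (S.mx l ∧ ¬ T.pres l)

def elem (σ : Sys L ι) (p e q : L) : Tr L where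
  pres l := σ.eqv p l ∨ σ.eqv e l ∨ σ.eqv q l
  nd l := σ.eqv e l
  mn l := l = p ∨ (l = q ∧ ¬ σ.eqv q e ∧ ¬ σ.eqv q p)
  mx l := l = q ∨ (l = p ∧ ¬ σ.eqv p e ∧ ¬ σ.eqv p q)
end Tr

section
variable {L ι : Type} (σ : Sys L ι)

def MonoI (g : ℝ → L) (a b : ℝ) : Prop :=
  ∀ x y, a ≤ x → x ≤ y → y ≤ b → σ.le (g x) (g y)

def tr (g : ℝ → L) (a b : ℝ) : Tr L where
  pres l := ∃ x, a ≤ x ∧ x ≤ b ∧ σ.eqv (g x) l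
  nd l := ∃ x y, a ≤ x ∧ x < y ∧ y ≤ b ∧ σ.eqv (g x) l ∧ σ.eqv (g y) l
  mn l := ∃ x, a ≤ x ∧ x ≤ b ∧ g x = l ∧ ∀ y, a ≤ y → y ≤ b → σ.eqv (g y) l → x ≤ y
  mx l := ∃ x, a ≤ x ∧ x ≤ b ∧ g x = l ∧ ∀ y, a ≤ y → y ≤ b → σ.eqv (g y) l → y ≤ x

variable {σ}

theorem MonoI.sub {g : ℝ → L} {a b a' b' : ℝ} (h : MonoI σ g a b) (ha : a ≤ a') (hb : b' ≤ b) :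
    MonoI σ g a' b' := fun x y h1 h2 h3 => h x y (ha.trans h1) h2 (h3.trans hb)

theorem tr_conc {g : ℝ → L} {a m b : ℝ} (hg : MonoI σ g a b) (h1 : a ≤ m) (h2 : m ≤ b) :
    tr σ g a b = Tr.conc (tr σ g a m) (tr σ g m b) := by
  ext l
  · constructor
    · rintro ⟨x, hx, hx', h⟩
      rcases le_total x m with h3 | h3
      · exact Or.inl ⟨x, hx, h3, h⟩
      · exact Or.inr ⟨x, h3, hx', h⟩
    · rintro (⟨x, hx, hx', h⟩ | ⟨x, hx, hx', h⟩)
      · exact ⟨x, hx, hx'.trans h2, h⟩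
      · exact ⟨x, h1.trans hx, hx', h⟩
  · constructor
    · rintro ⟨x, y, hx, hxy, hy, h, h'⟩
      rcases le_total y m with h3 | h3
      · exact Or.inl ⟨x, y, hx, hxy, h3, h, h'⟩
      rcases lt_or_ge x m with h4 | h4
      · exact Or.inl ⟨x, m, hx, h4, le_rfl, h,
          Sys.eqv_mid (hg x m hx h4.le h2) (hg m y h1 h3 hy) h h'⟩
      · exact Or.inr ⟨x, y, h4, hxy, hy, h, h'⟩
    · rintro (⟨x, y, hx, hxy, hy, h, h'⟩ | ⟨x, y, hx, hxy, hy, h, h'⟩)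
      · exact ⟨x, y, hx, hxy, hy.trans h2, h, h'⟩
      · exact ⟨x, y, h1.trans hx, hxy, hy, h, h'⟩
  · constructor
    · rintro ⟨x, hx, hx', h, h'⟩
      rcases le_or_gt x m with h3 | h3
      · exact Or.inl ⟨x, hx, h3, h, fun y hy hy' => h' y hy (hy'.trans h2)⟩
      · refine Or.inr ⟨⟨x, h3.le, hx', h, fun y hy hy' => h' y (h1.trans hy) hy'⟩, ?_⟩
        rintro ⟨y, hy, hy', h4⟩
        have := h' y hy (hy'.trans h2) h4
        linarith
    · rintro (⟨x, hx, hx', h, h'⟩ | ⟨⟨x, hx, hx', h, h'⟩, h4⟩)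
      · refine ⟨x, hx, hx'.trans h2, h, fun y hy hy' h5 => ?_⟩
        rcases le_total y m with h3 | h3
        · exact h' y hy h3 h5
        · exact hx'.trans h3
      · refine ⟨x, h1.trans hx, hx', h, fun y hy hy' h5 => ?_⟩
        rcases le_total y m with h3 | h3
        · exact (h4 ⟨y, hy, h3, h5⟩).elim
        · exact h' y h3 hy' h5
  · constructor
    · rintro ⟨x, hx, hx', h, h'⟩
      rcases lt_or_ge x m with h3 | h3
      · refine Or.inr ⟨⟨x, hx, h3.le, h, fun y hy hy' => h' y hy (hy'.trans h2)⟩, ?_⟩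
        rintro ⟨y, hy, hy', h4⟩
        have := h' y (h1.trans hy) hy' h4
        linarith
      · exact Or.inl ⟨x, h3, hx', h, fun y hy hy' => h' y (h1.trans hy) hy'⟩
    · rintro (⟨x, hx, hx', h, h'⟩ | ⟨⟨x, hx, hx', h, h'⟩, h4⟩)
      · refine ⟨x, h1.trans hx, hx', h, fun y hy hy' h5 => ?_⟩
        rcases le_total y m with h3 | h3
        · exact h3.trans hx
        · exact h' y h3 hy' h5
      · refine ⟨x, hx, hx'.trans h2, h, fun y hy hy' h5 => ?_⟩
        rcases le_total y m with h3 | h3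
        · exact h' y hy h3 h5
        · exact (h4 ⟨y, h3, hy', h5⟩).elim

theorem tr_elem {g : ℝ → L} {a b : ℝ} {e : L} (hg : MonoI σ g a b) (hab : a < b)
    (he : ∀ x, a < x → x < b → σ.eqv (g x) e) : tr σ g a b = Tr.elem σ (g a) e (g b) := by
  obtain ⟨u, hu1, hu2⟩ := exists_between hab
  obtain ⟨v, hv1, hv2⟩ := exists_between hu2
  have ha : ∀ {x}, a ≤ x → x ≤ b → x = a ∨ x = b ∨ (a < x ∧ x < b) := by
    intro x h1 h2
    rcases h1.eq_or_lt with h | h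
    · exact Or.inl h.symm
    rcases h2.eq_or_lt with h' | h'
    · exact Or.inr (Or.inl h')
    · exact Or.inr (Or.inr ⟨h, h'⟩)
  have hae : ∀ {l}, σ.eqv (g a) l → σ.eqv (g b) l → σ.eqv e l := fun h1 h2 =>
    (he u hu1 hu2).symm.trans (Sys.eqv_mid (hg a u le_rfl hu1.le hu2.le) (hg u b hu1.le hu2.le le_rfl) h1 h2)
  ext l
  · constructor
    · rintro ⟨x, hx, hx', h⟩
      rcases ha hx hx' with rfl | rfl | h1
      · exact Or.inl h
      · exact Or.inr (Or.inr h)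
      · exact Or.inr (Or.inl ((he x h1.1 h1.2).symm.trans h))
    · rintro (h | h | h)
      · exact ⟨a, le_rfl, hab.le, h⟩
      · exact ⟨u, hu1.le, hu2.le, (he u hu1 hu2).trans h⟩
      · exact ⟨b, hab.le, le_rfl, h⟩
  · constructor
    · rintro ⟨x, y, hx, hxy, hy, h, h'⟩
      rcases ha hx (hxy.le.trans hy) with rfl | rfl | h1
      · rcases ha hxy.le hy with rfl | rfl | h2
        · exact absurd hxy (lt_irrefl _)
        · exact hae h h'
        · exact (he y h2.1 h2.2).symm.trans h'
      · exact absurd hxy (not_lt.2 hy)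
      · exact (he x h1.1 h1.2).symm.trans h
    · intro h
      exact ⟨u, v, hu1.le, hv1, hv2.le, (he u hu1 hu2).trans h, (he v (hu1.trans hv1) hv2).trans h⟩
  · constructor
    · rintro ⟨x, hx, hx', rfl, h'⟩
      rcases ha hx hx' with rfl | rfl | h1
      · exact Or.inl rfl
      · refine Or.inr ⟨rfl, fun h => ?_, fun h => ?_⟩
        · have := h' u hu1.le hu2.le ((he u hu1 hu2).trans h.symm)
          linarith
        · have := h' a le_rfl hab.le h.symm
          linarith
      · obtain ⟨y, hy1, hy2⟩ := exists_between h1.1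
        have := h' y hy1.le (hy2.le.trans hx') ((he y hy1 (hy2.trans h1.2)).trans (he x h1.1 h1.2).symm)
        linarith
    · rintro (rfl | ⟨rfl, h, h2⟩)
      · exact ⟨a, le_rfl, hab.le, rfl, fun y hy _ _ => hy⟩
      · refine ⟨b, hab.le, le_rfl, rfl, fun y hy hy' h3 => ?_⟩
        rcases ha hy hy' with rfl | rfl | h1
        · exact (h2 h3.symm).elim
        · exact le_rfl
        · exact (h (h3.symm.trans (he y h1.1 h1.2))).elim
  · constructor
    · rintro ⟨x, hx, hx', rfl, h'⟩
      rcases ha hx hx' with rfl | rfl | h1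
      · refine Or.inr ⟨rfl, fun h => ?_, fun h => ?_⟩
        · have := h' u hu1.le hu2.le ((he u hu1 hu2).trans h.symm)
          linarith
        · have := h' b hab.le le_rfl h.symm
          linarith
      · exact Or.inl rfl
      · obtain ⟨y, hy1, hy2⟩ := exists_between h1.2
        have := h' y (hx.trans hy1.le) hy2.le ((he y (h1.1.trans hy1) hy2).trans (he x h1.1 h1.2).symm)
        linarith
    · rintro (rfl | ⟨rfl, h, h2⟩)
      · exact ⟨b, hab.le, le_rfl, rfl, fun y _ hy _ => hy⟩
      · refine ⟨a, le_rfl, hab.le, rfl, fun y hy hy' h3 => ?_⟩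
        rcases ha hy hy' with rfl | rfl | h1
        · exact le_rfl
        · exact (h2 h3.symm).elim
        · exact (h (h3.symm.trans (he y h1.1 h1.2))).elim


/-! ### Reparametrization -/

def cls (σ : Sys L ι) (g : ℝ → L) (a b : ℝ) (l : L) : Set ℝ := {y | a ≤ y ∧ y ≤ b ∧ σ.eqv (g y) l}
noncomputable def clo (σ : Sys L ι) (g : ℝ → L) (a b : ℝ) (l : L) : ℝ := sInf (cls σ g a b l)
noncomputable def chi (σ : Sys L ι) (g : ℝ → L) (a b : ℝ) (l : L) : ℝ := sSup (cls σ g a b l)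

noncomputable def aff (u v u' v' x : ℝ) : ℝ := u' + (x - u) / (v - u) * (v' - u')

theorem cls_congr {g : ℝ → L} {a b : ℝ} {l m : L} (h : σ.eqv l m) : cls σ g a b l = cls σ g a b m := by
  ext y
  exact ⟨fun h' => ⟨h'.1, h'.2.1, h'.2.2.trans h⟩, fun h' => ⟨h'.1, h'.2.1, h'.2.2.trans h.symm⟩⟩
theorem clo_congr {g : ℝ → L} {a b : ℝ} {l m : L} (h : σ.eqv l m) : clo σ g a b l = clo σ g a b m := by
  unfold clo; rw [cls_congr h]
theorem chi_congr {g : ℝ → L} {a b : ℝ} {l m : L} (h : σ.eqv l m) : chi σ g a b l = chi σ g a b m := by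
  unfold chi; rw [cls_congr h]

theorem cls_bddB {g : ℝ → L} {a b : ℝ} {l : L} : BddBelow (cls σ g a b l) := ⟨a, fun _ h => h.1⟩
theorem cls_bddA {g : ℝ → L} {a b : ℝ} {l : L} : BddAbove (cls σ g a b l) := ⟨b, fun _ h => h.2.1⟩
theorem clo_le {g : ℝ → L} {a b x : ℝ} {l : L} (hx : x ∈ cls σ g a b l) : clo σ g a b l ≤ x :=
  csInf_le cls_bddB hx
theorem le_chi {g : ℝ → L} {a b x : ℝ} {l : L} (hx : x ∈ cls σ g a b l) : x ≤ chi σ g a b l :=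
  le_csSup cls_bddA hx
theorem cls_of_between {g : ℝ → L} {a b x : ℝ} {l : L} (hg : MonoI σ g a b)
    (hne : (cls σ g a b l).Nonempty) (h1 : clo σ g a b l < x) (h2 : x < chi σ g a b l) :
    ∃ x1 x2, x1 < x ∧ x < x2 ∧ x1 ∈ cls σ g a b l ∧ x2 ∈ cls σ g a b l ∧ x ∈ cls σ g a b l := by
  obtain ⟨x1, h3, h4⟩ := exists_lt_of_csInf_lt hne h1
  obtain ⟨x2, h5, h6⟩ := exists_lt_of_lt_csSup hne h2
  have ha : a ≤ x := h3.1.trans h4.le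
  have hb : x ≤ b := h6.le.trans h5.2.1
  exact ⟨x1, x2, h4, h6, h3, h5, ha, hb,
    Sys.eqv_mid (hg x1 x h3.1 h4.le hb) (hg x x2 ha h6.le h5.2.1) h3.2.2 h5.2.2⟩

theorem aff_lt {u v u' v' x y : ℝ} (h : u < v) (h' : u' < v') (hxy : x < y) :
    aff u v u' v' x < aff u v u' v' y := by
  unfold aff
  have : (x - u) / (v - u) < (y - u) / (v - u) := by
    apply div_lt_div_of_pos_right <;> linarith
  nlinarith
theorem aff_left {u v u' v' : ℝ} : aff u v u' v' u = u' := by simp [aff]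
theorem aff_right {u v u' v' : ℝ} (h : u < v) : aff u v u' v' v = v' := by
  unfold aff; rw [div_self (by linarith)]; ring
theorem aff_aff {u v u' v' x : ℝ} (h : u < v) (h' : u' < v') :
    aff u v u' v' (aff u' v' u v x) = x := by
  unfold aff
  have : v - u ≠ 0 := by linarith
  have : v' - u' ≠ 0 := by linarith
  field_simp
  ring

section reparam
variable {g g' : ℝ → L} {a b c d : ℝ}

noncomputable def repT (σ : Sys L ι) (g g' : ℝ → L) (a b c d x : ℝ) : ℝ :=
  aff (clo σ g a b (g x)) (chi σ g a b (g x)) (clo σ g' c d (g x)) (chi σ g' c d (g x)) x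

theorem clo_lt_chi_iff {l : L} : (clo σ g a b l < chi σ g a b l) ↔ (tr σ g a b).nd l := by
  constructor
  · intro h
    by_cases hne : (cls σ g a b l).Nonempty
    · obtain ⟨x2, h5, h6⟩ := exists_lt_of_lt_csSup hne h
      obtain ⟨x1, h3, h4⟩ := exists_lt_of_csInf_lt hne h6
      exact ⟨x1, x2, h3.1, h4, h5.2.1, h3.2.2, h5.2.2⟩
    · rw [Set.not_nonempty_iff_eq_empty] at hne
      simp [clo, chi, hne] at h
  · rintro ⟨x, y, h1, h2, h3, h4, h5⟩
    exact (clo_le ⟨h1, h2.le.trans h3, h4⟩).trans_lt (h2.trans_le (le_chi ⟨h1.trans h2.le, h3, h5⟩))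

theorem repT_spec (hg : MonoI σ g a b) (hg' : MonoI σ g' c d) (h : tr σ g a b = tr σ g' c d)
    {x : ℝ} (hx : a ≤ x) (hx' : x ≤ b) :
    c ≤ repT σ g g' a b c d x ∧ repT σ g g' a b c d x ≤ d ∧ σ.eqv (g x) (g' (repT σ g g' a b c d x)) ∧
    (g x = g' (repT σ g g' a b c d x) ∨ ∃ x1 x2, a ≤ x1 ∧ x1 < x ∧ x < x2 ∧ x2 ≤ b ∧
      σ.eqv (g x1) (g x) ∧ σ.eqv (g x2) (g x)) := by
  set l := g x with hl
  have hxc : x ∈ cls σ g a b l := ⟨hx, hx', Sys.eqv.refl _⟩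
  have hpres : (tr σ g' c d).pres l := h ▸ ⟨x, hx, hx', Sys.eqv.refl _⟩
  obtain ⟨x', hx1, hx2, hx3⟩ := hpres
  have hne' : (cls σ g' c d l).Nonempty := ⟨x', hx1, hx2, hx3⟩
  have key : ∀ z, g' z = l → c ≤ z → z ≤ d → repT σ g g' a b c d x = z → c ≤ repT σ g g' a b c d x ∧ repT σ g g' a b c d x ≤ d ∧ σ.eqv l (g' (repT σ g g' a b c d x)) ∧
    (l = g' (repT σ g g' a b c d x) ∨ ∃ x1 x2, a ≤ x1 ∧ x1 < x ∧ x < x2 ∧ x2 ≤ b ∧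
      σ.eqv (g x1) l ∧ σ.eqv (g x2) l) := by
    intro z h1 h2 h3 h4
    rw [h4, h1]
    exact ⟨h2, h3, Sys.eqv.refl _, Or.inl rfl⟩
  rcases (clo_le hxc).eq_or_lt with h1 | h1
  · -- minimum attained
    have : (tr σ g' c d).mn l := h ▸ ⟨x, hx, hx', rfl, fun y hy hy' h2 => h1 ▸ clo_le ⟨hy, hy', h2⟩⟩
    obtain ⟨z, hz1, hz2, hz3, hz4⟩ := this
    refine key z hz3 hz1 hz2 ?_
    have h5 : clo σ g' c d l = z :=
      le_antisymm (clo_le ⟨hz1, hz2, hz3 ▸ Sys.eqv.refl _⟩) (le_csInf hne' fun y hy => hz4 y hy.1 hy.2.1 hy.2.2)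
    unfold repT
    rw [← hl, h1, aff_left, h5]
  rcases (le_chi hxc).eq_or_lt with h2 | h2
  · have : (tr σ g' c d).mx l := h ▸ ⟨x, hx, hx', rfl, fun y hy hy' h3 => h2 ▸ le_chi ⟨hy, hy', h3⟩⟩
    obtain ⟨z, hz1, hz2, hz3, hz4⟩ := this
    refine key z hz3 hz1 hz2 ?_
    have h5 : chi σ g' c d l = z :=
      le_antisymm (csSup_le hne' fun y hy => hz4 y hy.1 hy.2.1 hy.2.2) (le_chi ⟨hz1, hz2, hz3 ▸ Sys.eqv.refl _⟩)
    unfold repT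
    rw [← hl, ← h2, aff_right h1, h5]
  · obtain ⟨x1, x2, h3, h4, h5, h6, -⟩ := cls_of_between hg ⟨x, hxc⟩ h1 h2
    have hlt' : clo σ g' c d l < chi σ g' c d l := by
      rw [clo_lt_chi_iff, ← h, ← clo_lt_chi_iff]; exact h1.trans h2
    have e1 : clo σ g' c d l < repT σ g g' a b c d x := by
      have := aff_lt (h1.trans h2) hlt' h1
      rwa [aff_left] at this
    have e2 : repT σ g g' a b c d x < chi σ g' c d l := by
      have := aff_lt (h1.trans h2) hlt' h2
      rwa [aff_right (h1.trans h2)] at this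
    obtain ⟨_, _, _, _, _, _, e3⟩ := cls_of_between hg' hne' e1 e2
    exact ⟨e3.1, e3.2.1, e3.2.2.symm, Or.inr ⟨x1, x2, h5.1, h3, h4, h6.2.1, h5.2.2, h6.2.2⟩⟩

theorem repT_inv (hg : MonoI σ g a b) (hg' : MonoI σ g' c d) (h : tr σ g a b = tr σ g' c d)
    {x : ℝ} (hx : a ≤ x) (hx' : x ≤ b) :
    repT σ g' g c d a b (repT σ g g' a b c d x) = x := by
  have hs := repT_spec hg hg' h hx hx'
  have e := hs.2.2.1.symm
  unfold repT at e ⊢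
  rw [clo_congr e, clo_congr e, chi_congr e, chi_congr e]
  have hxc : x ∈ cls σ g a b (g x) := ⟨hx, hx', Sys.eqv.refl _⟩
  rcases ((clo_le hxc).trans (le_chi hxc)).eq_or_lt with h1 | h1
  · have h2 : clo σ g' c d (g x) = chi σ g' c d (g x) := by
      have hn : ¬ clo σ g' c d (g x) < chi σ g' c d (g x) := by
        rw [clo_lt_chi_iff, ← h, ← clo_lt_chi_iff, h1]; exact lt_irrefl _
      have e0 : repT σ g g' a b c d x ∈ cls σ g' c d (g x) := ⟨hs.1, hs.2.1, hs.2.2.1.symm⟩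
      exact le_antisymm ((clo_le e0).trans (le_chi e0)) (not_lt.1 hn)
    have h3 : clo σ g a b (g x) = x := le_antisymm (clo_le hxc) (h1 ▸ le_chi hxc)
    have h4 : chi σ g a b (g x) = x := h1 ▸ h3
    simp [aff, h3, h4]
  · have hlt' : clo σ g' c d (g x) < chi σ g' c d (g x) := by
      rw [clo_lt_chi_iff, ← h, ← clo_lt_chi_iff]; exact h1
    rw [aff_aff hlt' h1]

theorem repT_lt (hg : MonoI σ g a b) (hg' : MonoI σ g' c d) (h : tr σ g a b = tr σ g' c d)
    {x y : ℝ} (hx : a ≤ x) (hxy : x < y) (hy : y ≤ b) :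
    repT σ g g' a b c d x < repT σ g g' a b c d y := by
  have hsx := repT_spec hg hg' h hx (hxy.le.trans hy)
  have hsy := repT_spec hg hg' h (hx.trans hxy.le) hy
  by_contra hc
  push Not at hc
  have h1 := hg' _ _ hsy.1 hc hsx.2.1
  have h2 : σ.eqv (g y) (g x) := ⟨σ.trans' hsy.2.2.1.1 (σ.trans' h1 hsx.2.2.1.2), hg x y hx hxy.le hy⟩
  have h3 : clo σ g a b (g x) < chi σ g a b (g x) :=
    clo_lt_chi_iff.2 ⟨x, y, hx, hxy, hy, Sys.eqv.refl _, h2⟩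
  have hlt' : clo σ g' c d (g x) < chi σ g' c d (g x) := by
    rw [clo_lt_chi_iff, ← h, ← clo_lt_chi_iff]; exact h3
  have := aff_lt h3 hlt' hxy
  unfold repT at hc
  rw [clo_congr h2, clo_congr h2, chi_congr h2, chi_congr h2] at hc
  linarith

theorem repT_left (hab : a < b) (hcd : c < d) (hg : MonoI σ g a b) (hg' : MonoI σ g' c d) (h : tr σ g a b = tr σ g' c d) :
    repT σ g g' a b c d a = c := by
  have hs := repT_spec hg hg' h le_rfl hab.le
  have hs' := repT_spec hg' hg h.symm le_rfl hcd.le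
  by_contra hne
  have h1 : c < repT σ g g' a b c d a := lt_of_le_of_ne hs.1 (Ne.symm hne)
  have := repT_lt hg' hg h.symm le_rfl h1 hs.2.1
  rw [repT_inv hg hg' h le_rfl hab.le] at this
  linarith [hs'.1]

theorem repT_right (hab : a < b) (hcd : c < d) (hg : MonoI σ g a b) (hg' : MonoI σ g' c d) (h : tr σ g a b = tr σ g' c d) :
    repT σ g g' a b c d b = d := by
  have hs := repT_spec hg hg' h hab.le le_rfl
  have hs' := repT_spec hg' hg h.symm hcd.le le_rfl
  by_contra hne
  have h1 : repT σ g g' a b c d b < d := lt_of_le_of_ne hs.2.1 hne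
  have := repT_lt hg' hg h.symm hs.1 h1 le_rfl
  rw [repT_inv hg hg' h hab.le le_rfl] at this
  linarith [hs'.2.1]

theorem reparam (hab : a < b) (hcd : c < d) (hg : MonoI σ g a b) (hg' : MonoI σ g' c d)
    (h : tr σ g a b = tr σ g' c d) :
    ∃ θ : ℝ ≃o ℝ, θ a = c ∧ θ b = d ∧ ∀ x, a ≤ x → x ≤ b → σ.eqv (g x) (g' (θ x)) ∧
      (g x = g' (θ x) ∨ ∃ x1 x2, a ≤ x1 ∧ x1 < x ∧ x < x2 ∧ x2 ≤ b ∧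
        σ.eqv (g x1) (g x) ∧ σ.eqv (g x2) (g x)) := by
  classical
  let T : ℝ → ℝ := fun x => if x < a then x - a + c else if b < x then x - b + d else repT σ g g' a b c d x
  have hT : ∀ x, a ≤ x → x ≤ b → T x = repT σ g g' a b c d x := fun x h1 h2 => by
    simp only [T]; rw [if_neg (by linarith), if_neg (by linarith)]
  have hTm : StrictMono T := by
    intro x y hxy
    by_cases hxa : x < a
    · have e : T x = x - a + c := by simp only [T]; rw [if_pos hxa]
      rw [e]
      by_cases hya : y < a
      · have : T y = y - a + c := by simp only [T]; rw [if_pos hya]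
        linarith
      by_cases hyb : b < y
      · have : T y = y - b + d := by simp only [T]; rw [if_neg hya, if_pos hyb]
        linarith
      · rw [hT y (not_lt.1 hya) (not_lt.1 hyb)]
        have := (repT_spec hg hg' h (not_lt.1 hya) (not_lt.1 hyb)).1
        linarith
    · by_cases hyb : b < y
      · have e : T y = y - b + d := by simp only [T]; rw [if_neg (by linarith), if_pos hyb]
        rw [e]
        by_cases hxb : b < x
        · have : T x = x - b + d := by simp only [T]; rw [if_neg hxa, if_pos hxb]
          linarith
        · rw [hT x (not_lt.1 hxa) (not_lt.1 hxb)]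
          have := (repT_spec hg hg' h (not_lt.1 hxa) (not_lt.1 hxb)).2.1
          linarith
      · rw [hT x (not_lt.1 hxa) (by linarith), hT y (by linarith) (not_lt.1 hyb)]
        exact repT_lt hg hg' h (not_lt.1 hxa) hxy (not_lt.1 hyb)
  have hTs : Function.Surjective T := by
    intro y
    by_cases hyc : y < c
    · exact ⟨y - c + a, by simp only [T]; rw [if_pos (by linarith)]; ring⟩
    by_cases hyd : d < y
    · exact ⟨y - d + b, by simp only [T]; rw [if_neg (by linarith), if_pos (by linarith)]; ring⟩
    have hs := repT_spec hg' hg h.symm (not_lt.1 hyc) (not_lt.1 hyd)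
    exact ⟨_, by rw [hT _ hs.1 hs.2.1, repT_inv hg' hg h.symm (not_lt.1 hyc) (not_lt.1 hyd)]⟩
  refine ⟨hTm.orderIsoOfSurjective T hTs, ?_, ?_, fun x hx hx' => ?_⟩
  · show T a = c
    rw [hT a le_rfl hab.le, repT_left hab hcd hg hg' h]
  · show T b = d
    rw [hT b hab.le le_rfl, repT_right hab hcd hg hg' h]
  · show σ.eqv (g x) (g' (T x)) ∧ (g x = g' (T x) ∨ _)
    rw [hT x hx hx']
    exact (repT_spec hg hg' h hx hx').2.2
end reparam

theorem tr_congr {g g' : ℝ → L} {a b : ℝ} (h : ∀ x, a ≤ x → x ≤ b → g x = g' x) :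
    tr σ g a b = tr σ g' a b := by
  have : ∀ {x}, a ≤ x → x ≤ b → g x = g' x := fun {x} => h x
  ext l
  · exact exists_congr fun x => ⟨fun ⟨h1, h2, h3⟩ => ⟨h1, h2, by rwa [← h x h1 h2]⟩,
      fun ⟨h1, h2, h3⟩ => ⟨h1, h2, by rwa [h x h1 h2]⟩⟩
  · exact exists_congr fun x => exists_congr fun y =>
      ⟨fun ⟨h1, h2, h3, h4, h5⟩ => ⟨h1, h2, h3, by rwa [← h x h1 (h2.le.trans h3)], by rwa [← h y (h1.trans h2.le) h3]⟩,
      fun ⟨h1, h2, h3, h4, h5⟩ => ⟨h1, h2, h3, by rwa [h x h1 (h2.le.trans h3)], by rwa [h y (h1.trans h2.le) h3]⟩⟩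
  · exact exists_congr fun x =>
      ⟨fun ⟨h1, h2, h3, h4⟩ => ⟨h1, h2, by rwa [← h x h1 h2], fun y k1 k2 k3 => h4 y k1 k2 (by rwa [h y k1 k2])⟩,
      fun ⟨h1, h2, h3, h4⟩ => ⟨h1, h2, by rwa [h x h1 h2], fun y k1 k2 k3 => h4 y k1 k2 (by rwa [← h y k1 k2])⟩⟩
  · exact exists_congr fun x =>
      ⟨fun ⟨h1, h2, h3, h4⟩ => ⟨h1, h2, by rwa [← h x h1 h2], fun y k1 k2 k3 => h4 y k1 k2 (by rwa [h y k1 k2])⟩,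
      fun ⟨h1, h2, h3, h4⟩ => ⟨h1, h2, by rwa [h x h1 h2], fun y k1 k2 k3 => h4 y k1 k2 (by rwa [← h y k1 k2])⟩⟩

/-- one-dimensional similarity -/
def Sim1 (σ : Sys L ι) (g g' : ℝ → L) (a b : ℝ) : Prop :=
  ∀ x, a ≤ x → x ≤ b → σ.eqv (g x) (g' x) ∧ (g x = g' x ∨ ∃ x1 x2, a ≤ x1 ∧ x1 < x ∧ x < x2 ∧ x2 ≤ b ∧
        σ.eqv (g x1) (g x) ∧ σ.eqv (g x2) (g x))

theorem Sim1.left {g g' : ℝ → L} {a b : ℝ} (h : Sim1 σ g g' a b) (hab : a ≤ b) : g a = g' a := by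
  rcases (h a le_rfl hab).2 with h | ⟨x1, x2, h1, h2, -⟩
  · exact h
  · linarith
theorem Sim1.right {g g' : ℝ → L} {a b : ℝ} (h : Sim1 σ g g' a b) (hab : a ≤ b) : g b = g' b := by
  rcases (h b hab le_rfl).2 with h | ⟨x1, x2, h1, h2, h3, h4, -⟩
  · exact h
  · linarith
theorem Sim1.symm {g g' : ℝ → L} {a b : ℝ} (h : Sim1 σ g g' a b) : Sim1 σ g' g a b := by
  intro x hx hx'
  have h0 := h x hx hx'
  refine ⟨h0.1.symm, h0.2.imp Eq.symm ?_⟩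
  rintro ⟨x1, x2, h1, h2, h3, h4, h5, h6⟩
  exact ⟨x1, x2, h1, h2, h3, h4, (h x1 h1 (h2.le.trans hx')).1.symm.trans (h5.trans h0.1),
    (h x2 (hx.trans h3.le) h4).1.symm.trans (h6.trans h0.1)⟩

theorem Sim1.tr_eq {g g' : ℝ → L} {a b : ℝ} (h : Sim1 σ g g' a b) : tr σ g a b = tr σ g' a b := by
  have key : ∀ {g g' : ℝ → L}, Sim1 σ g g' a b → ∀ l, ((tr σ g a b).pres l → (tr σ g' a b).pres l) ∧
    ((tr σ g a b).nd l → (tr σ g' a b).nd l) ∧ ((tr σ g a b).mn l → (tr σ g' a b).mn l) ∧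
    ((tr σ g a b).mx l → (tr σ g' a b).mx l) := by
    intro g g' h l
    refine ⟨?_, ?_, ?_, ?_⟩
    · rintro ⟨x, h1, h2, h3⟩
      exact ⟨x, h1, h2, (h x h1 h2).1.symm.trans h3⟩
    · rintro ⟨x, y, h1, h2, h3, h4, h5⟩
      exact ⟨x, y, h1, h2, h3, (h x h1 (h2.le.trans h3)).1.symm.trans h4,
        (h y (h1.trans h2.le) h3).1.symm.trans h5⟩
    · rintro ⟨x, h1, h2, rfl, h4⟩
      refine ⟨x, h1, h2, ?_, fun y hy hy' h5 => h4 y hy hy' ((h y hy hy').1.trans h5)⟩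
      rcases (h x h1 h2).2 with h6 | ⟨x1, x2, e1, e2, e3, e4, e5, e6⟩
      · exact h6.symm
      · have := h4 x1 e1 (e2.le.trans h2) e5
        linarith
    · rintro ⟨x, h1, h2, rfl, h4⟩
      refine ⟨x, h1, h2, ?_, fun y hy hy' h5 => h4 y hy hy' ((h y hy hy').1.trans h5)⟩
      rcases (h x h1 h2).2 with h6 | ⟨x1, x2, e1, e2, e3, e4, e5, e6⟩
      · exact h6.symm
      · have := h4 x2 (h1.trans e3.le) e4 e6
        linarith
  ext l
  · exact ⟨(key h l).1, (key h.symm l).1⟩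
  · exact ⟨(key h l).2.1, (key h.symm l).2.1⟩
  · exact ⟨(key h l).2.2.1, (key h.symm l).2.2.1⟩
  · exact ⟨(key h l).2.2.2, (key h.symm l).2.2.2⟩

/-- the trace only depends on the function up to increasing reparametrization -/
theorem tr_comp (θ : ℝ ≃o ℝ) (g : ℝ → L) (a b : ℝ) :
    tr σ (fun x => g (θ x)) a b = tr σ g (θ a) (θ b) := by
  ext l
  · constructor
    · rintro ⟨x, h1, h2, h3⟩
      exact ⟨θ x, θ.monotone h1, θ.monotone h2, h3⟩
    · rintro ⟨x, h1, h2, h3⟩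
      exact ⟨θ.symm x, θ.le_symm_apply.2 h1, θ.symm_apply_le.2 h2, by simpa using h3⟩
  · constructor
    · rintro ⟨x, y, h1, h2, h3, h4, h5⟩
      exact ⟨θ x, θ y, θ.monotone h1, θ.strictMono h2, θ.monotone h3, h4, h5⟩
    · rintro ⟨x, y, h1, h2, h3, h4, h5⟩
      exact ⟨θ.symm x, θ.symm y, θ.le_symm_apply.2 h1, θ.symm.strictMono h2, θ.symm_apply_le.2 h3, by simpa using h4, by simpa using h5⟩
  · constructor
    · rintro ⟨x, h1, h2, h3, h4⟩
      refine ⟨θ x, θ.monotone h1, θ.monotone h2, h3, fun y k1 k2 k3 => ?_⟩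
      have := h4 (θ.symm y) (θ.le_symm_apply.2 k1) (θ.symm_apply_le.2 k2) (by simpa using k3)
      exact θ.le_symm_apply.1 this
    · rintro ⟨x, h1, h2, h3, h4⟩
      refine ⟨θ.symm x, θ.le_symm_apply.2 h1, θ.symm_apply_le.2 h2, by simpa using h3, fun y k1 k2 k3 => ?_⟩
      exact θ.symm_apply_le.2 (h4 (θ y) (θ.monotone k1) (θ.monotone k2) k3)
  · constructor
    · rintro ⟨x, h1, h2, h3, h4⟩
      refine ⟨θ x, θ.monotone h1, θ.monotone h2, h3, fun y k1 k2 k3 => ?_⟩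
      have := h4 (θ.symm y) (θ.le_symm_apply.2 k1) (θ.symm_apply_le.2 k2) (by simpa using k3)
      exact θ.symm_apply_le.1 this
    · rintro ⟨x, h1, h2, h3, h4⟩
      refine ⟨θ.symm x, θ.le_symm_apply.2 h1, θ.symm_apply_le.2 h2, by simpa using h3, fun y k1 k2 k3 => ?_⟩
      exact θ.le_symm_apply.2 (h4 (θ y) (θ.monotone k1) (θ.monotone k2) k3)

/-- elementary functions -/
noncomputable def elF (p e q : L) (a b x : ℝ) : L := if x ≤ a then p else if b ≤ x then q else e

theorem elF_left {p e q : L} {a b : ℝ} : elF p e q a b a = p := by simp [elF]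
theorem elF_right {p e q : L} {a b : ℝ} (h : a < b) : elF p e q a b b = q := by simp [elF, h]
theorem elF_mid {p e q : L} {a b x : ℝ} (h : a < x) (h' : x < b) : elF p e q a b x = e := by
  unfold elF; rw [if_neg (not_le.2 h), if_neg (not_le.2 h')]
theorem elF_mono {p e q : L} {a b : ℝ} (h1 : σ.le p e) (h2 : σ.le e q) :
    MonoI σ (elF p e q a b) a b := by
  intro x y hx hxy hy
  unfold elF
  split_ifs <;> first | exact σ.rfl' _ | assumption | exact σ.trans' h1 h2 | (exfalso; linarith)
theorem elF_tr {p e q : L} {a b : ℝ} (hab : a < b) (h1 : σ.le p e) (h2 : σ.le e q) :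
    tr σ (elF p e q a b) a b = Tr.elem σ p e q := by
  rw [tr_elem (elF_mono h1 h2) hab (e := e) (fun x hx hx' => elF_mid hx hx' ▸ Sys.eqv.refl _),
    elF_left, elF_right hab]

theorem elem_inv {g : ℝ → L} {a b : ℝ} {p e q : L} (hg : MonoI σ g a b) (hab : a < b)
    (h1 : σ.le p e) (h2 : σ.le e q) (h : tr σ g a b = Tr.elem σ p e q) :
    g a = p ∧ g b = q ∧ (∀ x, a < x → x < b → σ.eqv (g x) e) := by
  obtain ⟨θ, ha, hb, hθ⟩ := reparam hab hab hg (elF_mono h1 h2) (h.trans (elF_tr hab h1 h2).symm)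
  refine ⟨?_, ?_, fun x hx hx' => ?_⟩
  · rcases (hθ a le_rfl hab.le).2 with h | ⟨x1, x2, h1, h2, -⟩
    · rw [h, ha, elF_left]
    · linarith
  · rcases (hθ b hab.le le_rfl).2 with h | ⟨x1, x2, h1, h2, h3, h4, -⟩
    · rw [h, hb, elF_right hab]
    · linarith
  · have := (hθ x hx.le hx'.le).1
    rwa [elF_mid (ha ▸ θ.strictMono hx) (hb ▸ θ.strictMono hx')] at this

/-- an edge with elementary trace can be replaced by the standard elementary function -/
theorem elem_sim {g : ℝ → L} {a b : ℝ} {p e q : L} (hg : MonoI σ g a b) (hab : a < b)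
    (h1 : σ.le p e) (h2 : σ.le e q) (h : tr σ g a b = Tr.elem σ p e q) :
    Sim1 σ g (elF p e q a b) a b := by
  obtain ⟨e1, e2, e3⟩ := elem_inv hg hab h1 h2 h
  intro x hx hx'
  rcases hx.eq_or_lt with rfl | hx
  · rw [elF_left, e1]; exact ⟨Sys.eqv.refl _, Or.inl rfl⟩
  rcases hx'.eq_or_lt with rfl | hx'
  · rw [elF_right hab, e2]; exact ⟨Sys.eqv.refl _, Or.inl rfl⟩
  obtain ⟨u, hu1, hu2⟩ := exists_between hx
  obtain ⟨v, hv1, hv2⟩ := exists_between hx'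
  rw [elF_mid hx hx']
  exact ⟨e3 x hx hx', Or.inr ⟨u, v, hu1.le, hu2, hv1, hv2.le, (e3 u hu1 (hu2.trans hx')).trans (e3 x hx hx').symm,
    (e3 v (hx.trans hv1) hv2).trans (e3 x hx hx').symm⟩⟩
end
end Temporal

namespace Temporal

/-! ### Two-dimensional lax models -/
section
variable {L ι : Type} {σ : Sys L ι}

abbrev Pt := ℝ × ℝ

/-- `q` witnesses `i` (directly or since it lies in a thick cluster) -/
def Wt (σ : Sys L ι) (r : Pt → Pt → Prop) (f : Pt → L) (R : Set Pt) (q : Pt) (i : ι) : Prop :=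
  σ.wF (f q) i ∨ (σ.WF (f q) i ∧ ∃ q' ∈ R, r q q' ∧ q ≠ q' ∧ σ.eqv (f q) (f q'))

/-- the demand `i` at `p` is resolved in `R` or at an exit from `E` -/
def FA (σ : Sys L ι) (r : Pt → Pt → Prop) (f : Pt → L) (R E : Set Pt) (p : Pt) (i : ι) : Prop :=
  (∃ q ∈ R, r p q ∧ Wt σ r f R q i) ∨ ∃ q ∈ R, q ∈ E ∧ r p q ∧ σ.A (f q) i

def FutOK (σ : Sys L ι) (r : Pt → Pt → Prop) (f : Pt → L) (R E : Set Pt) : Prop :=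
  ∀ p ∈ R, ∀ i, σ.A (f p) i → FA σ r f R E p i

theorem Wt.mono {r : Pt → Pt → Prop} {f : Pt → L} {R R' : Set Pt} {q : Pt} {i : ι}
    (h : Wt σ r f R q i) (hR : R ⊆ R') : Wt σ r f R' q i := by
  rcases h with h | ⟨h, q', h1, h2⟩
  · exact Or.inl h
  · exact Or.inr ⟨h, q', hR h1, h2⟩

theorem FA.chain {r : Pt → Pt → Prop} (hr : ∀ p q s, r p q → r q s → r p s) {f : Pt → L}
    {R1 E1 R E : Set Pt} {p : Pt} {i : ι} (h : FA σ r f R1 E1 p i) (hR : R1 ⊆ R)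
    (hE : ∀ q ∈ R1, q ∈ E1 → r p q → σ.A (f q) i → FA σ r f R E q i) : FA σ r f R E p i := by
  rcases h with ⟨q, h1, h2, h3⟩ | ⟨q, h1, h2, h3, h4⟩
  · exact Or.inl ⟨q, hR h1, h2, h3.mono hR⟩
  · rcases hE q h1 h2 h3 h4 with ⟨s, h5, h6, h7⟩ | ⟨s, h5, h6, h7, h8⟩
    · exact Or.inl ⟨s, h5, hr _ _ _ h3 h6, h7⟩
    · exact Or.inr ⟨s, h5, h6, hr _ _ _ h3 h7, h8⟩

theorem FA.congr {r : Pt → Pt → Prop} {f f' : Pt → L} {R E : Set Pt} {p : Pt} {i : ι}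
    (h : FA σ r f R E p i) (hf : ∀ q ∈ R, f q = f' q) : FA σ r f' R E p i := by
  rcases h with ⟨q, h1, h2, h3⟩ | ⟨q, h1, h2, h3, h4⟩
  · refine Or.inl ⟨q, h1, h2, ?_⟩
    rcases h3 with h3 | ⟨h3, q', h4, h5, h6, h7⟩
    · exact Or.inl (hf q h1 ▸ h3)
    · exact Or.inr ⟨hf q h1 ▸ h3, q', h4, h5, h6, hf q h1 ▸ hf q' h4 ▸ h7⟩
  · exact Or.inr ⟨q, h1, h2, h3, hf q h1 ▸ h4⟩

theorem FutOK.congr {r : Pt → Pt → Prop} {f f' : Pt → L} {R E : Set Pt}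
    (h : FutOK σ r f R E) (hf : ∀ q ∈ R, f q = f' q) : FutOK σ r f' R E :=
  fun p hp i hA => (h p hp i ((hf p hp).symm ▸ hA)).congr hf

/-- transport along bijections -/
theorem FA.comp {r r' : Pt → Pt → Prop} (T : Pt ≃ Pt) (hT : ∀ p q, r' p q ↔ r (T p) (T q))
    {f : Pt → L} {R E : Set Pt} {p : Pt} {i : ι} (h : FA σ r f R E (T p) i) :
    FA σ r' (fun p => f (T p)) (T ⁻¹' R) (T ⁻¹' E) p i := by
  rcases h with ⟨q, h1, h2, h3⟩ | ⟨q, h1, h2, h3, h4⟩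
  · refine Or.inl ⟨T.symm q, by simpa using h1, by simpa [hT] using h2, ?_⟩
    rcases h3 with h3 | ⟨h3, q', h4, h5, h6, h7⟩
    · exact Or.inl (by simpa using h3)
    · refine Or.inr ⟨by simpa using h3, T.symm q', by simpa using h4, by simpa [hT] using h5, ?_, by simpa using h7⟩
      intro h; exact h6 (T.symm.injective h)
  · exact Or.inr ⟨T.symm q, by simpa using h1, by simpa using h2, by simpa [hT] using h3, by simpa using h4⟩

theorem FutOK.comp {r r' : Pt → Pt → Prop} (T : Pt ≃ Pt) (hT : ∀ p q, r' p q ↔ r (T p) (T q))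
    {f : Pt → L} {R E : Set Pt} (h : FutOK σ r f R E) :
    FutOK σ r' (fun p => f (T p)) (T ⁻¹' R) (T ⁻¹' E) :=
  fun p hp i hA => FA.comp T hT (h (T p) hp i hA)

/-- similarity of labellings on a region -/
def Sim (σ : Sys L ι) (f f' : Pt → L) (R : Set Pt) : Prop :=
  ∀ p ∈ R, σ.eqv (f p) (f' p) ∧ (f p = f' p ∨ ∃ p1 ∈ R, ∃ p2 ∈ R, p1 ≤ p ∧ p1 ≠ p ∧ p ≤ p2 ∧ p2 ≠ p ∧
    σ.eqv (f p1) (f p) ∧ σ.eqv (f p2) (f p))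

structure RegM (σ : Sys L ι) (f : Pt → L) (R E E' : Set Pt) : Prop where
  mono : ∀ p ∈ R, ∀ q ∈ R, p ≤ q → σ.le (f p) (f q)
  fut : FutOK σ (fun p q => p ≤ q) f R E
  past : FutOK σ.dual (fun p q => q ≤ p) f R E'

theorem Sim.Wt {f f' : Pt → L} {R : Set Pt} (h : Sim σ f f' R) {q : Pt} {i : ι} (hq : q ∈ R)
    (hW : Wt σ (fun p q => p ≤ q) f R q i) : Wt σ (fun p q => p ≤ q) f' R q i := by
  have h0 := h q hq
  rcases hW with hW | ⟨hW, q', h1, h2, h3, h4⟩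
  · rcases h0.2 with h1 | ⟨p1, k1, p2, k2, k3, k4, k5, k6, k7, k8⟩
    · exact Or.inl (h1 ▸ hW)
    · exact Or.inr ⟨h0.1.WF (Sys.WF_of hW), p2, k2, k5, k6.symm, (h0.1.symm.trans k8.symm).trans (h p2 k2).1⟩
  · exact Or.inr ⟨h0.1.WF hW, q', h1, h2, h3, (h0.1.symm.trans h4).trans (h q' h1).1⟩

theorem Sim.Wt' {f f' : Pt → L} {R : Set Pt} (h : Sim σ f f' R) {q : Pt} {i : ι} (hq : q ∈ R)
    (hW : Temporal.Wt σ.dual (fun p q => q ≤ p) f R q i) : Temporal.Wt σ.dual (fun p q => q ≤ p) f' R q i := by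
  have h0 := h q hq
  rcases hW with hW | ⟨hW, q', h1, h2, h3, h4⟩
  · rcases h0.2 with h1 | ⟨p1, k1, p2, k2, k3, k4, k5, k6, k7, k8⟩
    · exact Or.inl (h1 ▸ hW)
    · exact Or.inr ⟨(Sys.eqv_dual.2 h0.1).WF (Sys.WF_of hW), p1, k1, k3, k4.symm,
        Sys.eqv_dual.2 ((h0.1.symm.trans k7.symm).trans (h p1 k1).1)⟩
  · exact Or.inr ⟨(Sys.eqv_dual.2 h0.1).WF hW, q', h1, h2, h3,
      Sys.eqv_dual.2 ((h0.1.symm.trans (Sys.eqv_dual.1 h4)).trans (h q' h1).1)⟩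

theorem RegM.sim {f f' : Pt → L} {R E E' : Set Pt} (hM : RegM σ f R E E') (h : Sim σ f f' R) :
    RegM σ f' R E E' := by
  refine ⟨fun p hp q hq hpq => ?_, fun p hp i hA => ?_, fun p hp i hA => ?_⟩
  · exact σ.trans' (h p hp).1.2 (σ.trans' (hM.mono p hp q hq hpq) (h q hq).1.1)
  · rcases hM.fut p hp i ((h p hp).1.symm.A hA) with ⟨q, h1, h2, h3⟩ | ⟨q, h1, h2, h3, h4⟩
    · exact Or.inl ⟨q, h1, h2, h.Wt h1 h3⟩
    · exact Or.inr ⟨q, h1, h2, h3, (h q h1).1.A h4⟩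
  · rcases hM.past p hp i ((Sys.eqv_dual.2 (h p hp).1.symm).A hA) with ⟨q, h1, h2, h3⟩ | ⟨q, h1, h2, h3, h4⟩
    · exact Or.inl ⟨q, h1, h2, h.Wt' h1 h3⟩
    · exact Or.inr ⟨q, h1, h2, h3, (Sys.eqv_dual.2 (h q h1).1).A h4⟩

def bx (a b c d : ℝ) : Set Pt := {p | a ≤ p.1 ∧ p.1 ≤ b ∧ c ≤ p.2 ∧ p.2 ≤ d}
def exU (b d : ℝ) : Set Pt := {p | p.1 = b ∨ p.2 = d}

def IsM (σ : Sys L ι) (f : Pt → L) (a b c d : ℝ) : Prop := RegM σ f (bx a b c d) (exU b d) (exU a c)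

/-- Behaviours of rectangles -/
@[ext] structure Beh (L ι : Type) where
  lf : Tr L
  rt : Tr L
  bt : Tr L
  tp : Tr L
  rF : ι → Prop
  rP : ι → Prop

def Beh.swap (β : Beh L ι) : Beh L ι := ⟨β.bt, β.tp, β.lf, β.rt, β.rF, β.rP⟩

structure HasB (σ : Sys L ι) (f : Pt → L) (a b c d : ℝ) (β : Beh L ι) : Prop where
  lf : tr σ (fun y => f (a, y)) c d = β.lf
  rt : tr σ (fun y => f (b, y)) c d = β.rt
  bt : tr σ (fun x => f (x, c)) a b = β.bt
  tp : tr σ (fun x => f (x, d)) a b = β.tp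
  rF : ∀ i, β.rF i → ∃ q ∈ bx a b c d, Wt σ (fun p q => p ≤ q) f (bx a b c d) q i
  rP : ∀ i, β.rP i → ∃ q ∈ bx a b c d, Wt σ.dual (fun p q => q ≤ p) f (bx a b c d) q i

def MB (σ : Sys L ι) (f : Pt → L) (a b c d : ℝ) (β : Beh L ι) : Prop :=
  IsM σ f a b c d ∧ HasB σ f a b c d β

def Rlz (σ : Sys L ι) (β : Beh L ι) : Prop := ∃ f, MB σ f 0 1 0 1 β

theorem exists_iso {a b c d : ℝ} (h : a < b) (h' : c < d) : ∃ θ : ℝ ≃o ℝ, θ a = c ∧ θ b = d := by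
  have hm : StrictMono (aff a b c d) := fun x y hxy => aff_lt h h' hxy
  refine ⟨hm.orderIsoOfSurjective _ fun y => ⟨aff c d a b y, aff_aff h h'⟩, ?_, ?_⟩
  · exact aff_left
  · exact aff_right h

theorem exists_iso_aff {a b c d : ℝ} (h : a < b) (h' : c < d) : ∃ θ : ℝ ≃o ℝ, ∀ x, θ x = aff a b c d x := by
  have hm : StrictMono (aff a b c d) := fun x y hxy => aff_lt h h' hxy
  exact ⟨hm.orderIsoOfSurjective _ fun y => ⟨aff c d a b y, aff_aff h h'⟩, fun x => rfl⟩

def prodIso (θ η : ℝ ≃o ℝ) : Pt ≃ Pt := θ.toEquiv.prodCongr η.toEquiv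

theorem prodIso_apply (θ η : ℝ ≃o ℝ) (p : Pt) : prodIso θ η p = (θ p.1, η p.2) := rfl

theorem prodIso_le (θ η : ℝ ≃o ℝ) (p q : Pt) : p ≤ q ↔ prodIso θ η p ≤ prodIso θ η q := by
  simp [prodIso_apply, Prod.le_def]

theorem Wt.comp {r r' : Pt → Pt → Prop} (T : Pt ≃ Pt) (hT : ∀ p q, r' p q ↔ r (T p) (T q))
    {f : Pt → L} {R : Set Pt} {p : Pt} {i : ι} (h3 : Wt σ r f R (T p) i) :
    Wt σ r' (fun p => f (T p)) (T ⁻¹' R) p i := by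
  rcases h3 with h3 | ⟨h3, q', h4, h5, h6, h7⟩
  · exact Or.inl (by simpa using h3)
  · refine Or.inr ⟨by simpa using h3, T.symm q', by simpa using h4, by simpa [hT] using h5, ?_, by simpa using h7⟩
    rintro rfl; simp at h6

theorem RegM.comp (T : Pt ≃ Pt) (hT : ∀ p q, p ≤ q ↔ T p ≤ T q)
    {f : Pt → L} {R E E' : Set Pt} (h : RegM σ f R E E') :
    RegM σ (fun p => f (T p)) (T ⁻¹' R) (T ⁻¹' E) (T ⁻¹' E') :=
  ⟨fun p hp q hq hpq => h.mono _ hp _ hq ((hT p q).1 hpq), h.fut.comp T hT,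
    h.past.comp T (fun p q => hT q p)⟩

theorem bx_comp (θ η : ℝ ≃o ℝ) (a b c d : ℝ) :
    prodIso θ η ⁻¹' bx (θ a) (θ b) (η c) (η d) = bx a b c d := by
  ext p; simp [bx, prodIso_apply]

theorem exU_comp (θ η : ℝ ≃o ℝ) (b d : ℝ) : prodIso θ η ⁻¹' exU (θ b) (η d) = exU b d := by
  ext p; simp [exU, prodIso_apply]

theorem IsM.comp (θ η : ℝ ≃o ℝ) {f : Pt → L} {a b c d : ℝ} (h : IsM σ f (θ a) (θ b) (η c) (η d)) :
    IsM σ (fun p => f (θ p.1, η p.2)) a b c d := by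
  have := RegM.comp (prodIso θ η) (prodIso_le θ η) h
  rw [bx_comp, exU_comp, exU_comp] at this
  exact this

theorem Wt_ex_comp {r r' : Pt → Pt → Prop} (T : Pt ≃ Pt) (hT : ∀ p q, r' p q ↔ r (T p) (T q))
    {f : Pt → L} {R : Set Pt} {i : ι} (h : ∃ q ∈ R, Wt σ r f R q i) :
    ∃ q ∈ T ⁻¹' R, Wt σ r' (fun p => f (T p)) (T ⁻¹' R) q i := by
  obtain ⟨q, h1, h2⟩ := h
  exact ⟨T.symm q, by simpa using h1, Wt.comp T hT (by simpa using h2)⟩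

theorem MB.comp (θ η : ℝ ≃o ℝ) {f : Pt → L} {a b c d : ℝ} {β : Beh L ι}
    (h : MB σ f (θ a) (θ b) (η c) (η d) β) :
    MB σ (fun p => f (θ p.1, η p.2)) a b c d β := by
  obtain ⟨h1, h2⟩ := h
  refine ⟨h1.comp θ η, ?_, ?_, ?_, ?_, fun i hi => ?_, fun i hi => ?_⟩
  · rw [← h2.lf, ← tr_comp η]
  · rw [← h2.rt, ← tr_comp η]
  · rw [← h2.bt, ← tr_comp θ]
  · rw [← h2.tp, ← tr_comp θ]
  · have := Wt_ex_comp (prodIso θ η) (prodIso_le θ η) (h2.rF i hi)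
    rw [bx_comp] at this; exact this
  · have := Wt_ex_comp (prodIso θ η) (fun p q => prodIso_le θ η q p) (h2.rP i hi)
    rw [bx_comp] at this; exact this

theorem Rlz.box {β : Beh L ι} (h : Rlz σ β) {a b c d : ℝ} (hab : a < b) (hcd : c < d) :
    ∃ f, MB σ f a b c d β := by
  obtain ⟨f, hf⟩ := h
  obtain ⟨θ, h1, h2⟩ := exists_iso hab zero_lt_one
  obtain ⟨η, h3, h4⟩ := exists_iso hcd zero_lt_one
  exact ⟨_, MB.comp θ η (by rw [h1, h2, h3, h4]; exact hf)⟩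

theorem MB.rlz {f : Pt → L} {a b c d : ℝ} {β : Beh L ι} (h : MB σ f a b c d β) (hab : a < b) (hcd : c < d) :
    Rlz σ β := by
  obtain ⟨θ, h1, h2⟩ := exists_iso (zero_lt_one (α := ℝ)) hab
  obtain ⟨η, h3, h4⟩ := exists_iso (zero_lt_one (α := ℝ)) hcd
  exact ⟨_, MB.comp θ η (by rw [h1, h2, h3, h4]; exact h)⟩

theorem swap_le (p q : Pt) : p ≤ q ↔ Equiv.prodComm ℝ ℝ p ≤ Equiv.prodComm ℝ ℝ q := by
  simp [Prod.le_def, and_comm]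
theorem bx_swap (a b c d : ℝ) : Equiv.prodComm ℝ ℝ ⁻¹' bx a b c d = bx c d a b := by
  ext p; simp [bx]; tauto
theorem exU_swap (a b : ℝ) : Equiv.prodComm ℝ ℝ ⁻¹' exU a b = exU b a := by
  ext p; simp [exU]; tauto

theorem MB.swap {f : Pt → L} {a b c d : ℝ} {β : Beh L ι} (h : MB σ f a b c d β) :
    MB σ (fun p => f (p.2, p.1)) c d a b β.swap := by
  obtain ⟨h1, h2⟩ := h
  refine ⟨?_, h2.bt, h2.tp, h2.lf, h2.rt, fun i hi => ?_, fun i hi => ?_⟩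
  · have := RegM.comp _ swap_le h1
    rw [bx_swap, exU_swap, exU_swap] at this
    exact this
  · have := Wt_ex_comp (Equiv.prodComm ℝ ℝ) swap_le (h2.rF i hi)
    rw [bx_swap] at this; exact this
  · have := Wt_ex_comp (Equiv.prodComm ℝ ℝ) (fun p q => swap_le q p) (h2.rP i hi)
    rw [bx_swap] at this; exact this

theorem Beh.swap_swap (β : Beh L ι) : β.swap.swap = β := rfl

theorem Rlz.swap {β : Beh L ι} (h : Rlz σ β) : Rlz σ β.swap := by
  obtain ⟨f, hf⟩ := h
  exact ⟨_, hf.swap⟩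

theorem IsM.monoH {f : Pt → L} {a b c d y : ℝ} (h : IsM σ f a b c d) (h1 : c ≤ y) (h2 : y ≤ d) :
    MonoI σ (fun x => f (x, y)) a b := fun x x' hx hxx hx' =>
  h.mono _ ⟨hx, hxx.trans hx', h1, h2⟩ _ ⟨hx.trans hxx, hx', h1, h2⟩ ⟨hxx, le_rfl⟩

theorem IsM.monoV {f : Pt → L} {a b c d x : ℝ} (h : IsM σ f a b c d) (h1 : a ≤ x) (h2 : x ≤ b) :
    MonoI σ (fun y => f (x, y)) c d := fun y y' hy hyy hy' =>
  h.mono _ ⟨h1, h2, hy, hyy.trans hy'⟩ _ ⟨h1, h2, hy.trans hyy, hy'⟩ ⟨le_rfl, hyy⟩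

/-- Overriding a horizontal edge. -/
theorem MB.overrideH {f : Pt → L} {a b c d y0 : ℝ} {β : Beh L ι} {g : ℝ → L} (h : MB σ f a b c d β)
    (hab : a < b) (hcd : c < d) (hy : y0 = c ∨ y0 = d) (hg : Sim1 σ (fun x => f (x, y0)) g a b) :
    ∃ f', MB σ f' a b c d β ∧ (∀ x, f' (x, y0) = g x) ∧ ∀ x y, (y ≠ y0 ∨ x = a ∨ x = b) → f' (x, y) = f (x, y) := by
  classical
  let f' : Pt → L := fun p => if p.2 = y0 then g p.1 else f p
  have e1 : ∀ x, f' (x, y0) = g x := fun x => by simp [f']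
  have ea : f (a, y0) = g a := hg.left hab.le
  have eb : f (b, y0) = g b := hg.right hab.le
  have e2 : ∀ x y, (y ≠ y0 ∨ x = a ∨ x = b) → f' (x, y) = f (x, y) := by
    rintro x y h
    by_cases hy : y = y0
    · subst hy
      rcases h with h | rfl | rfl
      · exact absurd rfl h
      · rw [e1, ea]
      · rw [e1, eb]
    · simp [f', hy]
  have hyy : c ≤ y0 ∧ y0 ≤ d := by
    rcases hy with rfl | rfl
    · exact ⟨le_rfl, hcd.le⟩
    · exact ⟨hcd.le, le_rfl⟩
  have hS : Sim σ f f' (bx a b c d) := by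
    rintro ⟨x, y⟩ ⟨h1, h2, h3, h4⟩
    simp only at h1 h2 h3 h4
    by_cases hy' : y = y0
    · subst hy'
      rw [e1]
      refine ⟨(hg x h1 h2).1, (hg x h1 h2).2.imp id ?_⟩
      rintro ⟨x1, x2, k1, k2, k3, k4, k5, k6⟩
      refine ⟨(x1, y), ⟨k1, k2.le.trans h2, h3, h4⟩, (x2, y), ⟨h1.trans k3.le, k4, h3, h4⟩, ⟨k2.le, le_rfl⟩, ?_,
        ⟨k3.le, le_rfl⟩, ?_, k5, k6⟩
      · simpa using k2.ne
      · simpa using k3.ne'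
    · rw [e2 _ _ (Or.inl hy')]
      exact ⟨Sys.eqv.refl _, Or.inl rfl⟩
  have hH : ∀ y, tr σ (fun x => f' (x, y)) a b = tr σ (fun x => f (x, y)) a b := by
    intro y
    by_cases hy' : y = y0
    · subst hy'
      rw [hg.tr_eq]
      simp only [e1]
    · simp only [e2 _ _ (Or.inl hy')]
  refine ⟨f', ⟨h.1.sim hS, ⟨?_, ?_, ?_, ?_, fun i hi => ?_, fun i hi => ?_⟩⟩, e1, e2⟩
  · rw [← h.2.lf]; simp only [e2 a _ (Or.inr (Or.inl rfl))]
  · rw [← h.2.rt]; simp only [e2 b _ (Or.inr (Or.inr rfl))]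
  · rw [← h.2.bt, hH]
  · rw [← h.2.tp, hH]
  · obtain ⟨q, h1, h2⟩ := h.2.rF i hi
    exact ⟨q, h1, hS.Wt h1 h2⟩
  · obtain ⟨q, h1, h2⟩ := h.2.rP i hi
    exact ⟨q, h1, hS.Wt' h1 h2⟩

/-- Prescribing a horizontal edge. -/
theorem MB.prescribeH {f : Pt → L} {a b c d y0 : ℝ} {β : Beh L ι} {g : ℝ → L} (h : MB σ f a b c d β)
    (hab : a < b) (hcd : c < d) (hy : y0 = c ∨ y0 = d) (hg : MonoI σ g a b)
    (ht : tr σ (fun x => f (x, y0)) a b = tr σ g a b) :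
    ∃ f', MB σ f' a b c d β ∧ (∀ x, f' (x, y0) = g x) ∧ ∀ y, f' (a, y) = f (a, y) ∧ f' (b, y) = f (b, y) := by
  have hyy : c ≤ y0 ∧ y0 ≤ d := by
    rcases hy with rfl | rfl
    · exact ⟨le_rfl, hcd.le⟩
    · exact ⟨hcd.le, le_rfl⟩
  obtain ⟨θ, h1, h2, h3⟩ := reparam hab hab hg (h.1.monoH hyy.1 hyy.2) ht.symm
  have hM : MB σ (fun p => f (θ p.1, p.2)) a b c d β :=
    MB.comp θ (OrderIso.refl ℝ) (by rw [h1, h2]; exact h)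
  obtain ⟨f', k1, k2, k3⟩ := hM.overrideH (g := g) hab hcd hy (Sim1.symm h3)
  refine ⟨f', k1, k2, fun y => ⟨?_, ?_⟩⟩
  · rw [k3 _ _ (Or.inr (Or.inl rfl))]; simp [h1]
  · rw [k3 _ _ (Or.inr (Or.inr rfl))]; simp [h2]

theorem MB.overrideV {f : Pt → L} {a b c d x0 : ℝ} {β : Beh L ι} {g : ℝ → L} (h : MB σ f a b c d β)
    (hab : a < b) (hcd : c < d) (hy : x0 = a ∨ x0 = b) (hg : Sim1 σ (fun y => f (x0, y)) g c d) :
    ∃ f', MB σ f' a b c d β ∧ (∀ y, f' (x0, y) = g y) ∧ ∀ x y, (x ≠ x0 ∨ y = c ∨ y = d) → f' (x, y) = f (x, y) := by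
  obtain ⟨f', k1, k2, k3⟩ := h.swap.overrideH hcd hab hy hg
  exact ⟨_, k1.swap, k2, fun x y hxy => k3 y x hxy⟩

theorem MB.prescribeV {f : Pt → L} {a b c d x0 : ℝ} {β : Beh L ι} {g : ℝ → L} (h : MB σ f a b c d β)
    (hab : a < b) (hcd : c < d) (hy : x0 = a ∨ x0 = b) (hg : MonoI σ g c d)
    (ht : tr σ (fun y => f (x0, y)) c d = tr σ g c d) :
    ∃ f', MB σ f' a b c d β ∧ (∀ y, f' (x0, y) = g y) ∧ ∀ x, f' (x, c) = f (x, c) ∧ f' (x, d) = f (x, d) := by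
  obtain ⟨f', k1, k2, k3⟩ := h.swap.prescribeH hcd hab hy hg ht
  exact ⟨_, k1.swap, k2, k3⟩

theorem le_tr (p q s : Pt) (h : p ≤ q) (h' : q ≤ s) : p ≤ s := h.trans h'
theorem ge_tr (p q s : Pt) (h : q ≤ p) (h' : s ≤ q) : s ≤ p := h'.trans h

theorem MB.congr {f f' : Pt → L} {a b c d : ℝ} {β : Beh L ι} (h : MB σ f a b c d β) (hab : a ≤ b) (hcd : c ≤ d)
    (hf : ∀ p ∈ bx a b c d, f p = f' p) : MB σ f' a b c d β := by
  have hS : Sim σ f f' (bx a b c d) := fun p hp => ⟨hf p hp ▸ Sys.eqv.refl _, Or.inl (hf p hp)⟩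
  refine ⟨h.1.sim hS, ⟨?_, ?_, ?_, ?_, fun i hi => ?_, fun i hi => ?_⟩⟩
  · rw [← h.2.lf]; exact (tr_congr fun y h1 h2 => hf _ ⟨le_rfl, hab, h1, h2⟩).symm
  · rw [← h.2.rt]; exact (tr_congr fun y h1 h2 => hf _ ⟨hab, le_rfl, h1, h2⟩).symm
  · rw [← h.2.bt]; exact (tr_congr fun y h1 h2 => hf _ ⟨h1, h2, le_rfl, hcd⟩).symm
  · rw [← h.2.tp]; exact (tr_congr fun y h1 h2 => hf _ ⟨h1, h2, hcd, le_rfl⟩).symm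
  · obtain ⟨q, h1, h2⟩ := h.2.rF i hi
    exact ⟨q, h1, hS.Wt h1 h2⟩
  · obtain ⟨q, h1, h2⟩ := h.2.rP i hi
    exact ⟨q, h1, hS.Wt' h1 h2⟩

theorem bx_sub {a b c d a' b' c' d' : ℝ} (h1 : a' ≤ a) (h2 : b ≤ b') (h3 : c' ≤ c) (h4 : d ≤ d') :
    bx a b c d ⊆ bx a' b' c' d' := fun _ h =>
  ⟨h1.trans h.1, h.2.1.trans h2, h3.trans h.2.2.1, h.2.2.2.trans h4⟩

/-- joining two boxes along a vertical line -/
theorem IsM.join {f : Pt → L} {a m b c d : ℝ} (ham : a ≤ m) (hmb : m ≤ b) (h1 : IsM σ f a m c d)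
    (h2 : IsM σ f m b c d) : IsM σ f a b c d := by
  have s1 : bx a m c d ⊆ bx a b c d := bx_sub le_rfl hmb le_rfl le_rfl
  have s2 : bx m b c d ⊆ bx a b c d := bx_sub ham le_rfl le_rfl le_rfl
  have hcov : ∀ p ∈ bx a b c d, p ∈ bx a m c d ∨ p ∈ bx m b c d := by
    rintro p ⟨h1, h2, h3, h4⟩
    rcases le_total p.1 m with h | h
    · exact Or.inl ⟨h1, h, h3, h4⟩
    · exact Or.inr ⟨h, h2, h3, h4⟩
  refine ⟨fun p hp q hq hpq => ?_, ?_, ?_⟩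
  · rcases hcov p hp with h | h
    · rcases hcov q hq with h' | h'
      · exact h1.mono p h q h' hpq
      · have e1 : (m, p.2) ∈ bx a m c d := ⟨ham, le_rfl, h.2.2⟩
        have e2 : (m, p.2) ∈ bx m b c d := ⟨le_rfl, hmb, h.2.2⟩
        exact σ.trans' (h1.mono p h _ e1 ⟨h.2.1, le_rfl⟩) (h2.mono _ e2 q h' ⟨h'.1, hpq.2⟩)
    · have : q ∈ bx m b c d := ⟨h.1.trans hpq.1, hq.2⟩
      exact h2.mono p h q this hpq
  · have F2 : ∀ p ∈ bx m b c d, ∀ i, σ.A (f p) i → FA σ (fun p q => p ≤ q) f (bx a b c d) (exU b d) p i :=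
      fun p hp i hA => (h2.fut p hp i hA).chain le_tr s2 fun q hq hq' _ hA' =>
        Or.inr ⟨q, s2 hq, hq', le_rfl, hA'⟩
    intro p hp i hA
    rcases hcov p hp with h | h
    · refine (h1.fut p h i hA).chain le_tr s1 fun q hq hq' _ hA' => ?_
      rcases hq' with hq' | hq'
      · exact F2 q ⟨hq'.ge, hq'.le.trans hmb, hq.2.2⟩ i hA'
      · exact Or.inr ⟨q, s1 hq, Or.inr hq', le_rfl, hA'⟩
    · exact F2 p h i hA
  · have F2 : ∀ p ∈ bx a m c d, ∀ i, σ.dual.A (f p) i → FA σ.dual (fun p q => q ≤ p) f (bx a b c d) (exU a c) p i :=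
      fun p hp i hA => (h1.past p hp i hA).chain ge_tr s1 fun q hq hq' _ hA' =>
        Or.inr ⟨q, s1 hq, hq', le_rfl, hA'⟩
    intro p hp i hA
    rcases hcov p hp with h | h
    · exact F2 p h i hA
    · refine (h2.past p h i hA).chain ge_tr s2 fun q hq hq' _ hA' => ?_
      rcases hq' with hq' | hq'
      · exact F2 q ⟨ham.trans hq'.ge, hq'.le, hq.2.2⟩ i hA'
      · exact Or.inr ⟨q, s2 hq, Or.inr hq', le_rfl, hA'⟩

theorem Rlz.join {β1 β2 β : Beh L ι} (h1 : Rlz σ β1) (h2 : Rlz σ β2) (h : β1.rt = β2.lf)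
    (hl : β.lf = β1.lf) (hr : β.rt = β2.rt) (hb : β.bt = β1.bt.conc β2.bt) (ht : β.tp = β1.tp.conc β2.tp)
    (hF : ∀ i, β.rF i → β1.rF i ∨ β2.rF i) (hP : ∀ i, β.rP i → β1.rP i ∨ β2.rP i) : Rlz σ β := by
  classical
  obtain ⟨f1, hf1⟩ := h1.box (show (0 : ℝ) < 1 by norm_num) (show (0 : ℝ) < 1 by norm_num)
  obtain ⟨f2, hf2⟩ := h2.box (show (1 : ℝ) < 2 by norm_num) (show (0 : ℝ) < 1 by norm_num)
  obtain ⟨f2', k1, k2, -⟩ := hf2.prescribeV (by norm_num) (by norm_num) (Or.inl rfl) (hf1.1.monoV zero_le_one le_rfl)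
    (by rw [hf2.2.lf, hf1.2.rt, h])
  let f : Pt → L := fun p => if p.1 ≤ 1 then f1 p else f2' p
  have g1 : MB σ f 0 1 0 1 β1 := hf1.congr zero_le_one zero_le_one (fun p hp => by simp [f, hp.2.1])
  have g2 : MB σ f 1 2 0 1 β2 := by
    refine k1.congr one_le_two zero_le_one fun p hp => ?_
    by_cases hp1 : p.1 ≤ 1
    · have : p.1 = 1 := le_antisymm hp1 hp.1
      simp only [f, hp1, if_true]
      have e := k2 p.2
      rw [← this] at e
      exact e
    · simp [f, hp1]
  have hM : IsM σ f 0 2 0 1 := g1.1.join zero_le_one one_le_two g2.1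
  have s1 : bx 0 1 0 1 ⊆ bx 0 2 0 1 := bx_sub le_rfl one_le_two le_rfl le_rfl
  have s2 : bx 1 2 0 1 ⊆ bx 0 2 0 1 := bx_sub zero_le_one le_rfl le_rfl le_rfl
  refine MB.rlz (f := f) (a := 0) (b := 2) (c := 0) (d := 1) ⟨hM, ⟨?_, ?_, ?_, ?_, fun i hi => ?_, fun i hi => ?_⟩⟩ (by norm_num) (by norm_num)
  · rw [hl, g1.2.lf]
  · rw [hr, g2.2.rt]
  · rw [hb, ← g1.2.bt, ← g2.2.bt]
    exact tr_conc (hM.monoH le_rfl zero_le_one) zero_le_one one_le_two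
  · rw [ht, ← g1.2.tp, ← g2.2.tp]
    exact tr_conc (hM.monoH zero_le_one le_rfl) zero_le_one one_le_two
  · rcases hF i hi with h | h
    · obtain ⟨q, e1, e2⟩ := g1.2.rF i h
      exact ⟨q, s1 e1, e2.mono s1⟩
    · obtain ⟨q, e1, e2⟩ := g2.2.rF i h
      exact ⟨q, s2 e1, e2.mono s2⟩
  · rcases hP i hi with h | h
    · obtain ⟨q, e1, e2⟩ := g1.2.rP i h
      exact ⟨q, s1 e1, e2.mono s1⟩
    · obtain ⟨q, e1, e2⟩ := g2.2.rP i h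
      exact ⟨q, s2 e1, e2.mono s2⟩

end
end Temporal

namespace Temporal
section
variable {L ι : Type} {σ : Sys L ι}

/-- order conditions for the base rule -/
def BaseLe (σ : Sys L ι) (ll lr ul ur l r b t c : L) : Prop :=
  (σ.le ll b ∧ σ.le b lr) ∧ (σ.le l c ∧ σ.le c r) ∧ (σ.le ul t ∧ σ.le t ur) ∧
  (σ.le ll l ∧ σ.le l ul) ∧ (σ.le b c ∧ σ.le c t) ∧ (σ.le lr r ∧ σ.le r ur)

/-- demand conditions for the base rule -/
def BaseF (σ : Sys L ι) (ll lr ul l r b t c : L) : Prop :=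
  ∀ i, (σ.A c i → σ.WF c i ∨ σ.A t i ∨ σ.A r i) ∧
    (σ.A l i → σ.WF l i ∨ σ.A ul i ∨ σ.WF c i ∨ σ.A t i ∨ σ.A r i) ∧
    (σ.A b i → σ.WF b i ∨ σ.A lr i ∨ σ.WF c i ∨ σ.A t i ∨ σ.A r i) ∧
    (σ.A ll i → σ.wF ll i ∨ σ.WF l i ∨ σ.A ul i ∨ σ.WF b i ∨ σ.A lr i ∨ σ.WF c i ∨ σ.A t i ∨ σ.A r i)

def BaseRes (σ : Sys L ι) (ll lr ul ur l r b t c : L) (i : ι) : Prop :=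
  σ.wF ll i ∨ σ.wF lr i ∨ σ.wF ul i ∨ σ.wF ur i ∨ σ.WF l i ∨ σ.WF r i ∨ σ.WF b i ∨ σ.WF t i ∨ σ.WF c i

noncomputable def tab (ll lr ul ur l r b t c : L) (p : Pt) : L :=
  elF (elF ll l ul 0 1 p.2) (elF b c t 0 1 p.2) (elF lr r ur 0 1 p.2) 0 1 p.1

theorem elF_refl (p e q : L) (x : ℝ) : elF p e q 0 1 (1 - x) = elF q e p 0 1 x := by
  unfold elF
  split_ifs <;> first | rfl | (exfalso; linarith)

def refl2 : Pt ≃ Pt where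
  toFun p := (1 - p.1, 1 - p.2)
  invFun p := (1 - p.1, 1 - p.2)
  left_inv p := by ext <;> simp
  right_inv p := by ext <;> simp

theorem refl2_apply (p : Pt) : refl2 p = (1 - p.1, 1 - p.2) := rfl
theorem refl2_le (p q : Pt) : q ≤ p ↔ refl2 p ≤ refl2 q := by
  simp only [refl2_apply, Prod.le_def]
  constructor <;> rintro ⟨h1, h2⟩ <;> constructor <;> linarith
theorem refl2_bx : refl2 ⁻¹' bx 0 1 0 1 = bx 0 1 0 1 := by
  ext p; simp [bx, refl2_apply]; tauto
theorem refl2_exU : refl2 ⁻¹' exU 1 1 = exU 0 0 := by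
  ext p; simp [exU, refl2_apply]

theorem tab_refl (ll lr ul ur l r b t c : L) (p : Pt) :
    tab ur ul lr ll r l t b c (refl2 p) = tab ll lr ul ur l r b t c p := by
  simp only [tab, refl2_apply, elF_refl]

/-- trichotomy in the closed unit interval -/
theorem tri {x : ℝ} (h : 0 ≤ x) (h' : x ≤ 1) : x = 0 ∨ x = 1 ∨ (0 < x ∧ x < 1) := by
  rcases h.eq_or_lt with h | h
  · exact Or.inl h.symm
  rcases h'.eq_or_lt with h' | h'
  · exact Or.inr (Or.inl h')
  · exact Or.inr (Or.inr ⟨h, h'⟩)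

theorem elF_0 {p e q : L} : elF p e q 0 1 0 = p := elF_left
theorem elF_1 {p e q : L} : elF p e q 0 1 1 = q := elF_right zero_lt_one

section
variable {ll lr ul ur l r b t c : L}

theorem tab_c {x y : ℝ} (hx : 0 < x ∧ x < 1) (hy : 0 < y ∧ y < 1) : tab ll lr ul ur l r b t c (x, y) = c := by
  simp only [tab]; rw [elF_mid hx.1 hx.2, elF_mid hy.1 hy.2]
theorem tab_l {y : ℝ} (hy : 0 < y ∧ y < 1) : tab ll lr ul ur l r b t c (0, y) = l := by
  simp only [tab]; rw [elF_0, elF_mid hy.1 hy.2]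
theorem tab_r {y : ℝ} (hy : 0 < y ∧ y < 1) : tab ll lr ul ur l r b t c (1, y) = r := by
  simp only [tab]; rw [elF_1, elF_mid hy.1 hy.2]
theorem tab_b {x : ℝ} (hx : 0 < x ∧ x < 1) : tab ll lr ul ur l r b t c (x, 0) = b := by
  simp only [tab]; rw [elF_mid hx.1 hx.2, elF_0]
theorem tab_t {x : ℝ} (hx : 0 < x ∧ x < 1) : tab ll lr ul ur l r b t c (x, 1) = t := by
  simp only [tab]; rw [elF_mid hx.1 hx.2, elF_1]
theorem tab_ll : tab ll lr ul ur l r b t c (0, 0) = ll := by simp only [tab]; rw [elF_0, elF_0]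
theorem tab_lr : tab ll lr ul ur l r b t c (1, 0) = lr := by simp only [tab]; rw [elF_1, elF_0]
theorem tab_ul : tab ll lr ul ur l r b t c (0, 1) = ul := by simp only [tab]; rw [elF_0, elF_1]
theorem tab_ur : tab ll lr ul ur l r b t c (1, 1) = ur := by simp only [tab]; rw [elF_1, elF_1]

theorem up_mid {x : ℝ} (h : 0 ≤ x) (h' : x < 1) : ∃ u, x ≤ u ∧ 0 < u ∧ u < 1 :=
  ⟨(x + 1) / 2, by linarith, by linarith, by linarith⟩

theorem tab_W {i : ι} {x y x' y' : ℝ} {m : L} {f : Pt → L} (h1 : f (x, y) = m) (h2 : f (x', y') = m)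
    (hR' : (x', y') ∈ bx 0 1 0 1) (hle : x ≤ x' ∧ y ≤ y')
    (hne : x ≠ x' ∨ y ≠ y') (hW : σ.WF m i) : Wt σ (fun p q => p ≤ q) f (bx 0 1 0 1) (x, y) i := by
  refine Or.inr ⟨h1.symm ▸ hW, (x', y'), hR', hle, ?_, by rw [h1, h2]; exact Sys.eqv.refl _⟩
  rcases hne with h | h <;> simp [h]

/-- witnesses in the four kinds of open cells -/
theorem tab_Wx {i : ι} {m : L} {f : Pt → L} {y : ℝ} (hy : 0 ≤ y ∧ y ≤ 1)
    (hf : ∀ x, 0 < x ∧ x < 1 → f (x, y) = m) (hW : σ.WF m i) {x : ℝ} (hx : 0 ≤ x ∧ x < 1) :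
    ∃ q ∈ bx 0 1 0 1, (x, y) ≤ q ∧ q.2 = y ∧ Wt σ (fun p q => p ≤ q) f (bx 0 1 0 1) q i := by
  obtain ⟨u, hu1, hu2, hu3⟩ := up_mid hx.1 hx.2
  obtain ⟨v, hv1, hv2⟩ := exists_between hu3
  exact ⟨(u, y), ⟨hu2.le, hu3.le, hy⟩, ⟨hu1, le_rfl⟩, rfl,
    tab_W (hf u ⟨hu2, hu3⟩) (hf v ⟨hu2.trans hv1, hv2⟩) ⟨(hu2.trans hv1).le, hv2.le, hy⟩ ⟨hv1.le, le_rfl⟩ (Or.inl hv1.ne) hW⟩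

theorem tab_Wy {i : ι} {m : L} {f : Pt → L} {x : ℝ} (hx : 0 ≤ x ∧ x ≤ 1)
    (hf : ∀ y, 0 < y ∧ y < 1 → f (x, y) = m) (hW : σ.WF m i) {y : ℝ} (hy : 0 ≤ y ∧ y < 1) :
    ∃ q ∈ bx 0 1 0 1, (x, y) ≤ q ∧ q.1 = x ∧ Wt σ (fun p q => p ≤ q) f (bx 0 1 0 1) q i := by
  obtain ⟨u, hu1, hu2, hu3⟩ := up_mid hy.1 hy.2
  obtain ⟨v, hv1, hv2⟩ := exists_between hu3
  exact ⟨(x, u), ⟨hx.1, hx.2, hu2.le, hu3.le⟩, ⟨le_rfl, hu1⟩, rfl,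
    tab_W (hf u ⟨hu2, hu3⟩) (hf v ⟨hu2.trans hv1, hv2⟩) ⟨hx.1, hx.2, (hu2.trans hv1).le, hv2.le⟩ ⟨le_rfl, hv1.le⟩ (Or.inr hv1.ne) hW⟩

theorem tab_fut (h : BaseF σ ll lr ul l r b t c) :
    FutOK σ (fun p q => p ≤ q) (tab ll lr ul ur l r b t c) (bx 0 1 0 1) (exU 1 1) := by
  rintro ⟨x, y⟩ ⟨hx0, hx1, hy0, hy1⟩ i hA
  simp only at hx0 hx1 hy0 hy1
  by_cases hx : x = 1
  · exact Or.inr ⟨_, ⟨hx0, hx1, hy0, hy1⟩, Or.inl hx, le_rfl, hA⟩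
  by_cases hy : y = 1
  · exact Or.inr ⟨_, ⟨hx0, hx1, hy0, hy1⟩, Or.inr hy, le_rfl, hA⟩
  have hx' : x < 1 := lt_of_le_of_ne hx1 hx
  have hy' : y < 1 := lt_of_le_of_ne hy1 hy
  obtain ⟨u, hu1, hu2, hu3⟩ := up_mid hx0 hx'
  obtain ⟨v, hv1, hv2, hv3⟩ := up_mid hy0 hy'
  have goC : σ.WF c i → FA σ (fun p q => p ≤ q) (tab ll lr ul ur l r b t c) (bx 0 1 0 1) (exU 1 1) (x, y) i := fun hW => by
    obtain ⟨q, h1, h2, -, h3⟩ := tab_Wx (f := tab ll lr ul ur l r b t c) (m := c) ⟨hv2.le, hv3.le⟩ (fun x hx => tab_c hx ⟨hv2, hv3⟩) hW ⟨hx0, hx'⟩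
    exact Or.inl ⟨q, h1, le_trans (b := (x, v)) ⟨le_rfl, hv1⟩ h2, h3⟩
  have goT : σ.A t i → FA σ (fun p q => p ≤ q) (tab ll lr ul ur l r b t c) (bx 0 1 0 1) (exU 1 1) (x, y) i := fun hW =>
    Or.inr ⟨(u, 1), ⟨hu2.le, hu3.le, zero_le_one, le_rfl⟩, Or.inr rfl, ⟨hu1, hy1⟩, by rwa [tab_t ⟨hu2, hu3⟩]⟩
  have goR : σ.A r i → FA σ (fun p q => p ≤ q) (tab ll lr ul ur l r b t c) (bx 0 1 0 1) (exU 1 1) (x, y) i := fun hW =>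
    Or.inr ⟨(1, v), ⟨zero_le_one, le_rfl, hv2.le, hv3.le⟩, Or.inl rfl, ⟨hx1, hv1⟩, by rwa [tab_r ⟨hv2, hv3⟩]⟩
  have goUL : x = 0 → σ.A ul i → FA σ (fun p q => p ≤ q) (tab ll lr ul ur l r b t c) (bx 0 1 0 1) (exU 1 1) (x, y) i := fun hx hW =>
    Or.inr ⟨(0, 1), ⟨le_rfl, zero_le_one, zero_le_one, le_rfl⟩, Or.inr rfl, ⟨hx.le, hy1⟩, by rwa [tab_ul]⟩
  have goLR : y = 0 → σ.A lr i → FA σ (fun p q => p ≤ q) (tab ll lr ul ur l r b t c) (bx 0 1 0 1) (exU 1 1) (x, y) i := fun hx hW =>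
    Or.inr ⟨(1, 0), ⟨zero_le_one, le_rfl, le_rfl, zero_le_one⟩, Or.inl rfl, ⟨hx1, hx.le⟩, by rwa [tab_lr]⟩
  have goL : x = 0 → σ.WF l i → FA σ (fun p q => p ≤ q) (tab ll lr ul ur l r b t c) (bx 0 1 0 1) (exU 1 1) (x, y) i := fun hx hW => by
    subst hx
    obtain ⟨q, h1, h2, -, h3⟩ := tab_Wy (f := tab ll lr ul ur l r b t c) (m := l) ⟨le_rfl, zero_le_one⟩ (fun x hx => tab_l hx) hW ⟨hy0, hy'⟩
    exact Or.inl ⟨q, h1, h2, h3⟩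
  have goB : y = 0 → σ.WF b i → FA σ (fun p q => p ≤ q) (tab ll lr ul ur l r b t c) (bx 0 1 0 1) (exU 1 1) (x, y) i := fun hx hW => by
    subst hx
    obtain ⟨q, h1, h2, -, h3⟩ := tab_Wx (f := tab ll lr ul ur l r b t c) (m := b) ⟨le_rfl, zero_le_one⟩ (fun x hx => tab_b hx) hW ⟨hx0, hx'⟩
    exact Or.inl ⟨q, h1, h2, h3⟩
  obtain ⟨k1, k2, k3, k4⟩ := h i
  rcases hx0.eq_or_lt with e1 | e1
  · rcases hy0.eq_or_lt with e2 | e2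
    · subst e1 e2
      rw [tab_ll] at hA
      rcases k4 hA with h | h | h | h | h | h | h | h
      · exact Or.inl ⟨(0, 0), ⟨le_rfl, zero_le_one, le_rfl, zero_le_one⟩, le_rfl, Or.inl (by rwa [tab_ll])⟩
      · exact goL rfl h
      · exact goUL rfl h
      · exact goB rfl h
      · exact goLR rfl h
      · exact goC h
      · exact goT h
      · exact goR h
    · subst e1
      rw [tab_l ⟨e2, hy'⟩] at hA
      rcases k2 hA with h | h | h | h | h
      · exact goL rfl h
      · exact goUL rfl h
      · exact goC h
      · exact goT h
      · exact goR h
  · rcases hy0.eq_or_lt with e2 | e2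
    · subst e2
      rw [tab_b ⟨e1, hx'⟩] at hA
      rcases k3 hA with h | h | h | h | h
      · exact goB rfl h
      · exact goLR rfl h
      · exact goC h
      · exact goT h
      · exact goR h
    · rw [tab_c ⟨e1, hx'⟩ ⟨e2, hy'⟩] at hA
      rcases k1 hA with h | h | h
      · exact goC h
      · exact goT h
      · exact goR h

theorem tab_res {i : ι} (h : BaseRes σ ll lr ul ur l r b t c i) :
    ∃ q ∈ bx 0 1 0 1, Wt σ (fun p q => p ≤ q) (tab ll lr ul ur l r b t c) (bx 0 1 0 1) q i := by
  have z : (0 : ℝ) ≤ 0 ∧ (0 : ℝ) ≤ 1 := ⟨le_rfl, zero_le_one⟩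
  have z' : (0 : ℝ) ≤ 0 ∧ (0 : ℝ) < 1 := ⟨le_rfl, zero_lt_one⟩
  have o : (0 : ℝ) ≤ 1 ∧ (1 : ℝ) ≤ 1 := ⟨zero_le_one, le_rfl⟩
  have hf : (0 : ℝ) < 1 / 2 ∧ (1 / 2 : ℝ) < 1 := by norm_num
  rcases h with h | h | h | h | h | h | h | h | h
  · exact ⟨(0, 0), ⟨z.1, z.2, z.1, z.2⟩, Or.inl (by rwa [tab_ll])⟩
  · exact ⟨(1, 0), ⟨o.1, o.2, z.1, z.2⟩, Or.inl (by rwa [tab_lr])⟩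
  · exact ⟨(0, 1), ⟨z.1, z.2, o.1, o.2⟩, Or.inl (by rwa [tab_ul])⟩
  · exact ⟨(1, 1), ⟨o.1, o.2, o.1, o.2⟩, Or.inl (by rwa [tab_ur])⟩
  · obtain ⟨q, h1, -, -, h2⟩ := tab_Wy (f := tab ll lr ul ur l r b t c) (m := l) z (fun x hx => tab_l hx) h z'
    exact ⟨q, h1, h2⟩
  · obtain ⟨q, h1, -, -, h2⟩ := tab_Wy (f := tab ll lr ul ur l r b t c) (m := r) o (fun x hx => tab_r hx) h z'
    exact ⟨q, h1, h2⟩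
  · obtain ⟨q, h1, -, -, h2⟩ := tab_Wx (f := tab ll lr ul ur l r b t c) (m := b) z (fun x hx => tab_b hx) h z'
    exact ⟨q, h1, h2⟩
  · obtain ⟨q, h1, -, -, h2⟩ := tab_Wx (f := tab ll lr ul ur l r b t c) (m := t) o (fun x hx => tab_t hx) h z'
    exact ⟨q, h1, h2⟩
  · obtain ⟨q, h1, -, -, h2⟩ := tab_Wx (f := tab ll lr ul ur l r b t c) (m := c) ⟨hf.1.le, hf.2.le⟩ (fun x hx => tab_c hx hf) h z'
    exact ⟨q, h1, h2⟩

theorem elF_mono2 {p e q p' e' q' : L} {x y : ℝ} (hx : 0 ≤ x) (hxy : x ≤ y) (hy : y ≤ 1)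
    (h : σ.le p e ∧ σ.le e q) (h1 : σ.le p p') (h2 : σ.le e e') (h3 : σ.le q q') :
    σ.le (elF p e q 0 1 x) (elF p' e' q' 0 1 y) := by
  refine σ.trans' (elF_mono (a := 0) (b := 1) h.1 h.2 x y hx hxy hy) ?_
  unfold elF
  split_ifs <;> assumption

theorem elF_between {p e q p' e' q' : L} {x : ℝ} (h1 : σ.le p p') (h2 : σ.le e e') (h3 : σ.le q q') :
    σ.le (elF p e q 0 1 x) (elF p' e' q' 0 1 x) := by
  unfold elF
  split_ifs <;> assumption

theorem tab_mono (h : BaseLe σ ll lr ul ur l r b t c) :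
    ∀ p ∈ bx 0 1 0 1, ∀ q ∈ bx 0 1 0 1, p ≤ q →
      σ.le (tab ll lr ul ur l r b t c p) (tab ll lr ul ur l r b t c q) := by
  obtain ⟨h1, h2, h3, h4, h5, h6⟩ := h
  intro p hp q hq hpq
  unfold tab
  apply elF_mono2 hp.1 hpq.1 hq.2.1 ⟨elF_between h1.1 h2.1 h3.1, elF_between h1.2 h2.2 h3.2⟩
  · exact elF_mono (a := 0) (b := 1) h4.1 h4.2 _ _ hp.2.2.1 hpq.2 hq.2.2.2
  · exact elF_mono (a := 0) (b := 1) h5.1 h5.2 _ _ hp.2.2.1 hpq.2 hq.2.2.2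
  · exact elF_mono (a := 0) (b := 1) h6.1 h6.2 _ _ hp.2.2.1 hpq.2 hq.2.2.2

end

/-- the base rule -/
def BaseRule (σ : Sys L ι) (ll lr ul ur l r b t c : L) (β : Beh L ι) : Prop :=
  BaseLe σ ll lr ul ur l r b t c ∧ BaseF σ ll lr ul l r b t c ∧ BaseF σ.dual ur ul lr r l t b c ∧
  β.lf = Tr.elem σ ll l ul ∧ β.rt = Tr.elem σ lr r ur ∧ β.bt = Tr.elem σ ll b lr ∧ β.tp = Tr.elem σ ul t ur ∧
  (∀ i, β.rF i → BaseRes σ ll lr ul ur l r b t c i) ∧ (∀ i, β.rP i → BaseRes σ.dual ur ul lr ll r l t b c i)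

theorem Rlz.base {ll lr ul ur l r b t c : L} {β : Beh L ι} (h : BaseRule σ ll lr ul ur l r b t c β) :
    Rlz σ β := by
  obtain ⟨h1, h2, h3, h4, h5, h6, h7, h8, h9⟩ := h
  refine ⟨tab ll lr ul ur l r b t c, ⟨tab_mono h1, tab_fut h2, ?_⟩, ?_, ?_, ?_, ?_, fun i hi => tab_res (h8 i hi), fun i hi => ?_⟩
  · have := (tab_fut (ur := ll) h3).comp refl2 refl2_le
    simp only [tab_refl] at this
    rw [refl2_bx, refl2_exU] at this
    exact this
  · rw [h4, ← elF_tr (zero_lt_one) h1.2.2.2.1.1 h1.2.2.2.1.2]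
    simp only [tab, elF_0]
  · rw [h5, ← elF_tr (zero_lt_one) h1.2.2.2.2.2.1 h1.2.2.2.2.2.2]
    simp only [tab, elF_1]
  · rw [h6, ← elF_tr (zero_lt_one) h1.1.1 h1.1.2]
    simp only [tab, elF_0]
  · rw [h7, ← elF_tr (zero_lt_one) h1.2.2.1.1 h1.2.2.1.2]
    simp only [tab, elF_1]
  · have := Wt_ex_comp refl2 refl2_le (tab_res (h9 i hi))
    simp only [tab_refl] at this
    rw [refl2_bx] at this
    exact this
end
end Temporal

namespace Temporal
section
variable {L ι : Type} {σ : Sys L ι}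

/-! ### Soundness of the corner limit rule -/

noncomputable def sc (n : ℕ) : ℝ := (1 / 2) ^ n
theorem sc_pos (n : ℕ) : 0 < sc n := by unfold sc; positivity
theorem sc_succ (n : ℕ) : sc (n + 1) = sc n / 2 := by unfold sc; rw [pow_succ]; ring
theorem sc_zero : sc 0 = 1 := by simp [sc]
theorem sc_le {m n : ℕ} (h : m ≤ n) : sc n ≤ sc m := by
  unfold sc; exact pow_le_pow_of_le_one (by norm_num) (by norm_num) h
theorem exists_sc {x : ℝ} (h : 0 < x) : ∃ n, sc n ≤ x := by
  obtain ⟨n, hn⟩ := exists_pow_lt_of_lt_one h (show (1 / 2 : ℝ) < 1 by norm_num)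
  exact ⟨n, hn.le⟩

def MonoOn (σ : Sys L ι) (f : Pt → L) (R : Set Pt) : Prop := ∀ p ∈ R, ∀ q ∈ R, p ≤ q → σ.le (f p) (f q)

theorem lim_mono {F : Pt → L}
    (hβ : ∀ n, MonoOn σ F (bx 0 (sc n / 2) (-sc n) (-(sc n / 2))))
    (hα : ∀ n, MonoOn σ F (bx (sc n / 2) (sc n) (-sc n) (-(sc n / 2))))
    (hγ : ∀ n, MonoOn σ F (bx (sc n / 2) (sc n) (-(sc n / 2)) 0)) :
    ∀ k n p q, p ∈ bx 0 (sc n) (-sc n) 0 → q ∈ bx 0 (sc n) (-sc n) 0 → p ≤ q →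
      (sc (n + k) ≤ p.1 ∨ p.2 ≤ -sc (n + k)) → (sc (n + k) ≤ q.1 ∨ q.2 ≤ -sc (n + k)) → σ.le (F p) (F q) := by
  -- monotonicity on a ring
  have ring : ∀ n p q, p ∈ bx 0 (sc n) (-sc n) 0 → q ∈ bx 0 (sc n) (-sc n) 0 → p ≤ q →
      (sc n / 2 ≤ p.1 ∨ p.2 ≤ -(sc n / 2)) → (sc n / 2 ≤ q.1 ∨ q.2 ≤ -(sc n / 2)) → σ.le (F p) (F q) := by
    intro n p q hp hq hpq h1 h2
    have hs := sc_pos n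
    obtain ⟨p1, p2, p3, p4⟩ := hp
    obtain ⟨q1, q2, q3, q4⟩ := hq
    obtain ⟨x, y⟩ := p
    obtain ⟨u, v⟩ := q
    obtain ⟨hxu, hyv⟩ := hpq
    simp only at *
    -- within the right column
    have col : ∀ {x y u v : ℝ}, sc n / 2 ≤ x → u ≤ sc n → -sc n ≤ y → v ≤ 0 → x ≤ u → y ≤ v → σ.le (F (x, y)) (F (u, v)) := by
      intro x y u v h1 h2 h3 h4 h5 h6
      rcases le_total v (-(sc n / 2)) with h | h
      · exact hα n _ ⟨h1, h5.trans h2, h3, h6.trans h⟩ _ ⟨h1.trans h5, h2, h3.trans h6, h⟩ ⟨h5, h6⟩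
      rcases le_total y (-(sc n / 2)) with h' | h'
      · exact σ.trans' (hα n (x, y) ⟨h1, h5.trans h2, h3, h'⟩ (x, -(sc n / 2)) ⟨h1, h5.trans h2, by simp only; linarith, le_rfl⟩ ⟨le_rfl, h'⟩)
          (hγ n _ ⟨h1, h5.trans h2, le_rfl, by simp only; linarith⟩ (u, v) ⟨h1.trans h5, h2, h, h4⟩ ⟨h5, h⟩)
      · exact hγ n _ ⟨h1, h5.trans h2, h', h6.trans h4⟩ _ ⟨h1.trans h5, h2, h, h4⟩ ⟨h5, h6⟩
    by_cases hx : sc n / 2 ≤ x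
    · exact col hx q2 p3 q4 hxu hyv
    · have hy : y ≤ -(sc n / 2) := h1.resolve_left hx
      push Not at hx
      rcases le_total u (sc n / 2) with h | h
      · rcases h2 with h2 | h2
        · obtain rfl : u = sc n / 2 := le_antisymm h h2
          refine σ.trans' (hβ n (x, y) ⟨p1, hx.le, p3, hy⟩ (sc n / 2, y) ⟨by simp only; linarith, le_rfl, p3, hy⟩ ⟨hxu, le_rfl⟩) ?_
          exact col le_rfl (by linarith) p3 q4 le_rfl hyv
        · exact hβ n (x, y) ⟨p1, hx.le, p3, hy⟩ (u, v) ⟨q1, h, q3, h2⟩ ⟨hxu, hyv⟩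
      · refine σ.trans' (hβ n (x, y) ⟨p1, hx.le, p3, hy⟩ (sc n / 2, y) ⟨by simp only; linarith, le_rfl, p3, hy⟩ ⟨hx.le, le_rfl⟩) ?_
        exact col le_rfl q2 p3 q4 h hyv
  intro k
  induction k with
  | zero =>
    intro n p q hp hq hpq h1 h2
    have hs := sc_pos n
    exact ring n p q hp hq hpq (h1.imp (fun h => by simp only [add_zero] at h; linarith) (fun h => by simp only [add_zero] at h; linarith))
      (h2.imp (fun h => by simp only [add_zero] at h; linarith) (fun h => by simp only [add_zero] at h; linarith))
  | succ k ih =>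
    intro n p q hp hq hpq h1 h2
    have hs := sc_pos n
    have hss := sc_succ n
    have ek : n + (k + 1) = n + 1 + k := by ring
    rw [ek] at h1 h2
    by_cases rp : sc n / 2 ≤ p.1 ∨ p.2 ≤ -(sc n / 2)
    · by_cases rq : sc n / 2 ≤ q.1 ∨ q.2 ≤ -(sc n / 2)
      · exact ring n p q hp hq hpq rp rq
      · push Not at rq
        have hp1 : p.1 ≤ sc n / 2 := hpq.1.trans rq.1.le
        have hp2 : p.2 ≤ -(sc n / 2) := rp.elim (fun h => by linarith [hpq.1]) id
        refine σ.trans' (hβ n p ⟨hp.1, hp1, hp.2.2.1, hp2⟩ (q.1, -(sc n / 2)) ⟨hq.1, rq.1.le, by simp only; linarith, le_rfl⟩ ⟨hpq.1, hp2⟩) ?_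
        refine ih (n + 1) _ q ⟨hq.1, by simp only [hss]; linarith, by simp only [hss]; linarith, by simp only; linarith⟩
          ⟨hq.1, by linarith, by linarith, hq.2.2.2⟩ ⟨le_rfl, rq.2.le⟩ (Or.inr ?_) h2
        simp only
        have := sc_le (show n + 1 ≤ n + 1 + k by omega)
        linarith
    · push Not at rp
      by_cases rq : sc n / 2 ≤ q.1 ∨ q.2 ≤ -(sc n / 2)
      · have hq1 : sc n / 2 ≤ q.1 := rq.elim id (fun h => by linarith [hpq.2])
        refine σ.trans' ?_ (hγ n (sc n / 2, p.2) ⟨le_rfl, by simp only; linarith, rp.2.le, hp.2.2.2⟩ q ⟨hq1, hq.2.1, by linarith [hpq.2], hq.2.2.2⟩ ⟨hq1, hpq.2⟩)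
        refine ih (n + 1) p _ ⟨hp.1, by linarith, by linarith, hp.2.2.2⟩ ⟨by simp only; linarith, by simp only; linarith, by simp only; linarith, hp.2.2.2⟩
          ⟨rp.1.le, le_rfl⟩ h1 (Or.inl ?_)
        simp only
        have := sc_le (show n + 1 ≤ n + 1 + k by omega)
        linarith
      · push Not at rq
        exact ih (n + 1) p q ⟨hp.1, by linarith, by linarith, hp.2.2.2⟩ ⟨hq.1, by linarith, by linarith, hq.2.2.2⟩ hpq h1 h2

theorem lim_fut {F : Pt → L} {c z e : L} {rs : ι → Prop}
    (hβ : ∀ n, FutOK σ (fun p q => p ≤ q) F (bx 0 (sc n / 2) (-sc n) (-(sc n / 2))) (exU (sc n / 2) (-(sc n / 2))))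
    (hα : ∀ n, FutOK σ (fun p q => p ≤ q) F (bx (sc n / 2) (sc n) (-sc n) (-(sc n / 2))) (exU (sc n) (-(sc n / 2))))
    (hγ : ∀ n, FutOK σ (fun p q => p ≤ q) F (bx (sc n / 2) (sc n) (-(sc n / 2)) 0) (exU (sc n) 0))
    (hc : ∀ y, -1 ≤ y → y < 0 → σ.eqv (F (0, y)) c) (hz : F (0, 0) = z)
    (he : ∀ y, -(1 / 2) < y → y < 0 → σ.eqv (F (1, y)) e)
    (hrs : ∀ i, rs i → ∀ n, ∃ q ∈ bx 0 (sc n) (-sc n) 0, Wt σ (fun p q => p ≤ q) F (bx 0 (sc n) (-sc n) 0) q i)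
    (hcond : ∀ i, σ.A c i → σ.WF c i ∨ σ.A z i ∨ σ.A e i ∨ rs i) :
    FutOK σ (fun p q => p ≤ q) F (bx 0 1 (-1) 0) (exU 1 0) := by
  have s1 : ∀ n, sc n ≤ 1 := fun n => sc_zero ▸ sc_le (Nat.zero_le n)
  have sp := sc_pos
  have G : ∀ n, ∀ p ∈ bx (sc n / 2) (sc n) (-(sc n / 2)) 0, ∀ i, σ.A (F p) i →
      FA σ (fun p q => p ≤ q) F (bx 0 1 (-1) 0) (exU 1 0) p i := by
    intro n
    induction n with
    | zero =>
      intro p hp i hA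
      have hsub : bx (sc 0 / 2) (sc 0) (-(sc 0 / 2)) 0 ⊆ bx 0 1 (-1) 0 := by
        rw [sc_zero]; exact bx_sub (by norm_num) le_rfl (by norm_num) le_rfl
      refine (hγ 0 p hp i hA).chain le_tr hsub fun q hq hq' _ hA' => ?_
      refine Or.inr ⟨q, hsub hq, ?_, le_rfl, hA'⟩
      rwa [sc_zero] at hq'
    | succ n ih =>
      intro p hp i hA
      have := sp n
      have := s1 n
      have hsub : bx (sc (n+1) / 2) (sc (n+1)) (-(sc (n+1) / 2)) 0 ⊆ bx 0 1 (-1) 0 := by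
        rw [sc_succ]; exact bx_sub (by linarith) (by linarith) (by linarith) le_rfl
      refine (hγ (n + 1) p hp i hA).chain le_tr hsub fun q hq hq' _ hA' => ?_
      rcases hq' with h | h
      · rw [sc_succ] at h hq
        exact ih q ⟨h.ge, by linarith, by linarith [hq.2.2.1], hq.2.2.2⟩ i hA'
      · exact Or.inr ⟨q, hsub hq, Or.inr h, le_rfl, hA'⟩
  have Al : ∀ n, ∀ p ∈ bx (sc n / 2) (sc n) (-(sc n)) (-(sc n / 2)), ∀ i, σ.A (F p) i →
      FA σ (fun p q => p ≤ q) F (bx 0 1 (-1) 0) (exU 1 0) p i := by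
    intro n p hp i hA
    have := sp n
    have := s1 n
    have hsub : bx (sc n / 2) (sc n) (-(sc n)) (-(sc n / 2)) ⊆ bx 0 1 (-1) 0 :=
      bx_sub (by linarith) (by linarith) (by linarith) (by linarith)
    refine (hα n p hp i hA).chain le_tr hsub fun q hq hq' _ hA' => ?_
    rcases hq' with h | h
    · cases n with
      | zero => rw [sc_zero] at h; exact Or.inr ⟨q, hsub hq, Or.inl h, le_rfl, hA'⟩
      | succ n =>
        have := sp n
        rw [sc_succ] at h hq
        exact G n q ⟨h.ge, by linarith, by linarith [hq.2.2.1], by linarith [hq.2.2.2]⟩ i hA'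
    · exact G n q ⟨hq.1, hq.2.1, h.ge, by linarith [hq.2.2.2]⟩ i hA'
  have Be : ∀ k n, ∀ p ∈ bx 0 (sc n / 2) (-sc n) (-(sc n / 2)), sc (n + k + 1) ≤ p.1 → ∀ i, σ.A (F p) i →
      FA σ (fun p q => p ≤ q) F (bx 0 1 (-1) 0) (exU 1 0) p i := by
    intro k
    induction k with
    | zero =>
      intro n p hp hp1 i hA
      rw [add_zero, sc_succ] at hp1
      exact Al n p ⟨hp1, by linarith [hp.2.1, sp n], hp.2.2.1, hp.2.2.2⟩ i hA
    | succ k ih =>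
      intro n p hp hp1 i hA
      have := sp n
      have := s1 n
      have hsub : bx 0 (sc n / 2) (-(sc n)) (-(sc n / 2)) ⊆ bx 0 1 (-1) 0 :=
        bx_sub (by linarith) (by linarith) (by linarith) (by linarith)
      refine (hβ n p hp i hA).chain le_tr hsub fun q hq hq' hpq hA' => ?_
      rcases hq' with h | h
      · exact Al n q ⟨h.ge, by linarith, hq.2.2.1, hq.2.2.2⟩ i hA'
      · have e1 := sc_succ n
        have hq1 : sc (n + 1 + k + 1) ≤ q.1 := by
          have : n + (k + 1) + 1 = n + 1 + k + 1 := by ring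
          rw [← this]; exact hp1.trans hpq.1
        rcases le_total q.1 (sc (n + 1) / 2) with h' | h'
        · exact ih (n + 1) q ⟨hq.1, h', by linarith, by linarith⟩ hq1 i hA'
        · exact Al (n + 1) q ⟨h', by linarith [hq.2.1], by linarith, by linarith⟩ i hA'
  have key : ∀ n, ∀ p ∈ bx 0 (sc n) (-sc n) 0, (sc n / 2 ≤ p.1 ∨ p.2 ≤ -(sc n / 2)) → 0 < p.1 → ∀ i, σ.A (F p) i →
      FA σ (fun p q => p ≤ q) F (bx 0 1 (-1) 0) (exU 1 0) p i := by
    intro n p hp hor hp1 i hA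
    by_cases h1 : sc n / 2 ≤ p.1
    · rcases le_total p.2 (-(sc n / 2)) with h | h
      · exact Al n p ⟨h1, hp.2.1, hp.2.2.1, h⟩ i hA
      · exact G n p ⟨h1, hp.2.1, h, hp.2.2.2⟩ i hA
    · have h2 := hor.resolve_left h1
      push Not at h1
      obtain ⟨m, hm⟩ := exists_sc hp1
      refine Be m n p ⟨hp.1, h1.le, hp.2.2.1, h2⟩ ((sc_le (by omega)).trans hm) i hA
  rintro ⟨x, y⟩ hp i hA
  have hp' := hp
  obtain ⟨p1, p2, p3, p4⟩ := hp'
  simp only at p1 p2 p3 p4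
  rcases p4.eq_or_lt with hy | hy
  · exact Or.inr ⟨_, hp, Or.inr hy, le_rfl, hA⟩
  rcases p1.eq_or_lt with hx | hx
  · subst hx
    obtain ⟨n, hn⟩ := exists_sc (show 0 < -y by linarith)
    have hcy := hc y p3 hy
    rcases hcond i (hcy.A hA) with h | h | h | h
    · refine Or.inl ⟨(0, y), hp, le_rfl, Or.inr ⟨hcy.symm.WF h, (0, y / 2), ⟨le_rfl, zero_le_one, by simp only; linarith, by simp only; linarith⟩,
        ⟨le_rfl, by simp only; linarith⟩, ?_, hcy.trans (hc _ (by linarith) (by linarith)).symm⟩⟩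
      simp only [ne_eq, Prod.mk.injEq, true_and]; intro h; linarith
    · exact Or.inr ⟨(0, 0), ⟨le_rfl, zero_le_one, by simp only; linarith, le_rfl⟩, Or.inr rfl, ⟨le_rfl, p4⟩, hz ▸ h⟩
    · refine Or.inr ⟨(1, y / 4), ⟨zero_le_one, le_rfl, by simp only; linarith, by simp only; linarith⟩, Or.inl rfl, ⟨zero_le_one, by simp only; linarith⟩, ?_⟩
      exact (he _ (by linarith) (by linarith)).symm.A h
    · obtain ⟨q, h1, h2⟩ := hrs i h n
      have hsub : bx 0 (sc n) (-sc n) 0 ⊆ bx 0 1 (-1) 0 := bx_sub le_rfl (s1 n) (by linarith [s1 n]) le_rfl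
      exact Or.inl ⟨q, hsub h1, ⟨h1.1, by have := h1.2.2.1; simp only; linarith⟩, h2.mono hsub⟩
  · -- find the ring
    have : ∃ n, (x, y) ∈ bx 0 (sc n) (-sc n) 0 ∧ (sc n / 2 ≤ x ∨ y ≤ -(sc n / 2)) := by
      obtain ⟨m, hm⟩ := exists_sc hx
      have : ∀ m, (sc m ≤ x ∨ y ≤ -sc m) → ∃ n, (x, y) ∈ bx 0 (sc n) (-sc n) 0 ∧ (sc n / 2 ≤ x ∨ y ≤ -(sc n / 2)) := by
        intro m
        induction m with
        | zero =>
          intro h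
          refine ⟨0, by rw [sc_zero]; exact hp, ?_⟩
          rw [sc_zero] at h ⊢
          exact h.imp (fun h => by linarith) (fun h => by linarith)
        | succ m ih =>
          intro h
          by_cases h' : sc m ≤ x ∨ y ≤ -sc m
          · exact ih h'
          · push Not at h'
            rw [sc_succ] at h
            exact ⟨m, ⟨p1, h'.1.le, h'.2.le, p4⟩, h⟩
      exact this m (Or.inl hm)
    obtain ⟨n, h1, h2⟩ := this
    exact key n _ h1 h2 hx i hA
end
end Temporal

namespace Temporal
section
variable {L ι : Type} {σ : Sys L ι}

/-- gluing one-dimensional functions -/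
noncomputable def glue (m : ℝ) (g h : ℝ → L) (x : ℝ) : L := if x ≤ m then g x else h x

theorem glue_left {m : ℝ} {g h : ℝ → L} {x : ℝ} (hx : x ≤ m) : glue m g h x = g x := by simp [glue, hx]
theorem glue_right {m : ℝ} {g h : ℝ → L} (e : g m = h m) {x : ℝ} (hx : m ≤ x) : glue m g h x = h x := by
  rcases hx.eq_or_lt with rfl | hx
  · simp [glue, e]
  · simp [glue, not_le.2 hx]
theorem glue_mono {m a b : ℝ} {g h : ℝ → L} (e : g m = h m) (hg : MonoI σ g a m) (hh : MonoI σ h m b) :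
    MonoI σ (glue m g h) a b := by
  intro x y hx hxy hy
  rcases le_total y m with h1 | h1
  · rw [glue_left h1, glue_left (hxy.trans h1)]; exact hg x y hx hxy h1
  rcases le_total x m with h2 | h2
  · rw [glue_left h2, glue_right e h1]
    exact σ.trans' (hg x m hx h2 le_rfl) (e ▸ hh m y le_rfl h1 hy)
  · rw [glue_right e h1, glue_right e h2]; exact hh x y h2 hxy hy
theorem glue_tr {m a b : ℝ} {g h : ℝ → L} (e : g m = h m) (hg : MonoI σ g a m) (hh : MonoI σ h m b)
    (ha : a ≤ m) (hb : m ≤ b) : tr σ (glue m g h) a b = (tr σ g a m).conc (tr σ h m b) := by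
  rw [tr_conc (glue_mono e hg hh) ha hb]
  congr 1
  · exact tr_congr fun x _ h2 => glue_left h2
  · exact tr_congr fun x h1 _ => glue_right e h1

def rho : Pt ≃ Pt where
  toFun p := (-p.2, -p.1)
  invFun p := (-p.2, -p.1)
  left_inv p := by ext <;> simp
  right_inv p := by ext <;> simp

theorem rho_apply (p : Pt) : rho p = (-p.2, -p.1) := rfl
theorem rho_le (p q : Pt) : p ≤ q ↔ rho q ≤ rho p := by
  simp only [rho_apply, Prod.le_def]
  constructor <;> rintro ⟨h1, h2⟩ <;> constructor <;> linarith
theorem rho_le' (p q : Pt) : q ≤ p ↔ rho p ≤ rho q := rho_le q p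
theorem rho_bx (a b c d : ℝ) : rho ⁻¹' bx a b c d = bx (-d) (-c) (-b) (-a) := by
  ext p; simp only [bx, Set.mem_preimage, Set.mem_ofPred_eq, rho_apply]
  constructor <;> rintro ⟨h1, h2, h3, h4⟩ <;> refine ⟨?_, ?_, ?_, ?_⟩ <;> linarith
theorem rho_exU (b d : ℝ) : rho ⁻¹' exU b d = exU (-d) (-b) := by
  ext p; simp only [exU, Set.mem_preimage, Set.mem_ofPred_eq, rho_apply]
  constructor <;> rintro (h | h)
  · right; linarith
  · left; linarith
  · right; linarith
  · left; linarith

theorem FutOK.rho {F : Pt → L} {R E R' E' : Set Pt} (h : FutOK σ (fun p q => q ≤ p) F R E) (e1 : Temporal.rho ⁻¹' R = R')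
    (e2 : Temporal.rho ⁻¹' E = E') : FutOK σ (fun p q => p ≤ q) (fun p => F (Temporal.rho p)) R' E' := by
  subst e1; subst e2
  exact h.comp Temporal.rho rho_le
theorem FutOK.rho' {F : Pt → L} {R E R' E' : Set Pt} (h : FutOK σ (fun p q => p ≤ q) F R E) (e1 : Temporal.rho ⁻¹' R = R')
    (e2 : Temporal.rho ⁻¹' E = E') : FutOK σ (fun p q => q ≤ p) (fun p => F (Temporal.rho p)) R' E' := by
  subst e1; subst e2
  exact h.comp Temporal.rho rho_le'

/-- the corner limit rule -/
def LimRule (σ : Sys L ι) (α β γ q : Beh L ι) (c c' z e e' p p' p2 p3 p4 p5 : L) : Prop :=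
  (σ.le c z ∧ σ.le z c' ∧ σ.le c e' ∧ σ.le e c') ∧
  (σ.eqv p c ∧ σ.eqv p2 c ∧ σ.eqv p' c' ∧ σ.eqv p3 c' ∧ σ.eqv p4 e' ∧ σ.eqv p5 e) ∧
  (q.lf = Tr.elem σ p c z ∧ q.tp = Tr.elem σ z c' p' ∧ β.lf = Tr.elem σ p c p2 ∧ γ.tp = Tr.elem σ p3 c' p') ∧
  (β.tp = q.bt ∧ γ.lf = q.rt ∧ β.rt = α.lf ∧ α.tp = γ.bt) ∧
  (q.bt = β.bt.conc α.bt ∧ q.rt = α.rt.conc γ.rt ∧ β.bt = Tr.elem σ p e' p4 ∧ γ.rt = Tr.elem σ p5 e p') ∧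
  (∀ i, σ.A c i → σ.WF c i ∨ σ.A z i ∨ σ.A e i ∨ α.rF i ∨ β.rF i ∨ γ.rF i) ∧
  (∀ i, σ.B c' i → σ.WP c' i ∨ σ.B z i ∨ σ.B e' i ∨ α.rP i ∨ β.rP i ∨ γ.rP i) ∧
  (∀ i, q.rF i → α.rF i ∨ β.rF i ∨ γ.rF i ∨ σ.wF z i) ∧
  (∀ i, q.rP i → α.rP i ∨ β.rP i ∨ γ.rP i ∨ σ.wP z i)

/-- level zero of the limit construction -/
theorem lim_level {α β γ q : Beh L ι} {c c' z e e' p p' p2 p3 p4 p5 : L}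
    (h : LimRule σ α β γ q c c' z e e' p p' p2 p3 p4 p5) (hα : Rlz σ α) (hβ : Rlz σ β) (hγ : Rlz σ γ) :
    ∃ F : Pt → L, MB σ F 0 (1/2) (-1) (-(1/2)) β ∧ MB σ F (1/2) 1 (-1) (-(1/2)) α ∧ MB σ F (1/2) 1 (-(1/2)) 0 γ ∧
      (∀ y, -(1/2) ≤ y → y ≤ 0 → F (1/2, y) = F (1, 2 * y)) ∧ (∀ x, 0 ≤ x → x ≤ 1/2 → F (x, -(1/2)) = F (2 * x, -1)) := by
  classical
  obtain ⟨⟨l1, l2, l3, l4⟩, ⟨v1, v2, v3, v4, v5, v6⟩, ⟨t1, t2, t3, t4⟩, ⟨s1, s2, s3, s4⟩, ⟨b1, b2, b3, b4⟩, -⟩ := h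
  have n1 : (0 : ℝ) < 1 / 2 := by norm_num
  have n2 : (1 / 2 : ℝ) < 1 := by norm_num
  have n3 : (-1 : ℝ) < -(1 / 2) := by norm_num
  have n4 : (-(1 / 2) : ℝ) < 0 := by norm_num
  obtain ⟨fα, hfα⟩ := hα.box n2 n3
  obtain ⟨g0, hg0⟩ := hβ.box n1 n3
  obtain ⟨g1, hg1, a1, -⟩ := hg0.prescribeV n1 n3 (Or.inr rfl) (hfα.1.monoV le_rfl n2.le)
    (by rw [hg0.2.rt, hfα.2.lf, s3])
  have pe : σ.le p e' := σ.trans' v1.1 l3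
  obtain ⟨i1, i2, -⟩ := elem_inv (hg1.1.monoH le_rfl n3.le) n1 pe v5.2 (hg1.2.bt.trans b3)
  rw [a1] at i2
  have eb : elF p e' p4 0 (1/2) (1/2) = fα (1/2, -1) := by rw [elF_right n1, i2]
  have mb := glue_mono eb (elF_mono (a := 0) (b := 1/2) pe v5.2) (hfα.1.monoH le_rfl n3.le)
  have tb := glue_tr eb (elF_mono (a := 0) (b := 1/2) pe v5.2) (hfα.1.monoH le_rfl n3.le) n1.le n2.le
  rw [elF_tr n1 pe v5.2, ← b3, hfα.2.bt, ← b1, ← s1] at tb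
  let θ : ℝ ≃o ℝ := OrderIso.mulLeft₀ 2 (by norm_num)
  have θa : ∀ x, θ x = 2 * x := fun x => rfl
  obtain ⟨g2, hg2, a2, a3⟩ := hg1.prescribeH (y0 := -(1/2)) (g := fun x => glue (1/2) (elF p e' p4 0 (1/2)) (fun x => fα (x, -1)) (θ x)) n1 n3 (Or.inr rfl)
    (by intro x y hx hxy hy; simp only [θa]; exact mb _ _ (by linarith) (by linarith) (by linarith))
    (by rw [hg1.2.tp, tr_comp θ (glue (1/2) (elF p e' p4 0 (1/2)) (fun x => fα (x, -1)))]; simp only [θa]; norm_num at tb ⊢; exact tb.symm)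
  obtain ⟨fβ, hfβ, a4, a5⟩ := hg2.overrideH (y0 := -1) n1 n3 (Or.inl rfl) (elem_sim (hg2.1.monoH le_rfl n3.le) n1 pe v5.2 (hg2.2.bt.trans b3))
  have β1 : ∀ y, fβ (1/2, y) = fα (1/2, y) := fun y => by rw [a5 _ _ (Or.inr (Or.inr rfl)), (a3 y).2, a1]
  have β2 : ∀ x, fβ (x, -(1/2)) = glue (1/2) (elF p e' p4 0 (1/2)) (fun x => fα (x, -1)) (2 * x) := fun x => by
    rw [a5 _ _ (Or.inl (by norm_num)), a2, θa]
  -- the piece γ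
  obtain ⟨k0, hk0⟩ := hγ.box n2 n4
  obtain ⟨k1, hk1, c1, -⟩ := hk0.prescribeH n2 n4 (Or.inl rfl) (hfα.1.monoH n3.le le_rfl)
    (by rw [hk0.2.bt, hfα.2.tp, s4])
  have ep : σ.le e p' := σ.trans' l4 v3.2
  obtain ⟨j1, j2, -⟩ := elem_inv (hk1.1.monoV n2.le le_rfl) n4 v6.1 ep (hk1.2.rt.trans b4)
  rw [c1] at j1
  have er : fα (1, -(1/2)) = elF p5 e p' (-(1/2)) 0 (-(1/2)) := by rw [elF_left, j1]
  have mr := glue_mono (g := fun y => fα (1, y)) er (hfα.1.monoV n2.le le_rfl) (elF_mono (a := -(1/2)) (b := 0) v6.1 ep)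
  have tr' := glue_tr (g := fun y => fα (1, y)) er (hfα.1.monoV n2.le le_rfl) (elF_mono (a := -(1/2)) (b := 0) v6.1 ep) n3.le n4.le
  rw [elF_tr n4 v6.1 ep, ← b4, hfα.2.rt, ← b2, ← s2] at tr'
  obtain ⟨k2, hk2, c2, c3⟩ := hk1.prescribeV (x0 := 1/2) (g := fun y => glue (-(1/2)) (fun y => fα (1, y)) (elF p5 e p' (-(1/2)) 0) (θ y)) n2 n4 (Or.inl rfl)
    (by intro x y hx hxy hy; simp only [θa]; exact mr _ _ (by linarith) (by linarith) (by linarith))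
    (by rw [hk1.2.lf, tr_comp θ (glue (-(1/2)) (fun y => fα (1, y)) (elF p5 e p' (-(1/2)) 0))]; simp only [θa]; norm_num at tr' ⊢; exact tr'.symm)
  obtain ⟨fγ, hfγ, c4, c5⟩ := hk2.overrideV (x0 := 1) n2 n4 (Or.inr rfl) (elem_sim (hk2.1.monoV n2.le le_rfl) n4 v6.1 ep (hk2.2.rt.trans b4))
  have γ1 : ∀ x, fγ (x, -(1/2)) = fα (x, -(1/2)) := fun y => by rw [c5 _ _ (Or.inr (Or.inl rfl)), (c3 y).1, c1]
  have γ2 : ∀ y, fγ (1/2, y) = glue (-(1/2)) (fun y => fα (1, y)) (elF p5 e p' (-(1/2)) 0) (2 * y) := fun x => by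
    rw [c5 _ _ (Or.inl (by norm_num)), c2, θa]
  let F : Pt → L := fun p => if p.2 ≤ -(1/2) then (if p.1 ≤ 1/2 then fβ p else fα p) else fγ p
  have F1 : ∀ p ∈ bx 0 (1/2) (-1) (-(1/2)), fβ p = F p := fun p hp => by
    simp only [F, if_pos hp.2.2.2, if_pos hp.2.1]
  have F2 : ∀ p ∈ bx (1/2) 1 (-1) (-(1/2)), fα p = F p := fun p hp => by
    simp only [F, if_pos hp.2.2.2]
    split_ifs with h
    · have e : p.1 = 1/2 := le_antisymm h hp.1
      have := β1 p.2
      rw [← e] at this; exact this.symm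
    · rfl
  have F3 : ∀ p ∈ bx (1/2) 1 (-(1/2)) 0, fγ p = F p := fun p hp => by
    by_cases h : p.2 ≤ -(1/2)
    · have e : p.2 = -(1/2) := le_antisymm h hp.2.2.1
      have := γ1 p.1
      rw [← F2 p ⟨hp.1, hp.2.1, by linarith, h⟩]
      rw [← e] at this; exact this
    · simp only [F, if_neg h]
  refine ⟨F, hfβ.congr n1.le n3.le F1, hfα.congr n2.le n3.le F2, hfγ.congr n2.le n4.le F3, fun y h1 h2 => ?_, fun x h1 h2 => ?_⟩
  · rw [← F3 _ ⟨le_rfl, n2.le, h1, h2⟩, γ2]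
    rcases le_total (2 * y) (-(1/2)) with h | h
    · rw [glue_left h, ← F2 _ ⟨n2.le, le_rfl, by simp only; linarith, h⟩]
    · rw [glue_right er h, ← F3 _ ⟨n2.le, le_rfl, h, by simp only; linarith⟩, c4]
  · rw [← F1 _ ⟨h1, h2, n3.le, le_rfl⟩, β2]
    rcases le_total (2 * x) (1/2) with h | h
    · rw [glue_left h, ← F1 _ ⟨by simp only; linarith, h, le_rfl, n3.le⟩, a4]
    · rw [glue_right eb h, ← F2 _ ⟨h, by simp only; linarith, le_rfl, n3.le⟩]

/-- the self-similar extension -/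
theorem lim_ext (F0 : Pt → L) (z : L)
    (h1 : ∀ y, -(1/2) ≤ y → y ≤ 0 → F0 (1/2, y) = F0 (1, 2 * y)) (h2 : ∀ x, 0 ≤ x → x ≤ 1/2 → F0 (x, -(1/2)) = F0 (2 * x, -1)) :
    ∃ F : Pt → L, F (0, 0) = z ∧ ∀ n p, p ∈ bx 0 (sc n) (-sc n) 0 → (sc n / 2 ≤ p.1 ∨ p.2 ≤ -(sc n / 2)) →
      F p = F0 (2 ^ n * p.1, 2 ^ n * p.2) := by
  classical
  let P : Pt → ℕ → Prop := fun p n => p ∈ bx 0 (sc n) (-sc n) 0 ∧ (sc n / 2 ≤ p.1 ∨ p.2 ≤ -(sc n / 2))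
  refine ⟨fun p => if h : ∃ n, P p n then F0 (2 ^ (Nat.find h) * p.1, 2 ^ (Nat.find h) * p.2) else z, ?_, ?_⟩
  · beta_reduce; rw [dif_neg]
    rintro ⟨n, -, h⟩
    have := sc_pos n
    rcases h with h | h <;> simp only at h <;> linarith
  · intro n p hp hor
    have hn : P p n := ⟨hp, hor⟩
    have hex : ∃ n, P p n := ⟨n, hn⟩
    beta_reduce; rw [dif_pos hex]
    have hm := Nat.find_spec hex
    have hle := Nat.find_min' hex hn
    generalize Nat.find hex = m at hm hle
    have e : ∀ n, (2:ℝ) ^ n * sc n = 1 := fun n => by rw [sc, ← mul_pow]; norm_num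
    rcases hle.eq_or_lt with rfl | hlt
    · rfl
    have l1 : sc n ≤ sc (m + 1) := sc_le hlt
    rw [sc_succ] at l1
    have pm := sc_pos m
    obtain ⟨⟨a1, a2, a3, a4⟩, -⟩ := hn
    obtain ⟨-, b⟩ := hm
    have hs : sc n = sc m / 2 := by rcases b with b | b <;> linarith
    have hnm : n = m + 1 := by
      by_contra hne
      have : m + 2 ≤ n := by omega
      have := sc_le this
      rw [sc_succ, sc_succ] at this
      linarith
    subst hnm
    have em := e m
    have p2 : (0:ℝ) < 2 ^ m := by positivity
    rcases b with b | b
    · have e1 : p.1 = sc m / 2 := by linarith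
      have e2 : 2 ^ m * p.1 = 1 / 2 := by rw [e1]; linarith
      have e3 : 2 ^ (m + 1) * p.1 = 1 := by rw [pow_succ]; linarith
      rw [e2, e3, h1, pow_succ]
      · congr 2; ring
      · have := mul_le_mul_of_nonneg_left a3 p2.le; rw [hs] at this; linarith
      · exact mul_nonpos_of_nonneg_of_nonpos p2.le a4
    · have e1 : p.2 = -(sc m / 2) := by linarith
      have e2 : 2 ^ m * p.2 = -(1 / 2) := by rw [e1]; linarith
      have e3 : 2 ^ (m + 1) * p.2 = -1 := by rw [pow_succ]; linarith
      rw [e2, e3, h2, pow_succ]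
      · congr 2; ring
      · exact mul_nonneg p2.le a1
      · have := mul_le_mul_of_nonneg_left a2 p2.le; rw [hs] at this; linarith

theorem lim_find {y : ℝ} (h : 0 < y) (h' : y ≤ 1) : ∃ n, sc n / 2 ≤ y ∧ y ≤ sc n := by
  obtain ⟨m, hm⟩ := exists_sc h
  induction m with
  | zero => exact ⟨0, by rw [sc_zero] at *; linarith, by rwa [sc_zero]⟩
  | succ m ih =>
    by_cases h2 : sc m ≤ y
    · exact ih h2
    · exact ⟨m, by rw [sc_succ] at hm; exact hm, (not_le.1 h2).le⟩

theorem Rlz.lim {α β γ q : Beh L ι} {c c' z e e' p p' p2 p3 p4 p5 : L}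
    (h : LimRule σ α β γ q c c' z e e' p p' p2 p3 p4 p5) (hα : Rlz σ α) (hβ : Rlz σ β) (hγ : Rlz σ γ) : Rlz σ q := by
  obtain ⟨F0, g1, g2, g3, g4, g5⟩ := lim_level h hα hβ hγ
  obtain ⟨F, hz, hF⟩ := lim_ext F0 z g4 g5
  have sp := sc_pos
  have se : ∀ n, (2:ℝ) ^ n * sc n = 1 := fun n => by rw [sc, ← mul_pow]; norm_num
  let θ : ℕ → (ℝ ≃o ℝ) := fun n => OrderIso.mulLeft₀ (2 ^ n) (by positivity)
  have θa : ∀ n x, θ n x = 2 ^ n * x := fun n x => rfl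
  have θ1 : ∀ n, θ n (sc n) = 1 := fun n => se n
  have θ2 : ∀ n, θ n (sc n / 2) = 1 / 2 := fun n => by rw [θa]; linarith [se n]
  have θ3 : ∀ n, θ n (-sc n) = -1 := fun n => by rw [θa]; linarith [se n]
  have θ4 : ∀ n, θ n (-(sc n / 2)) = -(1 / 2) := fun n => by rw [θa]; linarith [se n]
  have θ0 : ∀ n, θ n 0 = 0 := fun n => by rw [θa, mul_zero]
  have hB : ∀ n, MB σ F 0 (sc n / 2) (-sc n) (-(sc n / 2)) β := fun n => by
    refine (MB.comp (θ n) (θ n) (by rw [θ0, θ2, θ3, θ4]; exact g1)).congr (by linarith [sp n]) (by linarith [sp n]) fun p hp => ?_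
    rw [hF n p (bx_sub le_rfl (by linarith [sp n]) le_rfl (by linarith [sp n]) hp) (Or.inr hp.2.2.2)]; rfl
  have hA : ∀ n, MB σ F (sc n / 2) (sc n) (-sc n) (-(sc n / 2)) α := fun n => by
    refine (MB.comp (θ n) (θ n) (by rw [θ1, θ2, θ3, θ4]; exact g2)).congr (by linarith [sp n]) (by linarith [sp n]) fun p hp => ?_
    rw [hF n p (bx_sub (by linarith [sp n]) le_rfl le_rfl (by linarith [sp n]) hp) (Or.inr hp.2.2.2)]; rfl
  have hG : ∀ n, MB σ F (sc n / 2) (sc n) (-(sc n / 2)) 0 γ := fun n => by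
    refine (MB.comp (θ n) (θ n) (by rw [θ1, θ2, θ0, θ4]; exact g3)).congr (by linarith [sp n]) (by linarith [sp n]) fun p hp => ?_
    rw [hF n p (bx_sub (by linarith [sp n]) le_rfl (by linarith [sp n]) le_rfl hp) (Or.inl hp.1)]; rfl
  clear g1 g2 g3 g4 g5 hF
  obtain ⟨⟨l1, l2, l3, l4⟩, ⟨v1, v2, v3, v4, v5, v6⟩, ⟨t1, t2, t3, t4⟩, ⟨s1, s2, s3, s4⟩, ⟨b1, b2, b3, b4⟩, d1, d2, r1, r2⟩ := h
  -- left and top edges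
  have L0 : ∀ n, F (0, -sc n) = p ∧ ∀ y, -sc n ≤ y → y ≤ -(sc n / 2) → σ.eqv (F (0, y)) c := by
    intro n
    obtain ⟨a1, a2, a3⟩ := elem_inv ((hB n).1.monoV le_rfl (by linarith [sp n])) (by linarith [sp n]) v1.1 v2.2 ((hB n).2.lf.trans t3)
    refine ⟨a1, fun y hy hy' => ?_⟩
    rcases hy.eq_or_lt with rfl | hy
    · rw [a1]; exact v1
    rcases hy'.eq_or_lt with rfl | hy'
    · rw [a2]; exact v2
    · exact a3 y hy hy'
  have T0 : ∀ n, F (sc n, 0) = p' ∧ ∀ x, sc n / 2 ≤ x → x ≤ sc n → σ.eqv (F (x, 0)) c' := by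
    intro n
    obtain ⟨a1, a2, a3⟩ := elem_inv ((hG n).1.monoH (by linarith [sp n]) le_rfl) (by linarith [sp n]) v4.1 v3.2 ((hG n).2.tp.trans t4)
    refine ⟨a2, fun y hy hy' => ?_⟩
    rcases hy.eq_or_lt with rfl | hy
    · rw [a1]; exact v4
    rcases hy'.eq_or_lt with rfl | hy'
    · rw [a2]; exact v3
    · exact a3 y hy hy'
  have L1 : ∀ y, -1 ≤ y → y < 0 → σ.eqv (F (0, y)) c := by
    intro y h1 h2
    obtain ⟨n, e1, e2⟩ := lim_find (y := -y) (by linarith) (by linarith)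
    exact (L0 n).2 y (by linarith) (by linarith)
  have T1 : ∀ x, 0 < x → x ≤ 1 → σ.eqv (F (x, 0)) c' := by
    intro y h1 h2
    obtain ⟨n, e1, e2⟩ := lim_find h1 h2
    exact (T0 n).2 y e1 e2
  have hE : ∀ y, -(1/2) < y → y < 0 → σ.eqv (F (1, y)) e := by
    have g := hG 0
    rw [sc_zero] at g
    exact (elem_inv (g.1.monoV (by norm_num) le_rfl) (by norm_num) v6.1 (σ.trans' l4 v3.2) (g.2.rt.trans b4)).2.2
  have hE' : ∀ x, 0 < x → x < 1/2 → σ.eqv (F (x, -1)) e' := by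
    have g := hB 0
    rw [sc_zero] at g
    exact (elem_inv (g.1.monoH le_rfl (by norm_num)) (by norm_num) (σ.trans' v1.1 l3) v5.2 (g.2.bt.trans b3)).2.2
  have mono : ∀ p ∈ bx 0 1 (-1) 0, ∀ q ∈ bx 0 1 (-1) 0, p ≤ q → σ.le (F p) (F q) := by
    rintro ⟨x, y⟩ hp ⟨u, v⟩ hq hpq
    have hp' := hp
    have hq' := hq
    obtain ⟨p1, p2, p3, p4⟩ := hp'
    obtain ⟨q1, q2, q3, q4⟩ := hq'
    obtain ⟨k1, k2⟩ := hpq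
    simp only at p1 p2 p3 p4 q1 q2 q3 q4 k1 k2
    by_cases ho : u = 0 ∧ v = 0
    · obtain ⟨rfl, rfl⟩ := ho
      obtain rfl : x = 0 := le_antisymm k1 p1
      rcases k2.eq_or_lt with rfl | k2
      · exact σ.rfl' _
      · rw [hz]; exact σ.trans' (L1 y p3 k2).1 l1
    by_cases ho' : x = 0 ∧ y = 0
    · obtain ⟨rfl, rfl⟩ := ho'
      obtain rfl : v = 0 := le_antisymm q4 k2
      rw [hz]
      have : u ≠ 0 := fun h => ho ⟨h, rfl⟩
      exact σ.trans' l2 (T1 u (lt_of_le_of_ne q1 this.symm) q2).2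
    have fd : ∀ x y : ℝ, 0 ≤ x → y ≤ 0 → ¬ (x = 0 ∧ y = 0) → ∃ m, ∀ k, m ≤ k → sc k ≤ x ∨ y ≤ -sc k := by
      intro x y hx hy hne
      rcases hx.eq_or_lt with rfl | hx
      · have : y < 0 := lt_of_le_of_ne hy fun h => hne ⟨rfl, h⟩
        obtain ⟨m, hm⟩ := exists_sc (show 0 < -y by linarith)
        exact ⟨m, fun k hk => Or.inr (by linarith [sc_le hk])⟩
      · obtain ⟨m, hm⟩ := exists_sc hx
        exact ⟨m, fun k hk => Or.inl (by linarith [sc_le hk])⟩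
    obtain ⟨m1, hm1⟩ := fd x y p1 p4 ho'
    obtain ⟨m2, hm2⟩ := fd u v q1 q4 ho
    refine lim_mono (fun n => (hB n).1.mono) (fun n => (hA n).1.mono) (fun n => (hG n).1.mono) (max m1 m2) 0 _ _
      (by rw [sc_zero]; exact hp) (by rw [sc_zero]; exact hq) ⟨k1, k2⟩ ?_ ?_
    · rw [zero_add]; exact hm1 _ (le_max_left _ _)
    · rw [zero_add]; exact hm2 _ (le_max_right _ _)
  have sub1 : ∀ n, bx 0 (sc n / 2) (-sc n) (-(sc n / 2)) ⊆ bx 0 (sc n) (-sc n) 0 := fun n =>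
    bx_sub le_rfl (by linarith [sp n]) le_rfl (by linarith [sp n])
  have sub2 : ∀ n, bx (sc n / 2) (sc n) (-sc n) (-(sc n / 2)) ⊆ bx 0 (sc n) (-sc n) 0 := fun n =>
    bx_sub (by linarith [sp n]) le_rfl le_rfl (by linarith [sp n])
  have sub3 : ∀ n, bx (sc n / 2) (sc n) (-(sc n / 2)) 0 ⊆ bx 0 (sc n) (-sc n) 0 := fun n =>
    bx_sub (by linarith [sp n]) le_rfl (by linarith [sp n]) le_rfl
  have resF : ∀ i, (α.rF i ∨ β.rF i ∨ γ.rF i) → ∀ n, ∃ q ∈ bx 0 (sc n) (-sc n) 0, Wt σ (fun p q => p ≤ q) F (bx 0 (sc n) (-sc n) 0) q i := by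
    rintro i (h | h | h) n
    · obtain ⟨q, a, b⟩ := (hA n).2.rF i h; exact ⟨q, sub2 n a, b.mono (sub2 n)⟩
    · obtain ⟨q, a, b⟩ := (hB n).2.rF i h; exact ⟨q, sub1 n a, b.mono (sub1 n)⟩
    · obtain ⟨q, a, b⟩ := (hG n).2.rF i h; exact ⟨q, sub3 n a, b.mono (sub3 n)⟩
  have resP : ∀ i, (α.rP i ∨ β.rP i ∨ γ.rP i) → ∀ n, ∃ q ∈ bx 0 (sc n) (-sc n) 0, Wt σ.dual (fun p q => q ≤ p) F (bx 0 (sc n) (-sc n) 0) q i := by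
    rintro i (h | h | h) n
    · obtain ⟨q, a, b⟩ := (hA n).2.rP i h; exact ⟨q, sub2 n a, b.mono (sub2 n)⟩
    · obtain ⟨q, a, b⟩ := (hB n).2.rP i h; exact ⟨q, sub1 n a, b.mono (sub1 n)⟩
    · obtain ⟨q, a, b⟩ := (hG n).2.rP i h; exact ⟨q, sub3 n a, b.mono (sub3 n)⟩
  have fut : FutOK σ (fun p q => p ≤ q) F (bx 0 1 (-1) 0) (exU 1 0) :=
    lim_fut (fun n => (hB n).1.fut) (fun n => (hA n).1.fut) (fun n => (hG n).1.fut) L1 hz hE resF d1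
  have past : FutOK σ.dual (fun p q => q ≤ p) F (bx 0 1 (-1) 0) (exU 0 (-1)) := by
    have := lim_fut (σ := σ.dual) (F := fun p => F (rho p)) (c := c') (z := z) (e := e') (rs := fun i => α.rP i ∨ β.rP i ∨ γ.rP i)
      (fun n => (hG n).1.past.rho (by rw [rho_bx]; simp) (by rw [rho_exU]; simp))
      (fun n => (hA n).1.past.rho (by rw [rho_bx]; simp) (by rw [rho_exU]; simp))
      (fun n => (hB n).1.past.rho (by rw [rho_bx]; simp) (by rw [rho_exU]; simp))
      (fun y h1 h2 => by rw [rho_apply]; simp only [neg_zero]; exact Sys.eqv_dual.2 (T1 _ (by linarith) (by linarith)))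
      (by rw [rho_apply]; simp only [neg_zero]; exact hz)
      (fun y h1 h2 => by rw [rho_apply]; exact Sys.eqv_dual.2 (hE' _ (by simp only; linarith) (by simp only; linarith)))
      (fun i hi n => by
        have := Wt_ex_comp (r' := fun p q => p ≤ q) rho rho_le (resP i hi n)
        rw [rho_bx] at this; simpa using this)
      (fun i hi => by rw [Sys.WF_dual]; exact d2 i hi)
    have := this.rho' (by rw [rho_bx]) (by rw [rho_exU])
    simpa [rho_apply] using this
  have hM : IsM σ F 0 1 (-1) 0 := ⟨mono, fut, past⟩
  have hB0 := hB 0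
  have hA0 := hA 0
  have hG0 := hG 0
  rw [sc_zero] at hB0 hA0 hG0
  refine MB.rlz (f := F) (a := 0) (b := 1) (c := -1) (d := 0) ⟨hM, ⟨?_, ?_, ?_, ?_, fun i hi => ?_, fun i hi => ?_⟩⟩ (by norm_num) (by norm_num)
  · rw [t1, tr_elem (e := c) (hM.monoV le_rfl zero_le_one) (by norm_num) fun y h1 h2 => L1 y h1.le h2, hz]
    have := (L0 0).1; rw [sc_zero] at this; rw [this]
  · rw [tr_conc (m := -(1/2)) (hM.monoV zero_le_one le_rfl) (by norm_num) (by norm_num), b2, hA0.2.rt, hG0.2.rt]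
  · rw [tr_conc (m := 1/2) (hM.monoH le_rfl (by norm_num)) (by norm_num) (by norm_num), b1, hA0.2.bt, hB0.2.bt]
  · rw [t2, tr_elem (e := c') (hM.monoH (by norm_num) le_rfl) (by norm_num) fun y h1 h2 => T1 y h1 h2.le, hz]
    have := (T0 0).1; rw [sc_zero] at this; rw [this]
  · have key : (α.rF i ∨ β.rF i ∨ γ.rF i) ∨ σ.wF z i := by have := r1 i hi; tauto
    rcases key with h | h
    · have := resF i h 0; rwa [sc_zero] at this
    · exact ⟨(0, 0), ⟨le_rfl, zero_le_one, by norm_num, le_rfl⟩, Or.inl (hz ▸ h)⟩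
  · have key : (α.rP i ∨ β.rP i ∨ γ.rP i) ∨ σ.wP z i := by have := r2 i hi; tauto
    rcases key with h | h
    · have := resP i h 0; rwa [sc_zero] at this
    · exact ⟨(0, 0), ⟨le_rfl, zero_le_one, by norm_num, le_rfl⟩, Or.inl (hz ▸ h)⟩

end
end Temporal

namespace Temporal
section
variable {L ι : Type} {σ : Sys L ι}

/-! ### Soundness of the shuffle rule -/

/-- open unit square -/
def ob : Set Pt := {p | 0 < p.1 ∧ p.1 < 1 ∧ 0 < p.2 ∧ p.2 < 1}

structure Shuf (σ : Sys L ι) (c0 c1 ts : L) (hl hr : ℕ → ℝ) (G F : ℕ → Pt → L) : Prop where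
  c01 : σ.le c0 c1
  ts0 : σ.le c0 ts
  ts1 : σ.le ts c1
  hr0 : ∀ n, 0 < hr n
  hr1 : ∀ n, hr n ≤ 1 / 2
  hl0 : ∀ n, 1 / 2 ≤ hl n
  hl1 : ∀ n, hl n < 1
  mV : ∀ n, IsM σ (G n) (1/3) (2/3) 0 1
  m0 : ∀ n, IsM σ (G n) 0 (1/3) 0 (hl n)
  m1 : ∀ n, IsM σ (G n) (2/3) 1 (hr n) 1
  b0 : ∀ n x, 0 ≤ x → x ≤ 1/3 → σ.eqv (G n (x, 0)) c0
  l0 : ∀ n y, 0 ≤ y → y ≤ hl n → σ.eqv (G n (0, y)) c0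
  t0 : ∀ n x, 0 ≤ x → x < 1/3 → σ.eqv (G n (x, hl n)) c0
  bV : ∀ n x, 1/3 ≤ x → x ≤ 2/3 → σ.eqv (G n (x, 0)) c0
  rV : ∀ n y, 0 ≤ y → y < hr n → σ.eqv (G n (2/3, y)) c0
  tV : ∀ n x, 1/3 ≤ x → x ≤ 2/3 → σ.eqv (G n (x, 1)) c1
  lV : ∀ n y, hl n < y → y ≤ 1 → σ.eqv (G n (1/3, y)) c1
  t1 : ∀ n x, 2/3 ≤ x → x ≤ 1 → σ.eqv (G n (x, 1)) c1
  r1 : ∀ n y, hr n ≤ y → y ≤ 1 → σ.eqv (G n (1, y)) c1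
  b1 : ∀ n x, 2/3 < x → x ≤ 1 → σ.eqv (G n (x, hr n)) c1
  okF : ∀ i, σ.A ts i → σ.wF ts i ∨ σ.A c1 i
  okP : ∀ i, σ.B ts i → σ.wP ts i ∨ σ.B c0 i
  FN : ∀ n p, p ∈ ob → ¬ (p.1 < 1/3 ∧ hl n < p.2) → ¬ (2/3 < p.1 ∧ p.2 < hr n) → F n p = G n p
  FU : ∀ n p, p ∈ ob → p.1 < 1/3 → hl n < p.2 → F n p = F (n + 1) (3 * p.1, (p.2 - hl n) / (1 - hl n))
  FL : ∀ n p, p ∈ ob → 2/3 < p.1 → p.2 < hr n → F n p = F (n + 1) (3 * p.1 - 2, p.2 / hr n)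
  ind : ∀ Q : ℕ → Pt → Prop, (∀ n p, p ∈ ob → ¬ (p.1 < 1/3 ∧ hl n < p.2) → ¬ (2/3 < p.1 ∧ p.2 < hr n) → Q n p) →
    (∀ n p, p ∈ ob → p.1 < 1/3 → hl n < p.2 → Q (n + 1) (3 * p.1, (p.2 - hl n) / (1 - hl n)) → Q n p) →
    (∀ n p, p ∈ ob → 2/3 < p.1 → p.2 < hr n → Q (n + 1) (3 * p.1 - 2, p.2 / hr n) → Q n p) →
    ∀ n p, p ∈ ob → Q n p ∨ F n p = ts

theorem IsM.refl {f : Pt → L} {a b c d : ℝ} (h : IsM σ f a b c d) :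
    IsM σ.dual (fun p => f (refl2 p)) (1 - b) (1 - a) (1 - d) (1 - c) := by
  have e : refl2 ⁻¹' bx a b c d = bx (1 - b) (1 - a) (1 - d) (1 - c) := by
    ext p; simp only [bx, Set.mem_preimage, Set.mem_ofPred_eq, refl2_apply]
    constructor <;> rintro ⟨h1, h2, h3, h4⟩ <;> refine ⟨?_, ?_, ?_, ?_⟩ <;> linarith
  have e2 : ∀ b d : ℝ, refl2 ⁻¹' exU b d = exU (1 - b) (1 - d) := by
    intro b d
    ext p; simp only [exU, Set.mem_preimage, Set.mem_ofPred_eq, refl2_apply]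
    constructor <;> rintro (h | h) <;> first | (left; linarith) | (right; linarith)
  refine ⟨fun p hp q hq hpq => ?_, ?_, ?_⟩
  · rw [← e] at hp hq
    exact h.mono _ hq _ hp ((refl2_le q p).1 hpq)
  · have := h.past.comp (r' := fun p q => p ≤ q) refl2 (fun p q => refl2_le q p)
    rw [e, e2] at this; exact this
  · have := h.fut.comp (r' := fun p q => q ≤ p) refl2 refl2_le
    rw [e, e2] at this; exact this

theorem refl2_ob {p : Pt} : refl2 p ∈ ob ↔ p ∈ ob := by
  simp only [ob, Set.mem_ofPred_eq, refl2_apply]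
  constructor <;> rintro ⟨h1, h2, h3, h4⟩ <;> refine ⟨?_, ?_, ?_, ?_⟩ <;> linarith
theorem refl2_refl2 (p : Pt) : refl2 (refl2 p) = p := by simp [refl2_apply]

variable {c0 c1 ts : L} {hl hr : ℕ → ℝ} {G F : ℕ → Pt → L}

theorem Shuf.refl (h : Shuf σ c0 c1 ts hl hr G F) :
    Shuf σ.dual c1 c0 ts (fun n => 1 - hr n) (fun n => 1 - hl n) (fun n p => G n (refl2 p)) (fun n p => F n (refl2 p)) where
  c01 := h.c01
  ts0 := h.ts1
  ts1 := h.ts0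
  hr0 n := by linarith [h.hl1 n]
  hr1 n := by linarith [h.hl0 n]
  hl0 n := by linarith [h.hr1 n]
  hl1 n := by linarith [h.hr0 n]
  mV n := by have := (h.mV n).refl; norm_num at this ⊢; exact this
  m0 n := by have := (h.m1 n).refl; norm_num at this ⊢; exact this
  m1 n := by have := (h.m0 n).refl; norm_num at this ⊢; exact this
  b0 n x h1 h2 := by rw [refl2_apply, Sys.eqv_dual]; simp only [sub_zero]; exact h.t1 n _ (by linarith) (by linarith)
  l0 n y h1 h2 := by rw [refl2_apply, Sys.eqv_dual]; simp only [sub_zero]; exact h.r1 n _ (by linarith) (by linarith)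
  t0 n x h1 h2 := by rw [refl2_apply, Sys.eqv_dual]; simp only [sub_sub_cancel]; exact h.b1 n _ (by linarith) (by linarith)
  bV n x h1 h2 := by rw [refl2_apply, Sys.eqv_dual]; simp only [sub_zero]; exact h.tV n _ (by linarith) (by linarith)
  rV n y h1 h2 := by
    rw [refl2_apply, Sys.eqv_dual]
    rw [show (1:ℝ) - 2/3 = 1/3 by norm_num]; exact h.lV n _ (by simp only; linarith) (by simp only; linarith)
  tV n x h1 h2 := by rw [refl2_apply, Sys.eqv_dual]; simp only [sub_self]; exact h.bV n _ (by linarith) (by linarith)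
  lV n y h1 h2 := by
    rw [refl2_apply, Sys.eqv_dual]
    rw [show (1:ℝ) - 1/3 = 2/3 by norm_num]; exact h.rV n _ (by simp only; linarith) (by simp only; linarith)
  t1 n x h1 h2 := by rw [refl2_apply, Sys.eqv_dual]; simp only [sub_self]; exact h.b0 n _ (by linarith) (by linarith)
  r1 n y h1 h2 := by rw [refl2_apply, Sys.eqv_dual]; simp only [sub_self]; exact h.l0 n _ (by linarith) (by linarith)
  b1 n x h1 h2 := by rw [refl2_apply, Sys.eqv_dual]; simp only [sub_sub_cancel]; exact h.t0 n _ (by linarith) (by linarith)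
  okF := h.okP
  okP := h.okF
  FN n p hp h1 h2 := by
    refine h.FN n _ (refl2_ob.2 hp) (fun h3 => h2 ?_) (fun h3 => h1 ?_)
    · simp only [refl2_apply] at h3; exact ⟨by linarith [h3.1], by linarith [h3.2]⟩
    · simp only [refl2_apply] at h3; exact ⟨by linarith [h3.1], by linarith [h3.2]⟩
  FU n p hp h1 h2 := by
    have := h.FL n _ (refl2_ob.2 hp) (by simp only [refl2_apply]; linarith) (by simp only [refl2_apply]; linarith)
    have h0 := h.hr0 n
    rw [this]
    simp only [refl2_apply]
    congr 2
    · ring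
    · rw [sub_sub_cancel]; field_simp; ring
  FL n p hp h1 h2 := by
    have := h.FU n _ (refl2_ob.2 hp) (by simp only [refl2_apply]; linarith) (by simp only [refl2_apply]; linarith)
    have h0 : 0 < 1 - hl n := by linarith [h.hl1 n]
    rw [this]
    simp only [refl2_apply]
    congr 2
    · ring
    · field_simp; ring
  ind Q h1 h2 h3 n p hp := by
    have key := h.ind (fun n p => Q n (refl2 p)) (fun n p hp k1 k2 => ?_) (fun n p hp k1 k2 k3 => ?_) (fun n p hp k1 k2 k3 => ?_) n (refl2 p) (refl2_ob.2 hp)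
    · rw [refl2_refl2] at key; exact key
    · refine h1 n _ (refl2_ob.2 hp) (fun h3 => k2 ?_) (fun h3 => k1 ?_)
      · simp only [refl2_apply] at h3; exact ⟨by linarith [h3.1], by linarith [h3.2]⟩
      · simp only [refl2_apply] at h3; exact ⟨by linarith [h3.1], by linarith [h3.2]⟩
    · refine h3 n _ (refl2_ob.2 hp) (by simp only [refl2_apply]; linarith) (by simp only [refl2_apply]; linarith) ?_
      have h0 : 0 < 1 - hl n := by linarith [h.hl1 n]
      convert k3 using 1
      simp only [refl2_apply, Prod.mk.injEq]
      constructor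
      · ring
      · field_simp; ring
    · refine h2 n _ (refl2_ob.2 hp) (by simp only [refl2_apply]; linarith) (by simp only [refl2_apply]; linarith) ?_
      have h0 := h.hr0 n
      convert k3 using 1
      simp only [refl2_apply, Prod.mk.injEq]
      constructor
      · ring
      · rw [sub_sub_cancel]; field_simp; ring

/-- the part of the square that is not in the open holes -/
def nh (hl hr : ℝ) (p : Pt) : Prop := ¬ (p.1 < 1/3 ∧ hl < p.2) ∧ ¬ (2/3 < p.1 ∧ p.2 < hr)

theorem Shuf.Gmono (h : Shuf σ c0 c1 ts hl hr G F) {n : ℕ} {p q : Pt} (hp : p ∈ bx 0 1 0 1) (hq : q ∈ bx 0 1 0 1)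
    (np : nh (hl n) (hr n) p) (nq : nh (hl n) (hr n) q) (hpq : p ≤ q) : σ.le (G n p) (G n q) := by
  obtain ⟨p1, p2, p3, p4⟩ := hp
  obtain ⟨q1, q2, q3, q4⟩ := hq
  obtain ⟨x, y⟩ := p
  obtain ⟨u, v⟩ := q
  obtain ⟨k1, k2⟩ := hpq
  simp only [nh, not_and, not_lt] at *
  have := h.hr0 n
  have := h.hl1 n
  -- V to anything
  have HV : ∀ x y, 1/3 ≤ x → x ≤ 2/3 → 0 ≤ y → x ≤ u → y ≤ v → σ.le (G n (x, y)) (G n (u, v)) := by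
    intro x y h1 h2 h3 h4 h5
    rcases le_or_gt u (2/3) with hu | hu
    · exact (h.mV n).mono _ ⟨h1, h2, h3, h5.trans q4⟩ _ ⟨h1.trans h4, hu, q3, q4⟩ ⟨h4, h5⟩
    · have hv := nq.2 hu
      exact σ.trans' ((h.mV n).mono _ ⟨h1, h2, h3, h5.trans q4⟩ (2/3, v) ⟨by norm_num, le_rfl, q3, q4⟩ ⟨h2, h5⟩)
        ((h.m1 n).mono _ ⟨le_rfl, by norm_num, hv, q4⟩ (u, v) ⟨hu.le, q2, hv, q4⟩ ⟨hu.le, le_rfl⟩)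
  rcases lt_or_ge x (1/3) with hx | hx
  · have hy := np.1 hx
    rcases lt_or_ge u (1/3) with hu | hu
    · exact (h.m0 n).mono _ ⟨p1, hx.le, p3, hy⟩ _ ⟨q1, hu.le, q3, nq.1 hu⟩ ⟨k1, k2⟩
    · exact σ.trans' ((h.m0 n).mono _ ⟨p1, hx.le, p3, hy⟩ (1/3, y) ⟨by norm_num, le_rfl, p3, hy⟩ ⟨hx.le, le_rfl⟩)
        (HV _ _ le_rfl (by norm_num) p3 hu k2)
  rcases le_or_gt x (2/3) with hx' | hx'
  · exact HV x y hx hx' p3 k1 k2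
  · exact (h.m1 n).mono _ ⟨hx'.le, p2, np.2 hx', p4⟩ _ ⟨hx'.le.trans k1, q2, (np.2 hx').trans k2, q4⟩ ⟨k1, k2⟩

theorem ob_bx {p : Pt} (h : p ∈ ob) : p ∈ bx 0 1 0 1 := ⟨h.1.le, h.2.1.le, h.2.2.1.le, h.2.2.2.le⟩

theorem Shuf.Gge (h : Shuf σ c0 c1 ts hl hr G F) {n : ℕ} {p : Pt} (hp : p ∈ bx 0 1 0 1)
    (np : nh (hl n) (hr n) p) : σ.le c0 (G n p) := by
  have := h.hr0 n
  have := h.hl0 n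
  exact σ.trans' (h.b0 n 0 le_rfl (by norm_num)).2 (h.Gmono ⟨le_rfl, zero_le_one, le_rfl, zero_le_one⟩ hp
    ⟨by simp only; rintro ⟨_, _⟩; linarith, by norm_num⟩ np ⟨hp.1, hp.2.2.1⟩)

theorem Shuf.Fge (h : Shuf σ c0 c1 ts hl hr G F) (n : ℕ) (p : Pt) (hp : p ∈ ob) : σ.le c0 (F n p) := by
  refine (h.ind (fun n p => σ.le c0 (F n p)) (fun n p hp h1 h2 => ?_) (fun n p hp h1 h2 h3 => ?_) (fun n p hp h1 h2 h3 => ?_) n p hp).elim id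
    (fun h' => by rw [h']; exact h.ts0)
  · rw [h.FN n p hp h1 h2]; exact h.Gge (ob_bx hp) ⟨h1, h2⟩
  · rw [h.FU n p hp h1 h2]; exact h3
  · rw [h.FL n p hp h1 h2]; exact h3

theorem Shuf.Fle (h : Shuf σ c0 c1 ts hl hr G F) (n : ℕ) (p : Pt) (hp : p ∈ ob) : σ.le (F n p) c1 := by
  have := h.refl.Fge n (refl2 p) (refl2_ob.2 hp)
  rw [refl2_refl2] at this; exact this

theorem mapU_ob {a : ℝ} (h : a < 1) {p : Pt} (hp : p ∈ ob) (h1 : p.1 < 1/3) (h2 : a < p.2) :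
    ((3 * p.1, (p.2 - a) / (1 - a)) : Pt) ∈ ob := by
  obtain ⟨p1, p2, p3, p4⟩ := hp
  refine ⟨by simp only; linarith, by simp only; linarith, div_pos (by linarith) (by linarith), ?_⟩
  simp only; rw [div_lt_one (by linarith)]; linarith
theorem mapL_ob {a : ℝ} (h : 0 < a) {p : Pt} (hp : p ∈ ob) (h1 : 2/3 < p.1) (h2 : p.2 < a) :
    ((3 * p.1 - 2, p.2 / a) : Pt) ∈ ob := by
  obtain ⟨p1, p2, p3, p4⟩ := hp
  refine ⟨by simp only; linarith, by simp only; linarith, div_pos (by linarith) (by linarith), ?_⟩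
  simp only; rw [div_lt_one (by linarith)]; linarith

/-- Points above a point in the upper left hole, not in it, are in `c1`. -/
theorem Shuf.topU (h : Shuf σ c0 c1 ts hl hr G F) {n : ℕ} {p q : Pt} (hp : p ∈ ob) (hq : q ∈ ob) (h1 : p.1 < 1/3)
    (h2 : hl n < p.2) (hpq : p ≤ q) (hn : ¬ (q.1 < 1/3 ∧ hl n < q.2)) : σ.le c1 (F n q) := by
  have := h.hl0 n
  have := h.hr1 n
  have k2 : hl n < q.2 := h2.trans_le hpq.2
  have k1 : 1/3 ≤ q.1 := by by_contra h'; exact hn ⟨not_le.1 h', k2⟩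
  have k3 : ¬ (2/3 < q.1 ∧ q.2 < hr n) := by rintro ⟨_, _⟩; linarith
  rw [h.FN n q hq hn k3]
  refine σ.trans' (h.lV n q.2 k2 hq.2.2.2.le).2 (h.Gmono ⟨by norm_num, by norm_num, hq.2.2.1.le, hq.2.2.2.le⟩ (ob_bx hq) ⟨by norm_num, by norm_num⟩ ⟨hn, k3⟩ ⟨k1, le_rfl⟩)
theorem Shuf.topL (h : Shuf σ c0 c1 ts hl hr G F) {n : ℕ} {p q : Pt} (hp : p ∈ ob) (hq : q ∈ ob) (h1 : 2/3 < p.1)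
    (h2 : p.2 < hr n) (hpq : p ≤ q) (hn : ¬ (2/3 < q.1 ∧ q.2 < hr n)) : σ.le c1 (F n q) := by
  have := h.hl0 n
  have := h.hr1 n
  have := h.hr0 n
  have k1 : 2/3 < q.1 := h1.trans_le hpq.1
  have k2 : hr n ≤ q.2 := by by_contra h'; exact hn ⟨k1, not_le.1 h'⟩
  have k3 : ¬ (q.1 < 1/3 ∧ hl n < q.2) := by rintro ⟨_, _⟩; linarith
  rw [h.FN n q hq k3 hn]
  refine σ.trans' (h.b1 n q.1 k1 hq.2.1.le).2 (h.Gmono ⟨hq.1.le, hq.2.1.le, (h.hr0 n).le, by simp only; linarith⟩ (ob_bx hq) ⟨?_, ?_⟩ ⟨k3, hn⟩ ⟨le_rfl, k2⟩)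
  · simp only; rintro ⟨_, _⟩; linarith
  · simp only; rintro ⟨_, _⟩; linarith

theorem Shuf.botU (h : Shuf σ c0 c1 ts hl hr G F) {n : ℕ} {p q : Pt} (hp : p ∈ ob) (hq : q ∈ ob) (h1 : q.1 < 1/3)
    (h2 : hl n < q.2) (hpq : p ≤ q) (hn : ¬ (p.1 < 1/3 ∧ hl n < p.2)) : σ.le (F n p) c0 := by
  have := h.refl.topL (n := n) (p := refl2 q) (q := refl2 p) (refl2_ob.2 hq) (refl2_ob.2 hp)
    (by simp only [refl2_apply]; linarith) (by simp only [refl2_apply]; linarith) ((refl2_le q p).1 hpq)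
    (fun h => hn (by simp only [refl2_apply] at h; exact ⟨by linarith [h.1], by linarith [h.2]⟩))
  rw [refl2_refl2] at this; exact this
theorem Shuf.botL (h : Shuf σ c0 c1 ts hl hr G F) {n : ℕ} {p q : Pt} (hp : p ∈ ob) (hq : q ∈ ob) (h1 : 2/3 < q.1)
    (h2 : q.2 < hr n) (hpq : p ≤ q) (hn : ¬ (2/3 < p.1 ∧ p.2 < hr n)) : σ.le (F n p) c0 := by
  have := h.refl.topU (n := n) (p := refl2 q) (q := refl2 p) (refl2_ob.2 hq) (refl2_ob.2 hp)
    (by simp only [refl2_apply]; linarith) (by simp only [refl2_apply]; linarith) ((refl2_le q p).1 hpq)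
    (fun h => hn (by simp only [refl2_apply] at h; exact ⟨by linarith [h.1], by linarith [h.2]⟩))
  rw [refl2_refl2] at this; exact this

theorem Shuf.monoHalf (h : Shuf σ c0 c1 ts hl hr G F) (n : ℕ) (p : Pt) (hp : p ∈ ob) :
    (∀ q ∈ ob, p ≤ q → σ.le (F n p) (F n q)) ∨ F n p = ts := by
  refine h.ind (fun n p => ∀ q ∈ ob, p ≤ q → σ.le (F n p) (F n q)) (fun n p hp h1 h2 q hq hpq => ?_)
    (fun n p hp h1 h2 h3 q hq hpq => ?_) (fun n p hp h1 h2 h3 q hq hpq => ?_) n p hp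
  · by_cases k1 : q.1 < 1/3 ∧ hl n < q.2
    · exact σ.trans' (h.botU hp hq k1.1 k1.2 hpq h1) (h.Fge n q hq)
    by_cases k2 : 2/3 < q.1 ∧ q.2 < hr n
    · exact σ.trans' (h.botL hp hq k2.1 k2.2 hpq h2) (h.Fge n q hq)
    rw [h.FN n p hp h1 h2, h.FN n q hq k1 k2]
    exact h.Gmono (ob_bx hp) (ob_bx hq) ⟨h1, h2⟩ ⟨k1, k2⟩ hpq
  · by_cases k1 : q.1 < 1/3 ∧ hl n < q.2
    · rw [h.FU n p hp h1 h2, h.FU n q hq k1.1 k1.2]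
      refine h3 _ (mapU_ob (h.hl1 n) hq k1.1 k1.2) ⟨by simp only; linarith [hpq.1], ?_⟩
      have : 0 < 1 - hl n := by linarith [h.hl1 n]
      simp only; have := hpq.2; gcongr
    · exact σ.trans' (h.Fle n p hp) (h.topU hp hq h1 h2 hpq k1)
  · by_cases k1 : 2/3 < q.1 ∧ q.2 < hr n
    · rw [h.FL n p hp h1 h2, h.FL n q hq k1.1 k1.2]
      refine h3 _ (mapL_ob (h.hr0 n) hq k1.1 k1.2) ⟨by simp only; linarith [hpq.1], ?_⟩
      have := h.hr0 n
      simp only; have := hpq.2; gcongr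
    · exact σ.trans' (h.Fle n p hp) (h.topL hp hq h1 h2 hpq k1)

theorem Shuf.mono (h : Shuf σ c0 c1 ts hl hr G F) (n : ℕ) {p q : Pt} (hp : p ∈ ob) (hq : q ∈ ob) (hpq : p ≤ q) :
    σ.le (F n p) (F n q) := by
  rcases h.monoHalf n p hp with h1 | h1
  · exact h1 q hq hpq
  rcases h.refl.monoHalf n (refl2 q) (refl2_ob.2 hq) with h2 | h2
  · have := h2 (refl2 p) (refl2_ob.2 hp) ((refl2_le q p).1 hpq)
    rw [refl2_refl2, refl2_refl2] at this; exact this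
  · rw [refl2_refl2] at h2; rw [h1, h2]; exact σ.rfl' _

/-- transport of witnesses through the holes -/
theorem Shuf.transU (h : Shuf σ c0 c1 ts hl hr G F) {n : ℕ} {q : Pt} {i : ι} (hq : q ∈ ob)
    (hW : Wt σ (fun p q => p ≤ q) (F (n + 1)) ob q i) :
    ((q.1 / 3, hl n + q.2 * (1 - hl n)) : Pt) ∈ ob ∧ Wt σ (fun p q => p ≤ q) (F n) ob (q.1 / 3, hl n + q.2 * (1 - hl n)) i := by
  have l1 : 0 < 1 - hl n := by linarith [h.hl1 n]
  have l0 := h.hl0 n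
  have key : ∀ q : Pt, q ∈ ob → ((q.1 / 3, hl n + q.2 * (1 - hl n)) : Pt) ∈ ob ∧ F n (q.1 / 3, hl n + q.2 * (1 - hl n)) = F (n + 1) q := by
    rintro ⟨x, y⟩ ⟨h1, h2, h3, h4⟩
    simp only at h1 h2 h3 h4
    have e1 : 0 < y * (1 - hl n) := mul_pos h3 l1
    have e2 : y * (1 - hl n) < 1 - hl n := by nlinarith
    have ho : ((x / 3, hl n + y * (1 - hl n)) : Pt) ∈ ob := ⟨by simp only; linarith, by simp only; linarith, by simp only; linarith, by simp only; linarith⟩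
    refine ⟨ho, ?_⟩
    simp only
    rw [h.FU n _ ho (by simp only; linarith) (by simp only; linarith)]
    congr 2
    · ring
    · field_simp; ring
  refine ⟨(key q hq).1, ?_⟩
  rcases hW with hW | ⟨hW, q', hq', h1, h2, h3⟩
  · exact Or.inl ((key q hq).2 ▸ hW)
  · refine Or.inr ⟨(key q hq).2.symm ▸ hW, _, (key q' hq').1, ⟨by simp only; linarith [h1.1], ?_⟩, fun e => h2 ?_, ?_⟩
    · have := h1.2; simp only; gcongr
    · simp only [Prod.mk.injEq] at e
      ext
      · linarith [e.1]
      · exact mul_right_cancel₀ l1.ne' (add_left_cancel e.2)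
    · rw [(key q hq).2, (key q' hq').2]; exact h3

theorem Shuf.transL (h : Shuf σ c0 c1 ts hl hr G F) {n : ℕ} {q : Pt} {i : ι} (hq : q ∈ ob)
    (hW : Wt σ (fun p q => p ≤ q) (F (n + 1)) ob q i) :
    (((q.1 + 2) / 3, q.2 * hr n) : Pt) ∈ ob ∧ Wt σ (fun p q => p ≤ q) (F n) ob ((q.1 + 2) / 3, q.2 * hr n) i := by
  have l1 : 0 < hr n := h.hr0 n
  have l0 := h.hr1 n
  have key : ∀ q : Pt, q ∈ ob → (((q.1 + 2) / 3, q.2 * hr n) : Pt) ∈ ob ∧ F n ((q.1 + 2) / 3, q.2 * hr n) = F (n + 1) q := by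
    rintro ⟨x, y⟩ ⟨h1, h2, h3, h4⟩
    simp only at h1 h2 h3 h4
    have e1 : 0 < y * hr n := mul_pos h3 l1
    have e2 : y * hr n < hr n := by nlinarith
    have ho : (((x + 2) / 3, y * hr n) : Pt) ∈ ob := ⟨by simp only; linarith, by simp only; linarith, by simp only; linarith, by simp only; linarith⟩
    refine ⟨ho, ?_⟩
    simp only
    rw [h.FL n _ ho (by simp only; linarith) (by simp only; linarith)]
    congr 2
    · ring
    · field_simp
  refine ⟨(key q hq).1, ?_⟩
  rcases hW with hW | ⟨hW, q', hq', h1, h2, h3⟩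
  · exact Or.inl ((key q hq).2 ▸ hW)
  · refine Or.inr ⟨(key q hq).2.symm ▸ hW, _, (key q' hq').1, ⟨by simp only; linarith [h1.1], ?_⟩, fun e => h2 ?_, ?_⟩
    · have := h1.2; simp only; gcongr
    · simp only [Prod.mk.injEq] at e
      ext
      · linarith [e.1]
      · exact mul_right_cancel₀ l1.ne' e.2
    · rw [(key q hq).2, (key q' hq').2]; exact h3

end
end Temporal

namespace Temporal
section
variable {L ι : Type} {σ : Sys L ι} {c0 c1 ts : L} {hl hr : ℕ → ℝ} {G F : ℕ → Pt → L}

theorem Wt.WF {r : Pt → Pt → Prop} {f : Pt → L} {R : Set Pt} {q : Pt} {i : ι} (h : Wt σ r f R q i) : σ.WF (f q) i := by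
  rcases h with h | h
  · exact Sys.WF_of h
  · exact h.1

theorem Sys.noWF {l k : L} {i : ι} (h1 : σ.le l k) (h2 : σ.A l i) (h3 : ¬ σ.A k i) : ¬ σ.WF k i := by
  rintro ⟨m, hm, hw⟩
  exact h3 (σ.axF h1 hm.1 h2 (Or.inr hw))

/-- a level-`n` witness in the body of the tile is a witness for `F n` -/
theorem Shuf.wtS (h : Shuf σ c0 c1 ts hl hr G F) {n : ℕ} {S : Set Pt} (hS : ∀ q ∈ S, q ∈ bx 0 1 0 1 ∧ nh (hl n) (hr n) q)
    {i : ι} (hw : ¬ σ.WF c1 i) {p q : Pt} (hp : p ∈ ob) (hpq : p ≤ q) (hq : q ∈ S)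
    (hW : Wt σ (fun p q => p ≤ q) (G n) S q i) : q ∈ ob ∧ Wt σ (fun p q => p ≤ q) (F n) ob q i := by
  have key : ∀ q ∈ S, p ≤ q → σ.WF (G n q) i → q ∈ ob ∧ F n q = G n q := by
    intro q hq hpq hW
    obtain ⟨⟨k1, k2, k3, k4⟩, n1, n2⟩ := hS q hq
    have l0 := h.hl1 n
    have : q ∈ ob := by
      refine ⟨hp.1.trans_le hpq.1, lt_of_le_of_ne k2 fun e => hw ?_, hp.2.2.1.trans_le hpq.2, lt_of_le_of_ne k4 fun e => hw ?_⟩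
      · have : q = (1, q.2) := by ext <;> simp [e]
        rw [this] at hW
        refine (h.r1 n q.2 ?_ k4).WF hW
        by_contra h'; exact n2 ⟨by rw [e]; norm_num, not_le.1 h'⟩
      · have : q = (q.1, 1) := by ext <;> simp [e]
        rw [this] at hW
        have h13 : 1/3 ≤ q.1 := by
          by_contra h'; exact n1 ⟨not_le.1 h', by rw [e]; exact l0⟩
        rcases le_total q.1 (2/3) with h' | h'
        · exact (h.tV n q.1 h13 h').WF hW
        · exact (h.t1 n q.1 h' k2).WF hW
    exact ⟨this, h.FN n q this n1 n2⟩
  obtain ⟨k1, k2⟩ := key q hq hpq hW.WF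
  refine ⟨k1, ?_⟩
  rcases hW with hW | ⟨hW, q', h1, h2, h3, h4⟩
  · exact Or.inl (k2.symm ▸ hW)
  · obtain ⟨k3, k4⟩ := key q' h1 (hpq.trans h2) (h4.WF hW)
    exact Or.inr ⟨k2.symm ▸ hW, q', k3, h2, h3, by rw [k2, k4]; exact h4⟩

theorem nhV {hl hr : ℝ} : ∀ q ∈ bx (1/3) (2/3) 0 1, q ∈ bx 0 1 0 1 ∧ nh hl hr q := by
  rintro q ⟨h1, h2, h3, h4⟩
  exact ⟨⟨by linarith, by linarith, h3, h4⟩, fun h => by linarith [h.1], fun h => by linarith [h.1]⟩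
theorem nh0 {hl hr : ℝ} (h : hl < 1) : ∀ q ∈ bx 0 (1/3) 0 hl, q ∈ bx 0 1 0 1 ∧ nh hl hr q := by
  rintro q ⟨h1, h2, h3, h4⟩
  exact ⟨⟨by linarith, by linarith, h3, by linarith⟩, fun h => by linarith [h.2], fun h => by linarith [h.1]⟩
theorem nh1 {hl hr : ℝ} (h : 0 < hr) : ∀ q ∈ bx (2/3) 1 hr 1, q ∈ bx 0 1 0 1 ∧ nh hl hr q := by
  rintro q ⟨h1, h2, h3, h4⟩
  exact ⟨⟨by linarith, by linarith, by linarith, by linarith⟩, fun h => by linarith [h.1], fun h => by linarith [h.2]⟩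

/-- infinitely many central pieces contain a witness for `i` -/
def VisH (σ : Sys L ι) (G : ℕ → Pt → L) (i : ι) : Prop :=
  ∀ N, ∃ m ≥ N, ∃ q ∈ bx (1/3) (2/3) 0 1, Wt σ (fun p q => p ≤ q) (G m) (bx (1/3) (2/3) 0 1) q i

theorem Shuf.visAll (h : Shuf σ c0 c1 ts hl hr G F) {i : ι} (hv : VisH σ G i) (h0 : ¬ σ.WF c0 i) (h1 : ¬ σ.WF c1 i) (n : ℕ) :
    ∃ q ∈ ob, Wt σ (fun p q => p ≤ q) (F n) ob q i := by
  obtain ⟨m, hm, q, hq, hW⟩ := hv n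
  have hm' : ∃ q ∈ ob, Wt σ (fun p q => p ≤ q) (F m) ob q i := by
    have q0 : 0 < q.2 := by
      refine lt_of_le_of_ne hq.2.2.1 fun e => h0 ?_
      have := hW.WF
      have e' : q = (q.1, 0) := by ext <;> simp [← e]
      rw [e'] at this
      exact (h.bV m q.1 hq.1 hq.2.1).WF this
    have := hq.2.2.2
    have := hq.1
    exact ⟨q, h.wtS nhV h1 (p := (1/4, q.2/2)) ⟨by norm_num, by norm_num, by simp only; linarith, by simp only; linarith⟩
      ⟨by simp only; linarith, by simp only; linarith⟩ hq hW⟩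
  obtain ⟨k, rfl⟩ := Nat.exists_eq_add_of_le hm
  clear hm hq hW
  induction k with
  | zero => exact hm'
  | succ k ih =>
    obtain ⟨q, hq, hW⟩ := hm'
    exact ih ⟨_, h.transU (n := n + k) hq hW⟩

theorem Shuf.visB (h : Shuf σ c0 c1 ts hl hr G F) {i : ι} (hv : VisH σ G i) (h0 : ¬ σ.WF c0 i) (h1 : ¬ σ.WF c1 i) (n : ℕ)
    {x : ℝ} (hx : x < 1) : ∃ q ∈ ob, x ≤ q.1 ∧ Wt σ (fun p q => p ≤ q) (F n) ob q i := by
  obtain ⟨k, hk⟩ := exists_pow_lt_of_lt_one (sub_pos.2 hx) (show (1/3 : ℝ) < 1 by norm_num)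
  clear hx
  induction k generalizing n x with
  | zero =>
    obtain ⟨q, hq, hW⟩ := h.visAll hv h0 h1 n
    exact ⟨q, hq, by simp at hk; linarith [hq.1], hW⟩
  | succ k ih =>
    obtain ⟨q, hq, h2, hW⟩ := ih (n + 1) (x := 3 * x - 2) (by rw [pow_succ] at hk; linarith)
    obtain ⟨h3, h4⟩ := h.transL hq hW
    exact ⟨_, h3, by simp only; linarith, h4⟩

theorem Shuf.visL (h : Shuf σ c0 c1 ts hl hr G F) {i : ι} (hv : VisH σ G i) (h0 : ¬ σ.WF c0 i) (h1 : ¬ σ.WF c1 i) (n : ℕ)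
    {y : ℝ} (hy : y < 1) : ∃ q ∈ ob, y ≤ q.2 ∧ Wt σ (fun p q => p ≤ q) (F n) ob q i := by
  obtain ⟨k, hk⟩ := exists_pow_lt_of_lt_one (sub_pos.2 hy) (show (1/2 : ℝ) < 1 by norm_num)
  clear hy
  induction k generalizing n y with
  | zero =>
    obtain ⟨q, hq, hW⟩ := h.visAll hv h0 h1 n
    exact ⟨q, hq, by simp at hk; linarith [hq.2.2.1], hW⟩
  | succ k ih =>
    have l0 := h.hl0 n
    have l1 : 0 < 1 - hl n := by linarith [h.hl1 n]
    have e : (1 - hl n) * ((y - hl n) / (1 - hl n)) = y - hl n := mul_div_cancel₀ _ l1.ne'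
    have hp : (0:ℝ) < (1/2)^k := by positivity
    obtain ⟨q, hq, h2, hW⟩ := ih (n + 1) (y := (y - hl n) / (1 - hl n)) (by
      rw [pow_succ] at hk
      rw [lt_sub_iff_add_lt, ← lt_sub_iff_add_lt', div_lt_iff₀ l1]
      nlinarith)
    obtain ⟨h3, h4⟩ := h.transU hq hW
    refine ⟨_, h3, ?_, h4⟩
    rw [div_le_iff₀ l1] at h2
    simp only; linarith

/-- hypotheses for the future demands -/
def NdF (σ : Sys L ι) (c0 c1 : L) (G : ℕ → Pt → L) : Prop :=
  ∀ i, σ.A c0 i → ¬ σ.WF c0 i → ¬ σ.A c1 i → VisH σ G i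

theorem Shuf.c0U (h : Shuf σ c0 c1 ts hl hr G F) (nd : NdF σ c0 c1 G) {i : ι} (h0 : σ.A c0 i) (h1 : ¬ σ.A c1 i)
    {n : ℕ} {p : Pt} (hp : p ∈ ob) (p1 : p.1 < 1/3) (p2 : p.2 ≤ hl n) :
    ∃ q ∈ ob, p ≤ q ∧ Wt σ (fun p q => p ≤ q) (F n) ob q i := by
  have l0 := h.hl0 n
  have l1 := h.hl1 n
  obtain ⟨z1, z2, z3, z4⟩ := hp
  by_cases hw : σ.WF c0 i
  · have key : ∀ x, p.1 ≤ x → x < 1/3 → ((x, hl n) : Pt) ∈ ob ∧ σ.eqv (F n (x, hl n)) c0 := by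
      intro x x1 x2
      have ho : ((x, hl n) : Pt) ∈ ob := ⟨by simp only; linarith, by simp only; linarith, by simp only; linarith, l1⟩
      refine ⟨ho, ?_⟩
      rw [h.FN n _ ho (fun h => lt_irrefl _ h.2) (fun h => by simp only at h; linarith [h.1])]
      exact h.t0 n x (by linarith) x2
    obtain ⟨x', x1, x2⟩ := exists_between p1
    obtain ⟨k1, k2⟩ := key p.1 le_rfl p1
    obtain ⟨k3, k4⟩ := key x' x1.le x2
    refine ⟨_, k1, ⟨le_rfl, p2⟩, Or.inr ⟨k2.symm.WF hw, _, k3, ⟨x1.le, le_rfl⟩, fun e => ?_, k2.trans k4.symm⟩⟩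
    simp only [Prod.mk.injEq] at e
    exact x1.ne e.1
  · obtain ⟨q, hq, h2, hW⟩ := h.visB (nd i h0 hw h1) hw (Sys.noWF h.c01 h0 h1) (n + 1) (x := 3 * p.1) (by linarith)
    obtain ⟨h3, h4⟩ := h.transU hq hW
    refine ⟨_, h3, ⟨by simp only; linarith, ?_⟩, h4⟩
    have : 0 < q.2 * (1 - hl n) := mul_pos hq.2.2.1 (by linarith)
    simp only; linarith

theorem Shuf.c0L (h : Shuf σ c0 c1 ts hl hr G F) (nd : NdF σ c0 c1 G) {i : ι} (h0 : σ.A c0 i) (h1 : ¬ σ.A c1 i)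
    {n : ℕ} {p : Pt} (hp : p ∈ ob) (p1 : p.1 ≤ 2/3) (p2 : p.2 < hr n) :
    ∃ q ∈ ob, p ≤ q ∧ Wt σ (fun p q => p ≤ q) (F n) ob q i := by
  have l0 := h.hr0 n
  have l1 := h.hr1 n
  obtain ⟨z1, z2, z3, z4⟩ := hp
  by_cases hw : σ.WF c0 i
  · have key : ∀ y, p.2 ≤ y → y < hr n → ((2/3, y) : Pt) ∈ ob ∧ σ.eqv (F n (2/3, y)) c0 := by
      intro y y1 y2
      have ho : ((2/3, y) : Pt) ∈ ob := ⟨by norm_num, by norm_num, by simp only; linarith, by simp only; linarith⟩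
      refine ⟨ho, ?_⟩
      rw [h.FN n _ ho (fun h => by norm_num at h) (fun h => lt_irrefl _ h.1)]
      exact h.rV n y (by linarith) y2
    obtain ⟨x', x1, x2⟩ := exists_between p2
    obtain ⟨k1, k2⟩ := key p.2 le_rfl p2
    obtain ⟨k3, k4⟩ := key x' x1.le x2
    refine ⟨_, k1, ⟨p1, le_rfl⟩, Or.inr ⟨k2.symm.WF hw, _, k3, ⟨le_rfl, x1.le⟩, fun e => ?_, k2.trans k4.symm⟩⟩
    simp only [Prod.mk.injEq] at e
    exact x1.ne e.2
  · obtain ⟨q, hq, h2, hW⟩ := h.visL (nd i h0 hw h1) hw (Sys.noWF h.c01 h0 h1) (n + 1) (y := p.2 / hr n) (by rw [div_lt_one l0]; exact p2)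
    obtain ⟨h3, h4⟩ := h.transL hq hW
    refine ⟨_, h3, ⟨by simp only; linarith [hq.1], ?_⟩, h4⟩
    rw [div_le_iff₀ l0] at h2
    exact h2

theorem Shuf.IE1 (h : Shuf σ c0 c1 ts hl hr G F) {i : ι} (h1 : ¬ σ.A c1 i) {n : ℕ} {p : Pt} (hp : p ∈ ob)
    (hp' : p ∈ bx (2/3) 1 (hr n) 1) (hA : σ.A (G n p) i) :
    ∃ q ∈ ob, p ≤ q ∧ Wt σ (fun p q => p ≤ q) (F n) ob q i := by
  have l0 := h.hr0 n
  have hle : σ.le (G n p) c1 := by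
    obtain ⟨_, k1, k2⟩ := nh1 l0 p hp'
    rw [← h.FN n p hp k1 k2]; exact h.Fle n p hp
  rcases (h.m1 n).fut p hp' i hA with ⟨q, hq, hpq, hW⟩ | ⟨q, hq, hE, hpq, hA'⟩
  · obtain ⟨k1, k2⟩ := h.wtS (nh1 l0) (Sys.noWF hle hA h1) hp hpq hq hW
    exact ⟨q, k1, hpq, k2⟩
  · exfalso
    apply h1
    obtain ⟨x, y⟩ := q
    rcases hE with e | e
    · simp only at e; subst e
      exact (h.r1 n y hq.2.2.1 hq.2.2.2).A hA'
    · simp only at e; subst e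
      exact (h.t1 n x hq.1 hq.2.1).A hA'

theorem Shuf.IV (h : Shuf σ c0 c1 ts hl hr G F) (nd : NdF σ c0 c1 G) {i : ι} (h1 : ¬ σ.A c1 i) {n : ℕ} {p : Pt} (hp : p ∈ ob)
    (hp' : p ∈ bx (1/3) (2/3) 0 1) (hA : σ.A (G n p) i) :
    ∃ q ∈ ob, p ≤ q ∧ Wt σ (fun p q => p ≤ q) (F n) ob q i := by
  have hle : σ.le (G n p) c1 := by
    obtain ⟨_, k1, k2⟩ := nhV (hl := hl n) (hr := hr n) p hp'
    rw [← h.FN n p hp k1 k2]; exact h.Fle n p hp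
  rcases (h.mV n).fut p hp' i hA with ⟨q, hq, hpq, hW⟩ | ⟨q, hq, hE, hpq, hA'⟩
  · obtain ⟨k1, k2⟩ := h.wtS nhV (Sys.noWF hle hA h1) hp hpq hq hW
    exact ⟨q, k1, hpq, k2⟩
  · obtain ⟨x, y⟩ := q
    by_cases e : y = 1
    · subst e
      exact absurd ((h.tV n x hq.1 hq.2.1).A hA') h1
    have e' : x = 2/3 := by
      rcases hE with e' | e'
      · exact e'
      · exact absurd e' e
    subst e'
    have hob : ((2/3, y) : Pt) ∈ ob := ⟨by norm_num, by norm_num, hp.2.2.1.trans_le hpq.2, lt_of_le_of_ne hq.2.2.2 e⟩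
    rcases le_or_gt (hr n) y with hy | hy
    · obtain ⟨q', k1, k2, k3⟩ := h.IE1 h1 hob ⟨le_rfl, by norm_num, hy, hq.2.2.2⟩ hA'
      exact ⟨q', k1, hpq.trans k2, k3⟩
    · obtain ⟨q', k1, k2, k3⟩ := h.c0L nd ((h.rV n y hq.2.2.1 hy).A hA') h1 hob le_rfl hy
      exact ⟨q', k1, hpq.trans k2, k3⟩

theorem Shuf.IE0 (h : Shuf σ c0 c1 ts hl hr G F) (nd : NdF σ c0 c1 G) {i : ι} (h1 : ¬ σ.A c1 i) {n : ℕ} {p : Pt} (hp : p ∈ ob)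
    (hp' : p ∈ bx 0 (1/3) 0 (hl n)) (hA : σ.A (G n p) i) :
    ∃ q ∈ ob, p ≤ q ∧ Wt σ (fun p q => p ≤ q) (F n) ob q i := by
  have l1 := h.hl1 n
  have hle : σ.le (G n p) c1 := by
    obtain ⟨_, k1, k2⟩ := nh0 (hr := hr n) l1 p hp'
    rw [← h.FN n p hp k1 k2]; exact h.Fle n p hp
  rcases (h.m0 n).fut p hp' i hA with ⟨q, hq, hpq, hW⟩ | ⟨q, hq, hE, hpq, hA'⟩
  · obtain ⟨k1, k2⟩ := h.wtS (nh0 l1) (Sys.noWF hle hA h1) hp hpq hq hW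
    exact ⟨q, k1, hpq, k2⟩
  · have hob : q ∈ ob := ⟨hp.1.trans_le hpq.1, by linarith [hq.2.1], hp.2.2.1.trans_le hpq.2, by linarith [hq.2.2.2]⟩
    rcases lt_or_ge q.1 (1/3) with hx | hx
    · have e : q.2 = hl n := by
        rcases hE with e | e
        · linarith
        · exact e
      have e' : q = (q.1, hl n) := by rw [← e]
      rw [e'] at hA'
      obtain ⟨q', k1, k2, k3⟩ := h.c0U nd ((h.t0 n q.1 hq.1 hx).A hA') h1 hob hx hq.2.2.2
      exact ⟨q', k1, hpq.trans k2, k3⟩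
    · obtain ⟨q', k1, k2, k3⟩ := h.IV nd h1 hob ⟨hx, by linarith [hq.2.1], hq.2.2.1, hob.2.2.2.le⟩ hA'
      exact ⟨q', k1, hpq.trans k2, k3⟩

theorem Shuf.futI (h : Shuf σ c0 c1 ts hl hr G F) (nd : NdF σ c0 c1 G) {i : ι} (h1 : ¬ σ.A c1 i) (n : ℕ) (p : Pt) (hp : p ∈ ob)
    (hA : σ.A (F n p) i) : ∃ q ∈ ob, p ≤ q ∧ Wt σ (fun p q => p ≤ q) (F n) ob q i := by
  revert hA
  refine (h.ind (fun n p => σ.A (F n p) i → ∃ q ∈ ob, p ≤ q ∧ Wt σ (fun p q => p ≤ q) (F n) ob q i)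
    (fun n p hp k1 k2 hA => ?_) (fun n p hp k1 k2 k3 hA => ?_) (fun n p hp k1 k2 k3 hA => ?_) n p hp).elim id
    (fun e hA => ?_)
  · rw [h.FN n p hp k1 k2] at hA
    rcases lt_or_ge p.1 (1/3) with hx | hx
    · exact h.IE0 nd h1 hp ⟨hp.1.le, hx.le, hp.2.2.1.le, by by_contra h'; exact k1 ⟨hx, not_le.1 h'⟩⟩ hA
    rcases le_or_gt p.1 (2/3) with hx' | hx'
    · exact h.IV nd h1 hp ⟨hx, hx', hp.2.2.1.le, hp.2.2.2.le⟩ hA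
    · exact h.IE1 h1 hp ⟨hx'.le, hp.2.1.le, by by_contra h'; exact k2 ⟨hx', not_le.1 h'⟩, hp.2.2.2.le⟩ hA
  · rw [h.FU n p hp k1 k2] at hA
    obtain ⟨q, hq, h2, hW⟩ := k3 hA
    obtain ⟨h3, h4⟩ := h.transU hq hW
    have l1 : 0 < 1 - hl n := by linarith [h.hl1 n]
    have := h2.2
    simp only at this
    rw [div_le_iff₀ l1] at this
    exact ⟨_, h3, ⟨by simp only; have := h2.1; simp only at this; linarith, by simp only; linarith⟩, h4⟩
  · rw [h.FL n p hp k1 k2] at hA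
    obtain ⟨q, hq, h2, hW⟩ := k3 hA
    obtain ⟨h3, h4⟩ := h.transL hq hW
    have l1 := h.hr0 n
    have := h2.2
    simp only at this
    rw [div_le_iff₀ l1] at this
    exact ⟨_, h3, ⟨by simp only; have := h2.1; simp only at this; linarith, by simp only; linarith⟩, h4⟩
  · rw [e] at hA
    rcases h.okF i hA with hw | hw
    · exact ⟨p, hp, le_rfl, Or.inl (e ▸ hw)⟩
    · exact absurd hw h1

/-! the final function -/
open Classical in
noncomputable def shF (k0 t' t k1 c0 c1 : L) (F0 : Pt → L) (p : Pt) : L :=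
  if p ∈ ob then F0 p else tab k0 t' t k1 c0 c1 c0 c1 c0 p

variable {k0 t' t k1 : L}

theorem shF_ob {F0 : Pt → L} {p : Pt} (hp : p ∈ ob) : shF k0 t' t k1 c0 c1 F0 p = F0 p := if_pos hp
theorem shF_n {F0 : Pt → L} {p : Pt} (hp : p ∉ ob) : shF k0 t' t k1 c0 c1 F0 p = tab k0 t' t k1 c0 c1 c0 c1 c0 p := if_neg hp
theorem shF_l {F0 : Pt → L} (y : ℝ) : shF k0 t' t k1 c0 c1 F0 (0, y) = elF k0 c0 t 0 1 y := by
  rw [shF_n (fun h => lt_irrefl _ h.1)]; simp only [tab, elF_0]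
theorem shF_r {F0 : Pt → L} (y : ℝ) : shF k0 t' t k1 c0 c1 F0 (1, y) = elF t' c1 k1 0 1 y := by
  rw [shF_n (fun h => lt_irrefl _ h.2.1)]; simp only [tab, elF_1]
theorem shF_b {F0 : Pt → L} (x : ℝ) : shF k0 t' t k1 c0 c1 F0 (x, 0) = elF k0 c0 t' 0 1 x := by
  rw [shF_n (fun h => lt_irrefl _ h.2.2.1)]; simp only [tab, elF_0]
theorem shF_t {F0 : Pt → L} (x : ℝ) : shF k0 t' t k1 c0 c1 F0 (x, 1) = elF t c1 k1 0 1 x := by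
  rw [shF_n (fun h => lt_irrefl _ h.2.2.2)]; simp only [tab, elF_1]

theorem shF_refl {F0 : Pt → L} (p : Pt) (hp : p ∈ bx 0 1 0 1) :
    shF k1 t t' k0 c1 c0 (fun p => F0 (refl2 p)) (refl2 p) = shF k0 t' t k1 c0 c1 F0 p := by
  by_cases h : p ∈ ob
  · rw [shF_ob (refl2_ob.2 h), shF_ob h, refl2_refl2]
  · obtain ⟨x, y⟩ := p
    rcases tri hp.1 hp.2.1 with e | e | e
    · simp only at e; subst e; rw [shF_l, refl2_apply]; simp only [sub_zero]; rw [shF_r, elF_refl]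
    · simp only at e; subst e; rw [shF_r, refl2_apply]; simp only [sub_self]; rw [shF_l, elF_refl]
    rcases tri hp.2.2.1 hp.2.2.2 with e' | e' | e'
    · simp only at e'; subst e'; rw [shF_b, refl2_apply]; simp only [sub_zero]; rw [shF_t, elF_refl]
    · simp only at e'; subst e'; rw [shF_t, refl2_apply]; simp only [sub_self]; rw [shF_b, elF_refl]
    · exact absurd ⟨e.1, e.2, e'⟩ h

theorem shWt {F0 : Pt → L} {q : Pt} {i : ι} (hq : q ∈ ob) (h : Wt σ (fun p q => p ≤ q) F0 ob q i) :
    Wt σ (fun p q => p ≤ q) (shF k0 t' t k1 c0 c1 F0) (bx 0 1 0 1) q i := by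
  rcases h with h | ⟨h, q', h1, h2, h3, h4⟩
  · exact Or.inl (by rw [shF_ob hq]; exact h)
  · exact Or.inr ⟨by rw [shF_ob hq]; exact h, q', ob_bx h1, h2, h3, by rw [shF_ob hq, shF_ob h1]; exact h4⟩

theorem Shuf.fut (h : Shuf σ c0 c1 ts hl hr G F) (nd : NdF σ c0 c1 G) (hk0 : σ.eqv k0 c0) (hk1 : σ.eqv k1 c1) :
    FutOK σ (fun p q => p ≤ q) (shF k0 t' t k1 c0 c1 (F 0)) (bx 0 1 0 1) (exU 1 1) := by
  intro p hp i hA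
  by_cases h1 : σ.A c1 i
  · refine Or.inr ⟨(1, 1), ⟨zero_le_one, le_rfl, zero_le_one, le_rfl⟩, Or.inl rfl, ⟨hp.2.1, hp.2.2.2⟩, ?_⟩
    rw [shF_t, elF_1]; exact hk1.symm.A h1
  by_cases hob : p ∈ ob
  · rw [shF_ob hob] at hA
    obtain ⟨q, k1, k2, k3⟩ := h.futI nd h1 0 p hob hA
    exact Or.inl ⟨q, ob_bx k1, k2, shWt k1 k3⟩
  by_cases hE : p ∈ exU 1 1
  · exact Or.inr ⟨p, hp, hE, le_rfl, hA⟩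
  obtain ⟨x, y⟩ := p
  obtain ⟨x0, x1, y0, y1⟩ := hp
  have x1' : x < 1 := lt_of_le_of_ne x1 fun e => hE (Or.inl e)
  have y1' : y < 1 := lt_of_le_of_ne y1 fun e => hE (Or.inr e)
  simp only at x0 y0
  rcases x0.eq_or_lt with e | e
  · subst e
    have hA0 : σ.A c0 i := by
      rw [shF_l] at hA
      rcases y0.eq_or_lt with e | e
      · subst e; rw [elF_0] at hA; exact hk0.A hA
      · rw [elF_mid e y1'] at hA; exact hA
    by_cases hw : σ.WF c0 i
    · obtain ⟨q, h1, h2, -, h3⟩ := tab_Wy (f := shF k0 t' t k1 c0 c1 (F 0)) (x := 0) ⟨le_rfl, zero_le_one⟩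
        (fun y hy => by rw [shF_l, elF_mid hy.1 hy.2]) hw ⟨y0, y1'⟩
      exact Or.inl ⟨q, h1, h2, h3⟩
    · obtain ⟨q, hq, h2, hW⟩ := h.visL (nd i hA0 hw h1) hw (Sys.noWF h.c01 hA0 h1) 0 y1'
      exact Or.inl ⟨q, ob_bx hq, ⟨hq.1.le, h2⟩, shWt hq hW⟩
  rcases y0.eq_or_lt with e' | e'
  · subst e'
    have hA0 : σ.A c0 i := by
      rw [shF_b, elF_mid e x1'] at hA; exact hA
    by_cases hw : σ.WF c0 i
    · obtain ⟨q, h1, h2, -, h3⟩ := tab_Wx (f := shF k0 t' t k1 c0 c1 (F 0)) (y := 0) ⟨le_rfl, zero_le_one⟩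
        (fun y hy => by rw [shF_b, elF_mid hy.1 hy.2]) hw ⟨x0, x1'⟩
      exact Or.inl ⟨q, h1, h2, h3⟩
    · obtain ⟨q, hq, h2, hW⟩ := h.visB (nd i hA0 hw h1) hw (Sys.noWF h.c01 hA0 h1) 0 x1'
      exact Or.inl ⟨q, ob_bx hq, ⟨h2, hq.2.2.1.le⟩, shWt hq hW⟩
  · exact absurd ⟨e, x1', e', y1'⟩ hob

theorem Shuf.res (h : Shuf σ c0 c1 ts hl hr G F) {i : ι} (hi : σ.WF c0 i ∨ σ.WF c1 i ∨ σ.wF t i ∨ σ.wF t' i ∨ VisH σ G i) :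
    ∃ q ∈ bx 0 1 0 1, Wt σ (fun p q => p ≤ q) (shF k0 t' t k1 c0 c1 (F 0)) (bx 0 1 0 1) q i := by
  by_cases hw : σ.WF c0 i
  · obtain ⟨q, h1, h2, -, h3⟩ := tab_Wy (f := shF k0 t' t k1 c0 c1 (F 0)) (x := 0) ⟨le_rfl, zero_le_one⟩
        (fun y hy => by rw [shF_l, elF_mid hy.1 hy.2]) hw ⟨le_rfl, zero_lt_one⟩
    exact ⟨q, h1, h3⟩
  by_cases hw' : σ.WF c1 i
  · obtain ⟨q, h1, h2, -, h3⟩ := tab_Wy (f := shF k0 t' t k1 c0 c1 (F 0)) (x := 1) ⟨zero_le_one, le_rfl⟩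
        (fun y hy => by rw [shF_r, elF_mid hy.1 hy.2]) hw' ⟨le_rfl, zero_lt_one⟩
    exact ⟨q, h1, h3⟩
  rcases hi with hi | hi | hi | hi | hi
  · exact absurd hi hw
  · exact absurd hi hw'
  · exact ⟨(0, 1), ⟨le_rfl, zero_le_one, zero_le_one, le_rfl⟩, Or.inl (by rw [shF_l, elF_1]; exact hi)⟩
  · exact ⟨(1, 0), ⟨zero_le_one, le_rfl, le_rfl, zero_le_one⟩, Or.inl (by rw [shF_r, elF_0]; exact hi)⟩
  · obtain ⟨q, h1, h2⟩ := h.visAll hi hw hw' 0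
    exact ⟨q, ob_bx h1, shWt h1 h2⟩

theorem Shuf.monoF (h : Shuf σ c0 c1 ts hl hr G F) (hk0 : σ.eqv k0 c0) (hk1 : σ.eqv k1 c1)
    (ht0 : σ.le c0 t) (ht1 : σ.le t c1) (ht0' : σ.le c0 t') (ht1' : σ.le t' c1) :
    ∀ p ∈ bx 0 1 0 1, ∀ q ∈ bx 0 1 0 1, p ≤ q →
      σ.le (shF k0 t' t k1 c0 c1 (F 0) p) (shF k0 t' t k1 c0 c1 (F 0) q) := by
  intro p hp q hq hpq
  have lo : ∀ p ∈ bx 0 1 0 1, (p.1 = 0 ∧ p.2 < 1 ∨ p.2 = 0 ∧ p.1 < 1) → σ.le (shF k0 t' t k1 c0 c1 (F 0) p) c0 := by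
    rintro ⟨x, y⟩ hp hh
    rcases hh with ⟨e, e1⟩ | ⟨e, e1⟩
    · simp only at e; subst e; rw [shF_l]
      rcases hp.2.2.1.eq_or_lt with e | e
      · simp only at e; subst e; rw [elF_0]; exact hk0.1
      · rw [elF_mid e e1]; exact σ.rfl' _
    · simp only at e; subst e; rw [shF_b]
      rcases hp.1.eq_or_lt with e | e
      · simp only at e; subst e; rw [elF_0]; exact hk0.1
      · rw [elF_mid e e1]; exact σ.rfl' _
  have hi : ∀ p ∈ bx 0 1 0 1, (p.1 = 1 ∧ 0 < p.2 ∨ p.2 = 1 ∧ 0 < p.1) → σ.le c1 (shF k0 t' t k1 c0 c1 (F 0) p) := by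
    rintro ⟨x, y⟩ hp hh
    rcases hh with ⟨e, e1⟩ | ⟨e, e1⟩
    · simp only at e; subst e; rw [shF_r]
      rcases hp.2.2.2.eq_or_lt with e | e
      · simp only at e; subst e; rw [elF_1]; exact hk1.2
      · rw [elF_mid e1 e]; exact σ.rfl' _
    · simp only at e; subst e; rw [shF_t]
      rcases hp.2.1.eq_or_lt with e | e
      · simp only at e; subst e; rw [elF_1]; exact hk1.2
      · rw [elF_mid e1 e]; exact σ.rfl' _
  have bd : ∀ p ∈ bx 0 1 0 1, p ∉ ob → (p.1 = 0 ∧ p.2 < 1 ∨ p.2 = 0 ∧ p.1 < 1) ∨ (p.1 = 1 ∧ 0 < p.2 ∨ p.2 = 1 ∧ 0 < p.1)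
      ∨ p = (0, 1) ∨ p = (1, 0) := by
    rintro ⟨x, y⟩ ⟨h1, h2, h3, h4⟩ hn
    simp only at *
    rcases tri h1 h2 with e | e | e
    · subst e
      rcases h4.eq_or_lt with e' | e'
      · subst e'; exact Or.inr (Or.inr (Or.inl rfl))
      · exact Or.inl (Or.inl ⟨rfl, e'⟩)
    · subst e
      rcases h3.eq_or_lt with e' | e'
      · subst e'; exact Or.inr (Or.inr (Or.inr rfl))
      · exact Or.inr (Or.inl (Or.inl ⟨rfl, e'⟩))
    · rcases tri h3 h4 with e' | e' | e'
      · exact Or.inl (Or.inr ⟨e', e.2⟩)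
      · exact Or.inr (Or.inl (Or.inr ⟨e', e.1⟩))
      · exact absurd ⟨e.1, e.2, e'⟩ hn
  have all0 : ∀ p ∈ bx 0 1 0 1, σ.le c0 (shF k0 t' t k1 c0 c1 (F 0) p) := by
    intro p hp
    by_cases ho : p ∈ ob
    · rw [shF_ob ho]; exact h.Fge 0 p ho
    rcases bd p hp ho with e | e | e | e
    · obtain ⟨x, y⟩ := p
      rcases e with ⟨e, e1⟩ | ⟨e, e1⟩
      · simp only at e; subst e; rw [shF_l]; unfold elF; split_ifs <;> first | exact hk0.2 | exact ht0 | exact σ.rfl' _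
      · simp only at e; subst e; rw [shF_b]; unfold elF; split_ifs <;> first | exact hk0.2 | exact ht0' | exact σ.rfl' _
    · exact σ.trans' h.c01 (hi p hp e)
    · rw [e, shF_l, elF_1]; exact ht0
    · rw [e, shF_r, elF_0]; exact ht0'
  have all1 : ∀ p ∈ bx 0 1 0 1, σ.le (shF k0 t' t k1 c0 c1 (F 0) p) c1 := by
    intro p hp
    by_cases ho : p ∈ ob
    · rw [shF_ob ho]; exact h.Fle 0 p ho
    rcases bd p hp ho with e | e | e | e
    · exact σ.trans' (lo p hp e) h.c01
    · obtain ⟨x, y⟩ := p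
      rcases e with ⟨e, e1⟩ | ⟨e, e1⟩
      · simp only at e; subst e; rw [shF_r]; unfold elF; split_ifs <;> first | exact hk1.1 | exact ht1' | exact σ.rfl' _
      · simp only at e; subst e; rw [shF_t]; unfold elF; split_ifs <;> first | exact hk1.1 | exact ht1 | exact σ.rfl' _
    · rw [e, shF_l, elF_1]; exact ht1
    · rw [e, shF_r, elF_0]; exact ht1'
  by_cases ho : p ∈ ob
  · by_cases ho' : q ∈ ob
    · rw [shF_ob ho, shF_ob ho']; exact h.mono 0 ho ho' hpq
    · refine σ.trans' (all1 p hp) (hi q hq ?_)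
      have h1 := ho.1.trans_le hpq.1
      have h2 := ho.2.2.1.trans_le hpq.2
      rcases hq.2.1.eq_or_lt with e | e
      · exact Or.inl ⟨e, h2⟩
      rcases hq.2.2.2.eq_or_lt with e' | e'
      · exact Or.inr ⟨e', h1⟩
      · exact absurd ⟨h1, e, h2, e'⟩ ho'
  rcases bd p hp ho with e | e | e | e
  · exact σ.trans' (lo p hp e) (all0 q hq)
  · refine σ.trans' (all1 p hp) (hi q hq ?_)
    rcases e with ⟨e, e1⟩ | ⟨e, e1⟩
    · exact Or.inl ⟨le_antisymm hq.2.1 (e ▸ hpq.1), e1.trans_le hpq.2⟩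
    · exact Or.inr ⟨le_antisymm hq.2.2.2 (e ▸ hpq.2), e1.trans_le hpq.1⟩
  · have e2 : q.2 = 1 := le_antisymm hq.2.2.2 (by rw [e] at hpq; exact hpq.2)
    rcases hq.1.eq_or_lt with e3 | e3
    · have : q = p := by rw [e]; ext <;> simp [e2, ← e3]
      rw [this]; exact σ.rfl' _
    · exact σ.trans' (all1 p hp) (hi q hq (Or.inr ⟨e2, e3⟩))
  · have e2 : q.1 = 1 := le_antisymm hq.2.1 (by rw [e] at hpq; exact hpq.1)
    rcases hq.2.2.1.eq_or_lt with e3 | e3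
    · have : q = p := by rw [e]; ext <;> simp [e2, ← e3]
      rw [this]; exact σ.rfl' _
    · exact σ.trans' (all1 p hp) (hi q hq (Or.inl ⟨e2, e3⟩))

theorem Shuf.rlz (h : Shuf σ c0 c1 ts hl hr G F) (hk0 : σ.eqv k0 c0) (hk1 : σ.eqv k1 c1)
    (ht0 : σ.le c0 t) (ht1 : σ.le t c1) (ht0' : σ.le c0 t') (ht1' : σ.le t' c1) {β : Beh L ι}
    (e1 : β.lf = Tr.elem σ k0 c0 t) (e2 : β.bt = Tr.elem σ k0 c0 t')
    (e3 : β.tp = Tr.elem σ t c1 k1) (e4 : β.rt = Tr.elem σ t' c1 k1)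
    (nd : NdF σ c0 c1 G) (ndP : NdF σ.dual c1 c0 (fun n p => G n (refl2 p)))
    (rF : ∀ i, β.rF i → σ.WF c0 i ∨ σ.WF c1 i ∨ σ.wF t i ∨ σ.wF t' i ∨ VisH σ G i)
    (rP : ∀ i, β.rP i → σ.dual.WF c1 i ∨ σ.dual.WF c0 i ∨ σ.dual.wF t' i ∨ σ.dual.wF t i ∨ VisH σ.dual (fun n p => G n (refl2 p)) i) :
    Rlz σ β := by
  refine ⟨shF k0 t' t k1 c0 c1 (F 0), ⟨h.monoF hk0 hk1 ht0 ht1 ht0' ht1', h.fut nd hk0 hk1, ?_⟩, ?_, ?_, ?_, ?_, fun i hi => h.res (rF i hi), fun i hi => ?_⟩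
  · have := (h.refl.fut (k0 := k1) (k1 := k0) (t := t') (t' := t) ndP (Sys.eqv_dual.2 hk1) (Sys.eqv_dual.2 hk0)).comp refl2 refl2_le
    rw [refl2_bx, refl2_exU] at this
    exact this.congr fun q hq => shF_refl q hq
  · simp only [shF_l]; rw [e1, elF_tr zero_lt_one (σ.trans' hk0.1 (σ.rfl' _)) ht0]
  · simp only [shF_r]; rw [e4, elF_tr zero_lt_one ht1' hk1.2]
  · simp only [shF_b]; rw [e2, elF_tr zero_lt_one hk0.1 ht0']
  · simp only [shF_t]; rw [e3, elF_tr zero_lt_one ht1 hk1.2]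
  · obtain ⟨q, h1, h2⟩ := Wt_ex_comp refl2 refl2_le (h.refl.res (k0 := k1) (k1 := k0) (t := t') (t' := t) (rP i hi))
    rw [refl2_bx] at h1 h2
    refine ⟨q, h1, ?_⟩
    rcases h2 with h2 | ⟨h2, q', h3, h4, h5, h6⟩
    · exact Or.inl (by rw [← shF_refl q h1]; exact h2)
    · exact Or.inr ⟨by rw [← shF_refl q h1]; exact h2, q', h3, h4, h5, by rw [← shF_refl q h1, ← shF_refl q' h3]; exact h6⟩

end
end Temporal

namespace Temporal
section
variable {L ι : Type} {σ : Sys L ι} {c0 c1 ts : L}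

/-- an edge that stays in one cluster -/
def CE (σ : Sys L ι) (T : Tr L) (c : L) : Prop := ∃ p q, σ.eqv p c ∧ σ.eqv q c ∧ T = Tr.elem σ p c q

theorem CE.all {T : Tr L} {c : L} (h : CE σ T c) {g : ℝ → L} {a b : ℝ} (hab : a < b) (hg : MonoI σ g a b)
    (e : tr σ g a b = T) : ∀ x, a ≤ x → x ≤ b → σ.eqv (g x) c := by
  obtain ⟨p, q, h1, h2, rfl⟩ := h
  obtain ⟨k1, k2, k3⟩ := elem_inv hg hab h1.1 h2.2 e
  intro x hx hx'
  rcases hx.eq_or_lt with rfl | hx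
  · rw [k1]; exact h1
  rcases hx'.eq_or_lt with rfl | hx'
  · rw [k2]; exact h2
  · exact k3 x hx hx'

def TileD (σ : Sys L ι) (c0 c1 : L) (V E0 E1 : Beh L ι) : Prop :=
  CE σ E0.lf c0 ∧ CE σ E0.bt c0 ∧ CE σ V.bt c0 ∧ CE σ V.tp c1 ∧ CE σ E1.rt c1 ∧ CE σ E1.tp c1 ∧
  (∃ g a b, σ.le c0 g ∧ σ.le g c1 ∧ σ.eqv a c0 ∧ σ.eqv b c1 ∧ E0.tp = Tr.elem σ a c0 g ∧
    V.lf = Tr.conc E0.rt (Tr.elem σ g c1 b)) ∧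
  (∃ g a b, σ.le c0 g ∧ σ.le g c1 ∧ σ.eqv a c0 ∧ σ.eqv b c1 ∧ E1.bt = Tr.elem σ g c1 b ∧
    V.rt = Tr.conc (Tr.elem σ a c0 g) E1.lf)

structure TileOK (σ : Sys L ι) (c0 c1 : L) (V : Beh L ι) (hl hr : ℝ) (G : Pt → L) : Prop where
  hr0 : 0 < hr
  hr1 : hr ≤ 1 / 2
  hl0 : 1 / 2 ≤ hl
  hl1 : hl < 1
  mV : IsM σ G (1/3) (2/3) 0 1
  m0 : IsM σ G 0 (1/3) 0 hl
  m1 : IsM σ G (2/3) 1 hr 1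
  b0 : ∀ x, 0 ≤ x → x ≤ 1/3 → σ.eqv (G (x, 0)) c0
  l0 : ∀ y, 0 ≤ y → y ≤ hl → σ.eqv (G (0, y)) c0
  t0 : ∀ x, 0 ≤ x → x < 1/3 → σ.eqv (G (x, hl)) c0
  bV : ∀ x, 1/3 ≤ x → x ≤ 2/3 → σ.eqv (G (x, 0)) c0
  rV : ∀ y, 0 ≤ y → y < hr → σ.eqv (G (2/3, y)) c0
  tV : ∀ x, 1/3 ≤ x → x ≤ 2/3 → σ.eqv (G (x, 1)) c1
  lV : ∀ y, hl < y → y ≤ 1 → σ.eqv (G (1/3, y)) c1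
  t1 : ∀ x, 2/3 ≤ x → x ≤ 1 → σ.eqv (G (x, 1)) c1
  r1 : ∀ y, hr ≤ y → y ≤ 1 → σ.eqv (G (1, y)) c1
  b1 : ∀ x, 2/3 < x → x ≤ 1 → σ.eqv (G (x, hr)) c1
  rF : ∀ i, V.rF i → ∃ q ∈ bx (1/3) (2/3) 0 1, Wt σ (fun p q => p ≤ q) G (bx (1/3) (2/3) 0 1) q i
  rP : ∀ i, V.rP i → ∃ q ∈ bx (1/3) (2/3) 0 1, Wt σ.dual (fun p q => q ≤ p) G (bx (1/3) (2/3) 0 1) q i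

theorem tile_real {V E0 E1 : Beh L ι} (c01 : ¬ σ.le c1 c0) (hV : Rlz σ V) (h0 : Rlz σ E0) (h1 : Rlz σ E1)
    (hD : TileD σ c0 c1 V E0 E1) : ∃ hl hr G, TileOK σ c0 c1 V hl hr G := by
  obtain ⟨d1, d2, d3, d4, d5, d6, ⟨g, a, b, g0, g1, ha, hb, d7, d8⟩, ⟨g', a', b', g0', g1', ha', hb', d9, d10⟩⟩ := hD
  obtain ⟨f0, m0⟩ := h0.box (a := 0) (b := 1/3) (c := 0) (d := 1/2) (by norm_num) (by norm_num)
  obtain ⟨f1, m1⟩ := h1.box (a := 2/3) (b := 1) (c := 1/2) (d := 1) (by norm_num) (by norm_num)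
  obtain ⟨fV, mV⟩ := hV.box (a := 1/3) (b := 2/3) (c := 0) (d := 1) (by norm_num) (by norm_num)
  have e0 := elem_inv (m0.1.monoH (y := 1/2) (by norm_num) le_rfl) (by norm_num) ha.1 g0 (m0.2.tp.trans d7)
  have e1 := elem_inv (m1.1.monoH (y := 1/2) le_rfl (by norm_num)) (by norm_num) g1' hb'.2 (m1.2.bt.trans d9)
  -- left edge of V
  have ge : (fun y => f0 (1/3, y)) (1/2) = elF g c1 b (1/2) 1 (1/2) := by rw [elF_left]; exact e0.2.1
  have gm1 : MonoI σ (fun y => f0 (1/3, y)) 0 (1/2) := m0.1.monoV (by norm_num) le_rfl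
  have gm2 : MonoI σ (elF g c1 b (1/2) 1) (1/2) 1 := elF_mono g1 hb.2
  obtain ⟨fV', mV', vl, -⟩ := mV.prescribeV (by norm_num) (by norm_num) (Or.inl rfl) (glue_mono ge gm1 gm2) (by
    rw [glue_tr ge gm1 gm2 (by norm_num) (by norm_num), mV.2.lf, m0.2.rt, elF_tr (by norm_num) g1 hb.2]; exact d8)
  -- right edge of V
  have ke : elF a' c0 g' 0 (1/2) (1/2) = (fun y => f1 (2/3, y)) (1/2) := by rw [elF_right (by norm_num)]; exact e1.1.symm
  have km1 : MonoI σ (elF a' c0 g' 0 (1/2)) 0 (1/2) := elF_mono ha'.1 g0'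
  have km2 : MonoI σ (fun y => f1 (2/3, y)) (1/2) 1 := m1.1.monoV le_rfl (by norm_num)
  obtain ⟨θ, θ0, θ1, hθ⟩ := reparam zero_lt_one zero_lt_one (mV'.1.monoV (x := 2/3) (by norm_num) le_rfl) (glue_mono ke km1 km2) (by
    rw [glue_tr ke km1 km2 (by norm_num) (by norm_num), mV'.2.rt, m1.2.lf, elF_tr (by norm_num) ha'.1 g0']; exact d10)
  obtain ⟨fW, mW, wr, wn⟩ := mV'.overrideV (x0 := 2/3) (g := fun y => glue (1/2) (elF a' c0 g' 0 (1/2)) (fun y => f1 (2/3, y)) (θ y))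
    (by norm_num) (by norm_num) (Or.inr rfl) hθ
  have wl : ∀ y, fW (1/3, y) = glue (1/2) (fun y => f0 (1/3, y)) (elF g c1 b (1/2) 1) y := fun y => by
    rw [wn (1/3) y (Or.inl (by norm_num)), vl]
  obtain ⟨hr, ehr⟩ : ∃ hr, θ hr = 1/2 := ⟨θ.symm (1/2), by simp⟩
  have hr0 : 0 < hr := by rw [← θ.lt_iff_lt, θ0, ehr]; norm_num
  have rlo : ∀ y, 0 ≤ y → y < hr → σ.eqv (fW (2/3, y)) c0 := by
    intro y h1 h2
    rw [← θ.lt_iff_lt, ehr] at h2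
    rw [← θ.le_iff_le, θ0] at h1
    rw [wr, glue_left h2.le]
    rcases h1.eq_or_lt with e | e
    · rw [← e, elF_left]; exact ha'
    · rw [elF_mid e h2]; exact Sys.eqv.refl _
  have lhi : ∀ y, 1/2 < y → y ≤ 1 → σ.eqv (fW (1/3, y)) c1 := by
    intro y h1 h2
    rw [wl, glue_right ge h1.le]
    rcases h2.eq_or_lt with e | e
    · rw [e, elF_right (by norm_num)]; exact hb
    · rw [elF_mid h1 e]; exact Sys.eqv.refl _
  have hr1' : hr < 1 := by rw [← θ.lt_iff_lt, θ1, ehr]; norm_num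
  have hr1 : hr ≤ 1/2 := by
    by_contra hh
    obtain ⟨y, y1, y2⟩ := exists_between (not_le.1 hh)
    exact c01 (σ.trans' (lhi y y1 (by linarith)).2 (σ.trans' (mW.1.mono (1/3, y) ⟨le_rfl, by norm_num, by simp only; linarith, by simp only; linarith⟩ (2/3, y)
      ⟨by norm_num, le_rfl, by simp only; linarith, by simp only; linarith⟩ ⟨by norm_num, le_rfl⟩) (rlo y (by linarith) y2).1))
  have m1' : MB σ (fun p => f1 (p.1, θ p.2)) (2/3) 1 hr 1 E1 := by
    have := MB.comp (f := f1) (OrderIso.refl ℝ) θ (a := 2/3) (b := 1) (c := hr) (d := 1) (β := E1) (by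
      rw [ehr, θ1]; exact m1)
    exact this
  let G : Pt → L := fun p => if p.1 < 1/3 then f0 p else if p.1 ≤ 2/3 then fW p else f1 (p.1, θ p.2)
  have n0 : MB σ G 0 (1/3) 0 (1/2) E0 := m0.congr (by norm_num) (by norm_num) (fun p hp => by
    rcases hp.2.1.lt_or_eq with e | e
    · simp only [G, if_pos e]
    · obtain ⟨x, y⟩ := p
      simp only at e; subst e
      simp only [G]; rw [if_neg (lt_irrefl _), if_pos (by norm_num), wl, glue_left hp.2.2.2])
  have nV : MB σ G (1/3) (2/3) 0 1 V := mW.congr (by norm_num) (by norm_num) (fun p hp => by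
    simp only [G]; rw [if_neg (not_lt.2 hp.1), if_pos hp.2.1])
  have n1 : MB σ G (2/3) 1 hr 1 E1 := m1'.congr (by norm_num) hr1'.le (fun p hp => by
    have := hp.1
    simp only [G]; rw [if_neg (by linarith)]
    rcases hp.1.lt_or_eq with e | e
    · rw [if_neg (not_le.2 e)]
    · obtain ⟨x, y⟩ := p
      simp only at e; subst e
      have : 1/2 ≤ θ y := by rw [← ehr]; exact θ.monotone hp.2.2.1
      simp only; rw [if_pos le_rfl, wr, glue_right ke this])
  refine ⟨1/2, hr, G, hr0, hr1, le_rfl, by norm_num, nV.1, n0.1, n1.1, ?_, ?_, ?_, ?_, ?_, ?_, ?_, ?_, ?_, ?_, nV.2.rF, nV.2.rP⟩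
  · exact d2.all (by norm_num) (n0.1.monoH le_rfl (by norm_num)) n0.2.bt
  · exact d1.all (by norm_num) (n0.1.monoV le_rfl (by norm_num)) n0.2.lf
  · intro x x0 x1
    simp only [G]; rw [if_pos x1]
    rcases x0.eq_or_lt with e | e
    · rw [← e, e0.1]; exact ha
    · exact e0.2.2 x e x1
  · exact d3.all (by norm_num) (nV.1.monoH le_rfl (by norm_num)) nV.2.bt
  · intro y y0 y1
    simp only [G]; rw [if_neg (by norm_num), if_pos le_rfl]; exact rlo y y0 y1
  · exact d4.all (by norm_num) (nV.1.monoH (by norm_num) le_rfl) nV.2.tp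
  · intro y y0 y1
    simp only [G]; rw [if_neg (by norm_num), if_pos (by norm_num)]; exact lhi y y0 y1
  · exact d6.all (by norm_num) (n1.1.monoH hr1'.le le_rfl) n1.2.tp
  · exact d5.all hr1' (n1.1.monoV (by norm_num) le_rfl) n1.2.rt
  · intro x x0 x1
    simp only [G]; rw [if_neg (by linarith), if_neg (not_le.2 x0), ehr]
    rcases x1.eq_or_lt with e | e
    · rw [e, e1.2.1]; exact hb'
    · exact e1.2.2 x x0 e

inductive RelV {P : Type} (step : P → Option P) (r : P → L) : P → L → Prop
  | base {p} : step p = none → RelV step r p (r p)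
  | step {p p' l} : step p = some p' → RelV step r p' l → RelV step r p l

theorem exists_unfold {P : Type} (step : P → Option P) (r : P → L) (d : L) :
    ∃ F : P → L, (∀ p, step p = none → F p = r p) ∧ (∀ p p', step p = some p' → F p = F p') ∧
      ∀ Q : P → Prop, (∀ p, step p = none → Q p) → (∀ p p', step p = some p' → Q p' → Q p) → ∀ p, Q p ∨ F p = d := by
  classical
  refine ⟨fun p => if h : ∃ l, RelV step r p l then h.choose else d, fun p hp => ?_, fun p p' hp => ?_, fun Q h1 h2 p => ?_⟩
  · have h : ∃ l, RelV step r p l := ⟨_, RelV.base hp⟩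
    simp only; rw [dif_pos h]
    generalize hl : h.choose = l
    have := h.choose_spec
    rw [hl] at this
    cases this with
    | base _ => rfl
    | step h' _ => rw [hp] at h'; cases h'
  · have : RelV step r p = RelV step r p' := by
      funext l
      apply propext
      constructor
      · intro h
        cases h with
        | base h' => rw [hp] at h'; cases h'
        | step h' h'' => rw [hp] at h'; cases h'; exact h''
      · exact RelV.step hp
    simp only [this]
  · by_cases h : ∃ l, RelV step r p l
    · left
      obtain ⟨l, hl⟩ := h
      induction hl with
      | base h => exact h1 _ h
      | step h _ ih => exact h2 _ _ h ih
    · right; simp only; rw [dif_neg h]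

open Classical in
theorem shuf_of_tiles {Vs : ℕ → Beh L ι} {hl hr : ℕ → ℝ} {G : ℕ → Pt → L} (c01 : σ.le c0 c1) (ts0 : σ.le c0 ts) (ts1 : σ.le ts c1)
    (okF : ∀ i, σ.A ts i → σ.wF ts i ∨ σ.A c1 i) (okP : ∀ i, σ.B ts i → σ.wP ts i ∨ σ.B c0 i)
    (h : ∀ n, TileOK σ c0 c1 (Vs n) (hl n) (hr n) (G n)) : ∃ F, Shuf σ c0 c1 ts hl hr G F := by
  let step : ℕ × Pt → Option (ℕ × Pt) := fun z =>
    if z.2.1 < 1/3 ∧ hl z.1 < z.2.2 then some (z.1 + 1, (3 * z.2.1, (z.2.2 - hl z.1) / (1 - hl z.1)))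
    else if 2/3 < z.2.1 ∧ z.2.2 < hr z.1 then some (z.1 + 1, (3 * z.2.1 - 2, z.2.2 / hr z.1)) else none
  have sU : ∀ n p, p.1 < 1/3 → hl n < p.2 → step (n, p) = some (n + 1, (3 * p.1, (p.2 - hl n) / (1 - hl n))) :=
    fun n p h1 h2 => if_pos ⟨h1, h2⟩
  have sL : ∀ n (p : Pt), 2/3 < p.1 → p.2 < hr n → step (n, p) = some (n + 1, (3 * p.1 - 2, p.2 / hr n)) := fun n p h1 h2 => by
    have : ¬ (p.1 < 1/3 ∧ hl n < p.2) := fun h => by linarith [h.1]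
    simp only [step]; rw [if_neg this, if_pos ⟨h1, h2⟩]
  have sN : ∀ n (p : Pt), ¬ (p.1 < 1/3 ∧ hl n < p.2) → ¬ (2/3 < p.1 ∧ p.2 < hr n) → step (n, p) = none := fun n p h1 h2 => by
    simp only [step]; rw [if_neg h1, if_neg h2]
  obtain ⟨F, hF1, hF2, hF3⟩ := exists_unfold step (fun z => G z.1 z.2) ts
  refine ⟨fun n p => F (n, p), ?_⟩
  exact
  { c01 := c01, ts0 := ts0, ts1 := ts1, okF := okF, okP := okP
    hr0 := fun n => (h n).hr0, hr1 := fun n => (h n).hr1, hl0 := fun n => (h n).hl0, hl1 := fun n => (h n).hl1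
    mV := fun n => (h n).mV, m0 := fun n => (h n).m0, m1 := fun n => (h n).m1
    b0 := fun n => (h n).b0, l0 := fun n => (h n).l0, t0 := fun n => (h n).t0, bV := fun n => (h n).bV, rV := fun n => (h n).rV
    tV := fun n => (h n).tV, lV := fun n => (h n).lV, t1 := fun n => (h n).t1, r1 := fun n => (h n).r1, b1 := fun n => (h n).b1
    FN := fun n p hp h1 h2 => hF1 _ (sN n p h1 h2)
    FU := fun n p hp h1 h2 => hF2 _ _ (sU n p h1 h2)
    FL := fun n p hp h1 h2 => hF2 _ _ (sL n p h1 h2)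
    ind := by
      intro Q q1 q2 q3 n p hp
      refine (hF3 (fun z => z.2 ∈ ob → Q z.1 z.2) ?_ ?_ (n, p)).imp (fun h => h hp) id
      · rintro ⟨n, p⟩ hs hp
        refine q1 n p hp (fun hh => ?_) (fun hh => ?_)
        · rw [sU n p hh.1 hh.2] at hs; cases hs
        · rw [sL n p hh.1 hh.2] at hs; cases hs
      · rintro ⟨n, p⟩ z hs hQ hp
        by_cases k1 : p.1 < 1/3 ∧ hl n < p.2
        · rw [sU n p k1.1 k1.2] at hs
          cases hs
          exact q2 n p hp k1.1 k1.2 (hQ (mapU_ob (h n).hl1 hp k1.1 k1.2))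
        by_cases k2 : 2/3 < p.1 ∧ p.2 < hr n
        · rw [sL n p k2.1 k2.2] at hs
          cases hs
          exact q3 n p hp k2.1 k2.2 (hQ (mapL_ob (h n).hr0 hp k2.1 k2.2))
        · rw [sN n p k1 k2] at hs; cases hs }

/-- the shuffle rule -/
def NeedF (σ : Sys L ι) (c0 c1 t t' : L) (rF : ι → Prop) (i : ι) : Prop :=
  (σ.A c0 i ∧ ¬ σ.WF c0 i ∧ ¬ σ.A c1 i) ∨ (rF i ∧ ¬ (σ.WF c0 i ∨ σ.WF c1 i ∨ σ.wF t i ∨ σ.wF t' i))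

def ShufRule (σ : Sys L ι) (S : Beh L ι → Prop) (c0 c1 ts t t' k0 k1 : L) (β : Beh L ι) : Prop :=
  (σ.le c0 ts ∧ σ.le ts c1 ∧ σ.le c0 t ∧ σ.le t c1 ∧ σ.le c0 t' ∧ σ.le t' c1 ∧ ¬ σ.le c1 c0 ∧ σ.eqv k0 c0 ∧ σ.eqv k1 c1) ∧
  (∀ i, σ.A ts i → σ.wF ts i ∨ σ.A c1 i) ∧ (∀ i, σ.B ts i → σ.wP ts i ∨ σ.B c0 i) ∧
  (β.lf = Tr.elem σ k0 c0 t ∧ β.bt = Tr.elem σ k0 c0 t' ∧ β.tp = Tr.elem σ t c1 k1 ∧ β.rt = Tr.elem σ t' c1 k1) ∧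
  (∃ V E0 E1, S V ∧ S E0 ∧ S E1 ∧ TileD σ c0 c1 V E0 E1) ∧
  (∀ i, NeedF σ c0 c1 t t' β.rF i → ∃ V E0 E1, S V ∧ S E0 ∧ S E1 ∧ TileD σ c0 c1 V E0 E1 ∧ V.rF i) ∧
  (∀ i, NeedF σ.dual c1 c0 t t' β.rP i → ∃ V E0 E1, S V ∧ S E0 ∧ S E1 ∧ TileD σ c0 c1 V E0 E1 ∧ V.rP i)

theorem Rlz.shuf [Encodable ι] {t t' k0 k1 : L} {β : Beh L ι} (h : ShufRule σ (Rlz σ) c0 c1 ts t t' k0 k1 β) : Rlz σ β := by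
  classical
  obtain ⟨⟨h1, h2, h3, h4, h5, h6, h7, h8, h9⟩, okF, okP, ⟨e1, e2, e3, e4⟩, hex, hF, hP⟩ := h
  have key : ∀ n : ℕ, ∃ V hl hr G, TileOK σ c0 c1 V hl hr G ∧
      (∀ i : ι, (Encodable.decode n.unpair.1 : Option (ι ⊕ ι)) = some (Sum.inl i) → NeedF σ c0 c1 t t' β.rF i → V.rF i) ∧
      (∀ i : ι, (Encodable.decode n.unpair.1 : Option (ι ⊕ ι)) = some (Sum.inr i) → NeedF σ.dual c1 c0 t t' β.rP i → V.rP i) := by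
    intro n
    have : ∃ V E0 E1, (Rlz σ V ∧ Rlz σ E0 ∧ Rlz σ E1 ∧ TileD σ c0 c1 V E0 E1) ∧
      (∀ i : ι, (Encodable.decode n.unpair.1 : Option (ι ⊕ ι)) = some (Sum.inl i) → NeedF σ c0 c1 t t' β.rF i → V.rF i) ∧
      (∀ i : ι, (Encodable.decode n.unpair.1 : Option (ι ⊕ ι)) = some (Sum.inr i) → NeedF σ.dual c1 c0 t t' β.rP i → V.rP i) := by
      obtain ⟨V, E0, E1, hd⟩ := hex
      generalize (Encodable.decode n.unpair.1 : Option (ι ⊕ ι)) = o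
      rcases o with _ | (i | i)
      · exact ⟨V, E0, E1, hd, by simp, by simp⟩
      · by_cases hi : NeedF σ c0 c1 t t' β.rF i
        · obtain ⟨V, E0, E1, k1, k2, k3, k4, k5⟩ := hF i hi
          exact ⟨V, E0, E1, ⟨k1, k2, k3, k4⟩, by rintro j hj -; cases hj; exact k5, by simp⟩
        · exact ⟨V, E0, E1, hd, by rintro j hj hj'; cases hj; exact absurd hj' hi, by simp⟩
      · by_cases hi : NeedF σ.dual c1 c0 t t' β.rP i
        · obtain ⟨V, E0, E1, k1, k2, k3, k4, k5⟩ := hP i hi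
          exact ⟨V, E0, E1, ⟨k1, k2, k3, k4⟩, by simp, by rintro j hj -; cases hj; exact k5⟩
        · exact ⟨V, E0, E1, hd, by simp, by rintro j hj hj'; cases hj; exact absurd hj' hi⟩
    obtain ⟨V, E0, E1, ⟨k1, k2, k3, k4⟩, k5, k6⟩ := this
    obtain ⟨hl, hr, G, hT⟩ := tile_real h7 k1 k2 k3 k4
    exact ⟨V, hl, hr, G, hT, k5, k6⟩
  choose Vs hl hr G hT hTF hTP using key
  obtain ⟨F, hS⟩ := shuf_of_tiles (ts := ts) (σ.trans' h1 h2) h1 h2 okF okP hT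
  have vF : ∀ i, NeedF σ c0 c1 t t' β.rF i → VisH σ G i := by
    intro i hi N
    refine ⟨Nat.pair (Encodable.encode (Sum.inl i : ι ⊕ ι)) N, Nat.right_le_pair _ _, (hT _).rF i (hTF _ i ?_ hi)⟩
    rw [Nat.unpair_pair]; exact Encodable.encodek _
  have vP : ∀ i, NeedF σ.dual c1 c0 t t' β.rP i → VisH σ.dual (fun n p => G n (refl2 p)) i := by
    intro i hi N
    have := (hT (Nat.pair (Encodable.encode (Sum.inr i : ι ⊕ ι)) N)).rP i (hTP _ i (by rw [Nat.unpair_pair]; exact Encodable.encodek _) hi)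
    refine ⟨_, Nat.right_le_pair (Encodable.encode (Sum.inr i : ι ⊕ ι)) N, ?_⟩
    have e : refl2 ⁻¹' bx (1/3) (2/3) 0 1 = bx (1/3) (2/3) 0 1 := by
      ext p; simp only [bx, Set.mem_preimage, Set.mem_ofPred_eq, refl2_apply]
      constructor <;> rintro ⟨h1, h2, h3, h4⟩ <;> refine ⟨?_, ?_, ?_, ?_⟩ <;> linarith
    have := Wt_ex_comp (r' := fun p q => p ≤ q) refl2 (fun p q => refl2_le q p) this
    rw [e] at this
    exact this
  refine hS.rlz h8 h9 h3 h4 h5 h6 e1 e2 e3 e4 (fun i a b c => vF i (Or.inl ⟨a, b, c⟩)) (fun i a b c => vP i (Or.inl ⟨a, b, c⟩))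
    (fun i hi => ?_) (fun i hi => ?_)
  · by_cases hh : σ.WF c0 i ∨ σ.WF c1 i ∨ σ.wF t i ∨ σ.wF t' i
    · tauto
    · have := vF i (Or.inr ⟨hi, hh⟩); tauto
  · by_cases hh : σ.dual.WF c1 i ∨ σ.dual.WF c0 i ∨ σ.dual.wF t i ∨ σ.dual.wF t' i
    · tauto
    · have := vP i (Or.inr ⟨hi, hh⟩); tauto

end
end Temporal

namespace Temporal

/-! ### Closed families of behaviours and strict models -/
section
variable {L ι : Type} {σ : Sys L ι}

structure Closed (σ : Sys L ι) (S : Beh L ι → Prop) : Prop where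
  swap : ∀ β, S β → S β.swap
  join : ∀ β β1 β2, S β1 → S β2 → β1.rt = β2.lf → β.lf = β1.lf → β.rt = β2.rt →
    β.bt = β1.bt.conc β2.bt → β.tp = β1.tp.conc β2.tp → (∀ i, β.rF i → β1.rF i ∨ β2.rF i) →
    (∀ i, β.rP i → β1.rP i ∨ β2.rP i) → S β
  base : ∀ ll lr ul ur l r b t c β, BaseRule σ ll lr ul ur l r b t c β → S β
  lim : ∀ α β γ q c c' z e e' p p' p2 p3 p4 p5, LimRule σ α β γ q c c' z e e' p p' p2 p3 p4 p5 →
    S α → S β → S γ → S q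
  shuf : ∀ c0 c1 ts t t' k0 k1 β, ShufRule σ S c0 c1 ts t t' k0 k1 β → S β

theorem closed_rlz [Encodable ι] : Closed σ (Rlz σ) where
  swap := fun β h => h.swap
  join := fun β β1 β2 h1 h2 h3 h4 h5 h6 h7 h8 h9 => Rlz.join h1 h2 h3 h4 h5 h6 h7 h8 h9
  base := fun ll lr ul ur l r b t c β h => Rlz.base h
  lim := fun α β γ q c c' z e e' p p' p2 p3 p4 p5 h h1 h2 h3 => Rlz.lim h h1 h2 h3
  shuf := fun c0 c1 ts t t' k0 k1 β h => Rlz.shuf h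

def FutS (σ : Sys L ι) (f : Pt → L) : Prop :=
  ∀ p i b d, σ.A (f p) i → p.1 ≤ b → p.2 ≤ d → ∃ q, p.1 ≤ q.1 ∧ p.2 ≤ q.2 ∧ q.1 ≤ b ∧ q.2 ≤ d ∧
    (σ.wF (f q) i ∨ ((q.1 = b ∨ q.2 = d) ∧ σ.A (f q) i))

structure HM (σ : Sys L ι) (f : Pt → L) : Prop where
  mono : ∀ p q : Pt, p.1 ≤ q.1 → p.2 ≤ q.2 → σ.le (f p) (f q)
  fut : FutS σ f
  past : FutS σ.dual (fun p => f (-p.1, -p.2))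

theorem HM.refl {f : Pt → L} (h : HM σ f) : HM σ.dual (fun p => f (-p.1, -p.2)) where
  mono := fun p q h1 h2 => h.mono _ _ (by simpa using h1) (by simpa using h2)
  fut := h.past
  past := by
    have := h.fut
    simpa [Sys.dual_dual] using this

theorem FutS.swap {f : Pt → L} (h : FutS σ f) : FutS σ (fun p => f p.swap) := by
  intro p i b d hA h1 h2
  obtain ⟨q, k1, k2, k3, k4, k5⟩ := h p.swap i d b hA h2 h1
  refine ⟨q.swap, k2, k1, k4, k3, ?_⟩
  rcases k5 with k | ⟨k, k'⟩
  · exact Or.inl (by simpa using k)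
  · exact Or.inr ⟨k.symm, by simpa using k'⟩

theorem HM.swap {f : Pt → L} (h : HM σ f) : HM σ (fun p => f p.swap) where
  mono := fun p q h1 h2 => h.mono _ _ h2 h1
  fut := h.fut.swap
  past := h.past.swap

theorem HM.dem {f : Pt → L} (h : HM σ f) {p : Pt} {i : ι} {b d : ℝ} (hA : σ.A (f p) i) (h1 : p.1 ≤ b)
    (h2 : p.2 ≤ d) : ∃ q : Pt, p.1 ≤ q.1 ∧ p.2 ≤ q.2 ∧ q.1 ≤ b ∧ q.2 ≤ d ∧ σ.A (f q) i ∧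
    (σ.wF (f q) i ∨ q.1 = b ∨ q.2 = d) := by
  obtain ⟨q, k1, k2, k3, k4, k5⟩ := h.fut p i b d hA h1 h2
  refine ⟨q, k1, k2, k3, k4, ?_⟩
  rcases k5 with k | k
  · exact ⟨σ.axF (h.mono _ _ k1 k2) (σ.rfl' _) hA (Or.inr k), Or.inl k⟩
  · exact ⟨k.2, Or.inr k.1⟩

theorem HM.mid {f : Pt → L} (h : HM σ f) {p m q : Pt} {i : ι} (hA : σ.A (f p) i) (hA' : σ.A (f q) i)
    (h1 : p.1 ≤ m.1) (h2 : p.2 ≤ m.2) (h3 : m.1 ≤ q.1) (h4 : m.2 ≤ q.2) : σ.A (f m) i :=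
  σ.axF (h.mono _ _ h1 h2) (h.mono _ _ h3 h4) hA (Or.inl hA')

theorem HM.between {f : Pt → L} (h : HM σ f) {p m q : Pt} {l : L} (hp : σ.eqv (f p) l) (hq : σ.eqv (f q) l)
    (h1 : p.1 ≤ m.1) (h2 : p.2 ≤ m.2) (h3 : m.1 ≤ q.1) (h4 : m.2 ≤ q.2) : σ.eqv (f m) l :=
  Sys.eqv_mid (h.mono _ _ h1 h2) (h.mono _ _ h3 h4) hp hq

def behS (σ : Sys L ι) (f : Pt → L) (a b c d : ℝ) : Beh L ι where
  lf := tr σ (fun y => f (a, y)) c d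
  rt := tr σ (fun y => f (b, y)) c d
  bt := tr σ (fun x => f (x, c)) a b
  tp := tr σ (fun x => f (x, d)) a b
  rF i := ∃ q ∈ bx a b c d, σ.wF (f q) i
  rP i := ∃ q ∈ bx a b c d, σ.wP (f q) i

def Gd (S : Beh L ι → Prop) (σ : Sys L ι) (f : Pt → L) (a b c d : ℝ) : Prop :=
  a < b → c < d → S (behS σ f a b c d)

theorem behS_swap (f : Pt → L) (a b c d : ℝ) :
    behS σ (fun p => f p.swap) c d a b = (behS σ f a b c d).swap := by
  have key : ∀ P : Pt → Prop, (∃ q ∈ bx c d a b, P q.swap) ↔ ∃ q ∈ bx a b c d, P q := by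
    intro P
    constructor
    · rintro ⟨q, ⟨h1, h2, h3, h4⟩, h⟩; exact ⟨q.swap, ⟨h3, h4, h1, h2⟩, h⟩
    · rintro ⟨q, ⟨h1, h2, h3, h4⟩, h⟩; exact ⟨q.swap, ⟨h3, h4, h1, h2⟩, by simpa using h⟩
  unfold behS Beh.swap
  congr 1
  · funext i; exact propext (key fun q => σ.wF (f q) i)
  · funext i; exact propext (key fun q => σ.wP (f q) i)

variable {S : Beh L ι → Prop}

theorem Closed.gd_swap (hS : Closed σ S) {f : Pt → L} {a b c d : ℝ} (h : Gd S σ f a b c d) :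
    Gd S σ (fun p => f p.swap) c d a b := by
  intro h1 h2
  rw [behS_swap]
  exact hS.swap _ (h h2 h1)

theorem Closed.gd_swap' (hS : Closed σ S) {f : Pt → L} {a b c d : ℝ}
    (h : Gd S σ (fun p => f p.swap) c d a b) : Gd S σ f a b c d := by
  have := hS.gd_swap h
  simpa using this

theorem HM.monoV {f : Pt → L} (h : HM σ f) (x a b : ℝ) : MonoI σ (fun y => f (x, y)) a b :=
  fun y y' _ h1 _ => h.mono _ _ le_rfl h1
theorem HM.monoH {f : Pt → L} (h : HM σ f) (y a b : ℝ) : MonoI σ (fun x => f (x, y)) a b :=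
  fun x x' _ h1 _ => h.mono _ _ h1 le_rfl

theorem Closed.cutV (hS : Closed σ S) {f : Pt → L} (hf : HM σ f) {a m b c d : ℝ} (h1 : a ≤ m) (h2 : m ≤ b)
    (h : Gd S σ f a m c d) (h' : Gd S σ f m b c d) : Gd S σ f a b c d := by
  intro hab hcd
  rcases h1.eq_or_lt with rfl | h1
  · exact h' hab hcd
  rcases h2.eq_or_lt with rfl | h2
  · exact h hab hcd
  refine hS.join _ _ _ (h h1 hcd) (h' h2 hcd) rfl rfl rfl ?_ ?_ ?_ ?_
  · exact tr_conc (hf.monoH c a b) h1.le h2.le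
  · exact tr_conc (hf.monoH d a b) h1.le h2.le
  all_goals
    rintro i ⟨q, ⟨k1, k2, k3, k4⟩, hq⟩
    rcases le_total q.1 m with h | h
    · exact Or.inl ⟨q, ⟨k1, h, k3, k4⟩, hq⟩
    · exact Or.inr ⟨q, ⟨h, k2, k3, k4⟩, hq⟩

theorem Closed.cutH (hS : Closed σ S) {f : Pt → L} (hf : HM σ f) {a b c m d : ℝ} (h1 : c ≤ m) (h2 : m ≤ d)
    (h : Gd S σ f a b c m) (h' : Gd S σ f a b m d) : Gd S σ f a b c d :=
  hS.gd_swap' (hS.cutV hf.swap h1 h2 (hS.gd_swap h) (hS.gd_swap h'))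

theorem Closed.cut4 (hS : Closed σ S) {f : Pt → L} (hf : HM σ f) {a b c d x y : ℝ} (h1 : a ≤ x) (h2 : x ≤ b)
    (h3 : c ≤ y) (h4 : y ≤ d) (ha : Gd S σ f a x c y) (hb : Gd S σ f x b c y) (hc : Gd S σ f a x y d)
    (hd : Gd S σ f x b y d) : Gd S σ f a b c d :=
  hS.cutH hf h3 h4 (hS.cutV hf h1 h2 ha hb) (hS.cutV hf h1 h2 hc hd)

/-! ### local principle -/
theorem bis1 {P : ℝ → ℝ → Prop} (cut : ∀ a m b, a ≤ m → m ≤ b → P a m → P m b → P a b) {a b : ℝ}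
    (hab : a ≤ b) (loc : ∀ x, a ≤ x → x ≤ b → ∃ ε > 0, ∀ a' b', a ≤ a' → a' ≤ x → x ≤ b' → b' ≤ b →
      x - ε < a' → b' < x + ε → P a' b') : P a b := by
  set s : Set ℝ := {x | a ≤ x ∧ x ≤ b ∧ P a x} with hs
  have ha : a ∈ s := by
    obtain ⟨ε, h1, h2⟩ := loc a le_rfl hab
    exact ⟨le_rfl, hab, h2 a a le_rfl le_rfl le_rfl hab (by linarith) (by linarith)⟩
  have hbd : BddAbove s := ⟨b, fun x hx => hx.2.1⟩
  set x := sSup s with hx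
  have h1 : a ≤ x := le_csSup hbd ha
  have h2 : x ≤ b := csSup_le ⟨a, ha⟩ fun y hy => hy.2.1
  obtain ⟨ε, h3, h4⟩ := loc x h1 h2
  obtain ⟨y, hy, hy'⟩ := exists_lt_of_lt_csSup ⟨a, ha⟩ (show x - ε < x by linarith)
  have hyx : y ≤ x := le_csSup hbd hy
  have h5 : ∀ x', x ≤ x' → x' ≤ b → x' < x + ε → P a x' := fun x' k1 k2 k3 =>
    cut a y x' hy.1 (hyx.trans k1) hy.2.2 (h4 y x' hy.1 hyx k1 k2 hy' k3)
  rcases h2.eq_or_lt with h6 | h6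
  · exact h6 ▸ h5 x le_rfl h2 (by linarith)
  · have h7 : min b (x + ε / 2) ∈ s := by
      refine ⟨le_min hab (by linarith), min_le_left _ _, h5 _ (le_min h6.le (by linarith)) (min_le_left _ _) ?_⟩
      exact (min_le_right _ _).trans_lt (by linarith)
    have h8 : min b (x + ε / 2) ≤ x := le_csSup hbd h7
    rcases min_le_iff.1 h8 with h | h <;> linarith

/-- C1 -/
theorem Closed.localP (hS : Closed σ S) {f : Pt → L} (hf : HM σ f) {a b c d : ℝ} (hab : a ≤ b) (hcd : c ≤ d)
    (loc : ∀ x y, a ≤ x → x ≤ b → c ≤ y → y ≤ d → ∃ ε > 0, ∀ a' b' c' d', a ≤ a' → a' ≤ x → x ≤ b' → b' ≤ b →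
      c ≤ c' → c' ≤ y → y ≤ d' → d' ≤ d → x - ε < a' → b' < x + ε → y - ε < c' → d' < y + ε →
      Gd S σ f a' b' c' d') : Gd S σ f a b c d := by
  refine bis1 (P := fun a b => Gd S σ f a b c d) (fun _ _ _ h1 h2 => hS.cutV hf h1 h2) hab fun x h1 h2 => ?_
  refine bis1 (P := fun c d => ∃ ε > 0, ∀ a' b', a ≤ a' → a' ≤ x → x ≤ b' → b' ≤ b →
      x - ε < a' → b' < x + ε → Gd S σ f a' b' c d) ?_ hcd fun y h3 h4 => ?_
  · rintro c m d h3 h4 ⟨ε, h5, h6⟩ ⟨ε', h7, h8⟩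
    refine ⟨min ε ε', lt_min h5 h7, fun a' b' k1 k2 k3 k4 k5 k6 => ?_⟩
    have := min_le_left ε ε'
    have := min_le_right ε ε'
    exact hS.cutH hf h3 h4 (h6 a' b' k1 k2 k3 k4 (by linarith) (by linarith))
      (h8 a' b' k1 k2 k3 k4 (by linarith) (by linarith))
  · obtain ⟨ε, h5, h6⟩ := loc x y h1 h2 h3 h4
    exact ⟨ε, h5, fun c' d' k1 k2 k3 k4 k5 k6 => ⟨ε, h5, fun a' b' k7 k8 k9 k10 k11 k12 =>
      h6 a' b' c' d' k7 k8 k9 k10 k1 k2 k3 k4 k11 k12 k5 k6⟩⟩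

/-! ### one-sided constancy -/
theorem evR [Finite L] {g : ℝ → L} (hg : ∀ x y, x ≤ y → σ.le (g x) (g y)) (z : ℝ) :
    ∃ ε > 0, ∃ l, ∀ y, z < y → y < z + ε → σ.eqv (g y) l := by
  have h : ∀ᶠ y in nhdsWithin z (Set.Ioi z), ∀ m : L, (∀ y' > z, σ.le m (g y')) ∨ ¬ σ.le m (g y) := by
    rw [Filter.eventually_all]
    intro m
    by_cases h : ∀ y' > z, σ.le m (g y')
    · exact Filter.Eventually.of_forall fun _ => Or.inl h
    · push Not at h
      obtain ⟨y', h1, h2⟩ := h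
      filter_upwards [Ioo_mem_nhdsGT h1] with y hy
      exact Or.inr fun h3 => h2 (σ.trans' h3 (hg _ _ hy.2.le))
  obtain ⟨u, hu, hu'⟩ := (mem_nhdsGT_iff_exists_Ioo_subset).1 h
  have hu : z < u := hu
  refine ⟨u - z, by linarith, g ((z + u) / 2), fun y h1 h2 => ?_⟩
  have key : ∀ y y', z < y → y < u → z < y' → y' < u → σ.le (g y) (g y') := fun y y' k1 k2 k3 k4 =>
    (hu' ⟨k1, k2⟩ (g y)).elim (fun h => h y' k3) (fun h => absurd (σ.rfl' _) h)
  exact ⟨key _ _ h1 (by linarith) (by linarith) (by linarith), key _ _ (by linarith) (by linarith) h1 (by linarith)⟩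

theorem evL [Finite L] {g : ℝ → L} (hg : ∀ x y, x ≤ y → σ.le (g x) (g y)) (z : ℝ) :
    ∃ ε > 0, ∃ l, ∀ y, z - ε < y → y < z → σ.eqv (g y) l := by
  obtain ⟨ε, h1, l, h2⟩ := evR (σ := σ.dual) (g := fun x => g (-x)) (fun x y h => hg _ _ (by linarith)) (-z)
  refine ⟨ε, h1, l, fun y h3 h4 => ?_⟩
  have := h2 (-y) (by linarith) (by linarith)
  rw [neg_neg] at this
  exact Sys.eqv_dual.1 this

theorem ev2 [Finite L] {g : ℝ → L} (hg : ∀ x y, x ≤ y → σ.le (g x) (g y)) (z : ℝ) :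
    ∃ ε > 0, (∃ l, ∀ y, z < y → y < z + ε → σ.eqv (g y) l) ∧ (∃ l, ∀ y, z - ε < y → y < z → σ.eqv (g y) l) := by
  obtain ⟨ε, h1, l, h2⟩ := evR hg z
  obtain ⟨ε', h3, l', h4⟩ := evL hg z
  have := min_le_left ε ε'
  have := min_le_right ε ε'
  exact ⟨min ε ε', lt_min h1 h3, ⟨l, fun y k1 k2 => h2 y k1 (by linarith)⟩,
    ⟨l', fun y k1 k2 => h4 y (by linarith) k2⟩⟩

/-! ### C0 -/
theorem HM.baseF {f : Pt → L} (hf : HM σ f) {a b c d : ℝ} (hab : a < b) (hcd : c < d) {l r b' t e : L}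
    (hl : ∀ y, c < y → y < d → σ.eqv (f (a, y)) l) (hr : ∀ y, c < y → y < d → σ.eqv (f (b, y)) r)
    (hb : ∀ x, a < x → x < b → σ.eqv (f (x, c)) b') (ht : ∀ x, a < x → x < b → σ.eqv (f (x, d)) t)
    (he : ∀ x y, a < x → x < b → c < y → y < d → σ.eqv (f (x, y)) e) :
    BaseF σ (f (a, c)) (f (b, c)) (f (a, d)) l r b' t e := by
  obtain ⟨x, hx, hx'⟩ := exists_between hab
  obtain ⟨y, hy, hy'⟩ := exists_between hcd
  intro i
  have main : ∀ p : Pt, σ.A (f p) i → (p = (a, c) ∨ p = (a, y) ∨ p = (x, c) ∨ p = (x, y)) →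
      ((p = (a, c) ∧ σ.wF (f (a, c)) i) ∨ (p.1 = a ∧ (σ.WF l i ∨ σ.A (f (a, d)) i)) ∨
        (p.2 = c ∧ (σ.WF b' i ∨ σ.A (f (b, c)) i)) ∨ σ.WF e i ∨ σ.A t i ∨ σ.A r i) := by
    intro p hA hp
    have hp1 : a ≤ p.1 ∧ p.1 ≤ x ∧ c ≤ p.2 ∧ p.2 ≤ y := by
      rcases hp with rfl | rfl | rfl | rfl <;> refine ⟨?_, ?_, ?_, ?_⟩ <;> dsimp only <;> linarith
    obtain ⟨⟨q1, q2⟩, k1, k2, k3, k4, k5, k6⟩ := hf.dem hA (show p.1 ≤ b by linarith) (show p.2 ≤ d by linarith)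
    dsimp only at k1 k2 k3 k4 k6
    rcases k4.eq_or_lt with rfl | k4
    · -- top
      rcases (hp1.1.trans k1).eq_or_lt with rfl | k7
      · exact Or.inr (Or.inl ⟨by linarith [hp1.1], Or.inr k5⟩)
      rcases k3.eq_or_lt with rfl | k3
      · have := hf.mid (m := (x, q2)) hA k5 hp1.2.1 k2 (by dsimp only; linarith) le_rfl
        exact Or.inr (Or.inr (Or.inr (Or.inr (Or.inl ((ht x hx hx').A this)))))
      · exact Or.inr (Or.inr (Or.inr (Or.inr (Or.inl ((ht q1 k7 k3).A k5)))))
    rcases k3.eq_or_lt with rfl | k3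
    · rcases (hp1.2.2.1.trans k2).eq_or_lt with rfl | k7
      · exact Or.inr (Or.inr (Or.inl ⟨by linarith [hp1.1], Or.inr k5⟩))
      · exact Or.inr (Or.inr (Or.inr (Or.inr (Or.inr ((hr q2 k7 k4).A k5)))))
    have hw : σ.wF (f (q1, q2)) i := by
      rcases k6 with k6 | k6 | k6
      · exact k6
      · linarith
      · linarith
    rcases (hp1.1.trans k1).eq_or_lt with rfl | k7
    · rcases (hp1.2.2.1.trans k2).eq_or_lt with rfl | k8
      · exact Or.inl ⟨Prod.ext (by linarith [hp1.1]) (by linarith [hp1.1]), hw⟩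
      · exact Or.inr (Or.inl ⟨by linarith [hp1.1], Or.inl ((hl q2 k8 k4).WF (Sys.WF_of hw))⟩)
    · rcases (hp1.2.2.1.trans k2).eq_or_lt with rfl | k8
      · exact Or.inr (Or.inr (Or.inl ⟨by linarith [hp1.1], Or.inl ((hb q1 k7 k3).WF (Sys.WF_of hw))⟩))
      · exact Or.inr (Or.inr (Or.inr (Or.inl ((he q1 q2 k7 k3 k8 k4).WF (Sys.WF_of hw)))))
  have e1 : ∀ {y}, c < y → (a, y) ≠ ((a, c) : Pt) := fun h h' => by
    have := congrArg Prod.snd h'; dsimp only at this; linarith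
  have e2 : ∀ {x y}, a < x → (x, y) ≠ ((a, c) : Pt) := fun h h' => by
    have := congrArg Prod.fst h'; dsimp only at this; linarith
  refine ⟨fun h => ?_, fun h => ?_, fun h => ?_, fun h => ?_⟩
  · rcases main (x, y) ((he x y hx hx' hy hy').symm.A h) (by simp) with k | k | k | k
    · exact absurd k.1 (e2 hx)
    · exact absurd k.1 hx.ne'
    · exact absurd k.1 hy.ne'
    · exact k
  · rcases main (a, y) ((hl y hy hy').symm.A h) (by simp) with k | k | k | k
    · exact absurd k.1 (e1 hy)
    · tauto
    · exact absurd k.1 hy.ne'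
    · tauto
  · rcases main (x, c) ((hb x hx hx').symm.A h) (by simp) with k | k | k | k
    · exact absurd k.1 (e2 hx)
    · exact absurd k.1 hx.ne'
    · tauto
    · tauto
  · rcases main (a, c) h (by simp) with k | k | k | k <;> tauto

theorem HM.baseRes {f : Pt → L} {a b c d : ℝ} {l r b' t e : L}
    (hl : ∀ y, c < y → y < d → σ.eqv (f (a, y)) l) (hr : ∀ y, c < y → y < d → σ.eqv (f (b, y)) r)
    (hb : ∀ x, a < x → x < b → σ.eqv (f (x, c)) b') (ht : ∀ x, a < x → x < b → σ.eqv (f (x, d)) t)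
    (he : ∀ x y, a < x → x < b → c < y → y < d → σ.eqv (f (x, y)) e) {i : ι}
    (h : ∃ q ∈ bx a b c d, σ.wF (f q) i) :
    BaseRes σ (f (a, c)) (f (b, c)) (f (a, d)) (f (b, d)) l r b' t e i := by
  obtain ⟨⟨x, y⟩, ⟨h1, h2, h3, h4⟩, hw⟩ := h
  dsimp only at h1 h2 h3 h4
  unfold BaseRes
  rcases h1.eq_or_lt with rfl | h1
  · rcases h3.eq_or_lt with rfl | h3
    · tauto
    rcases h4.eq_or_lt with rfl | h4
    · tauto
    have := (hl y h3 h4).WF (Sys.WF_of hw)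
    tauto
  rcases h2.eq_or_lt with rfl | h2
  · rcases h3.eq_or_lt with rfl | h3
    · tauto
    rcases h4.eq_or_lt with rfl | h4
    · tauto
    have := (hr y h3 h4).WF (Sys.WF_of hw)
    tauto
  rcases h3.eq_or_lt with rfl | h3
  · have := (hb x h1 h2).WF (Sys.WF_of hw)
    tauto
  rcases h4.eq_or_lt with rfl | h4
  · have := (ht x h1 h2).WF (Sys.WF_of hw)
    tauto
  have := (he x y h1 h2 h3 h4).WF (Sys.WF_of hw)
  tauto

theorem Closed.C0 (hS : Closed σ S) {f : Pt → L} (hf : HM σ f) {a b c d : ℝ} {l r b' t e : L}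
    (hl : ∀ y, c < y → y < d → σ.eqv (f (a, y)) l) (hr : ∀ y, c < y → y < d → σ.eqv (f (b, y)) r)
    (hb : ∀ x, a < x → x < b → σ.eqv (f (x, c)) b') (ht : ∀ x, a < x → x < b → σ.eqv (f (x, d)) t)
    (he : ∀ x y, a < x → x < b → c < y → y < d → σ.eqv (f (x, y)) e) : Gd S σ f a b c d := by
  intro hab hcd
  obtain ⟨x, hx, hx'⟩ := exists_between hab
  obtain ⟨y, hy, hy'⟩ := exists_between hcd
  have kl := hl y hy hy'
  have kr := hr y hy hy'
  have kb := hb x hx hx'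
  have kt := ht x hx hx'
  have ke := he x y hx hx' hy hy'
  have le2 : ∀ {p q : Pt} {l m : L}, σ.eqv (f p) l → σ.eqv (f q) m → p.1 ≤ q.1 → p.2 ≤ q.2 → σ.le l m :=
    fun h1 h2 h3 h4 => h2.le_right (h1.le_left (hf.mono _ _ h3 h4))
  have rf : ∀ p : Pt, σ.eqv (f p) (f p) := fun p => Sys.eqv.refl _
  have cv : ∀ {x' y' : ℝ} {m : L}, σ.eqv (f (x', y')) m → σ.eqv (f (- -x', - -y')) m := by
    intro x' y' m h; rwa [neg_neg, neg_neg]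
  have cv1 : ∀ {y'} (x' : ℝ) {m : L}, σ.eqv (f (x', - y')) m → σ.dual.eqv (f (- -x', - y')) m := by
    intro y' x' m h; rw [neg_neg]; exact Sys.eqv_dual.2 h
  have cv2 : ∀ {x'} (y' : ℝ) {m : L}, σ.eqv (f (-x', y')) m → σ.dual.eqv (f (-x', - -y')) m := by
    intro y' x' m h; rw [neg_neg]; exact Sys.eqv_dual.2 h
  have hl' : ∀ y, -d < y → y < -c → σ.dual.eqv ((fun p : Pt => f (-p.1, -p.2)) (-a, y)) l :=
    fun y h1 h2 => cv1 a (hl (-y) (by linarith) (by linarith))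
  have hr' : ∀ y, -d < y → y < -c → σ.dual.eqv ((fun p : Pt => f (-p.1, -p.2)) (-b, y)) r :=
    fun y h1 h2 => cv1 b (hr (-y) (by linarith) (by linarith))
  have hb' : ∀ x, -b < x → x < -a → σ.dual.eqv ((fun p : Pt => f (-p.1, -p.2)) (x, -c)) b' :=
    fun y h1 h2 => cv2 c (hb (-y) (by linarith) (by linarith))
  have ht' : ∀ x, -b < x → x < -a → σ.dual.eqv ((fun p : Pt => f (-p.1, -p.2)) (x, -d)) t :=
    fun y h1 h2 => cv2 d (ht (-y) (by linarith) (by linarith))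
  have he' : ∀ x y, -b < x → x < -a → -d < y → y < -c →
      σ.dual.eqv ((fun p : Pt => f (-p.1, -p.2)) (x, y)) e :=
    fun x y h1 h2 h3 h4 => Sys.eqv_dual.2 (he (-x) (-y) (by linarith) (by linarith) (by linarith) (by linarith))
  refine hS.base (f (a, c)) (f (b, c)) (f (a, d)) (f (b, d)) l r b' t e _ ⟨?_, hf.baseF hab hcd hl hr hb ht he,
    ?_, ?_, ?_, ?_, ?_, fun i hi => HM.baseRes hl hr hb ht he hi, fun i hi => ?_⟩
  · refine ⟨⟨le2 (rf _) kb ?_ ?_, le2 kb (rf _) ?_ ?_⟩, ⟨le2 kl ke ?_ ?_, le2 ke kr ?_ ?_⟩,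
      ⟨le2 (rf _) kt ?_ ?_, le2 kt (rf _) ?_ ?_⟩, ⟨le2 (rf _) kl ?_ ?_, le2 kl (rf _) ?_ ?_⟩,
      ⟨le2 kb ke ?_ ?_, le2 ke kt ?_ ?_⟩, ⟨le2 (rf _) kr ?_ ?_, le2 kr (rf _) ?_ ?_⟩⟩ <;> dsimp only <;> linarith
  · have := HM.baseF hf.refl (show -b < -a by linarith) (show -d < -c by linarith) hr' hl' ht' hb' he'
    simpa only [neg_neg] using this
  · exact tr_elem (hf.monoV a c d) hcd hl
  · exact tr_elem (hf.monoV b c d) hcd hr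
  · exact tr_elem (hf.monoH c a b) hab hb
  · exact tr_elem (hf.monoH d a b) hab ht
  · have := HM.baseRes (σ := σ.dual) (f := fun p : Pt => f (-p.1, -p.2)) hr' hl' ht' hb' he' (i := i) (by
      obtain ⟨q, ⟨h1, h2, h3, h4⟩, h⟩ := hi
      refine ⟨(-q.1, -q.2), ⟨neg_le_neg h2, neg_le_neg h1, neg_le_neg h4, neg_le_neg h3⟩, ?_⟩
      show σ.wP (f (- -q.1, - -q.2)) i
      simpa only [neg_neg] using h)
    simpa only [neg_neg] using this

/-! ### C2 -/
theorem Closed.C2 [Finite L] (hS : Closed σ S) {f : Pt → L} (hf : HM σ f) {a b c d : ℝ} {e : L}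
    (he : ∀ x y, a < x → x < b → c < y → y < d → σ.eqv (f (x, y)) e) : Gd S σ f a b c d := by
  intro hab hcd
  refine hS.localP hf hab.le hcd.le (fun x y h1 h2 h3 h4 => ?_) hab hcd
  obtain ⟨ε1, p1, q1⟩ := ev2 (σ := σ) (g := fun y => f (a, y)) (fun _ _ h => hf.mono _ _ le_rfl h) y
  obtain ⟨ε2, p2, q2⟩ := ev2 (σ := σ) (g := fun y => f (b, y)) (fun _ _ h => hf.mono _ _ le_rfl h) y
  obtain ⟨ε3, p3, q3⟩ := ev2 (σ := σ) (g := fun x => f (x, c)) (fun _ _ h => hf.mono _ _ h le_rfl) x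
  obtain ⟨ε4, p4, q4⟩ := ev2 (σ := σ) (g := fun x => f (x, d)) (fun _ _ h => hf.mono _ _ h le_rfl) x
  obtain ⟨ε, hε, e1, e2, e3, e4⟩ : ∃ ε > 0, ε ≤ ε1 ∧ ε ≤ ε2 ∧ ε ≤ ε3 ∧ ε ≤ ε4 :=
    ⟨min (min ε1 ε2) (min ε3 ε4), by positivity, by simp, by simp, by simp, by simp⟩
  have V1 : ∀ x', a ≤ x' → x' ≤ b → ∃ l, ∀ y', y < y' → y' < y + ε → y' < d → σ.eqv (f (x', y')) l := by
    intro x' k1 k2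
    rcases k1.eq_or_lt with rfl | k1
    · obtain ⟨l, hl⟩ := q1.1; exact ⟨l, fun y' m1 m2 m3 => hl y' m1 (by linarith)⟩
    rcases k2.eq_or_lt with rfl | k2
    · obtain ⟨l, hl⟩ := q2.1; exact ⟨l, fun y' m1 m2 m3 => hl y' m1 (by linarith)⟩
    exact ⟨e, fun y' m1 m2 m3 => he _ _ k1 k2 (by linarith) m3⟩
  have V2 : ∀ x', a ≤ x' → x' ≤ b → ∃ l, ∀ y', y - ε < y' → y' < y → c < y' → σ.eqv (f (x', y')) l := by
    intro x' k1 k2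
    rcases k1.eq_or_lt with rfl | k1
    · obtain ⟨l, hl⟩ := q1.2; exact ⟨l, fun y' m1 m2 m3 => hl y' (by linarith) m2⟩
    rcases k2.eq_or_lt with rfl | k2
    · obtain ⟨l, hl⟩ := q2.2; exact ⟨l, fun y' m1 m2 m3 => hl y' (by linarith) m2⟩
    exact ⟨e, fun y' m1 m2 m3 => he _ _ k1 k2 m3 (by linarith)⟩
  have H1 : ∀ y', c ≤ y' → y' ≤ d → ∃ l, ∀ x', x < x' → x' < x + ε → x' < b → σ.eqv (f (x', y')) l := by
    intro x' k1 k2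
    rcases k1.eq_or_lt with rfl | k1
    · obtain ⟨l, hl⟩ := q3.1; exact ⟨l, fun y' m1 m2 m3 => hl y' m1 (by linarith)⟩
    rcases k2.eq_or_lt with rfl | k2
    · obtain ⟨l, hl⟩ := q4.1; exact ⟨l, fun y' m1 m2 m3 => hl y' m1 (by linarith)⟩
    exact ⟨e, fun y' m1 m2 m3 => he _ _ (by linarith) m3 k1 k2⟩
  have H2 : ∀ y', c ≤ y' → y' ≤ d → ∃ l, ∀ x', x - ε < x' → x' < x → a < x' → σ.eqv (f (x', y')) l := by
    intro x' k1 k2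
    rcases k1.eq_or_lt with rfl | k1
    · obtain ⟨l, hl⟩ := q3.2; exact ⟨l, fun y' m1 m2 m3 => hl y' (by linarith) m2⟩
    rcases k2.eq_or_lt with rfl | k2
    · obtain ⟨l, hl⟩ := q4.2; exact ⟨l, fun y' m1 m2 m3 => hl y' (by linarith) m2⟩
    exact ⟨e, fun y' m1 m2 m3 => he _ _ m3 (by linarith) k1 k2⟩
  refine ⟨ε, hε, fun a' b' c' d' k1 k2 k3 k4 k5 k6 k7 k8 k9 k10 k11 k12 => ?_⟩
  have E : ∀ x' y', a' < x' → x' < b' → c' < y' → y' < d' → σ.eqv (f (x', y')) e :=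
    fun x' y' m1 m2 m3 m4 => he _ _ (by linarith) (by linarith) (by linarith) (by linarith)
  obtain ⟨v1, V1a⟩ := V1 a' k1 (by linarith)
  obtain ⟨v2, V1x⟩ := V1 x h1 h2
  obtain ⟨v3, V1b⟩ := V1 b' (by linarith) k4
  obtain ⟨v4, V2a⟩ := V2 a' k1 (by linarith)
  obtain ⟨v5, V2x⟩ := V2 x h1 h2
  obtain ⟨v6, V2b⟩ := V2 b' (by linarith) k4
  obtain ⟨w1, H1c⟩ := H1 c' k5 (by linarith)
  obtain ⟨w2, H1y⟩ := H1 y h3 h4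
  obtain ⟨w3, H1d⟩ := H1 d' (by linarith) k8
  obtain ⟨w4, H2c⟩ := H2 c' k5 (by linarith)
  obtain ⟨w5, H2y⟩ := H2 y h3 h4
  obtain ⟨w6, H2d⟩ := H2 d' (by linarith) k8
  refine hS.cut4 hf k2 k3 k6 k7 ?_ ?_ ?_ ?_
  · exact hS.C0 hf (fun y' m1 m2 => V2a y' (by linarith) m2 (by linarith))
      (fun y' m1 m2 => V2x y' (by linarith) m2 (by linarith))
      (fun y' m1 m2 => H2c y' (by linarith) m2 (by linarith))
      (fun y' m1 m2 => H2y y' (by linarith) m2 (by linarith))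
      (fun x' y' m1 m2 m3 m4 => E x' y' m1 (by linarith) m3 (by linarith))
  · exact hS.C0 hf (fun y' m1 m2 => V2x y' (by linarith) m2 (by linarith))
      (fun y' m1 m2 => V2b y' (by linarith) m2 (by linarith))
      (fun y' m1 m2 => H1c y' m1 (by linarith) (by linarith))
      (fun y' m1 m2 => H1y y' m1 (by linarith) (by linarith))
      (fun x' y' m1 m2 m3 m4 => E x' y' (by linarith) m2 m3 (by linarith))
  · exact hS.C0 hf (fun y' m1 m2 => V1a y' m1 (by linarith) (by linarith))
      (fun y' m1 m2 => V1x y' m1 (by linarith) (by linarith))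
      (fun y' m1 m2 => H2y y' (by linarith) m2 (by linarith))
      (fun y' m1 m2 => H2d y' (by linarith) m2 (by linarith))
      (fun x' y' m1 m2 m3 m4 => E x' y' m1 (by linarith) (by linarith) m4)
  · exact hS.C0 hf (fun y' m1 m2 => V1x y' m1 (by linarith) (by linarith))
      (fun y' m1 m2 => V1b y' m1 (by linarith) (by linarith))
      (fun y' m1 m2 => H1y y' m1 (by linarith) (by linarith))
      (fun y' m1 m2 => H1d y' m1 (by linarith) (by linarith))
      (fun x' y' m1 m2 m3 m4 => E x' y' (by linarith) m2 (by linarith) m4)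

/-! ### cylinders -/
theorem HM.cyl {f : Pt → L} (hf : HM σ f) (x0 : ℝ) : HM σ (fun p => f (x0, p.2)) where
  mono := fun p q _ h => hf.mono _ _ le_rfl h
  fut := fun p i b d hA h1 h2 => ⟨(b, p.2), h1, le_rfl, le_rfl, h2, Or.inr ⟨Or.inl rfl, hA⟩⟩
  past := fun p i b d hA h1 h2 => ⟨(b, p.2), h1, le_rfl, le_rfl, h2, Or.inr ⟨Or.inl rfl, hA⟩⟩

theorem Closed.cyl [Finite L] (hS : Closed σ S) {f : Pt → L} (hf : HM σ f) (x0 a b c d : ℝ) :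
    Gd S σ (fun p => f (x0, p.2)) a b c d := by
  intro hab hcd
  refine hS.localP (hf.cyl x0) hab.le hcd.le (fun x y h1 h2 h3 h4 => ?_) hab hcd
  obtain ⟨ε, h5, ⟨l, h6⟩, ⟨l', h7⟩⟩ := ev2 (σ := σ) (g := fun y => f (x0, y)) (fun _ _ h => hf.mono _ _ le_rfl h) y
  refine ⟨ε, h5, fun a' b' c' d' k1 k2 k3 k4 k5 k6 k7 k8 k9 k10 k11 k12 => ?_⟩
  refine hS.cutH (hf.cyl x0) k6 k7 ?_ ?_
  · exact hS.C0 (hf.cyl x0) (l := l') (r := l') (b' := f (x0, c')) (t := f (x0, y)) (e := l') (fun y' m1 m2 => h7 y' (by linarith) m2)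
      (fun y' m1 m2 => h7 y' (by linarith) m2) (fun _ _ _ => Sys.eqv.refl _) (fun _ _ _ => Sys.eqv.refl _)
      (fun _ y' _ _ m1 m2 => h7 y' (by linarith) m2)
  · exact hS.C0 (hf.cyl x0) (l := l) (r := l) (b' := f (x0, y)) (t := f (x0, d')) (e := l) (fun y' m1 m2 => h6 y' m1 (by linarith))
      (fun y' m1 m2 => h6 y' m1 (by linarith)) (fun _ _ _ => Sys.eqv.refl _) (fun _ _ _ => Sys.eqv.refl _)
      (fun _ y' _ _ m1 m2 => h6 y' m1 (by linarith))

end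
end Temporal

namespace Temporal

/-! ### C3: corner limits -/
section
variable {L ι : Type} {σ : Sys L ι} {S : Beh L ι → Prop}

theorem finite_tr [Finite L] : Finite (Tr L) := by
  refine Finite.of_injective (fun t : Tr L => ((t.pres, t.nd), (t.mn, t.mx))) fun s t h => ?_
  simp only [Prod.mk.injEq] at h
  obtain ⟨⟨h1, h2⟩, h3, h4⟩ := h
  exact Tr.ext h1 h2 h3 h4

theorem finite_beh [Finite L] [Finite ι] : Finite (Beh L ι) := by
  have := finite_tr (L := L)
  refine Finite.of_injective (fun t : Beh L ι => ((t.lf, t.rt, t.bt, t.tp), (t.rF, t.rP))) fun s t h => ?_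
  simp only [Prod.mk.injEq] at h
  obtain ⟨⟨h1, h2, h5, h6⟩, h3, h4⟩ := h
  exact Beh.ext h1 h2 h5 h6 h3 h4

theorem evRes [Finite ι] (w : Pt → ι → Prop) (R : Set Pt) (x0 y0 : ℝ) (u : ℕ → Pt)
    (hu : ∀ δ > 0, ∀ᶠ n in Filter.atTop, (u n).1 < x0 + δ ∧ y0 - δ < (u n).2) :
    ∀ᶠ n in Filter.atTop, ∀ i, (∃ q ∈ R, w q i ∧ (x0 < q.1 ∨ q.2 < y0)) →
      ∃ q ∈ R, w q i ∧ ((u n).1 < q.1 ∨ q.2 < (u n).2) := by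
  rw [Filter.eventually_all]
  intro i
  by_cases h : ∃ q ∈ R, w q i ∧ (x0 < q.1 ∨ q.2 < y0)
  · obtain ⟨q, h1, h2, h3⟩ := h
    rcases h3 with h3 | h3
    · filter_upwards [hu (q.1 - x0) (by linarith)] with n hn _
      exact ⟨q, h1, h2, Or.inl (by linarith [hn.1])⟩
    · filter_upwards [hu (y0 - q.2) (by linarith)] with n hn _
      exact ⟨q, h1, h2, Or.inr (by linarith [hn.2])⟩
  · exact Filter.Eventually.of_forall fun _ h' => absurd h' h

theorem HM.c3dem {f : Pt → L} (hf : HM σ f) {x0 y0 xk yk xl yl : ℝ} (h1 : x0 < xl) (h2 : xl < xk) (h3 : yk < yl)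
    (h4 : yl < y0) {c z e : L} (hc : ∀ y, yk ≤ y → y < y0 → σ.eqv (f (x0, y)) c) (hz : f (x0, y0) = z)
    (he : ∀ y, yl ≤ y → y < y0 → σ.eqv (f (xk, y)) e) {i : ι} (hA : σ.A c i) :
    σ.A z i ∨ σ.A e i ∨ (∃ q ∈ bx xl xk yl y0, σ.wF (f q) i) ∨ (∃ q ∈ bx x0 xk yk y0, σ.wF (f q) i) := by
  have hA' : σ.A (f (x0, yl)) i := (hc yl h3.le h4).symm.A hA
  obtain ⟨⟨q1, q2⟩, k1, k2, k3, k4, k5, k6⟩ := hf.dem (b := xk) (d := y0) hA' (by dsimp only; linarith) h4.le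
  dsimp only at k1 k2 k3 k4 k6
  rcases k6 with k6 | rfl | rfl
  · exact Or.inr (Or.inr (Or.inr ⟨_, ⟨k1, k3, by dsimp only; linarith, k4⟩, k6⟩))
  · refine Or.inr (Or.inl ((he yl le_rfl h4).A (hf.mid hA' k5 ?_ le_rfl le_rfl k2)))
    dsimp only; linarith
  · exact Or.inl (hz ▸ hf.mid hA' k5 le_rfl k2 k1 le_rfl)

theorem HM.c3dem' {f : Pt → L} (hf : HM σ f) {x0 y0 xk yk xl yl : ℝ} (h1 : x0 < xl) (h2 : xl < xk) (h3 : yk < yl)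
    (h4 : yl < y0) {c z e : L} (hc : ∀ x, x0 < x → x ≤ xk → σ.eqv (f (x, y0)) c) (hz : f (x0, y0) = z)
    (he : ∀ x, x0 < x → x ≤ xl → σ.eqv (f (x, yk)) e) {i : ι} (hA : σ.B c i) :
    σ.B z i ∨ σ.B e i ∨ (∃ q ∈ bx x0 xl yk yl, σ.wP (f q) i) ∨ (∃ q ∈ bx x0 xk yk y0, σ.wP (f q) i) := by
  have := HM.c3dem hf.refl.swap (x0 := -y0) (y0 := -x0) (xk := -yk) (yk := -xk) (xl := -yl) (yl := -xl)
    (c := c) (z := z) (e := e) (i := i)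
    (by linarith) (by linarith) (by linarith) (by linarith)
    (fun y k1 k2 => Sys.eqv_dual.2 (by simpa using hc (-y) (by linarith) (by linarith))) (by simpa using hz)
    (fun y k1 k2 => Sys.eqv_dual.2 (by simpa using he (-y) (by linarith) (by linarith))) hA
  rcases this with h | h | ⟨q, ⟨k1, k2, k3, k4⟩, h⟩ | ⟨q, ⟨k1, k2, k3, k4⟩, h⟩
  · exact Or.inl h
  · exact Or.inr (Or.inl h)
  · refine Or.inr (Or.inr (Or.inr ⟨(-q.2, -q.1), ⟨?_, ?_, ?_, ?_⟩, h⟩)) <;> dsimp only <;> linarith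
  · refine Or.inr (Or.inr (Or.inr ⟨(-q.2, -q.1), ⟨?_, ?_, ?_, ?_⟩, h⟩)) <;> dsimp only <;> linarith

theorem Closed.C3 [Finite L] [Finite ι] (hS : Closed σ S) {f : Pt → L} (hf : HM σ f) {x0 y0 : ℝ} (G : Set Pt)
    (hG : ∀ g ∈ G, x0 < g.1 ∧ g.2 < y0)
    (hlim : ∀ ε > 0, ∃ g ∈ G, g.1 < x0 + ε ∧ y0 - ε < g.2)
    (hβ : ∀ g ∈ G, ∀ h ∈ G, h.1 < g.1 → g.2 < h.2 → Gd S σ f x0 h.1 g.2 h.2)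
    (hα : ∀ g ∈ G, ∀ h ∈ G, h.1 < g.1 → g.2 < h.2 → Gd S σ f h.1 g.1 g.2 h.2)
    (hγ : ∀ g ∈ G, ∀ h ∈ G, h.1 < g.1 → g.2 < h.2 → Gd S σ f h.1 g.1 h.2 y0) :
    ∀ g ∈ G, Gd S σ f x0 g.1 g.2 y0 := by
  have := finite_beh (L := L) (ι := ι)
  have hlim' : ∀ n : ℕ, ∃ g ∈ G, g.1 < x0 + 1 / ((n : ℝ) + 1) ∧ y0 - 1 / ((n : ℝ) + 1) < g.2 :=
    fun n => hlim _ (by positivity)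
  choose u uG ux uy using hlim'
  have hu : ∀ δ > 0, ∀ᶠ n in Filter.atTop, (u n).1 < x0 + δ ∧ y0 - δ < (u n).2 := by
    intro δ hδ
    have := (tendsto_one_div_add_atTop_nhds_zero_nat (𝕜 := ℝ)).eventually (gt_mem_nhds hδ)
    filter_upwards [this] with n hn
    exact ⟨by linarith [ux n], by linarith [uy n]⟩
  obtain ⟨B, hB⟩ := Finite.exists_infinite_fiber (fun n => behS σ f x0 (u n).1 (u n).2 y0)
  have hfr : ∃ᶠ n in Filter.atTop, behS σ f x0 (u n).1 (u n).2 y0 = B :=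
    Nat.frequently_atTop_iff_infinite.2 (Set.infinite_coe_iff.1 hB)
  obtain ⟨ε1, e1, c, hc⟩ := evL (σ := σ) (g := fun y => f (x0, y)) (fun _ _ h => hf.mono _ _ le_rfl h) y0
  obtain ⟨ε2, e2, c', hc'⟩ := evR (σ := σ) (g := fun x => f (x, y0)) (fun _ _ h => hf.mono _ _ h le_rfl) x0
  have main : ∀ δ > 0, ∃ k, (u k).1 < x0 + δ ∧ y0 - δ < (u k).2 ∧ Gd S σ f x0 (u k).1 (u k).2 y0 := by
    intro δ hδ
    obtain ⟨k, ⟨hkB, hkδ⟩, hk1, hk2⟩ := ((hfr.and_eventually (hu δ hδ)).and_eventually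
      ((hu ε1 e1).and (hu ε2 e2))).exists
    refine ⟨k, hkδ.1, hkδ.2, fun _ _ => ?_⟩
    set g := u k with hg
    obtain ⟨g1, g2⟩ := hG g (uG k)
    obtain ⟨ε3, e3, e', he'⟩ := evR (σ := σ) (g := fun x => f (x, g.2)) (fun _ _ h => hf.mono _ _ h le_rfl) x0
    obtain ⟨ε4, e4, e, he⟩ := evL (σ := σ) (g := fun y => f (g.1, y)) (fun _ _ h => hf.mono _ _ le_rfl h) y0
    obtain ⟨l, ⟨hlB, hl1⟩, hl2, hl3, hl4, hl5, hl6⟩ := ((hfr.and_eventually (hu (g.1 - x0) (by linarith))).and_eventually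
      ((hu ε3 e3).and ((hu ε4 e4).and ((hu (y0 - g.2) (by linarith)).and
      ((evRes (fun q i => σ.wF (f q) i) (bx x0 g.1 g.2 y0) x0 y0 u hu).and
      (evRes (fun q i => σ.wP (f q) i) (bx x0 g.1 g.2 y0) x0 y0 u hu)))))).exists
    set h := u l with hh
    obtain ⟨h1, h2⟩ := hG h (uG l)
    have k1 : h.1 < g.1 := by linarith [hl1.1]
    have k2 : g.2 < h.2 := by linarith [hl4.2]
    have hcc : ∀ y, g.2 ≤ y → y < y0 → σ.eqv (f (x0, y)) c := fun y m1 m2 => hc y (by linarith [hk1.2]) m2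
    have hcc' : ∀ x, x0 < x → x ≤ g.1 → σ.eqv (f (x, y0)) c' := fun x m1 m2 => hc' x m1 (by linarith [hk2.1])
    have hee : ∀ y, h.2 ≤ y → y < y0 → σ.eqv (f (g.1, y)) e := fun y m1 m2 => he y (by linarith [hl3.2]) m2
    have hee' : ∀ x, x0 < x → x ≤ h.1 → σ.eqv (f (x, g.2)) e' := fun x m1 m2 => he' x m1 (by linarith [hl2.1])
    have hring : ∀ P : Pt → Prop, (∃ q ∈ bx x0 g.1 g.2 y0, P q ∧ (h.1 < q.1 ∨ q.2 < h.2)) →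
        (∃ q ∈ bx h.1 g.1 g.2 h.2, P q) ∨ (∃ q ∈ bx x0 h.1 g.2 h.2, P q) ∨ (∃ q ∈ bx h.1 g.1 h.2 y0, P q) := by
      rintro P ⟨q, ⟨m1, m2, m3, m4⟩, m5, m6⟩
      rcases le_total q.1 h.1 with m7 | m7
      · rcases le_total q.2 h.2 with m8 | m8
        · exact Or.inr (Or.inl ⟨q, ⟨m1, m7, m3, m8⟩, m5⟩)
        · rcases m6 with m6 | m6 <;> linarith
      · rcases le_total q.2 h.2 with m8 | m8
        · exact Or.inl ⟨q, ⟨m7, m2, m3, m8⟩, m5⟩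
        · exact Or.inr (Or.inr ⟨q, ⟨m7, m2, m8, m4⟩, m5⟩)
    have hcorner : ∀ P : Pt → Prop, (∃ q ∈ bx x0 g.1 g.2 y0, P q) → P (x0, y0) ∨
        ∃ q ∈ bx x0 g.1 g.2 y0, P q ∧ (x0 < q.1 ∨ q.2 < y0) := by
      rintro P ⟨q, ⟨m1, m2, m3, m4⟩, m5⟩
      rcases m1.eq_or_lt with m6 | m6
      · rcases m4.eq_or_lt with m7 | m7
        · left; rwa [show (x0, y0) = q from Prod.ext m6 m7.symm]
        · exact Or.inr ⟨q, ⟨m1, m2, m3, m4⟩, m5, Or.inr m7⟩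
      · exact Or.inr ⟨q, ⟨m1, m2, m3, m4⟩, m5, Or.inl m6⟩
    have resF : ∀ i, (∃ q ∈ bx x0 g.1 g.2 y0, σ.wF (f q) i) → (behS σ f h.1 g.1 g.2 h.2).rF i ∨
        (behS σ f x0 h.1 g.2 h.2).rF i ∨ (behS σ f h.1 g.1 h.2 y0).rF i ∨ σ.wF (f (x0, y0)) i := by
      intro i hi
      rcases hcorner (fun q => σ.wF (f q) i) hi with hi | hi
      · exact Or.inr (Or.inr (Or.inr hi))
      · rcases hring _ (hl5 i hi) with m | m | m
        · exact Or.inl m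
        · exact Or.inr (Or.inl m)
        · exact Or.inr (Or.inr (Or.inl m))
    have resP : ∀ i, (∃ q ∈ bx x0 g.1 g.2 y0, σ.wP (f q) i) → (behS σ f h.1 g.1 g.2 h.2).rP i ∨
        (behS σ f x0 h.1 g.2 h.2).rP i ∨ (behS σ f h.1 g.1 h.2 y0).rP i ∨ σ.wP (f (x0, y0)) i := by
      intro i hi
      rcases hcorner (fun q => σ.wP (f q) i) hi with hi | hi
      · exact Or.inr (Or.inr (Or.inr hi))
      · rcases hring _ (hl6 i hi) with m | m | m
        · exact Or.inl m
        · exact Or.inr (Or.inl m)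
        · exact Or.inr (Or.inr (Or.inl m))
    have hBB : behS σ f x0 h.1 h.2 y0 = behS σ f x0 g.1 g.2 y0 := hlB.trans hkB.symm
    have le2 : ∀ {p q : Pt} {l m : L}, σ.eqv (f p) l → σ.eqv (f q) m → p.1 ≤ q.1 → p.2 ≤ q.2 → σ.le l m :=
      fun h1 h2 h3 h4 => h2.le_right (h1.le_left (hf.mono _ _ h3 h4))
    refine hS.lim (behS σ f h.1 g.1 g.2 h.2) (behS σ f x0 h.1 g.2 h.2) (behS σ f h.1 g.1 h.2 y0)
      (behS σ f x0 g.1 g.2 y0) c c' (f (x0, y0)) e e' (f (x0, g.2)) (f (g.1, y0)) (f (x0, h.2)) (f (h.1, y0))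
      (f (h.1, g.2)) (f (g.1, h.2)) ⟨⟨?_, ?_, ?_, ?_⟩, ⟨hcc _ le_rfl g2, hcc _ k2.le h2, hcc' _ g1 le_rfl,
      hcc' _ h1 k1.le, hee' _ h1 le_rfl, hee _ le_rfl h2⟩, ⟨?_, ?_, ?_, ?_⟩, ⟨?_, ?_, rfl, rfl⟩,
      ⟨?_, ?_, ?_, ?_⟩, fun i hi => ?_, fun i hi => ?_, resF, resP⟩ (hα g (uG k) h (uG l) k1 k2 k1 k2)
      (hβ g (uG k) h (uG l) k1 k2 h1 k2) (hγ g (uG k) h (uG l) k1 k2 k1 h2)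
    · exact le2 (hcc _ le_rfl g2) (Sys.eqv.refl _) le_rfl g2.le
    · exact le2 (Sys.eqv.refl _) (hcc' _ g1 le_rfl) g1.le le_rfl
    · exact le2 (hcc _ le_rfl g2) (hee' _ h1 le_rfl) h1.le le_rfl
    · exact le2 (hee _ le_rfl h2) (hcc' _ g1 le_rfl) le_rfl h2.le
    · exact tr_elem (hf.monoV _ _ _) g2 fun y m1 m2 => hcc y m1.le m2
    · exact tr_elem (hf.monoH _ _ _) g1 fun x m1 m2 => hcc' x m1 m2.le
    · exact tr_elem (hf.monoV _ _ _) k2 fun y m1 m2 => hcc y m1.le (m2.trans h2)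
    · exact tr_elem (hf.monoH _ _ _) k1 fun x m1 m2 => hcc' x (h1.trans m1) m2.le
    · rw [← hBB]; rfl
    · rw [← hBB]; rfl
    · exact tr_conc (hf.monoH _ _ _) h1.le k1.le
    · exact tr_conc (hf.monoV _ _ _) k2.le h2.le
    · exact tr_elem (hf.monoH _ _ _) h1 fun x m1 m2 => hee' x m1 m2.le
    · exact tr_elem (hf.monoV _ _ _) h2 fun y m1 m2 => hee y m1.le m2
    · rcases hf.c3dem h1 k1 k2 h2 hcc rfl hee hi with m | m | m | m
      · exact Or.inr (Or.inl m)
      · exact Or.inr (Or.inr (Or.inl m))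
      · exact Or.inr (Or.inr (Or.inr (Or.inr (Or.inr m))))
      · rcases resF i m with m | m | m | m
        · exact Or.inr (Or.inr (Or.inr (Or.inl m)))
        · exact Or.inr (Or.inr (Or.inr (Or.inr (Or.inl m))))
        · exact Or.inr (Or.inr (Or.inr (Or.inr (Or.inr m))))
        · refine Or.inr (Or.inl (σ.axF ?_ (σ.rfl' _) hi (Or.inr m)))
          exact le2 (hcc _ le_rfl g2) (Sys.eqv.refl _) le_rfl g2.le
    · rcases hf.c3dem' h1 k1 k2 h2 hcc' rfl hee' hi with m | m | m | m
      · exact Or.inr (Or.inl m)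
      · exact Or.inr (Or.inr (Or.inl m))
      · exact Or.inr (Or.inr (Or.inr (Or.inr (Or.inl m))))
      · rcases resP i m with m | m | m | m
        · exact Or.inr (Or.inr (Or.inr (Or.inl m)))
        · exact Or.inr (Or.inr (Or.inr (Or.inr (Or.inl m))))
        · exact Or.inr (Or.inr (Or.inr (Or.inr (Or.inr m))))
        · refine Or.inr (Or.inl (σ.axP (σ.rfl' _) ?_ hi (Or.inr m)))
          exact le2 (Sys.eqv.refl _) (hcc' _ g1 le_rfl) g1.le le_rfl
  intro g hg
  obtain ⟨g1, g2⟩ := hG g hg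
  obtain ⟨k, h1, h2, h3⟩ := main (min (g.1 - x0) (y0 - g.2)) (lt_min (by linarith) (by linarith))
  have m1 := min_le_left (g.1 - x0) (y0 - g.2)
  have m2 := min_le_right (g.1 - x0) (y0 - g.2)
  obtain ⟨k1, k2⟩ := hG _ (uG k)
  have k3 : (u k).1 < g.1 := by linarith
  have k4 : g.2 < (u k).2 := by linarith
  exact hS.cut4 hf k1.le k3.le k4.le k2.le (hβ g hg _ (uG k) k3 k4) (hα g hg _ (uG k) k3 k4) h3 (hγ g hg _ (uG k) k3 k4)

/-- lower-right corner version -/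
theorem Closed.C3' [Finite L] [Finite ι] (hS : Closed σ S) {f : Pt → L} (hf : HM σ f) {x0 y0 : ℝ} (G : Set Pt)
    (hG : ∀ g ∈ G, g.1 < x0 ∧ y0 < g.2)
    (hlim : ∀ ε > 0, ∃ g ∈ G, x0 - ε < g.1 ∧ g.2 < y0 + ε)
    (hβ : ∀ g ∈ G, ∀ h ∈ G, g.1 < h.1 → h.2 < g.2 → Gd S σ f g.1 h.1 y0 h.2)
    (hα : ∀ g ∈ G, ∀ h ∈ G, g.1 < h.1 → h.2 < g.2 → Gd S σ f g.1 h.1 h.2 g.2)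
    (hγ : ∀ g ∈ G, ∀ h ∈ G, g.1 < h.1 → h.2 < g.2 → Gd S σ f h.1 x0 h.2 g.2) :
    ∀ g ∈ G, Gd S σ f g.1 x0 y0 g.2 := by
  intro g hg
  refine hS.gd_swap' (hS.C3 hf.swap (Prod.swap ⁻¹' G) (fun g hg => ?_) (fun ε hε => ?_)
    (fun g hg h hh h1 h2 => ?_) (fun g hg h hh h1 h2 => ?_) (fun g hg h hh h1 h2 => ?_) g.swap (by simpa using hg))
  · exact (hG _ hg).symm
  · obtain ⟨g, h1, h2, h3⟩ := hlim ε hε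
    exact ⟨g.swap, by simpa using h1, h3, h2⟩
  · exact hS.gd_swap (hβ _ hg _ hh h2 h1)
  · exact hS.gd_swap (hα _ hg _ hh h2 h1)
  · exact hS.gd_swap (hγ _ hg _ hh h2 h1)

end
end Temporal

namespace Temporal

/-! ### bad points -/
section
variable {L ι : Type} {σ : Sys L ι} {S : Beh L ι → Prop}

def badS (S : Beh L ι → Prop) (σ : Sys L ι) (f : Pt → L) (a b c d : ℝ) : Set Pt :=
  {z | (a ≤ z.1 ∧ z.1 ≤ b ∧ c ≤ z.2 ∧ z.2 ≤ d) ∧ ∀ ε > 0, ∃ a' b' c' d', a ≤ a' ∧ b' ≤ b ∧ c ≤ c' ∧ d' ≤ d ∧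
    z.1 - ε < a' ∧ b' < z.1 + ε ∧ z.2 - ε < c' ∧ d' < z.2 + ε ∧ ¬ Gd S σ f a' b' c' d'}

theorem badS_mono {f : Pt → L} {a b c d a' b' c' d' : ℝ} (h1 : a ≤ a') (h2 : b' ≤ b) (h3 : c ≤ c') (h4 : d' ≤ d) :
    badS S σ f a' b' c' d' ⊆ badS S σ f a b c d := by
  rintro z ⟨⟨k1, k2, k3, k4⟩, k⟩
  refine ⟨⟨h1.trans k1, k2.trans h2, h3.trans k3, k4.trans h4⟩, fun ε hε => ?_⟩
  obtain ⟨p, q, r, s, m1, m2, m3, m4, m⟩ := k ε hε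
  exact ⟨p, q, r, s, h1.trans m1, m2.trans h2, h3.trans m3, m4.trans h4, m⟩

theorem Closed.of_noBad (hS : Closed σ S) {f : Pt → L} (hf : HM σ f) {a b c d : ℝ}
    (h : ∀ z, z ∉ badS S σ f a b c d) : Gd S σ f a b c d := by
  intro hab hcd
  refine hS.localP hf hab.le hcd.le (fun x y h1 h2 h3 h4 => ?_) hab hcd
  by_contra hc
  push Not at hc
  refine h (x, y) ⟨⟨h1, h2, h3, h4⟩, fun ε hε => ?_⟩
  obtain ⟨p, q, r, s, m1, m2, m3, m4, m5, m6, m7, m8, m9, m10, m11, m12, m13⟩ := hc ε hε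
  exact ⟨p, q, r, s, m1, m4, m5, m8, m9, m10, m11, m12, m13⟩

theorem badS_closed {f : Pt → L} {a b c d : ℝ} : IsClosed (badS S σ f a b c d) := by
  refine isClosed_of_closure_subset fun z hz => ?_
  rw [Metric.mem_closure_iff] at hz
  have hd : ∀ w : Pt, |z.1 - w.1| ≤ dist z w ∧ |z.2 - w.2| ≤ dist z w := fun w => by
    rw [Prod.dist_eq, Real.dist_eq, Real.dist_eq]
    exact ⟨le_max_left _ _, le_max_right _ _⟩
  have hb : ∀ ε > 0, ∃ w ∈ badS S σ f a b c d, |z.1 - w.1| < ε ∧ |z.2 - w.2| < ε := fun ε hε => by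
    obtain ⟨w, h1, h2⟩ := hz ε hε
    exact ⟨w, h1, (hd w).1.trans_lt h2, (hd w).2.trans_lt h2⟩
  have hle : ∀ {x y : ℝ}, (∀ ε > 0, x ≤ y + ε) → x ≤ y := fun h => le_of_forall_pos_le_add h
  refine ⟨⟨hle fun ε hε => ?_, hle fun ε hε => ?_, hle fun ε hε => ?_, hle fun ε hε => ?_⟩, fun ε hε => ?_⟩
  any_goals
    obtain ⟨w, ⟨⟨k1, k2, k3, k4⟩, _⟩, k5, k6⟩ := hb ε hε
    rw [abs_lt] at k5 k6
    linarith
  obtain ⟨w, ⟨_, hw⟩, k5, k6⟩ := hb (ε / 2) (by linarith)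
  obtain ⟨p, q, r, s, m1, m2, m3, m4, m5, m6, m7, m8, m9⟩ := hw (ε / 2) (by linarith)
  rw [abs_lt] at k5 k6
  exact ⟨p, q, r, s, m1, m2, m3, m4, by linarith, by linarith, by linarith, by linarith, m9⟩

theorem exists_isolated {C : Set Pt} (h1 : IsClosed C) (h2 : C.Nonempty) (h3 : C.Countable) :
    ∃ z ∈ C, ∃ ε > 0, ∀ w ∈ C, |w.1 - z.1| < ε → |w.2 - z.2| < ε → w = z := by
  by_contra hc
  push Not at hc
  have hp : Perfect C := by
    refine ⟨h1, fun x hx => ?_⟩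
    rw [accPt_iff_nhds]
    intro U hU
    obtain ⟨ε, hε, hU⟩ := Metric.mem_nhds_iff.1 hU
    obtain ⟨w, k1, k2, k3, k4⟩ := hc x hx ε hε
    refine ⟨w, ⟨hU ?_, k1⟩, k4⟩
    rw [Metric.mem_ball, Prod.dist_eq, Real.dist_eq, Real.dist_eq]
    exact max_lt k2 k3
  obtain ⟨F, hF1, hF2, hF3⟩ := hp.exists_nat_bool_injection h2
  have : Countable (ℕ → Bool) := by
    have : (Set.range F).Countable := h3.mono hF1
    have h4 : Countable (Set.range F) := this.to_subtype
    exact (Set.rangeFactorization_injective.2 hF3).countable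
  obtain ⟨e, he⟩ := exists_surjective_nat (ℕ → Bool)
  obtain ⟨n, hn⟩ := he fun n => !(e n n)
  have := congrFun hn n
  simp at this

/-- C4 -/
theorem Closed.C4 [Finite L] [Finite ι] (hS : Closed σ S) {f : Pt → L} (hf : HM σ f) {a b c d : ℝ} {c0 c1 : L}
    (hlow : ∀ z ∈ badS S σ f a b c d, ∀ x y, a < x → x < z.1 → c < y → y < z.2 → σ.eqv (f (x, y)) c0)
    (hup : ∀ z ∈ badS S σ f a b c d, ∀ x y, z.1 < x → x < b → z.2 < y → y < d → σ.eqv (f (x, y)) c1)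
    (hct : (badS S σ f a b c d).Countable) : Gd S σ f a b c d := by
  by_contra hng
  have hne : (badS S σ f a b c d).Nonempty := by
    by_contra hne
    exact hng (hS.of_noBad hf fun z hz => hne ⟨z, hz⟩)
  obtain ⟨z, hz, ε, hε, hiso⟩ := exists_isolated badS_closed hne hct
  obtain ⟨p, q, r, s, m1, m2, m3, m4, m5, m6, m7, m8, m9⟩ := hz.2 ε hε
  have sub : ∀ a2 b2 c2 d2, p ≤ a2 → b2 ≤ q → r ≤ c2 → d2 ≤ s →
      ¬ (a2 ≤ z.1 ∧ z.1 ≤ b2 ∧ c2 ≤ z.2 ∧ z.2 ≤ d2) → Gd S σ f a2 b2 c2 d2 := by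
    intro a2 b2 c2 d2 k1 k2 k3 k4 k5
    refine hS.of_noBad hf fun w hw => k5 ?_
    have hw' := hw
    obtain ⟨⟨n1, n2, n3, n4⟩, _⟩ := hw'
    have := hiso w (badS_mono (by linarith) (by linarith) (by linarith) (by linarith) hw)
      (abs_lt.2 ⟨by linarith, by linarith⟩) (abs_lt.2 ⟨by linarith, by linarith⟩)
    subst this
    exact ⟨n1, n2, n3, n4⟩
  by_cases hin : p ≤ z.1 ∧ z.1 ≤ q ∧ r ≤ z.2 ∧ z.2 ≤ s
  · obtain ⟨k1, k2, k3, k4⟩ := hin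
    refine m9 (hS.cut4 hf k1 k2 k3 k4 ?_ ?_ ?_ ?_)
    · exact hS.C2 hf fun x y n1 n2 n3 n4 => hlow z hz x y (by linarith) n2 (by linarith) n4
    · intro h1 h2
      refine hS.C3 hf {g | z.1 < g.1 ∧ g.1 ≤ q ∧ r ≤ g.2 ∧ g.2 < z.2} (fun g hg => ⟨hg.1, hg.2.2.2⟩) ?_ ?_ ?_ ?_
        (q, r) ⟨h1, le_rfl, le_rfl, h2⟩ h1 h2
      · intro δ hδ
        refine ⟨(min q (z.1 + δ / 2), max r (z.2 - δ / 2)), ⟨?_, ?_, ?_, ?_⟩, ?_, ?_⟩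
        · exact lt_min h1 (by linarith)
        · exact min_le_left _ _
        · exact le_max_left _ _
        · exact max_lt h2 (by linarith)
        · exact (min_le_right _ _).trans_lt (by linarith)
        · exact lt_of_lt_of_le (by linarith) (le_max_right _ _)
      all_goals
        rintro g ⟨g1, g2, g3, g4⟩ h ⟨h1, h2, h3, h4⟩ h5 h6
        refine sub _ _ _ _ (by linarith) (by linarith) (by linarith) (by linarith) fun h7 => ?_
        linarith [h7.1, h7.2.1, h7.2.2.1, h7.2.2.2]
    · intro h1 h2
      refine hS.C3' hf {g | p ≤ g.1 ∧ g.1 < z.1 ∧ z.2 < g.2 ∧ g.2 ≤ s} (fun g hg => ⟨hg.2.1, hg.2.2.1⟩) ?_ ?_ ?_ ?_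
        (p, s) ⟨le_rfl, h1, h2, le_rfl⟩ h1 h2
      · intro δ hδ
        refine ⟨(max p (z.1 - δ / 2), min s (z.2 + δ / 2)), ⟨?_, ?_, ?_, ?_⟩, ?_, ?_⟩
        · exact le_max_left _ _
        · exact max_lt h1 (by linarith)
        · exact lt_min h2 (by linarith)
        · exact min_le_left _ _
        · exact lt_of_lt_of_le (by linarith) (le_max_right _ _)
        · exact (min_le_right _ _).trans_lt (by linarith)
      all_goals
        rintro g ⟨g1, g2, g3, g4⟩ h ⟨h1, h2, h3, h4⟩ h5 h6
        refine sub _ _ _ _ (by linarith) (by linarith) (by linarith) (by linarith) fun h7 => ?_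
        linarith [h7.1, h7.2.1, h7.2.2.1, h7.2.2.2]
    · exact hS.C2 hf fun x y n1 n2 n3 n4 => hup z hz x y n1 (by linarith) n3 (by linarith)
  · exact m9 (sub p q r s le_rfl le_rfl le_rfl le_rfl hin)

/-! ### C5: countability -/
theorem line_countable {T : Set Pt} (h : ∀ z ∈ T, ∀ z' ∈ T, z.2 = z'.2)
    (h3 : ∀ z ∈ T, ∀ z' ∈ T, ∀ z'' ∈ T, z.2 = z'.2 → z'.2 = z''.2 → z.1 < z'.1 → z'.1 < z''.1 → False) :
    T.Countable := by
  have : T ⊆ {z | z ∈ T ∧ ∀ w ∈ T, z.1 ≤ w.1} ∪ {z | z ∈ T ∧ ∀ w ∈ T, w.1 ≤ z.1} := by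
    intro z hz
    by_contra hc
    rw [Set.mem_union, not_or] at hc
    obtain ⟨k1, k2⟩ := hc
    have k1 : ¬ ∀ w ∈ T, z.1 ≤ w.1 := fun h => k1 ⟨hz, h⟩
    have k2 : ¬ ∀ w ∈ T, w.1 ≤ z.1 := fun h => k2 ⟨hz, h⟩
    push Not at k1 k2
    obtain ⟨w, hw, k1⟩ := k1
    obtain ⟨w', hw', k2⟩ := k2
    exact h3 w hw z hz w' hw' (h _ hw _ hz) (h _ hz _ hw') k1 k2
  refine Set.Countable.mono this (Set.Countable.union (Set.Subsingleton.countable ?_) (Set.Subsingleton.countable ?_))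
  · rintro z ⟨h1, h2⟩ w ⟨k1, k2⟩
    exact Prod.ext (le_antisymm (h2 w k1) (k2 z h1)) (h _ h1 _ k1)
  · rintro z ⟨h1, h2⟩ w ⟨k1, k2⟩
    exact Prod.ext (le_antisymm (k2 z h1) (h2 w k1)) (h _ h1 _ k1)

theorem ray_countable {T : Set Pt} (Q : ℝ → ℝ → Prop) (h1 : ∀ z ∈ T, ∃ r : ℚ, (r : ℝ) < z.1 ∧ Q r z.2)
    (h2 : ∀ z ∈ T, ∀ z' ∈ T, ∀ r : ℚ, (r : ℝ) < z.1 → (r : ℝ) < z'.1 → Q r z.2 → Q r z'.2 → ¬ z.2 < z'.2)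
    (h3 : ∀ z ∈ T, ∀ z' ∈ T, ∀ z'' ∈ T, z.2 = z'.2 → z'.2 = z''.2 → z.1 < z'.1 → z'.1 < z''.1 → False) :
    T.Countable := by
  have : T ⊆ ⋃ r : ℚ, {z | z ∈ T ∧ (r : ℝ) < z.1 ∧ Q r z.2} := fun z hz => by
    obtain ⟨r, h⟩ := h1 z hz
    exact Set.mem_iUnion.2 ⟨r, hz, h⟩
  refine Set.Countable.mono this (Set.countable_iUnion fun r => line_countable ?_ ?_)
  · rintro z ⟨k1, k2, k3⟩ w ⟨m1, m2, m3⟩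
    rcases lt_trichotomy z.2 w.2 with h | h | h
    · exact absurd h (h2 z k1 w m1 r k2 m2 k3 m3)
    · exact h
    · exact absurd h (h2 w m1 z k1 r m2 k2 m3 k3)
  · rintro z ⟨k1, -⟩ w ⟨m1, -⟩ v ⟨n1, -⟩
    exact h3 z k1 w m1 v n1

end
end Temporal

namespace Temporal

/-! ### generic points -/
section
variable {L ι : Type} {σ : Sys L ι} {S : Beh L ι → Prop}

/-- the situation in the induction step of the completeness proof -/
structure Ctx (σ : Sys L ι) (S : Beh L ι → Prop) (f : Pt → L) (a b c d : ℝ) (c0 c1 : L) : Prop where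
  hS : Closed σ S
  hf : HM σ f
  hab : a < b
  hcd : c < d
  h0 : σ.eqv (f (a, c)) c0
  h1 : σ.eqv (f (b, d)) c1
  hne : ¬ σ.le c1 c0
  ih : ∀ a' b' c' d', a ≤ a' → a' ≤ b' → b' ≤ b → c ≤ c' → c' ≤ d' → d' ≤ d →
    (¬ σ.eqv (f (a', c')) c0 ∨ ¬ σ.eqv (f (b', d')) c1) → Gd S σ f a' b' c' d'

def genS (σ : Sys L ι) (f : Pt → L) (a b c d : ℝ) (c0 c1 : L) : Set Pt :=
  {z | (a < z.1 ∧ z.1 < b ∧ c < z.2 ∧ z.2 < d) ∧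
    (∀ x y, a ≤ x → c ≤ y → x ≤ z.1 → y ≤ z.2 → (x < z.1 ∨ y < z.2) → σ.eqv (f (x, y)) c0) ∧
    (∀ x y, x ≤ b → y ≤ d → z.1 ≤ x → z.2 ≤ y → (z.1 < x ∨ z.2 < y) → σ.eqv (f (x, y)) c1)}

variable {f : Pt → L} {a b c d : ℝ} {c0 c1 : L}

theorem Ctx.low (H : Ctx σ S f a b c d c0 c1) {z : Pt} (hz : z ∈ badS S σ f a b c d) {x y : ℝ}
    (h1 : a ≤ x) (h2 : x < z.1) (h3 : c ≤ y) (h4 : y < z.2) : σ.eqv (f (x, y)) c0 := by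
  obtain ⟨p, q, r, s, m1, m2, m3, m4, m5, m6, m7, m8, m9⟩ := hz.2 (min (z.1 - x) (z.2 - y))
    (lt_min (by linarith) (by linarith))
  have e1 := min_le_left (z.1 - x) (z.2 - y)
  have e2 := min_le_right (z.1 - x) (z.2 - y)
  have hpq : p < q := by by_contra h; exact m9 fun h' => absurd h' h
  have hrs : r < s := by by_contra h; exact m9 fun _ h' => absurd h' h
  have : σ.eqv (f (p, r)) c0 := by
    by_contra hc
    exact m9 (H.ih p q r s m1 hpq.le m2 m3 hrs.le m4 (Or.inl hc))
  exact H.hf.between H.h0 this h1 h3 (by simp only; linarith) (by simp only; linarith)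

theorem Ctx.up (H : Ctx σ S f a b c d c0 c1) {z : Pt} (hz : z ∈ badS S σ f a b c d) {x y : ℝ}
    (h1 : z.1 < x) (h2 : x ≤ b) (h3 : z.2 < y) (h4 : y ≤ d) : σ.eqv (f (x, y)) c1 := by
  obtain ⟨p, q, r, s, m1, m2, m3, m4, m5, m6, m7, m8, m9⟩ := hz.2 (min (x - z.1) (y - z.2))
    (lt_min (by linarith) (by linarith))
  have e1 := min_le_left (x - z.1) (y - z.2)
  have e2 := min_le_right (x - z.1) (y - z.2)
  have hpq : p < q := by by_contra h; exact m9 fun h' => absurd h' h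
  have hrs : r < s := by by_contra h; exact m9 fun _ h' => absurd h' h
  have : σ.eqv (f (q, s)) c1 := by
    by_contra hc
    exact m9 (H.ih p q r s m1 hpq.le m2 m3 hrs.le m4 (Or.inr hc))
  exact H.hf.between this H.h1 (by simp only; linarith) (by simp only; linarith) h2 h4

theorem Ctx.noH [Finite L] (H : Ctx σ S f a b c d c0 c1) {z z' z'' : Pt} (hz : z ∈ badS S σ f a b c d)
    (hz' : z' ∈ badS S σ f a b c d) (hz'' : z'' ∈ badS S σ f a b c d) (e1 : z.2 = z'.2) (e2 : z'.2 = z''.2)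
    (l1 : z.1 < z'.1) (l2 : z'.1 < z''.1) : False := by
  obtain ⟨p, q, r, s, m1, m2, m3, m4, m5, m6, m7, m8, m9⟩ := hz'.2 (min (z'.1 - z.1) (z''.1 - z'.1))
    (lt_min (by linarith) (by linarith))
  have k1 := min_le_left (z'.1 - z.1) (z''.1 - z'.1)
  have k2 := min_le_right (z'.1 - z.1) (z''.1 - z'.1)
  have lo : ∀ s', s' ≤ z'.2 → Gd S σ f p q r s' := fun s' hs' =>
    H.hS.C2 (e := c0) H.hf fun x y n1 n2 n3 n4 =>
      H.low hz'' (by linarith) (by linarith) (by linarith) (by linarith)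
  have hi : ∀ r', z'.2 ≤ r' → Gd S σ f p q r' s := fun r' hr' =>
    H.hS.C2 (e := c1) H.hf fun x y n1 n2 n3 n4 =>
      H.up hz (by linarith) (by linarith) (by linarith) (by linarith)
  rcases le_total s z'.2 with h | h
  · exact m9 (lo s h)
  · rcases le_total z'.2 r with h' | h'
    · exact m9 (hi r h')
    · exact m9 (H.hS.cutH H.hf h' h (lo _ le_rfl) (hi _ le_rfl))

theorem Ctx.noV [Finite L] (H : Ctx σ S f a b c d c0 c1) {z z' z'' : Pt} (hz : z ∈ badS S σ f a b c d)
    (hz' : z' ∈ badS S σ f a b c d) (hz'' : z'' ∈ badS S σ f a b c d) (e1 : z.1 = z'.1) (e2 : z'.1 = z''.1)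
    (l1 : z.2 < z'.2) (l2 : z'.2 < z''.2) : False := by
  obtain ⟨p, q, r, s, m1, m2, m3, m4, m5, m6, m7, m8, m9⟩ := hz'.2 (min (z'.2 - z.2) (z''.2 - z'.2))
    (lt_min (by linarith) (by linarith))
  have k1 := min_le_left (z'.2 - z.2) (z''.2 - z'.2)
  have k2 := min_le_right (z'.2 - z.2) (z''.2 - z'.2)
  have lo : ∀ s', s' ≤ z'.1 → Gd S σ f p s' r s := fun s' hs' =>
    H.hS.C2 (e := c0) H.hf fun x y n1 n2 n3 n4 =>
      H.low hz'' (by linarith) (by linarith) (by linarith) (by linarith)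
  have hi : ∀ r', z'.1 ≤ r' → Gd S σ f r' q r s := fun r' hr' =>
    H.hS.C2 (e := c1) H.hf fun x y n1 n2 n3 n4 =>
      H.up hz (by linarith) (by linarith) (by linarith) (by linarith)
  rcases le_total q z'.1 with h | h
  · exact m9 (lo q h)
  · rcases le_total z'.1 p with h' | h'
    · exact m9 (hi p h')
    · exact m9 (H.hS.cutV H.hf h' h (lo _ le_rfl) (hi _ le_rfl))

theorem countable_swap {T : Set Pt} (h : {z : Pt | z.swap ∈ T}.Countable) : T.Countable := by
  have : T = Prod.swap '' {z : Pt | z.swap ∈ T} := by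
    ext z
    constructor
    · intro hz; exact ⟨z.swap, by simpa using hz, by simp⟩
    · rintro ⟨w, hw, rfl⟩; exact hw
  rw [this]; exact h.image _

theorem countable_neg {T : Set Pt} (h : {z : Pt | (-z.1, -z.2) ∈ T}.Countable) : T.Countable := by
  have : T = (fun z : Pt => ((-z.1, -z.2) : Pt)) '' {z : Pt | (-z.1, -z.2) ∈ T} := by
    ext z
    constructor
    · intro hz; exact ⟨(-z.1, -z.2), by simpa using hz, by simp⟩
    · rintro ⟨w, hw, rfl⟩; exact hw
  rw [this]; exact h.image _

theorem Ctx.bad_countable [Finite L] (H : Ctx σ S f a b c d c0 c1) :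
    (badS S σ f a b c d \ genS σ f a b c d c0 c1).Countable := by
  set T := badS S σ f a b c d with hT
  have lineH : ∀ y, {z | z ∈ T ∧ z.2 = y}.Countable := fun y =>
    line_countable (fun z hz z' hz' => hz.2.trans hz'.2.symm)
      fun z hz z' hz' z'' hz'' => H.noH hz.1 hz'.1 hz''.1
  have lineV : ∀ x, {z | z ∈ T ∧ z.1 = x}.Countable := fun x =>
    countable_swap <| line_countable (fun z hz z' hz' => hz.2.trans hz'.2.symm)
      fun z hz z' hz' z'' hz'' => H.noV hz.1 hz'.1 hz''.1
  have dn : ∀ {x y x' y' : ℝ}, x ≤ x' → y ≤ y' → a ≤ x → c ≤ y → ¬ σ.eqv (f (x, y)) c0 → ¬ σ.eqv (f (x', y')) c0 :=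
    fun h1 h2 h3 h4 h5 h6 => h5 (H.hf.between H.h0 h6 h3 h4 h1 h2)
  have upp : ∀ {x y x' y' : ℝ}, x' ≤ x → y' ≤ y → x ≤ b → y ≤ d → ¬ σ.eqv (f (x, y)) c1 → ¬ σ.eqv (f (x', y')) c1 :=
    fun h1 h2 h3 h4 h5 h6 => h5 (H.hf.between h6 H.h1 h1 h2 h3 h4)
  have rL : {z | z ∈ T ∧ ∃ r, a ≤ r ∧ r < z.1 ∧ ¬ σ.eqv (f (r, z.2)) c0}.Countable := by
    refine ray_countable (fun r y => a ≤ r ∧ ¬ σ.eqv (f (r, y)) c0) ?_ ?_ ?_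
    · rintro z ⟨hz, r, h1, h2, h3⟩
      obtain ⟨q, hq1, hq2⟩ := exists_rat_btwn h2
      exact ⟨q, hq2, h1.trans hq1.le, dn hq1.le le_rfl h1 hz.1.2.2.1 h3⟩
    · rintro z ⟨hz, -⟩ z' ⟨hz', -⟩ r h1 h2 ⟨h3, h3'⟩ ⟨h4, h4'⟩ h5
      exact h3' (H.low hz' h3 h2 hz.1.2.2.1 h5)
    · exact fun z hz z' hz' z'' hz'' => H.noH hz.1 hz'.1 hz''.1
  have rD : {z | z ∈ T ∧ ∃ r, c ≤ r ∧ r < z.2 ∧ ¬ σ.eqv (f (z.1, r)) c0}.Countable := by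
    refine countable_swap <| ray_countable (fun r x => c ≤ r ∧ ¬ σ.eqv (f (x, r)) c0) ?_ ?_ ?_
    · rintro z ⟨hz, r, h1, h2, h3⟩
      obtain ⟨q, hq1, hq2⟩ := exists_rat_btwn h2
      exact ⟨q, hq2, h1.trans hq1.le, dn le_rfl hq1.le hz.1.1 h1 h3⟩
    · rintro z ⟨hz, -⟩ z' ⟨hz', -⟩ r h1 h2 ⟨h3, h3'⟩ ⟨h4, h4'⟩ h5
      exact h3' (H.low hz' hz.1.1 h5 h3 h2)
    · exact fun z hz z' hz' z'' hz'' => H.noV hz.1 hz'.1 hz''.1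
  have rR : {z | z ∈ T ∧ ∃ r, r ≤ b ∧ z.1 < r ∧ ¬ σ.eqv (f (r, z.2)) c1}.Countable := by
    refine countable_neg <| ray_countable (fun r y => -r ≤ b ∧ ¬ σ.eqv (f (-r, -y)) c1) ?_ ?_ ?_
    · rintro z ⟨hz, r, h1, h2, h3⟩
      obtain ⟨q, hq1, hq2⟩ := exists_rat_btwn h2
      refine ⟨-q, by push_cast; simp only at hq1; linarith, ?_, ?_⟩
      · push_cast; linarith
      · push_cast; rw [neg_neg]
        exact upp hq2.le le_rfl h1 hz.1.2.2.2 h3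
    · rintro z ⟨hz, -⟩ z' ⟨hz', -⟩ r h1 h2 ⟨h3, h3'⟩ ⟨h4, h4'⟩ h5
      exact h3' (H.up hz' (by simp only; linarith) h3 (by simp only; linarith) hz.1.2.2.2)
    · intro z hz z' hz' z'' hz'' e1 e2 h1 h2
      exact H.noH hz''.1 hz'.1 hz.1 (by simp only [e2]) (by simp only [e1]) (by simp only; linarith) (by simp only; linarith)
  have rU : {z | z ∈ T ∧ ∃ r, r ≤ d ∧ z.2 < r ∧ ¬ σ.eqv (f (z.1, r)) c1}.Countable := by
    refine countable_swap <| countable_neg <| ray_countable (fun r x => -r ≤ d ∧ ¬ σ.eqv (f (-x, -r)) c1) ?_ ?_ ?_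
    · rintro z ⟨hz, r, h1, h2, h3⟩
      obtain ⟨q, hq1, hq2⟩ := exists_rat_btwn h2
      refine ⟨-q, by push_cast; simp only [Prod.snd_swap] at hq1; linarith, ?_, ?_⟩
      · push_cast; linarith
      · push_cast; rw [neg_neg]
        exact upp le_rfl hq2.le hz.1.2.1 h1 h3
    · rintro z ⟨hz, -⟩ z' ⟨hz', -⟩ r h1 h2 ⟨h3, h3'⟩ ⟨h4, h4'⟩ h5
      exact h3' (H.up hz' (by simp only [Prod.fst_swap]; linarith) hz.1.2.1 (by simp only [Prod.snd_swap]; linarith) h3)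
    · intro z hz z' hz' z'' hz'' e1 e2 h1 h2
      exact H.noV hz''.1 hz'.1 hz.1 (by simp only [Prod.fst_swap, e2]) (by simp only [Prod.fst_swap, e1])
        (by simp only [Prod.snd_swap]; linarith) (by simp only [Prod.snd_swap]; linarith)
  refine Set.Countable.mono ?_ ((((lineH c).union (lineH d)).union ((lineV a).union (lineV b))).union
    ((rL.union rD).union (rR.union rU)))
  rintro z ⟨hz, hg⟩
  obtain ⟨k1, k2, k3, k4⟩ := hz.1
  by_contra hc
  simp only [Set.mem_union, Set.mem_ofPred_eq, not_or] at hc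
  obtain ⟨⟨⟨n1, n2⟩, n3, n4⟩, ⟨n5, n6⟩, n7, n8⟩ := hc
  have q1 : z.2 ≠ c := fun h => n1 ⟨hz, h⟩
  have q2 : z.2 ≠ d := fun h => n2 ⟨hz, h⟩
  have q3 : z.1 ≠ a := fun h => n3 ⟨hz, h⟩
  have q4 : z.1 ≠ b := fun h => n4 ⟨hz, h⟩
  have q5 : ∀ r, a ≤ r → r < z.1 → σ.eqv (f (r, z.2)) c0 := fun r h1 h2 => by
    by_contra h; exact n5 ⟨hz, r, h1, h2, h⟩
  have q6 : ∀ r, c ≤ r → r < z.2 → σ.eqv (f (z.1, r)) c0 := fun r h1 h2 => by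
    by_contra h; exact n6 ⟨hz, r, h1, h2, h⟩
  have q7 : ∀ r, r ≤ b → z.1 < r → σ.eqv (f (r, z.2)) c1 := fun r h1 h2 => by
    by_contra h; exact n7 ⟨hz, r, h1, h2, h⟩
  have q8 : ∀ r, r ≤ d → z.2 < r → σ.eqv (f (z.1, r)) c1 := fun r h1 h2 => by
    by_contra h; exact n8 ⟨hz, r, h1, h2, h⟩
  refine hg ⟨⟨lt_of_le_of_ne k1 q3.symm, lt_of_le_of_ne k2 q4, lt_of_le_of_ne k3 q1.symm, lt_of_le_of_ne k4 q2⟩, ?_, ?_⟩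
  · intro x y h1 h2 h3 h4 h5
    rcases h3.lt_or_eq with h3 | h3
    · exact H.hf.between H.h0 (q5 x h1 h3) h1 h2 le_rfl h4
    · subst h3
      exact q6 y h2 (h5.resolve_left (lt_irrefl _))
  · intro x y h1 h2 h3 h4 h5
    rcases h3.lt_or_eq with h3 | h3
    · exact H.hf.between (q7 x h1 h3) H.h1 le_rfl h4 h1 h2
    · subst h3
      exact q8 y h2 (h5.resolve_left (lt_irrefl _))

/-- boxes with countably many generic points are good -/
theorem Ctx.gdC [Finite L] [Finite ι] (H : Ctx σ S f a b c d c0 c1) {a' b' c' d' : ℝ} (h1 : a ≤ a') (h2 : b' ≤ b)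
    (h3 : c ≤ c') (h4 : d' ≤ d)
    (hc : {g | g ∈ genS σ f a b c d c0 c1 ∧ a' ≤ g.1 ∧ g.1 ≤ b' ∧ c' ≤ g.2 ∧ g.2 ≤ d'}.Countable) :
    Gd S σ f a' b' c' d' := by
  have hm := badS_mono (S := S) (σ := σ) (f := f) h1 h2 h3 h4
  refine H.hS.C4 (c0 := c0) (c1 := c1) H.hf ?_ ?_ ?_
  · intro z hz x y k1 k2 k3 k4
    exact H.low (hm hz) (by linarith) k2 (by linarith) k4
  · intro z hz x y k1 k2 k3 k4
    exact H.up (hm hz) k1 (by linarith) k3 (by linarith)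
  · refine Set.Countable.mono ?_ (H.bad_countable.union hc)
    intro z hz
    by_cases hg : z ∈ genS σ f a b c d c0 c1
    · exact Or.inr ⟨hg, hz.1⟩
    · exact Or.inl ⟨hm hz, hg⟩

theorem Ctx.anti (H : Ctx σ S f a b c d c0 c1) {u v : Pt} (hu : u ∈ genS σ f a b c d c0 c1)
    (hv : v ∈ genS σ f a b c d c0 c1) (h1 : u.1 ≤ v.1) (h2 : u.2 ≤ v.2) : u = v := by
  by_contra hne
  have hlt : u.1 < v.1 ∨ u.2 < v.2 := by
    by_contra h
    push Not at h
    exact hne (Prod.ext (le_antisymm h1 h.1) (le_antisymm h2 h.2))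
  obtain ⟨⟨u1, u2, u3, u4⟩, u5, u6⟩ := hu
  obtain ⟨⟨v1, v2, v3, v4⟩, v5, v6⟩ := hv
  have e0 := v5 ((u.1 + v.1) / 2) ((u.2 + v.2) / 2) (by linarith) (by linarith) (by linarith) (by linarith)
    (by rcases hlt with h | h; exact Or.inl (by linarith); exact Or.inr (by linarith))
  have e1 := u6 ((u.1 + v.1) / 2) ((u.2 + v.2) / 2) (by linarith) (by linarith) (by linarith) (by linarith)
    (by rcases hlt with h | h; exact Or.inl (by linarith); exact Or.inr (by linarith))
  exact H.hne (σ.trans' e1.2 e0.1)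

/-- two generic points are weakly anti-ordered -/
theorem Ctx.tot (H : Ctx σ S f a b c d c0 c1) {u v : Pt} (hu : u ∈ genS σ f a b c d c0 c1)
    (hv : v ∈ genS σ f a b c d c0 c1) : (u.1 ≤ v.1 ∧ v.2 ≤ u.2) ∨ (v.1 ≤ u.1 ∧ u.2 ≤ v.2) := by
  rcases le_total u.1 v.1 with h | h <;> rcases le_total u.2 v.2 with h' | h'
  · have := H.anti hu hv h h'; subst this; exact Or.inl ⟨le_rfl, le_rfl⟩
  · exact Or.inl ⟨h, h'⟩
  · exact Or.inr ⟨h, h'⟩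
  · have := H.anti hv hu h h'; subst this; exact Or.inl ⟨le_rfl, le_rfl⟩

end
end Temporal

namespace Temporal

/-! ### C6: boxes spanned by generic points -/
section
variable {L ι : Type} {σ : Sys L ι} {S : Beh L ι → Prop}
variable {f : Pt → L} {a b c d : ℝ} {c0 c1 : L}

theorem ce_tr {g : ℝ → L} {x y : ℝ} {e : L} (hg : MonoI σ g x y) (hxy : x < y)
    (h : ∀ t, x ≤ t → t ≤ y → σ.eqv (g t) e) : CE σ (tr σ g x y) e :=
  ⟨g x, g y, h x le_rfl hxy.le, h y hxy.le le_rfl, tr_elem hg hxy fun t h1 h2 => h t h1.le h2.le⟩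

theorem Ctx.le0 (H : Ctx σ S f a b c d c0 c1) {x y : ℝ} (h1 : a ≤ x) (h2 : c ≤ y) : σ.le c0 (f (x, y)) :=
  σ.trans' H.h0.2 (H.hf.mono _ _ h1 h2)
theorem Ctx.le1 (H : Ctx σ S f a b c d c0 c1) {x y : ℝ} (h1 : x ≤ b) (h2 : y ≤ d) : σ.le (f (x, y)) c1 :=
  σ.trans' (H.hf.mono _ _ h1 h2) H.h1.1

theorem Ctx.tileGeo [Finite L] (H : Ctx σ S f a b c d c0 c1) {u v : Pt} (hu : u ∈ genS σ f a b c d c0 c1)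
    (hv : v ∈ genS σ f a b c d c0 c1) {lx ly rx ry : ℝ} (h1 : u.1 ≤ lx) (h2 : lx ≤ rx) (h3 : rx ≤ v.1)
    (h4 : v.2 ≤ ly) (h5 : ly ≤ u.2) (h6 : v.2 ≤ ry) (h7 : ry ≤ u.2)
    (hl0 : ∀ x y, a ≤ x → x < lx → c ≤ y → y ≤ ly → σ.eqv (f (x, y)) c0)
    (hl1 : ∀ y, ly < y → y ≤ d → σ.eqv (f (lx, y)) c1)
    (hr1 : ∀ x y, rx < x → x ≤ b → ry ≤ y → y ≤ d → σ.eqv (f (x, y)) c1)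
    (hr0 : ∀ y, c ≤ y → y < ry → σ.eqv (f (rx, y)) c0)
    {V : Beh L ι} (eV1 : V.lf = tr σ (fun y => f (lx, y)) c d) (eV2 : V.rt = tr σ (fun y => f (rx, y)) c d)
    (eV3 : CE σ V.bt c0) (eV4 : CE σ V.tp c1) :
    ∃ E0 E1, S E0 ∧ S E1 ∧ TileD σ c0 c1 V E0 E1 := by
  obtain ⟨⟨u1, u2, u3, u4⟩, u5, u6⟩ := hu
  obtain ⟨⟨v1, v2, v3, v4⟩, v5, v6⟩ := hv
  have hb : ∀ x, a ≤ x → x ≤ v.1 → σ.eqv (f (x, c)) c0 := fun x k1 k2 =>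
    v5 x c k1 le_rfl k2 v3.le (Or.inr v3)
  have ht : ∀ x, u.1 ≤ x → x ≤ b → σ.eqv (f (x, d)) c1 := fun x k1 k2 =>
    u6 x d k2 le_rfl k1 u4.le (Or.inr u4)
  have hr : ∀ y, v.2 ≤ y → y ≤ d → σ.eqv (f (b, y)) c1 := fun y k1 k2 =>
    v6 b y le_rfl k2 v2.le k1 (Or.inl v2)
  have hl : ∀ y, c ≤ y → y ≤ u.2 → σ.eqv (f (a, y)) c0 := fun y k1 k2 =>
    u5 a y le_rfl k1 u1.le k2 (Or.inl u1)
  refine ⟨behS σ f a lx c ly, behS σ f rx b ry d, ?_, ?_, ?_⟩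
  · exact H.hS.C2 (e := c0) H.hf (fun x y k1 k2 k3 k4 => hl0 x y k1.le k2 k3.le k4.le) (by linarith) (by linarith)
  · exact H.hS.C2 (e := c1) H.hf (fun x y k1 k2 k3 k4 => hr1 x y k1 k2.le k3.le k4.le) (by linarith) (by linarith)
  refine ⟨?_, ?_, eV3, eV4, ?_, ?_, ?_, ?_⟩
  · exact ce_tr (H.hf.monoV _ _ _) (by linarith) fun t k1 k2 => hl t k1 (by linarith)
  · exact ce_tr (H.hf.monoH _ _ _) (by linarith) fun t k1 k2 => hb t k1 (by linarith)
  · exact ce_tr (H.hf.monoV _ _ _) (by linarith) fun t k1 k2 => hr t (by linarith) k2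
  · exact ce_tr (H.hf.monoH _ _ _) (by linarith) fun t k1 k2 => ht t (by linarith) k2
  · refine ⟨f (lx, ly), f (a, ly), f (lx, d), H.le0 (by linarith) (by linarith), H.le1 (by linarith) (by linarith),
      hl _ (by linarith) h5, ht _ h1 (by linarith), ?_, ?_⟩
    · exact tr_elem (H.hf.monoH _ _ _) (by linarith) fun x k1 k2 => hl0 x ly k1.le k2 (by linarith) le_rfl
    · rw [eV1, tr_conc (H.hf.monoV _ _ _) (m := ly) (by linarith) (by linarith),
        tr_elem (H.hf.monoV lx ly d) (by linarith) fun y k1 k2 => hl1 y k1 k2.le]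
      rfl
  · refine ⟨f (rx, ry), f (rx, c), f (b, ry), H.le0 (by linarith) (by linarith), H.le1 (by linarith) (by linarith),
      hb _ (by linarith) h3, hr _ h6 (by linarith), ?_, ?_⟩
    · exact tr_elem (H.hf.monoH _ _ _) (by linarith) fun x k1 k2 => hr1 x ry k1 k2.le le_rfl (by linarith)
    · rw [eV2, tr_conc (H.hf.monoV _ _ _) (m := ry) (by linarith) (by linarith),
        tr_elem (H.hf.monoV rx c ry) (by linarith) fun y k1 k2 => hr0 y k1.le k2]
      rfl

theorem Ctx.tile [Finite L] [Finite ι] (H : Ctx σ S f a b c d c0 c1) {u v : Pt} (hu : u ∈ genS σ f a b c d c0 c1)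
    (hv : v ∈ genS σ f a b c d c0 c1) {q : Pt} (h1 : u.1 ≤ q.1) (h2 : q.1 ≤ v.1) (h3 : v.2 ≤ q.2) (h4 : q.2 ≤ u.2)
    (hq : ∀ g ∈ genS σ f a b c d c0 c1, (g.1 ≤ q.1 ∧ q.2 ≤ g.2) ∨ (q.1 ≤ g.1 ∧ g.2 ≤ q.2)) :
    ∃ V E0 E1, (S V ∧ S E0 ∧ S E1 ∧ TileD σ c0 c1 V E0 E1) ∧ (∀ i, σ.wF (f q) i → V.rF i) ∧
      (∀ i, σ.wP (f q) i → V.rP i) := by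
  set G := genS σ f a b c d c0 c1 with hG
  obtain ⟨lx, hlx⟩ := Real.exists_isLUB (s := {x | ∃ g ∈ G, g.1 ≤ q.1 ∧ q.2 ≤ g.2 ∧ g.1 = x})
    ⟨u.1, u, hu, h1, h4, rfl⟩ ⟨q.1, by rintro x ⟨g, _, k, _, rfl⟩; exact k⟩
  obtain ⟨ly, hly⟩ := Real.exists_isGLB (s := {x | ∃ g ∈ G, g.1 ≤ q.1 ∧ q.2 ≤ g.2 ∧ g.2 = x})
    ⟨u.2, u, hu, h1, h4, rfl⟩ ⟨q.2, by rintro x ⟨g, _, _, k, rfl⟩; exact k⟩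
  obtain ⟨rx, hrx⟩ := Real.exists_isGLB (s := {x | ∃ g ∈ G, q.1 ≤ g.1 ∧ g.2 ≤ q.2 ∧ g.1 = x})
    ⟨v.1, v, hv, h2, h3, rfl⟩ ⟨q.1, by rintro x ⟨g, _, k, _, rfl⟩; exact k⟩
  obtain ⟨ry, hry⟩ := Real.exists_isLUB (s := {x | ∃ g ∈ G, q.1 ≤ g.1 ∧ g.2 ≤ q.2 ∧ g.2 = x})
    ⟨v.2, v, hv, h2, h3, rfl⟩ ⟨q.2, by rintro x ⟨g, _, _, k, rfl⟩; exact k⟩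
  have a1 : u.1 ≤ lx := hlx.1 ⟨u, hu, h1, h4, rfl⟩
  have a2 : lx ≤ q.1 := hlx.2 (by rintro x ⟨g, _, k, _, rfl⟩; exact k)
  have a3 : q.1 ≤ rx := hrx.2 (by rintro x ⟨g, _, k, _, rfl⟩; exact k)
  have a4 : rx ≤ v.1 := hrx.1 ⟨v, hv, h2, h3, rfl⟩
  have a5 : q.2 ≤ ly := hly.2 (by rintro x ⟨g, _, _, k, rfl⟩; exact k)
  have a6 : ly ≤ u.2 := hly.1 ⟨u, hu, h1, h4, rfl⟩
  have a7 : v.2 ≤ ry := hry.1 ⟨v, hv, h2, h3, rfl⟩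
  have a8 : ry ≤ q.2 := hry.2 (by rintro x ⟨g, _, _, k, rfl⟩; exact k)
  obtain ⟨⟨u1, u2, u3, u4⟩, u5, u6⟩ := hu
  obtain ⟨⟨v1, v2, v3, v4⟩, v5, v6⟩ := hv
  have hl0 : ∀ x y, a ≤ x → x < lx → c ≤ y → y ≤ ly → σ.eqv (f (x, y)) c0 := by
    intro x y k1 k2 k3 k4
    obtain ⟨_, ⟨g, hg, m1, m2, rfl⟩, hx⟩ := (lt_isLUB_iff hlx).1 k2
    exact hg.2.1 x y k1 k3 hx.le (k4.trans (hly.1 ⟨g, hg, m1, m2, rfl⟩)) (Or.inl hx)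
  have hl1 : ∀ y, ly < y → y ≤ d → σ.eqv (f (lx, y)) c1 := by
    intro y k1 k2
    obtain ⟨_, ⟨g, hg, m1, m2, rfl⟩, hx⟩ := (isGLB_lt_iff hly).1 k1
    exact hg.2.2 lx y (by linarith) k2 (hlx.1 ⟨g, hg, m1, m2, rfl⟩) hx.le (Or.inr hx)
  have hr1 : ∀ x y, rx < x → x ≤ b → ry ≤ y → y ≤ d → σ.eqv (f (x, y)) c1 := by
    intro x y k1 k2 k3 k4
    obtain ⟨_, ⟨g, hg, m1, m2, rfl⟩, hx⟩ := (isGLB_lt_iff hrx).1 k1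
    exact hg.2.2 x y k2 k4 hx.le ((hry.1 ⟨g, hg, m1, m2, rfl⟩ : g.2 ≤ ry).trans k3) (Or.inl hx)
  have hr0 : ∀ y, c ≤ y → y < ry → σ.eqv (f (rx, y)) c0 := by
    intro y k1 k2
    obtain ⟨_, ⟨g, hg, m1, m2, rfl⟩, hx⟩ := (lt_isLUB_iff hry).1 k2
    exact hg.2.1 rx y (by linarith) k1 (hrx.1 ⟨g, hg, m1, m2, rfl⟩) hx.le (Or.inr hx)
  have hb : ∀ x, a ≤ x → x ≤ v.1 → σ.eqv (f (x, c)) c0 := fun x k1 k2 =>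
    v5 x c k1 le_rfl k2 v3.le (Or.inr v3)
  have ht : ∀ x, u.1 ≤ x → x ≤ b → σ.eqv (f (x, d)) c1 := fun x k1 k2 =>
    u6 x d k2 le_rfl k1 u4.le (Or.inr u4)
  have geo := @Ctx.tileGeo L ι σ S f a b c d c0 c1 _ H u v ⟨⟨u1, u2, u3, u4⟩, u5, u6⟩ ⟨⟨v1, v2, v3, v4⟩, v5, v6⟩
    lx ly rx ry a1 (a2.trans a3) a4 (h3.trans a5) a6 a7 (a8.trans h4) hl0 hl1 hr1 hr0
  rcases (a2.trans a3).lt_or_eq with hlr | hlr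
  · have hV : S (behS σ f lx rx c d) := by
      refine H.gdC (by linarith) (by linarith) le_rfl le_rfl ?_ hlr H.hcd
      have sub : {g | g ∈ G ∧ lx ≤ g.1 ∧ g.1 ≤ rx ∧ c ≤ g.2 ∧ g.2 ≤ d} ⊆ {g | g ∈ G ∧ g.1 = lx} ∪ {g | g ∈ G ∧ g.1 = rx} := by
        rintro g ⟨hg, m1, m2, -, -⟩
        rcases hq g hg with k | k
        · exact Or.inl ⟨hg, le_antisymm (hlx.1 ⟨g, hg, k.1, k.2, rfl⟩) m1⟩
        · exact Or.inr ⟨hg, le_antisymm m2 (hrx.1 ⟨g, hg, k.1, k.2, rfl⟩)⟩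
      have ss : ∀ x, {g | g ∈ G ∧ g.1 = x}.Countable := fun x => by
        refine Set.Subsingleton.countable ?_
        rintro g ⟨hg, e⟩ g' ⟨hg', e'⟩
        rcases le_total g.2 g'.2 with h | h
        · exact H.anti hg hg' (e.trans e'.symm).le h
        · exact (H.anti hg' hg (e'.trans e.symm).le h).symm
      exact Set.Countable.mono sub ((ss _).union (ss _))
    obtain ⟨E0, E1, k1, k2, k3⟩ := geo (V := behS σ f lx rx c d) rfl rfl
      (ce_tr (H.hf.monoH _ _ _) hlr fun t k1 k2 => hb t (by linarith) (by linarith))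
      (ce_tr (H.hf.monoH _ _ _) hlr fun t k1 k2 => ht t (by linarith) (by linarith))
    have hqin : q ∈ bx lx rx c d := ⟨a2, a3, by linarith, by linarith⟩
    exact ⟨_, E0, E1, ⟨hV, k1, k2, k3⟩, fun i hi => ⟨q, hqin, hi⟩, fun i hi => ⟨q, hqin, hi⟩⟩
  · have e1 : lx = q.1 := by linarith
    have e2 : rx = q.1 := by linarith
    have hV : S (behS σ (fun p => f (q.1, p.2)) 0 1 c d) := H.hS.cyl H.hf q.1 0 1 c d one_pos H.hcd
    have hm := H.hf.cyl q.1
    obtain ⟨E0, E1, k1, k2, k3⟩ := geo (V := behS σ (fun p => f (q.1, p.2)) 0 1 c d) (by rw [e1]; rfl) (by rw [e2]; rfl)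
      (ce_tr (hm.monoH _ _ _) one_pos fun t k1 k2 => hb _ (by linarith) (by linarith))
      (ce_tr (hm.monoH _ _ _) one_pos fun t k1 k2 => ht _ (by linarith) (by linarith))
    have hqin : ((0, q.2) : Pt) ∈ bx 0 1 c d := ⟨le_rfl, zero_le_one, by simp only; linarith, by simp only; linarith⟩
    exact ⟨_, E0, E1, ⟨hV, k1, k2, k3⟩, fun i hi => ⟨_, hqin, hi⟩, fun i hi => ⟨_, hqin, hi⟩⟩

theorem HM.demP {f : Pt → L} (h : HM σ f) {p : Pt} {i : ι} {a c : ℝ} (hA : σ.B (f p) i) (h1 : a ≤ p.1)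
    (h2 : c ≤ p.2) : ∃ q : Pt, q.1 ≤ p.1 ∧ q.2 ≤ p.2 ∧ a ≤ q.1 ∧ c ≤ q.2 ∧ σ.B (f q) i ∧
    (σ.wP (f q) i ∨ q.1 = a ∨ q.2 = c) := by
  obtain ⟨q, k1, k2, k3, k4, k5, k6⟩ := h.refl.dem (p := (-p.1, -p.2)) (i := i) (b := -a) (d := -c)
    (by simp only [neg_neg]; exact hA) (by simpa using h1) (by simpa using h2)
  refine ⟨(-q.1, -q.2), by simp only at *; linarith, by simp only at *; linarith, by simp only; linarith,
    by simp only; linarith, k5, ?_⟩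
  rcases k6 with k | k | k
  · exact Or.inl k
  · exact Or.inr (Or.inl (by simp only; linarith))
  · exact Or.inr (Or.inr (by simp only; linarith))

/-- C6 -/
theorem Ctx.gdGen [Finite L] [Finite ι] (H : Ctx σ S f a b c d c0 c1) {u v : Pt} (hu : u ∈ genS σ f a b c d c0 c1)
    (hv : v ∈ genS σ f a b c d c0 c1) : Gd S σ f u.1 v.1 v.2 u.2 := by
  intro huv hvu
  have hu' := hu
  have hv' := hv
  obtain ⟨⟨u1, u2, u3, u4⟩, u5, u6⟩ := hu'
  obtain ⟨⟨v1, v2, v3, v4⟩, v5, v6⟩ := hv'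
  -- witnesses at generic points
  have gF : ∀ g ∈ genS σ f a b c d c0 c1, ∀ i, σ.A (f g) i → σ.wF (f g) i ∨ σ.A c1 i := by
    intro g hg i hA
    obtain ⟨q, k1, k2, k3, k4, k5, k6⟩ := H.hf.dem hA hg.1.2.1.le hg.1.2.2.2.le
    by_cases hlt : g.1 < q.1 ∨ g.2 < q.2
    · exact Or.inr ((hg.2.2 q.1 q.2 k3 k4 k1 k2 hlt).A k5)
    · push Not at hlt
      have e : q = g := Prod.ext (le_antisymm hlt.1 k1) (le_antisymm hlt.2 k2)
      subst e
      rcases k6 with k | k | k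
      · exact Or.inl k
      · exact absurd k hg.1.2.1.ne
      · exact absurd k hg.1.2.2.2.ne
  have gP : ∀ g ∈ genS σ f a b c d c0 c1, ∀ i, σ.B (f g) i → σ.wP (f g) i ∨ σ.B c0 i := by
    intro g hg i hA
    obtain ⟨q, k1, k2, k3, k4, k5, k6⟩ := H.hf.demP hA hg.1.1.le hg.1.2.2.1.le
    by_cases hlt : q.1 < g.1 ∨ q.2 < g.2
    · exact Or.inr ((hg.2.1 q.1 q.2 k3 k4 k1 k2 hlt).B k5)
    · push Not at hlt
      have e : q = g := Prod.ext (le_antisymm k1 hlt.1) (le_antisymm k2 hlt.2)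
      subst e
      rcases k6 with k | k | k
      · exact Or.inl k
      · exact absurd k hg.1.1.ne'
      · exact absurd k hg.1.2.2.1.ne'
  have tot := fun q (hq : q ∈ genS σ f a b c d c0 c1) g hg => H.tot (u := g) (v := q) hg hq
  have tg := fun q hq (h1 : u.1 ≤ q.1) (h2 : q.1 ≤ v.1) (h3 : v.2 ≤ q.2) (h4 : q.2 ≤ u.2) =>
    H.tile hu hv h1 h2 h3 h4 (tot q hq)
  have tn : ∀ q : Pt, u.1 ≤ q.1 → q.1 ≤ v.1 → v.2 ≤ q.2 → q.2 ≤ u.2 → ¬ σ.eqv (f q) c0 → ¬ σ.eqv (f q) c1 →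
      ∃ V E0 E1, (S V ∧ S E0 ∧ S E1 ∧ TileD σ c0 c1 V E0 E1) ∧ (∀ i, σ.wF (f q) i → V.rF i) ∧
      (∀ i, σ.wP (f q) i → V.rP i) := by
    intro q h1 h2 h3 h4 n0 n1
    refine H.tile hu hv h1 h2 h3 h4 fun g hg => ?_
    rcases le_total g.1 q.1 with h | h <;> rcases le_total g.2 q.2 with h' | h'
    · by_cases hlt : g.1 < q.1 ∨ g.2 < q.2
      · exact absurd (hg.2.2 q.1 q.2 (by linarith) (by linarith) h h' hlt) n1
      · push Not at hlt; exact Or.inl ⟨h, hlt.2⟩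
    · exact Or.inl ⟨h, h'⟩
    · exact Or.inr ⟨h, h'⟩
    · by_cases hlt : q.1 < g.1 ∨ q.2 < g.2
      · exact absurd (hg.2.1 q.1 q.2 (by linarith) (by linarith) h h' hlt) n0
      · push Not at hlt; exact Or.inr ⟨h, hlt.2⟩
  have k0 : σ.eqv (f (u.1, v.2)) c0 := u5 _ _ u1.le v3.le le_rfl hvu.le (Or.inr hvu)
  have k1 : σ.eqv (f (v.1, u.2)) c1 := u6 _ _ v2.le u4.le huv.le le_rfl (Or.inl huv)
  refine H.hS.shuf c0 c1 (f u) (f u) (f v) (f (u.1, v.2)) (f (v.1, u.2)) _ ⟨⟨?_, ?_, ?_, ?_, ?_, ?_, H.hne, k0, k1⟩,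
    gF u hu, gP u hu, ⟨?_, ?_, ?_, ?_⟩, ?_, ?_, ?_⟩
  · exact H.le0 u1.le u3.le
  · exact H.le1 u2.le u4.le
  · exact H.le0 u1.le u3.le
  · exact H.le1 u2.le u4.le
  · exact H.le0 v1.le v3.le
  · exact H.le1 v2.le v4.le
  · exact tr_elem (H.hf.monoV _ _ _) hvu fun y m1 m2 => u5 _ _ u1.le (by linarith) le_rfl m2.le (Or.inr m2)
  · exact tr_elem (H.hf.monoH _ _ _) huv fun x m1 m2 => v5 _ _ (by linarith) v3.le m2.le le_rfl (Or.inl m2)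
  · exact tr_elem (H.hf.monoH _ _ _) huv fun x m1 m2 => u6 _ _ (by linarith) u4.le m1.le le_rfl (Or.inl m1)
  · exact tr_elem (H.hf.monoV _ _ _) hvu fun y m1 m2 => v6 _ _ v2.le (by linarith) le_rfl m1.le (Or.inr m1)
  · obtain ⟨V, E0, E1, ⟨m1, m2, m3, m4⟩, -⟩ := tg u hu le_rfl huv.le hvu.le le_rfl
    exact ⟨V, E0, E1, m1, m2, m3, m4⟩
  · intro i hi
    have key : ∃ q : Pt, (u.1 ≤ q.1 ∧ q.1 ≤ v.1 ∧ v.2 ≤ q.2 ∧ q.2 ≤ u.2) ∧ σ.wF (f q) i ∧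
        ((¬ σ.eqv (f q) c0 ∧ ¬ σ.eqv (f q) c1) ∨ q ∈ genS σ f a b c d c0 c1) := by
      rcases hi with ⟨n1, n2, n3⟩ | ⟨⟨q, hq, hw⟩, hn⟩
      · obtain ⟨q, m1, m2, m3, m4, m5, m6⟩ := H.hf.dem (k0.symm.A n1) huv.le hvu.le
        have hq1 : ¬ σ.eqv (f q) c1 := fun h => n3 (h.A m5)
        rcases m6 with m | m | m
        · exact ⟨q, ⟨m1, m3, m2, m4⟩, m, Or.inl ⟨fun h => n2 (h.WF (Sys.WF_of m)), hq1⟩⟩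
        · have e : q = v := by
            refine Prod.ext m (le_antisymm ?_ m2)
            by_contra hlt
            push Not at hlt
            exact hq1 (v6 q.1 q.2 (by linarith) (by linarith) m.ge m2 (Or.inr hlt))
          subst e
          exact ⟨q, ⟨m1, m3, m2, m4⟩, (gF q hv i m5).resolve_right n3, Or.inr hv⟩
        · have e : q = u := by
            refine Prod.ext (le_antisymm ?_ m1) m
            by_contra hlt
            push Not at hlt
            exact hq1 (u6 q.1 q.2 (by linarith) (by linarith) m1 m.ge (Or.inl hlt))
          subst e
          exact ⟨q, ⟨m1, m3, m2, m4⟩, (gF q hu i m5).resolve_right n3, Or.inr hu⟩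
      · exact ⟨q, ⟨hq.1, hq.2.1, hq.2.2.1, hq.2.2.2⟩, hw, Or.inl ⟨fun h => hn (Or.inl (h.WF (Sys.WF_of hw))),
          fun h => hn (Or.inr (Or.inl (h.WF (Sys.WF_of hw))))⟩⟩
    obtain ⟨q, ⟨m1, m2, m3, m4⟩, hw, hq | hq⟩ := key
    · obtain ⟨V, E0, E1, ⟨n1, n2, n3, n4⟩, n5, n6⟩ := tn q m1 m2 m3 m4 hq.1 hq.2
      exact ⟨V, E0, E1, n1, n2, n3, n4, n5 i hw⟩
    · obtain ⟨V, E0, E1, ⟨n1, n2, n3, n4⟩, n5, n6⟩ := tg q hq m1 m2 m3 m4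
      exact ⟨V, E0, E1, n1, n2, n3, n4, n5 i hw⟩
  · intro i hi
    have key : ∃ q : Pt, (u.1 ≤ q.1 ∧ q.1 ≤ v.1 ∧ v.2 ≤ q.2 ∧ q.2 ≤ u.2) ∧ σ.wP (f q) i ∧
        ((¬ σ.eqv (f q) c0 ∧ ¬ σ.eqv (f q) c1) ∨ q ∈ genS σ f a b c d c0 c1) := by
      rcases hi with ⟨n1, n2, n3⟩ | ⟨⟨q, hq, hw⟩, hn⟩
      · rw [Sys.WF_dual] at n2
        obtain ⟨q, m1, m2, m3, m4, m5, m6⟩ := H.hf.demP (k1.symm.B n1) huv.le hvu.le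
        have hq1 : ¬ σ.eqv (f q) c0 := fun h => n3 (h.B m5)
        rcases m6 with m | m | m
        · exact ⟨q, ⟨m3, m1, m4, m2⟩, m, Or.inl ⟨hq1, fun h => n2 (h.WP (Sys.WP_of m))⟩⟩
        · have e : q = u := by
            refine Prod.ext m (le_antisymm m2 ?_)
            by_contra hlt
            push Not at hlt
            exact hq1 (u5 q.1 q.2 (by linarith) (by linarith) m.le m2 (Or.inr hlt))
          subst e
          exact ⟨q, ⟨m3, m1, m4, m2⟩, (gP q hu i m5).resolve_right n3, Or.inr hu⟩
        · have e : q = v := by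
            refine Prod.ext (le_antisymm m1 ?_) m
            by_contra hlt
            push Not at hlt
            exact hq1 (v5 q.1 q.2 (by linarith) (by linarith) m1 m.le (Or.inl hlt))
          subst e
          exact ⟨q, ⟨m3, m1, m4, m2⟩, (gP q hv i m5).resolve_right n3, Or.inr hv⟩
      · rw [Sys.WF_dual, Sys.WF_dual] at hn
        exact ⟨q, ⟨hq.1, hq.2.1, hq.2.2.1, hq.2.2.2⟩, hw, Or.inl ⟨fun h => hn (Or.inr (Or.inl (h.WP (Sys.WP_of hw)))),
          fun h => hn (Or.inl (h.WP (Sys.WP_of hw)))⟩⟩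
    obtain ⟨q, ⟨m1, m2, m3, m4⟩, hw, hq | hq⟩ := key
    · obtain ⟨V, E0, E1, ⟨n1, n2, n3, n4⟩, n5, n6⟩ := tn q m1 m2 m3 m4 hq.1 hq.2
      exact ⟨V, E0, E1, n1, n2, n3, n4, n6 i hw⟩
    · obtain ⟨V, E0, E1, ⟨n1, n2, n3, n4⟩, n5, n6⟩ := tg q hq m1 m2 m3 m4
      exact ⟨V, E0, E1, n1, n2, n3, n4, n6 i hw⟩

end
end Temporal

namespace Temporal

/-! ### C7 and completeness -/
section
variable {L ι : Type} {σ : Sys L ι} {S : Beh L ι → Prop}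
variable {f : Pt → L} {a b c d : ℝ} {c0 c1 : L}

theorem Ctx.gd [Finite L] [Finite ι] (H : Ctx σ S f a b c d c0 c1) : Gd S σ f a b c d := by
  set G := genS σ f a b c d c0 c1 with hG
  by_cases hne : G.Nonempty
  swap
  · refine H.gdC le_rfl le_rfl le_rfl le_rfl (Set.Subsingleton.countable ?_)
    rintro g ⟨hg, -⟩
    exact absurd ⟨g, hg⟩ hne
  obtain ⟨u0, hu0⟩ := hne
  obtain ⟨x1, hx1⟩ := Real.exists_isGLB (s := Prod.fst '' G) ⟨u0.1, u0, hu0, rfl⟩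
    ⟨a, by rintro x ⟨g, hg, rfl⟩; exact hg.1.1.le⟩
  obtain ⟨x2, hx2⟩ := Real.exists_isLUB (s := Prod.fst '' G) ⟨u0.1, u0, hu0, rfl⟩
    ⟨b, by rintro x ⟨g, hg, rfl⟩; exact hg.1.2.1.le⟩
  obtain ⟨y2, hy2⟩ := Real.exists_isGLB (s := Prod.snd '' G) ⟨u0.2, u0, hu0, rfl⟩
    ⟨c, by rintro x ⟨g, hg, rfl⟩; exact hg.1.2.2.1.le⟩
  obtain ⟨y1, hy1⟩ := Real.exists_isLUB (s := Prod.snd '' G) ⟨u0.2, u0, hu0, rfl⟩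
    ⟨d, by rintro x ⟨g, hg, rfl⟩; exact hg.1.2.2.2.le⟩
  have gx1 : ∀ g ∈ G, x1 ≤ g.1 := fun g hg => hx1.1 ⟨g, hg, rfl⟩
  have gx2 : ∀ g ∈ G, g.1 ≤ x2 := fun g hg => hx2.1 ⟨g, hg, rfl⟩
  have gy2 : ∀ g ∈ G, y2 ≤ g.2 := fun g hg => hy2.1 ⟨g, hg, rfl⟩
  have gy1 : ∀ g ∈ G, g.2 ≤ y1 := fun g hg => hy1.1 ⟨g, hg, rfl⟩
  have ax1 : a ≤ x1 := hx1.2 (by rintro x ⟨g, hg, rfl⟩; exact hg.1.1.le)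
  have bx2 : x2 ≤ b := hx2.2 (by rintro x ⟨g, hg, rfl⟩; exact hg.1.2.1.le)
  have cy2 : c ≤ y2 := hy2.2 (by rintro x ⟨g, hg, rfl⟩; exact hg.1.2.2.1.le)
  have dy1 : y1 ≤ d := hy1.2 (by rintro x ⟨g, hg, rfl⟩; exact hg.1.2.2.2.le)
  have x12 : x1 ≤ x2 := (gx1 u0 hu0).trans (gx2 u0 hu0)
  have y21 : y2 ≤ y1 := (gy2 u0 hu0).trans (gy1 u0 hu0)
  have ex1 : ∀ t, x1 < t → ∃ g ∈ G, g.1 < t := fun t ht => by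
    obtain ⟨_, ⟨g, hg, rfl⟩, h⟩ := (isGLB_lt_iff hx1).1 ht; exact ⟨g, hg, h⟩
  have ex2 : ∀ t, t < x2 → ∃ g ∈ G, t < g.1 := fun t ht => by
    obtain ⟨_, ⟨g, hg, rfl⟩, h⟩ := (lt_isLUB_iff hx2).1 ht; exact ⟨g, hg, h⟩
  have ey2 : ∀ t, y2 < t → ∃ g ∈ G, g.2 < t := fun t ht => by
    obtain ⟨_, ⟨g, hg, rfl⟩, h⟩ := (isGLB_lt_iff hy2).1 ht; exact ⟨g, hg, h⟩
  have ey1 : ∀ t, t < y1 → ∃ g ∈ G, t < g.2 := fun t ht => by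
    obtain ⟨_, ⟨g, hg, rfl⟩, h⟩ := (lt_isLUB_iff hy1).1 ht; exact ⟨g, hg, h⟩
  -- constant boxes
  have C0 : ∀ a' b' c' d', a ≤ a' → c ≤ c' →
      (∀ x y, a' < x → x < b' → c' < y → y < d' → ∃ g ∈ G, x ≤ g.1 ∧ y < g.2) → Gd S σ f a' b' c' d' :=
    fun a' b' c' d' h1 h2 h => H.hS.C2 (e := c0) H.hf fun x y k1 k2 k3 k4 => by
      obtain ⟨g, hg, m1, m2⟩ := h x y k1 k2 k3 k4
      exact hg.2.1 x y (by linarith) (by linarith) m1 m2.le (Or.inr m2)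
  have C1 : ∀ a' b' c' d', b' ≤ b → d' ≤ d →
      (∀ x y, a' < x → x < b' → c' < y → y < d' → ∃ g ∈ G, g.1 ≤ x ∧ g.2 < y) → Gd S σ f a' b' c' d' :=
    fun a' b' c' d' h1 h2 h => H.hS.C2 (e := c1) H.hf fun x y k1 k2 k3 k4 => by
      obtain ⟨g, hg, m1, m2⟩ := h x y k1 k2 k3 k4
      exact hg.2.2 x y (by linarith) (by linarith) m1 m2.le (Or.inr m2)
  -- the two off-diagonal boxes
  have UL : Gd S σ f x1 u0.1 u0.2 y1 := by
    by_cases hz : ((x1, y1) : Pt) ∈ G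
    · exact H.gdGen hz hu0
    have hnl : ∀ g ∈ G, x1 < g.1 ∧ g.2 < y1 := by
      intro g hg
      by_contra hc
      apply hz
      have hmin : (∀ h ∈ G, g.1 ≤ h.1) ∧ (∀ h ∈ G, h.2 ≤ g.2) := by
        have : g.1 = x1 ∨ g.2 = y1 := by
          by_contra hn
          push Not at hn
          exact hc ⟨lt_of_le_of_ne (gx1 g hg) hn.1.symm, lt_of_le_of_ne (gy1 g hg) hn.2⟩
        rcases this with e | e
        · refine ⟨fun h hh => e.le.trans (gx1 h hh), fun h hh => ?_⟩
          by_contra hlt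
          push Not at hlt
          have := H.anti hg hh (e.le.trans (gx1 h hh)) hlt.le
          rw [this] at hlt; exact lt_irrefl _ hlt
        · refine ⟨fun h hh => ?_, fun h hh => (gy1 h hh).trans e.ge⟩
          by_contra hlt
          push Not at hlt
          have := H.anti hh hg hlt.le ((gy1 h hh).trans e.ge)
          rw [this] at hlt; exact lt_irrefl _ hlt
      have e1 : g.1 = x1 := le_antisymm (hx1.2 (by rintro x ⟨h, hh, rfl⟩; exact hmin.1 h hh)) (gx1 g hg)
      have e2 : g.2 = y1 := le_antisymm (gy1 g hg) (hy1.2 (by rintro x ⟨h, hh, rfl⟩; exact hmin.2 h hh))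
      rw [← e1, ← e2]; exact hg
    refine H.hS.C3 H.hf G hnl ?_ ?_ ?_ ?_ u0 hu0
    · intro ε hε
      obtain ⟨g, hg, k1⟩ := ex1 (x1 + ε) (by linarith)
      obtain ⟨h, hh, k2⟩ := ey1 (y1 - ε) (by linarith)
      rcases H.tot hg hh with ⟨m1, m2⟩ | ⟨m1, m2⟩
      · exact ⟨g, hg, k1, by linarith⟩
      · exact ⟨h, hh, by linarith, k2⟩
    · intro g hg h hh k1 k2
      exact C0 _ _ _ _ ax1 hg.1.2.2.1.le fun x y n1 n2 n3 n4 => ⟨h, hh, n2.le, n4⟩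
    · intro g hg h hh k1 k2
      exact H.gdGen hh hg
    · intro g hg h hh k1 k2
      exact C1 _ _ _ _ hg.1.2.1.le dy1 fun x y n1 n2 n3 n4 => ⟨h, hh, n1.le, n3⟩
  have LR : Gd S σ f u0.1 x2 y2 u0.2 := by
    by_cases hz : ((x2, y2) : Pt) ∈ G
    · exact H.gdGen hu0 hz
    have hnl : ∀ g ∈ G, g.1 < x2 ∧ y2 < g.2 := by
      intro g hg
      by_contra hc
      apply hz
      have hmin : (∀ h ∈ G, h.1 ≤ g.1) ∧ (∀ h ∈ G, g.2 ≤ h.2) := by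
        have : g.1 = x2 ∨ g.2 = y2 := by
          by_contra hn
          push Not at hn
          exact hc ⟨lt_of_le_of_ne (gx2 g hg) hn.1, lt_of_le_of_ne (gy2 g hg) hn.2.symm⟩
        rcases this with e | e
        · refine ⟨fun h hh => (gx2 h hh).trans e.ge, fun h hh => ?_⟩
          by_contra hlt
          push Not at hlt
          have := H.anti hh hg ((gx2 h hh).trans e.ge) hlt.le
          rw [this] at hlt; exact lt_irrefl _ hlt
        · refine ⟨fun h hh => ?_, fun h hh => e.le.trans (gy2 h hh)⟩
          by_contra hlt
          push Not at hlt
          have := H.anti hg hh hlt.le (e.le.trans (gy2 h hh))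
          rw [this] at hlt; exact lt_irrefl _ hlt
      have e1 : g.1 = x2 := le_antisymm (gx2 g hg) (hx2.2 (by rintro x ⟨h, hh, rfl⟩; exact hmin.1 h hh))
      have e2 : g.2 = y2 := le_antisymm (hy2.2 (by rintro x ⟨h, hh, rfl⟩; exact hmin.2 h hh)) (gy2 g hg)
      rw [← e1, ← e2]; exact hg
    refine H.hS.C3' H.hf G hnl ?_ ?_ ?_ ?_ u0 hu0
    · intro ε hε
      obtain ⟨g, hg, k1⟩ := ex2 (x2 - ε) (by linarith)
      obtain ⟨h, hh, k2⟩ := ey2 (y2 + ε) (by linarith)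
      rcases H.tot hg hh with ⟨m1, m2⟩ | ⟨m1, m2⟩
      · exact ⟨h, hh, by linarith, k2⟩
      · exact ⟨g, hg, k1, by linarith⟩
    · intro g hg h hh k1 k2
      exact C0 _ _ _ _ hg.1.1.le cy2 fun x y n1 n2 n3 n4 => ⟨h, hh, n2.le, n4⟩
    · intro g hg h hh k1 k2
      exact H.gdGen hg hh
    · intro g hg h hh k1 k2
      exact C1 _ _ _ _ bx2 hg.1.2.2.2.le fun x y n1 n2 n3 n4 => ⟨h, hh, n1.le, n3⟩
  have center : Gd S σ f x1 x2 y2 y1 := by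
    refine H.hS.cut4 H.hf (gx1 u0 hu0) (gx2 u0 hu0) (gy2 u0 hu0) (gy1 u0 hu0) ?_ LR UL ?_
    · exact C0 _ _ _ _ ax1 cy2 fun x y n1 n2 n3 n4 => ⟨u0, hu0, n2.le, n4⟩
    · exact C1 _ _ _ _ bx2 dy1 fun x y n1 n2 n3 n4 => ⟨u0, hu0, n1.le, n3⟩
  have col1 : Gd S σ f a x1 c d := by
    refine H.hS.cutH H.hf (cy2.trans y21) dy1 ?_ ?_
    · refine C0 _ _ _ _ le_rfl le_rfl fun x y n1 n2 n3 n4 => ?_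
      obtain ⟨g, hg, k⟩ := ey1 y n4
      exact ⟨g, hg, n2.le.trans (gx1 g hg), k⟩
    · refine H.gdC le_rfl (x12.trans bx2) (cy2.trans y21) le_rfl (Set.Subsingleton.countable ?_)
      rintro g ⟨hg, k1, k2, k3, k4⟩ g' ⟨hg', k1', k2', k3', k4'⟩
      exact H.anti hg hg' (k2.trans (gx1 g' hg')) ((gy1 g hg).trans k3')
  have col2 : Gd S σ f x1 x2 c d := by
    refine H.hS.cutH H.hf cy2 (y21.trans dy1) ?_ (H.hS.cutH H.hf y21 dy1 center ?_)
    · refine C0 _ _ _ _ ax1 le_rfl fun x y n1 n2 n3 n4 => ?_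
      obtain ⟨g, hg, k⟩ := ex2 x n2
      exact ⟨g, hg, k.le, n4.trans_le (gy2 g hg)⟩
    · refine C1 _ _ _ _ bx2 le_rfl fun x y n1 n2 n3 n4 => ?_
      obtain ⟨g, hg, k⟩ := ex1 x n1
      exact ⟨g, hg, k.le, (gy1 g hg).trans_lt n3⟩
  have col3 : Gd S σ f x2 b c d := by
    refine H.hS.cutH H.hf cy2 (y21.trans dy1) ?_ ?_
    · refine H.gdC (ax1.trans x12) le_rfl le_rfl (y21.trans dy1) (Set.Subsingleton.countable ?_)
      rintro g ⟨hg, k1, k2, k3, k4⟩ g' ⟨hg', k1', k2', k3', k4'⟩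
      exact H.anti hg hg' ((gx2 g hg).trans k1') (k4.trans (gy2 g' hg'))
    · refine C1 _ _ _ _ le_rfl le_rfl fun x y n1 n2 n3 n4 => ?_
      obtain ⟨g, hg, k⟩ := ey2 y n3
      exact ⟨g, hg, (gx2 g hg).trans n1.le, k⟩
  exact H.hS.cutV H.hf ax1 (x12.trans bx2) col1 (H.hS.cutV H.hf x12 bx2 col2 col3)

theorem Closed.complete [Finite L] [Finite ι] (hS : Closed σ S) (hf : HM σ f) (a b c d : ℝ) : Gd S σ f a b c d := by
  suffices key : ∀ n : ℕ, ∀ a b c d, {l | σ.le (f (a, c)) l ∧ σ.le l (f (b, d))}.ncard < n → Gd S σ f a b c d from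
    key _ a b c d (Nat.lt_succ_self _)
  intro n
  induction n with
  | zero => intro a b c d h; exact absurd h (Nat.not_lt_zero _)
  | succ n ih =>
    intro a b c d hn hab hcd
    by_cases hle : σ.le (f (b, d)) (f (a, c))
    · refine hS.C2 (e := f (a, c)) hf (fun x y h1 h2 h3 h4 => ⟨?_, hf.mono _ _ h1.le h3.le⟩) hab hcd
      exact σ.trans' (hf.mono _ (b, d) h2.le h4.le) hle
    refine Ctx.gd (c0 := f (a, c)) (c1 := f (b, d)) ⟨hS, hf, hab, hcd, Sys.eqv.refl _, Sys.eqv.refl _, hle, ?_⟩ hab hcd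
    intro a' b' c' d' h1 h2 h3 h4 h5 h6 h7
    refine ih a' b' c' d' (lt_of_lt_of_le (Set.ncard_lt_ncard ?_ (Set.toFinite _)) (Nat.lt_succ_iff.1 hn))
    have l0 : σ.le (f (a, c)) (f (a', c')) := hf.mono _ _ h1 h4
    have l1 : σ.le (f (b', d')) (f (b, d)) := hf.mono _ _ h3 h6
    have l2 : σ.le (f (a', c')) (f (b', d')) := hf.mono _ _ h2 h5
    refine ⟨fun l hl => ⟨σ.trans' l0 hl.1, σ.trans' hl.2 l1⟩, fun hsub => ?_⟩
    rcases h7 with h | h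
    · exact h ⟨(hsub ⟨σ.rfl' _, σ.trans' l0 (σ.trans' l2 l1)⟩).1, l0⟩
    · exact h ⟨l1, (hsub ⟨σ.trans' l0 (σ.trans' l2 l1), σ.rfl' _⟩).2⟩

end
end Temporal

namespace Temporal

/-! ### The concrete system of types -/

def valN (N l : ℕ) : Prop :=
  l.testBit N = true ∧ ∀ i < N + 1, (i % 5 = 1 → (l.testBit i = true ↔ ¬ l.testBit (i / 5) = true)) ∧
    (i % 5 = 2 → (l.testBit i = true ↔ (l.testBit (i / 5).unpair.1 = true ∨ l.testBit (i / 5).unpair.2 = true))) ∧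
    (i % 5 = 3 ∨ i % 5 = 4 → l.testBit (i / 5) = true → l.testBit i = true)

def vtN (N l : ℕ) : Prop := l < 2 ^ (N + 1) ∧ valN N l

def rkN (N l : ℕ) : ℕ :=
  if l < 2 ^ (N + 1) then 2 else if l = 2 ^ (N + 1) then 0 else if l ≤ 2 ^ (N + 1) + 2 then 1
  else if l ≤ 2 ^ (N + 1) + 4 then 3 else 4

def tleN (N l m : ℕ) : Prop :=
  ∀ i < N + 1, (i % 5 = 3 → m.testBit i = true → l.testBit i = true) ∧
    (i % 5 = 4 → l.testBit i = true → m.testBit i = true)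

def okN (N l : ℕ) : Prop := l < 2 ^ (N + 1) → valN N l

def leN (N l m : ℕ) : Prop :=
  l = m ∨ (vtN N l ∧ vtN N m ∧ tleN N l m) ∨ (okN N l ∧ okN N m ∧ rkN N l < rkN N m)

def aN (N l i : ℕ) : Prop := vtN N l ∧ 5 * i + 3 ≤ N ∧ l.testBit (5 * i + 3) = true
def bN (N l i : ℕ) : Prop := vtN N l ∧ 5 * i + 4 ≤ N ∧ l.testBit (5 * i + 4) = true
def wFN (N l i : ℕ) : Prop := vtN N l ∧ 5 * i + 3 ≤ N ∧ l.testBit i = true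
def wPN (N l i : ℕ) : Prop := vtN N l ∧ 5 * i + 4 ≤ N ∧ l.testBit i = true

theorem rk_vt {N l : ℕ} (h : vtN N l) : rkN N l = 2 := by unfold rkN; rw [if_pos h.1]
theorem vt_of_rk {N l : ℕ} (h : okN N l) (h' : rkN N l = 2) : vtN N l := by
  have : l < 2 ^ (N + 1) := by
    unfold rkN at h'; split_ifs at h' <;> first | assumption | omega
  exact ⟨this, h this⟩
theorem ok_vt {N l : ℕ} (h : vtN N l) : okN N l := fun _ => h.2

theorem leN_trans {N l m k : ℕ} (h : leN N l m) (h' : leN N m k) : leN N l k := by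
  rcases h with rfl | ⟨h1, h2, h3⟩ | ⟨h1, h2, h3⟩
  · exact h'
  · rcases h' with rfl | ⟨k1, k2, k3⟩ | ⟨k1, k2, k3⟩
    · exact Or.inr (Or.inl ⟨h1, h2, h3⟩)
    · exact Or.inr (Or.inl ⟨h1, k2, fun i hi => ⟨fun e b => (h3 i hi).1 e ((k3 i hi).1 e b),
        fun e b => (k3 i hi).2 e ((h3 i hi).2 e b)⟩⟩)
    · exact Or.inr (Or.inr ⟨ok_vt h1, k2, by rw [rk_vt h1, ← rk_vt h2]; exact k3⟩)
  · rcases h' with rfl | ⟨k1, k2, k3⟩ | ⟨k1, k2, k3⟩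
    · exact Or.inr (Or.inr ⟨h1, h2, h3⟩)
    · exact Or.inr (Or.inr ⟨h1, ok_vt k2, by rw [rk_vt k2, ← rk_vt k1]; exact h3⟩)
    · exact Or.inr (Or.inr ⟨h1, k2, h3.trans k3⟩)

theorem leN_vt {N l m : ℕ} (h : leN N l m) (hl : vtN N l) (hm : vtN N m) : tleN N l m := by
  rcases h with rfl | ⟨h1, h2, h3⟩ | ⟨h1, h2, h3⟩
  · exact fun i hi => ⟨fun _ h => h, fun _ h => h⟩
  · exact h3
  · rw [rk_vt hl, rk_vt hm] at h3; omega

theorem leN_mid {N l m k : ℕ} (h : leN N l m) (h' : leN N m k) (hl : vtN N l) (hk : vtN N k) : vtN N m := by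
  rcases h with rfl | ⟨h1, h2, h3⟩ | ⟨h1, h2, h3⟩
  · exact hl
  · exact h2
  · rcases h' with rfl | ⟨k1, k2, k3⟩ | ⟨k1, k2, k3⟩
    · exact hk
    · exact k1
    · rw [rk_vt hl] at h3; rw [rk_vt hk] at k3; omega

theorem aN_of_wFN {N l i : ℕ} (h : wFN N l i) : aN N l i := by
  refine ⟨h.1, h.2.1, ?_⟩
  have e := (h.1.2.2 (5 * i + 3) (by have := h.2.1; omega)).2.2
  have e1 : (5 * i + 3) / 5 = i := by omega
  rw [e1] at e
  exact e (Or.inl (by omega)) h.2.2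
theorem bN_of_wPN {N l i : ℕ} (h : wPN N l i) : bN N l i := by
  refine ⟨h.1, h.2.1, ?_⟩
  have e := (h.1.2.2 (5 * i + 4) (by have := h.2.1; omega)).2.2
  have e1 : (5 * i + 4) / 5 = i := by omega
  rw [e1] at e
  exact e (Or.inr (by omega)) h.2.2

def MN (N : ℕ) : ℕ := 2 ^ (N + 1) + 6

def sysN (N : ℕ) : Sys (Fin (MN N)) (Fin (MN N)) where
  le l m := leN N l m
  A l i := aN N l i
  B l i := bN N l i
  wF l i := wFN N l i
  wP l i := wPN N l i
  rfl' := fun l => Or.inl rfl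
  trans' := leN_trans
  axF := by
    intro l m k i h1 h2 h3 h4
    have hk : aN N k i := h4.elim id aN_of_wFN
    have hm := leN_mid h1 h2 h3.1 hk.1
    exact ⟨hm, hk.2.1, ((leN_vt h2 hm hk.1) _ (by have := hk.2.1; omega)).1 (by omega) hk.2.2⟩
  axP := by
    intro l m k i h1 h2 h3 h4
    have hl : bN N l i := h4.elim id bN_of_wPN
    have hm := leN_mid h1 h2 hl.1 h3.1
    exact ⟨hm, hl.2.1, ((leN_vt h1 hl.1 hm) _ (by have := hl.2.1; omega)).2 (by omega) hl.2.2⟩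

def exN (N k : ℕ) (h : k < 6) : Fin (MN N) := ⟨2 ^ (N + 1) + k, by unfold MN; omega⟩

/-- the boundary condition -/
def BdN (N : ℕ) (β : Beh (Fin (MN N)) (Fin (MN N))) : Prop :=
  β.lf = Tr.elem (sysN N) (exN N 0 (by omega)) (exN N 1 (by omega)) (exN N 1 (by omega)) ∧
  β.bt = Tr.elem (sysN N) (exN N 0 (by omega)) (exN N 2 (by omega)) (exN N 2 (by omega)) ∧
  β.tp = Tr.elem (sysN N) (exN N 1 (by omega)) (exN N 3 (by omega)) (exN N 5 (by omega)) ∧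
  β.rt = Tr.elem (sysN N) (exN N 2 (by omega)) (exN N 4 (by omega)) (exN N 5 (by omega))

theorem exN_not_vt {N k : ℕ} {h : k < 6} : ¬ vtN N (exN N k h) := fun h => by
  have := h.1; simp [exN] at this
theorem exN_ok {N k : ℕ} {h : k < 6} : okN N (exN N k h) := fun h => by simp [exN] at h
theorem exN_rk {N k : ℕ} {h : k < 6} : rkN N (exN N k h) = if k = 0 then 0 else if k ≤ 2 then 1 else if k ≤ 4 then 3 else 4 := by
  simp [rkN, exN]
theorem exN_eqv {N k : ℕ} {h : k < 6} {l : Fin (MN N)} (hl : (sysN N).eqv l (exN N k h)) : l = exN N k h := by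
  rcases hl.1 with h1 | h1 | h1
  · exact Fin.ext h1
  · exact absurd h1.2.1 exN_not_vt
  rcases hl.2 with h2 | h2 | h2
  · exact (Fin.ext h2).symm
  · exact absurd h2.1 exN_not_vt
  · have := h1.2.2; have := h2.2.2; omega
theorem exN_le {N k k' : ℕ} {h : k < 6} {h' : k' < 6}
    (hr : rkN N (exN N k h) < rkN N (exN N k' h')) : (sysN N).le (exN N k h) (exN N k' h') :=
  Or.inr (Or.inr ⟨exN_ok, exN_ok, hr⟩)

/-- truth lemma -/
theorem truth {N : ℕ} {g : Pt → ℕ} (hv : ∀ p, vtN N (g p)) (hm : ∀ p q : Pt, p ≤ q → tleN N (g p) (g q))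
    (hF : ∀ p i, 5 * i + 3 ≤ N → (g p).testBit (5 * i + 3) = true → ∃ q, p ≤ q ∧ (g q).testBit i = true)
    (hP : ∀ p i, 5 * i + 4 ≤ N → (g p).testBit (5 * i + 4) = true → ∃ q, q ≤ p ∧ (g q).testBit i = true) :
    ∀ i, i ≤ N → ∀ p, TSat (fun p q : Pt => p ≤ q) (fun n => {p | (g p).testBit (5 * n) = true}) (decodeT i) p ↔
      (g p).testBit i = true := by
  intro n
  induction n using Nat.strong_induction_on with
  | _ n ih =>
    intro hn p
    have hq := (hv p).2.2 n (by omega)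
    rw [decodeT]
    by_cases h0 : n % 5 = 0
    · rw [dif_pos h0]
      have : 5 * (n / 5) = n := by omega
      simp [TSat, this]
    · have hlt : n / 5 < n := by omega
      have h1 : (n / 5).unpair.1 < n := lt_of_le_of_lt (Nat.unpair_left_le _) hlt
      have h2 : (n / 5).unpair.2 < n := lt_of_le_of_lt (Nat.unpair_right_le _) hlt
      rw [dif_neg h0]
      have i0 := ih _ hlt (by omega)
      by_cases e1 : n % 5 = 1
      · rw [if_pos e1, TSat, i0, hq.1 e1]
      · rw [if_neg e1]
        by_cases e2 : n % 5 = 2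
        · rw [if_pos e2, TSat, ih _ h1 (by omega), ih _ h2 (by omega), hq.2.1 e2]
        · rw [if_neg e2]
          by_cases e3 : n % 5 = 3
          · rw [if_pos e3, TSat]
            simp only [i0]
            have e : 5 * (n / 5) + 3 = n := by omega
            constructor
            · rintro ⟨q, h3, h4⟩
              exact (hm p q h3 n (by omega)).1 e3 (((hv q).2.2 n (by omega)).2.2 (Or.inl e3) h4)
            · intro h3
              exact hF p (n / 5) (by omega) (by rw [e]; exact h3)
          · rw [if_neg e3, TSat]
            have e4 : n % 5 = 4 := by omega
            simp only [i0]
            have e : 5 * (n / 5) + 4 = n := by omega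
            constructor
            · rintro ⟨q, h3, h4⟩
              exact (hm q p h3 n (by omega)).2 e4 (((hv q).2.2 n (by omega)).2.2 (Or.inr e4) h4)
            · intro h3
              exact hP p (n / 5) (by omega) (by rw [e]; exact h3)

def codeN (φ : TForm) : ℕ := 5 * (5 * encodeT φ + 3) + 4

theorem bits_exist (P : ℕ → Prop) (n : ℕ) : ∃ l, l < 2 ^ n ∧ ∀ i < n, (l.testBit i = true ↔ P i) := by
  classical
  refine ⟨Nat.ofBits (fun i : Fin n => decide (P i)), Nat.ofBits_lt_two_pow _, fun i hi => ?_⟩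
  rw [Nat.testBit_ofBits_lt _ _ hi]; simp

end Temporal

namespace Temporal

/-! ### From models to behaviours -/
section
variable {N : ℕ}

structure TMod (N : ℕ) (g : Pt → ℕ) : Prop where
  vt : ∀ p, vtN N (g p)
  mono : ∀ p q : Pt, p ≤ q → tleN N (g p) (g q)
  fut : ∀ p i, 5 * i + 3 ≤ N → (g p).testBit (5 * i + 3) = true → ∃ q, p ≤ q ∧ (g q).testBit i = true
  past : ∀ p i, 5 * i + 4 ≤ N → (g p).testBit (5 * i + 4) = true → ∃ q, q ≤ p ∧ (g q).testBit i = true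

theorem TMod.sat {φ : TForm} {g : Pt → ℕ} (h : TMod (codeN φ) g) : TSatisfiable (fun p q : ℝ × ℝ => p ≤ q) φ := by
  have h0 := (h.vt (0, 0)).2.1
  obtain ⟨q, -, hq⟩ := h.past (0, 0) (5 * encodeT φ + 3) (by unfold codeN; omega) h0
  obtain ⟨r, -, hr⟩ := h.fut q (encodeT φ) (by unfold codeN; omega) hq
  have := (truth h.vt h.mono h.fut h.past (encodeT φ) (by unfold codeN; omega) r).2 hr
  rw [decodeT_encodeT] at this
  exact ⟨_, r, this⟩

theorem decodeT_eq (n : ℕ) (φ : TForm) (h : n = encodeT φ) : decodeT n = φ := by rw [h, decodeT_encodeT]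

theorem tmod_of_sat {φ : TForm} (h : TSatisfiable (fun p q : ℝ × ℝ => p ≤ q) φ) : ∃ g, TMod (codeN φ) g := by
  obtain ⟨v, w, hw⟩ := h
  set R := (fun p q : ℝ × ℝ => p ≤ q) with hR
  choose g hg1 hg2 using fun p : Pt => bits_exist (fun i => TSat R v (decodeT i) p) (codeN φ + 1)
  have d1 : ∀ i, i % 5 = 1 → decodeT i = .neg (decodeT (i / 5)) := by
    intro i hi; refine decodeT_eq _ _ ?_; rw [encodeT, encodeT_decodeT]; omega
  have d2 : ∀ i, i % 5 = 2 → decodeT i = .or (decodeT (i / 5).unpair.1) (decodeT (i / 5).unpair.2) := by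
    intro i hi; refine decodeT_eq _ _ ?_; rw [encodeT, encodeT_decodeT, encodeT_decodeT, Nat.pair_unpair]; omega
  have d3 : ∀ i, i % 5 = 3 → decodeT i = .fut (decodeT (i / 5)) := by
    intro i hi; refine decodeT_eq _ _ ?_; rw [encodeT, encodeT_decodeT]; omega
  have d4 : ∀ i, i % 5 = 4 → decodeT i = .past (decodeT (i / 5)) := by
    intro i hi; refine decodeT_eq _ _ ?_; rw [encodeT, encodeT_decodeT]; omega
  refine ⟨g, ?_, ?_, ?_, ?_⟩
  · intro p
    refine ⟨hg1 p, ?_, ?_⟩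
    · rw [hg2 p _ (by omega), decodeT_eq (codeN φ) (.past (.fut φ)) (by rw [encodeT, encodeT]; rfl)]
      exact ⟨(min p.1 w.1, min p.2 w.2), ⟨min_le_left _ _, min_le_left _ _⟩, w, ⟨min_le_right _ _, min_le_right _ _⟩, hw⟩
    · intro i hi
      have b0 := hg2 p i hi
      have b1 := hg2 p (i / 5) (by omega)
      have b2 := hg2 p (i / 5).unpair.1 (lt_of_le_of_lt (Nat.unpair_left_le _) (by omega))
      have b3 := hg2 p (i / 5).unpair.2 (lt_of_le_of_lt (Nat.unpair_right_le _) (by omega))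
      refine ⟨fun e => ?_, fun e => ?_, fun e => ?_⟩
      · rw [b0, b1, d1 i e, TSat]
      · rw [b0, b2, b3, d2 i e, TSat]
      · rw [b0, b1]
        intro h
        rcases e with e | e
        · rw [d3 i e]; exact ⟨p, le_refl p, h⟩
        · rw [d4 i e]; exact ⟨p, le_refl p, h⟩
  · intro p q hpq i hi
    rw [hg2 p i hi, hg2 q i hi]
    refine ⟨fun e => ?_, fun e => ?_⟩
    · rw [d3 i e]; rintro ⟨y, h1, h2⟩; exact ⟨y, le_trans hpq h1, h2⟩
    · rw [d4 i e]; rintro ⟨y, h1, h2⟩; exact ⟨y, le_trans h1 hpq, h2⟩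
  · intro p i hi h
    rw [hg2 p _ (by omega), d3 _ (by omega)] at h
    have e : (5 * i + 3) / 5 = i := by omega
    rw [e] at h
    obtain ⟨q, h1, h2⟩ := h
    exact ⟨q, h1, (hg2 q i (by omega)).2 h2⟩
  · intro p i hi h
    rw [hg2 p _ (by omega), d4 _ (by omega)] at h
    have e : (5 * i + 4) / 5 = i := by omega
    rw [e] at h
    obtain ⟨q, h1, h2⟩ := h
    exact ⟨q, h1, (hg2 q i (by omega)).2 h2⟩

/-- compression of the line -/
theorem exists_J : ∃ J K : ℝ → ℝ, (∀ x y, -1 < x → x < 1 → -1 < y → y < 1 → x ≤ y → J x ≤ J y) ∧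
    (∀ x, -1 < K x ∧ K x < 1) ∧ (∀ x, J (K x) = x) ∧ (∀ x, -1 < x → x < 1 → K (J x) = x) ∧ Monotone K := by
  classical
  let e := orderIsoIooNegOneOne ℝ
  have hJ : ∀ x (h : -1 < x ∧ x < 1), (if h : -1 < x ∧ x < 1 then e.symm ⟨x, h⟩ else 0) = e.symm ⟨x, h⟩ := by
    intro x h; rw [dif_pos h]
  refine ⟨fun x => if h : -1 < x ∧ x < 1 then e.symm ⟨x, h⟩ else 0, fun x => (e x : ℝ), ?_, fun x => (e x).2, ?_, ?_, ?_⟩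
  · intro x y h1 h2 h3 h4 h
    simp only
    rw [hJ x ⟨h1, h2⟩, hJ y ⟨h3, h4⟩]
    exact e.symm.monotone h
  · intro x
    simp only
    rw [hJ _ (e x).2]
    exact e.symm_apply_apply x
  · intro x h1 h2
    simp only
    rw [hJ x ⟨h1, h2⟩, e.apply_symm_apply]
  · intro x y h; exact e.monotone h

open Classical in
/-- the extended labelling -/
noncomputable def extF (N : ℕ) (t : Pt → Fin (MN N)) (p : Pt) : Fin (MN N) :=
  if p.1 ≤ -1 then (if p.2 ≤ -1 then exN N 0 (by omega) else exN N 1 (by omega))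
  else if p.2 ≤ -1 then exN N 2 (by omega)
  else if 1 ≤ p.1 then (if 1 ≤ p.2 then exN N 5 (by omega) else exN N 4 (by omega))
  else if 1 ≤ p.2 then exN N 3 (by omega) else t p

def InI (p : Pt) : Prop := -1 < p.1 ∧ p.1 < 1 ∧ -1 < p.2 ∧ p.2 < 1

theorem extF_in {t : Pt → Fin (MN N)} {p : Pt} (h : InI p) : extF N t p = t p := by
  obtain ⟨h1, h2, h3, h4⟩ := h
  unfold extF
  rw [if_neg (by linarith), if_neg (by linarith), if_neg (by linarith), if_neg (by linarith)]

theorem extF_inv {t : Pt → Fin (MN N)} {p : Pt} (h : vtN N (extF N t p)) : InI p := by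
  unfold extF at h
  by_contra hc
  unfold InI at hc
  split_ifs at h <;> first | exact exN_not_vt h | skip
  apply hc
  refine ⟨?_, ?_, ?_, ?_⟩ <;> (by_contra; simp_all)

theorem hm_of_tmod {g : Pt → ℕ} (h : TMod N g) : ∃ t : Pt → Fin (MN N), HM (sysN N) (extF N t) := by
  obtain ⟨J, K, hJ, hK, hJK, hKJ, hKm⟩ := exists_J
  have hg : ∀ p, g p < MN N := fun p => by have := (h.vt p).1; unfold MN; omega
  refine ⟨fun p => ⟨g (J p.1, J p.2), hg _⟩, ?_⟩
  set t : Pt → Fin (MN N) := fun p => ⟨g (J p.1, J p.2), hg _⟩ with ht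
  have hm0 : ∀ p q : Pt, InI p → InI q → p.1 ≤ q.1 → p.2 ≤ q.2 → ((J p.1, J p.2) : Pt) ≤ (J q.1, J q.2) := by
    intro p q hp hq h1 h2
    exact ⟨hJ _ _ hp.1 hp.2.1 hq.1 hq.2.1 h1, hJ _ _ hp.2.2.1 hp.2.2.2 hq.2.2.1 hq.2.2.2 h2⟩
  have okE : ∀ p, okN N (extF N t p) := by
    intro p
    unfold extF
    split_ifs <;> first | exact exN_ok | exact ok_vt (h.vt _)
  have hmono : ∀ p q : Pt, p.1 ≤ q.1 → p.2 ≤ q.2 → (sysN N).le (extF N t p) (extF N t q) := by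
    intro p q h1 h2
    by_cases e : InI p ∧ InI q
    · refine Or.inr (Or.inl ?_)
      rw [extF_in e.1, extF_in e.2]
      exact ⟨h.vt _, h.vt _, h.mono _ _ (hm0 p q e.1 e.2 h1 h2)⟩
    · by_cases e' : extF N t p = extF N t q
      · rw [e']; exact (sysN N).rfl' _
      refine Or.inr (Or.inr ⟨okE p, okE q, ?_⟩)
      have rt : ∀ p, rkN N (t p) = 2 := fun p => rk_vt (h.vt _)
      have hp : InI p ∨ ¬ InI p := em _
      have hq : InI q ∨ ¬ InI q := em _
      unfold InI at e
      unfold extF at e' ⊢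
      split_ifs at e' ⊢ <;> first
        | (exfalso; linarith)
        | (exfalso; exact e' rfl)
        | (simp only [exN_rk, rt]; norm_num; done)
        | (exfalso; apply e; constructor <;> refine ⟨?_, ?_, ?_, ?_⟩ <;> linarith)
  refine ⟨hmono, ?_, ?_⟩
  · intro p i b d hA h1 h2
    have hp := extF_inv hA.1
    rw [extF_in hp] at hA
    obtain ⟨q0, k1, k2⟩ := h.fut _ i hA.2.1 hA.2.2
    have kp1 : p.1 ≤ K q0.1 := by rw [← hKJ p.1 hp.1 hp.2.1]; exact hKm k1.1
    have kp2 : p.2 ≤ K q0.2 := by rw [← hKJ p.2 hp.2.2.1 hp.2.2.2]; exact hKm k1.2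
    have hq : InI (K q0.1, K q0.2) := ⟨(hK _).1, (hK _).2, (hK _).1, (hK _).2⟩
    have hw : wFN N (t (K q0.1, K q0.2)) i := by
      refine ⟨h.vt _, hA.2.1, ?_⟩
      simp only [ht, hJK]; exact k2
    by_cases hc : K q0.1 ≤ b ∧ K q0.2 ≤ d
    · exact ⟨(K q0.1, K q0.2), kp1, kp2, hc.1, hc.2, Or.inl (by rw [extF_in hq]; exact hw)⟩
    · have hr : InI (min (K q0.1) b, min (K q0.2) d) :=
        ⟨lt_min hq.1 (lt_of_lt_of_le hp.1 h1), lt_of_le_of_lt (min_le_left _ _) hq.2.1,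
          lt_min hq.2.2.1 (lt_of_lt_of_le hp.2.2.1 h2), lt_of_le_of_lt (min_le_left _ _) hq.2.2.2⟩
      refine ⟨(min (K q0.1) b, min (K q0.2) d), le_min kp1 h1, le_min kp2 h2, min_le_right _ _, min_le_right _ _, Or.inr ⟨?_, ?_⟩⟩
      · simp only [not_and_or, not_le] at hc
        rcases hc with hc | hc
        · exact Or.inl (min_eq_right hc.le)
        · exact Or.inr (min_eq_right hc.le)
      · have := hmono (min (K q0.1) b, min (K q0.2) d) (K q0.1, K q0.2) (min_le_left _ _) (min_le_left _ _)
        refine (sysN N).axF (k := extF N t (K q0.1, K q0.2)) (hmono p _ (le_min kp1 h1) (le_min kp2 h2)) this ?_ (Or.inr ?_)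
        · rw [extF_in hp]; exact hA
        · rw [extF_in hq]; exact hw
  · intro p' i b d hA h1 h2
    obtain ⟨p, rfl⟩ : ∃ p : Pt, p' = (-p.1, -p.2) := ⟨(-p'.1, -p'.2), by simp⟩
    simp only [neg_neg, Prod.mk.eta] at hA h1 h2
    have hp := extF_inv hA.1
    change bN N (extF N t p) i at hA
    rw [extF_in hp] at hA
    obtain ⟨q0, k1, k2⟩ := h.past _ i hA.2.1 hA.2.2
    have kp1 : K q0.1 ≤ p.1 := by rw [← hKJ p.1 hp.1 hp.2.1]; exact hKm k1.1
    have kp2 : K q0.2 ≤ p.2 := by rw [← hKJ p.2 hp.2.2.1 hp.2.2.2]; exact hKm k1.2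
    have hq : InI (K q0.1, K q0.2) := ⟨(hK _).1, (hK _).2, (hK _).1, (hK _).2⟩
    have hw : wPN N (t (K q0.1, K q0.2)) i := by
      refine ⟨h.vt _, hA.2.1, ?_⟩
      simp only [ht, hJK]; exact k2
    by_cases hc : -b ≤ K q0.1 ∧ -d ≤ K q0.2
    · refine ⟨(-K q0.1, -K q0.2), neg_le_neg kp1, neg_le_neg kp2, by simpa using neg_le_neg hc.1, by simpa using neg_le_neg hc.2, Or.inl ?_⟩
      simp only [neg_neg]
      rw [extF_in hq]; exact hw
    · have m1 : -b ≤ p.1 := by linarith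
      have m2 : -d ≤ p.2 := by linarith
      have hr : InI (max (K q0.1) (-b), max (K q0.2) (-d)) :=
        ⟨lt_of_lt_of_le hq.1 (le_max_left _ _), max_lt hq.2.1 (lt_of_le_of_lt m1 hp.2.1),
          lt_of_lt_of_le hq.2.2.1 (le_max_left _ _), max_lt hq.2.2.2 (lt_of_le_of_lt m2 hp.2.2.2)⟩
      refine ⟨(-max (K q0.1) (-b), -max (K q0.2) (-d)), neg_le_neg (max_le kp1 m1), neg_le_neg (max_le kp2 m2), ?_, ?_, Or.inr ⟨?_, ?_⟩⟩
      · have := le_max_right (K q0.1) (-b); simp only; linarith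
      · have := le_max_right (K q0.2) (-d); simp only; linarith
      · simp only [not_and_or, not_le] at hc
        rcases hc with hc | hc
        · exact Or.inl (by simp only; rw [max_eq_right hc.le, neg_neg])
        · exact Or.inr (by simp only; rw [max_eq_right hc.le, neg_neg])
      · simp only [neg_neg]
        have := hmono (K q0.1, K q0.2) (max (K q0.1) (-b), max (K q0.2) (-d)) (le_max_left _ _) (le_max_left _ _)
        refine (sysN N).axP (l := extF N t (K q0.1, K q0.2)) this (hmono _ p (max_le kp1 m1) (max_le kp2 m2)) ?_ (Or.inr ?_)
        · rw [extF_in hp]; exact hA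
        · rw [extF_in hq]; exact hw

theorem beh_of_tmod {g : Pt → ℕ} (h : TMod N g) {S : Beh (Fin (MN N)) (Fin (MN N)) → Prop} (hS : Closed (sysN N) S) :
    ∃ β, S β ∧ BdN N β := by
  obtain ⟨t, ht⟩ := hm_of_tmod h
  refine ⟨_, hS.complete ht (-1) 1 (-1) 1 (by norm_num) (by norm_num), ?_, ?_, ?_, ?_⟩
  · have := tr_elem (ht.monoV (-1) (-1) 1) (e := exN N 1 (by omega)) (by norm_num) (fun x h1 h2 => by
      unfold extF; simp only [le_refl, if_true]; rw [if_neg (by linarith)]; exact Sys.eqv.refl _)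
    refine Eq.trans this ?_
    simp only [extF]; norm_num
  · have := tr_elem (ht.monoH (-1) (-1) 1) (e := exN N 2 (by omega)) (by norm_num) (fun x h1 h2 => by
      unfold extF; simp only [le_refl, if_true]; rw [if_neg (by linarith)]; exact Sys.eqv.refl _)
    refine Eq.trans this ?_
    simp only [extF]; norm_num
  · have := tr_elem (ht.monoH 1 (-1) 1) (e := exN N 3 (by omega)) (by norm_num) (fun x h1 h2 => by
      unfold extF; simp only [le_refl, if_true]; rw [if_neg (by linarith), if_neg (by norm_num), if_neg (by linarith)]; exact Sys.eqv.refl _)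
    refine Eq.trans this ?_
    simp only [extF]; norm_num
  · have := tr_elem (ht.monoV 1 (-1) 1) (e := exN N 4 (by omega)) (by norm_num) (fun x h1 h2 => by
      unfold extF; simp only [le_refl, if_true]; rw [if_neg (by norm_num), if_neg (by linarith), if_neg (by linarith)]; exact Sys.eqv.refl _)
    refine Eq.trans this ?_
    simp only [extF]; norm_num

end
end Temporal

namespace Temporal

/-! ### From behaviours to models -/
section
variable {N : ℕ}

theorem exists_dense (n : ℕ) (hn : 0 < n) : ∃ G : ℝ → Fin n, ∀ (k : Fin n) (a b : ℝ), a < b → ∃ s, a < s ∧ s < b ∧ G s = k := by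
  classical
  have huniq : ∀ (k k' : Fin n) (q q' : ℚ), (q : ℝ) + (k : ℕ) * √2 = q' + (k' : ℕ) * √2 → k = k' := by
    intro k k' q q' h
    by_contra hne
    have hz : ((k : ℕ) : ℚ) - ((k' : ℕ) : ℚ) ≠ 0 := by
      intro h0
      apply hne
      have : ((k : ℕ) : ℚ) = ((k' : ℕ) : ℚ) := by linarith
      exact Fin.ext (by exact_mod_cast this)
    apply irrational_sqrt_two
    refine ⟨(q' - q) / (((k : ℕ) : ℚ) - ((k' : ℕ) : ℚ)), ?_⟩
    have hz' : ((k : ℕ) : ℝ) - ((k' : ℕ) : ℝ) ≠ 0 := by exact_mod_cast hz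
    push_cast
    field_simp
    linarith
  refine ⟨fun s => if h : ∃ k : Fin n, ∃ q : ℚ, s = q + (k : ℕ) * √2 then h.choose else ⟨0, hn⟩, ?_⟩
  intro k a b hab
  obtain ⟨q, h1, h2⟩ := exists_rat_btwn (show a - (k : ℕ) * √2 < b - (k : ℕ) * √2 by linarith)
  have hex : ∃ k' : Fin n, ∃ q' : ℚ, (q : ℝ) + (k : ℕ) * √2 = q' + (k' : ℕ) * √2 := ⟨k, q, rfl⟩
  refine ⟨q + (k : ℕ) * √2, by linarith, by linarith, ?_⟩
  simp only
  rw [dif_pos hex]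
  obtain ⟨q', h⟩ := hex.choose_spec
  exact (huniq _ _ _ _ h).symm

def In1 (p : Pt) : Prop := 0 < p.1 ∧ p.1 < 1 ∧ 0 < p.2 ∧ p.2 < 1

theorem In1.bx {p : Pt} (h : In1 p) : p ∈ bx 0 1 0 1 := ⟨h.1.le, h.2.1.le, h.2.2.1.le, h.2.2.2.le⟩

theorem In1.mid {p q r : Pt} (hp : In1 p) (hr : In1 r) (h1 : p ≤ q) (h2 : q ≤ r) : In1 q :=
  ⟨lt_of_lt_of_le hp.1 h1.1, lt_of_le_of_lt h2.1 hr.2.1, lt_of_lt_of_le hp.2.2.1 h1.2, lt_of_le_of_lt h2.2 hr.2.2.2⟩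

theorem vt_between {l : Fin (MN N)} (h1 : (sysN N).le (exN N 1 (by omega)) l) (h2 : (sysN N).le (exN N 2 (by omega)) l)
    (h3 : (sysN N).le l (exN N 3 (by omega))) (h4 : (sysN N).le l (exN N 4 (by omega))) : vtN N l := by
  have r1 : rkN N (exN N 1 (by omega)) = 1 := by rw [exN_rk]; norm_num
  have r2 : rkN N (exN N 2 (by omega)) = 1 := by rw [exN_rk]; norm_num
  have r3 : rkN N (exN N 3 (by omega)) = 3 := by rw [exN_rk]; norm_num
  have r4 : rkN N (exN N 4 (by omega)) = 3 := by rw [exN_rk]; norm_num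
  have a1 : okN N l ∧ 1 < rkN N l := by
    rcases h1 with e | e | e
    · rcases h2 with e' | e' | e'
      · rw [← e'] at e; simp [exN] at e
      · exact absurd e'.1 exN_not_vt
      · exact ⟨e'.2.1, r2 ▸ e'.2.2⟩
    · exact absurd e.1 exN_not_vt
    · exact ⟨e.2.1, r1 ▸ e.2.2⟩
  have a2 : rkN N l < 3 := by
    rcases h3 with e | e | e
    · rcases h4 with e' | e' | e'
      · rw [e'] at e; simp [exN] at e
      · exact absurd e'.2.1 exN_not_vt
      · exact r4 ▸ e'.2.2
    · exact absurd e.2.1 exN_not_vt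
    · exact r3 ▸ e.2.2
  exact vt_of_rk a1.1 (by omega)

theorem vt_eqv {l m : Fin (MN N)} (h : (sysN N).eqv l m) (hl : vtN N l) : vtN N m := leN_mid h.1 h.2 hl hl

theorem tmod_of_rlz {β : Beh (Fin (MN N)) (Fin (MN N))} (h : Rlz (sysN N) β) (hb : BdN N β) : ∃ g, TMod N g := by
  classical
  obtain ⟨f, hm, hB⟩ := h
  obtain ⟨b1, b2, b3, b4⟩ := hb
  have mV : ∀ x, 0 ≤ x → x ≤ 1 → MonoI (sysN N) (fun y => f (x, y)) 0 1 := by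
    intro x h1 h2 y y' h3 h4 h5
    exact hm.mono _ ⟨h1, h2, h3, h4.trans h5⟩ _ ⟨h1, h2, h3.trans h4, h5⟩ ⟨le_refl _, h4⟩
  have mH : ∀ x, 0 ≤ x → x ≤ 1 → MonoI (sysN N) (fun y => f (y, x)) 0 1 := by
    intro x h1 h2 y y' h3 h4 h5
    exact hm.mono _ ⟨h3, h4.trans h5, h1, h2⟩ _ ⟨h3.trans h4, h5, h1, h2⟩ ⟨h4, le_refl _⟩
  have R : ∀ k k' (h : k < 6) (h' : k' < 6), (if k = 0 then 0 else if k ≤ 2 then 1 else if k ≤ 4 then 3 else 4) <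
      (if k' = 0 then 0 else if k' ≤ 2 then 1 else if k' ≤ 4 then 3 else 4) → (sysN N).le (exN N k h) (exN N k' h') := by
    intro k k' h h' hh
    exact exN_le (by rw [exN_rk, exN_rk]; exact hh)
  obtain ⟨p1, p2, p3⟩ := elem_inv (mV 0 le_rfl zero_le_one) one_pos (R _ _ _ _ (by norm_num)) ((sysN N).rfl' _) (hB.lf.trans b1)
  obtain ⟨q1, q2, q3⟩ := elem_inv (mH 0 le_rfl zero_le_one) one_pos (R _ _ _ _ (by norm_num)) ((sysN N).rfl' _) (hB.bt.trans b2)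
  obtain ⟨r1, r2, r3⟩ := elem_inv (mH 1 zero_le_one le_rfl) one_pos (R _ _ _ _ (by norm_num)) (R _ _ _ _ (by norm_num)) (hB.tp.trans b3)
  obtain ⟨s1, s2, s3⟩ := elem_inv (mV 1 zero_le_one le_rfl) one_pos (R _ _ _ _ (by norm_num)) (R _ _ _ _ (by norm_num)) (hB.rt.trans b4)
  have inner : ∀ q, In1 q → vtN N (f q) := by
    intro q hq
    have hq' := hq.bx
    obtain ⟨e1, e2, e3, e4⟩ := hq
    obtain ⟨d1, d2, d3, d4⟩ := hq'
    refine vt_between ?_ ?_ ?_ ?_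
    · rw [← exN_eqv (p3 q.2 e3 e4)]; exact hm.mono (0, q.2) ⟨le_rfl, zero_le_one, d3, d4⟩ _ ⟨d1, d2, d3, d4⟩ ⟨d1, le_rfl⟩
    · rw [← exN_eqv (q3 q.1 e1 e2)]; exact hm.mono (q.1, 0) ⟨d1, d2, le_rfl, zero_le_one⟩ _ ⟨d1, d2, d3, d4⟩ ⟨le_rfl, d3⟩
    · rw [← exN_eqv (r3 q.1 e1 e2)]; exact hm.mono _ ⟨d1, d2, d3, d4⟩ (q.1, 1) ⟨d1, d2, zero_le_one, le_rfl⟩ ⟨le_rfl, d4⟩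
    · rw [← exN_eqv (s3 q.2 e3 e4)]; exact hm.mono _ ⟨d1, d2, d3, d4⟩ (1, q.2) ⟨zero_le_one, le_rfl, d3, d4⟩ ⟨d2, le_rfl⟩
  have bdry : ∀ q, q ∈ bx 0 1 0 1 → vtN N (f q) → In1 q := by
    rintro ⟨x, y⟩ ⟨d1, d2, d3, d4⟩ hv
    simp only at d1 d2 d3 d4
    have cs : ∀ x : ℝ, 0 ≤ x → x ≤ 1 → x = 0 ∨ x = 1 ∨ (0 < x ∧ x < 1) := by
      intro x h1 h2
      rcases h1.eq_or_lt with h | h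
      · exact Or.inl h.symm
      rcases h2.eq_or_lt with h' | h'
      · exact Or.inr (Or.inl h')
      · exact Or.inr (Or.inr ⟨h, h'⟩)
    rcases cs x d1 d2 with rfl | rfl | ⟨x1, x2⟩
    · exfalso
      rcases cs y d3 d4 with rfl | rfl | ⟨y1, y2⟩
      · rw [p1] at hv; exact exN_not_vt hv
      · rw [p2] at hv; exact exN_not_vt hv
      · rw [exN_eqv (p3 y y1 y2)] at hv; exact exN_not_vt hv
    · exfalso
      rcases cs y d3 d4 with rfl | rfl | ⟨y1, y2⟩
      · rw [s1] at hv; exact exN_not_vt hv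
      · rw [s2] at hv; exact exN_not_vt hv
      · rw [exN_eqv (s3 y y1 y2)] at hv; exact exN_not_vt hv
    · rcases cs y d3 d4 with rfl | rfl | ⟨y1, y2⟩
      · rw [exN_eqv (q3 x x1 x2)] at hv; exact absurd hv exN_not_vt
      · rw [exN_eqv (r3 x x1 x2)] at hv; exact absurd hv exN_not_vt
      · exact ⟨x1, x2, y1, y2⟩
  obtain ⟨G, hG⟩ := exists_dense (MN N) (Nat.succ_pos _)
  let th : Pt → Prop := fun s => ∃ a b, In1 a ∧ In1 b ∧ a ≤ s ∧ s ≤ b ∧ a ≠ s ∧ s ≠ b ∧ (sysN N).eqv (f a) (f b)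
  let F : Pt → Fin (MN N) := fun s => if th s ∧ (sysN N).eqv (f s) (G (s.1 + s.2)) then G (s.1 + s.2) else f s
  have hF : ∀ s, (sysN N).eqv (F s) (f s) := by
    intro s
    simp only [F]
    split_ifs with hc
    · exact hc.2.symm
    · exact Sys.eqv.refl _
  have att : ∀ a b l, In1 a → In1 b → a ≤ b → a ≠ b → (sysN N).eqv (f a) (f b) → (sysN N).eqv (f a) l →
      ∃ s, a ≤ s ∧ s ≤ b ∧ F s = l := by
    intro a b l ha hb hab hne h1 h2
    have hlt : a.1 + a.2 < b.1 + b.2 := by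
      rcases hab.1.eq_or_lt with e | e
      · rcases hab.2.eq_or_lt with e' | e'
        · exact absurd (Prod.ext e e') hne
        · linarith
      · have := hab.2; linarith
    obtain ⟨c, c1, c2, c3⟩ := hG l _ _ hlt
    set τ := (c - (a.1 + a.2)) / (b.1 + b.2 - (a.1 + a.2)) with hτ
    have hD : 0 < b.1 + b.2 - (a.1 + a.2) := by linarith
    have τ0 : 0 < τ := div_pos (by linarith) hD
    have τ1 : τ < 1 := by rw [hτ, div_lt_one hD]; linarith
    have τe : τ * (b.1 + b.2 - (a.1 + a.2)) = c - (a.1 + a.2) := by rw [hτ]; field_simp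
    have x1 := hab.1
    have y1 := hab.2
    set s : Pt := (a.1 + τ * (b.1 - a.1), a.2 + τ * (b.2 - a.2)) with hs
    have hsum : s.1 + s.2 = c := by simp only [hs]; linarith
    have as : a ≤ s := ⟨by simp only [hs]; nlinarith, by simp only [hs]; nlinarith⟩
    have sb : s ≤ b := ⟨by simp only [hs]; nlinarith, by simp only [hs]; nlinarith⟩
    have sIn := In1.mid ha hb as sb
    have e1 : (sysN N).eqv (f s) (f b) :=
      Sys.eqv_mid (hm.mono _ ha.bx _ sIn.bx as) (hm.mono _ sIn.bx _ hb.bx sb) h1 (Sys.eqv.refl _)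
    refine ⟨s, as, sb, ?_⟩
    have cond : th s ∧ (sysN N).eqv (f s) (G (s.1 + s.2)) := by
      refine ⟨⟨a, b, ha, hb, as, sb, ?_, ?_, h1⟩, ?_⟩
      · intro e; rw [e] at c1; linarith
      · intro e; rw [← e] at c2; linarith
      · rw [hsum, c3]; exact (e1.trans h1.symm).trans h2
    simp only [F]
    rw [if_pos cond, hsum, c3]
  have thick : ∀ q, F q ≠ f q → th q := by
    intro q hq
    by_contra hc
    exact hq (by simp only [F]; rw [if_neg (fun h => hc h.1)])
  have fut : ∀ p i, In1 p → aN N (F p) i → ∃ q, In1 q ∧ p ≤ q ∧ wFN N (F q) i := by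
    intro p i hp hA
    have hA' : (sysN N).A (f p) ⟨i, by have := hA.2.1; have := @Nat.lt_two_pow_self (N + 1); unfold MN; omega⟩ :=
      Sys.eqv.A (hF p) hA
    rcases hm.fut p hp.bx _ hA' with ⟨q, k1, k2, k3⟩ | ⟨q, k1, k2, k3, k4⟩
    · rcases k3 with k3 | ⟨⟨l, k3, k3'⟩, q', k4, k5, k6, k7⟩
      · have hq := bdry q k1 k3.1
        by_cases e : F q = f q
        · exact ⟨q, hq, k2, by rw [e]; exact k3⟩
        · obtain ⟨a, b, ha, hb, a1, a2, a3, a4, a5⟩ := thick q e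
          have e1 : (sysN N).eqv (f q) (f b) :=
            Sys.eqv_mid (hm.mono _ ha.bx _ hq.bx a1) (hm.mono _ hq.bx _ hb.bx a2) a5 (Sys.eqv.refl _)
          obtain ⟨s, t1, t2, t3⟩ := att q b (f q) hq hb a2 a4 e1 (Sys.eqv.refl _)
          exact ⟨s, In1.mid hq hb t1 t2, le_trans k2 t1, by rw [t3]; exact k3⟩
      · have hq := bdry q k1 (vt_eqv k3.symm k3'.1)
        have hq' := bdry q' k4 (vt_eqv k7 (inner q hq))
        obtain ⟨s, t1, t2, t3⟩ := att q q' l hq hq' k5 k6 k7 k3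
        exact ⟨s, In1.mid hq hq' t1 t2, le_trans k2 t1, by rw [t3]; exact k3'⟩
    · have hq := bdry q k1 k4.1
      rcases k2 with k2 | k2
      · have := hq.2.1; linarith
      · have := hq.2.2.2; linarith
  have past : ∀ p i, In1 p → bN N (F p) i → ∃ q, In1 q ∧ q ≤ p ∧ wPN N (F q) i := by
    intro p i hp hA
    have hA' : (sysN N).B (f p) ⟨i, by have := hA.2.1; have := @Nat.lt_two_pow_self (N + 1); unfold MN; omega⟩ :=
      Sys.eqv.B (hF p) hA
    rcases hm.past p hp.bx _ hA' with ⟨q, k1, k2, k3⟩ | ⟨q, k1, k2, k3, k4⟩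
    · rcases k3 with k3 | ⟨⟨l, k3, k3'⟩, q', k4, k5, k6, k7⟩
      · have hq := bdry q k1 k3.1
        by_cases e : F q = f q
        · exact ⟨q, hq, k2, by rw [e]; exact k3⟩
        · obtain ⟨a, b, ha, hb, a1, a2, a3, a4, a5⟩ := thick q e
          have e1 : (sysN N).eqv (f q) (f a) :=
            Sys.eqv_mid (hm.mono _ ha.bx _ hq.bx a1) (hm.mono _ hq.bx _ hb.bx a2) (Sys.eqv.refl _) a5.symm
          obtain ⟨s, t1, t2, t3⟩ := att a q (f q) ha hq a1 a3 e1.symm e1.symm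
          exact ⟨s, In1.mid ha hq t1 t2, le_trans t2 k2, by rw [t3]; exact k3⟩
      · rw [Sys.eqv_dual] at k3 k7
        have hq := bdry q k1 (vt_eqv k3.symm k3'.1)
        have hq' := bdry q' k4 (vt_eqv k7 (inner q hq))
        obtain ⟨s, t1, t2, t3⟩ := att q' q l hq' hq k5 (Ne.symm k6) k7.symm (k7.symm.trans k3)
        exact ⟨s, In1.mid hq' hq t1 t2, le_trans t2 k2, by rw [t3]; exact k3'⟩
    · have hq := bdry q k1 k4.1
      rcases k2 with k2 | k2
      · have := hq.1; linarith
      · have := hq.2.2.1; linarith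
  obtain ⟨J, K, hJ, hK, hJK, hKJ, hKm⟩ := exists_J
  let u : Pt → Pt := fun p => ((K p.1 + 1) / 2, (K p.2 + 1) / 2)
  let w : Pt → Pt := fun p => (J (2 * p.1 - 1), J (2 * p.2 - 1))
  have uIn : ∀ p, In1 (u p) := by
    intro p
    have h1 := hK p.1; have h2 := hK p.2
    refine ⟨?_, ?_, ?_, ?_⟩ <;> (simp only [u]; linarith)
  have um : ∀ p q, p ≤ q → u p ≤ u q := by
    intro p q hpq
    have h1 := hKm hpq.1; have h2 := hKm hpq.2
    exact ⟨by simp only [u]; linarith, by simp only [u]; linarith⟩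
  have uw : ∀ q, In1 q → u (w q) = q := by
    intro q hq
    obtain ⟨h1, h2, h3, h4⟩ := hq
    simp only [u, w]
    rw [hKJ _ (by linarith) (by linarith), hKJ _ (by linarith) (by linarith)]
    ext <;> simp
  have wu : ∀ p, w (u p) = p := by
    intro p
    simp only [u, w]
    have e1 : 2 * ((K p.1 + 1) / 2) - 1 = K p.1 := by ring
    have e2 : 2 * ((K p.2 + 1) / 2) - 1 = K p.2 := by ring
    rw [e1, e2, hJK, hJK]
  have wm : ∀ p q, In1 p → In1 q → p ≤ q → w p ≤ w q := by
    intro p q hp hq hpq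
    obtain ⟨h1, h2, h3, h4⟩ := hp
    obtain ⟨h5, h6, h7, h8⟩ := hq
    have a1 := hpq.1; have a2 := hpq.2
    exact ⟨hJ _ _ (by linarith) (by linarith) (by linarith) (by linarith) (by linarith),
      hJ _ _ (by linarith) (by linarith) (by linarith) (by linarith) (by linarith)⟩
  have FV : ∀ p, vtN N (F (u p)) := fun p => vt_eqv (hF _).symm (inner _ (uIn p))
  refine ⟨fun p => F (u p), FV, ?_, ?_, ?_⟩
  · intro p q hpq
    refine leN_vt ?_ (FV p) (FV q)
    exact (sysN N).trans' (hF _).1 ((sysN N).trans' (hm.mono _ (uIn p).bx _ (uIn q).bx (um _ _ hpq)) (hF _).2)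
  · intro p i hi hbit
    obtain ⟨q, h1, h2, h3⟩ := fut (u p) i (uIn p) ⟨FV p, hi, hbit⟩
    refine ⟨w q, ?_, ?_⟩
    · rw [← wu p]; exact wm _ _ (uIn p) h1 h2
    · rw [uw q h1]; exact h3.2.2
  · intro p i hi hbit
    obtain ⟨q, h1, h2, h3⟩ := past (u p) i (uIn p) ⟨FV p, hi, hbit⟩
    refine ⟨w q, ?_, ?_⟩
    · rw [← wu p]; exact wm _ _ h1 (uIn p) h2
    · rw [uw q h1]; exact h3.2.2

theorem sat_iff (φ : TForm) : TSatisfiable (fun p q : ℝ × ℝ => p ≤ q) φ ↔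
    ∀ S, Closed (sysN (codeN φ)) S → ∃ β, S β ∧ BdN (codeN φ) β := by
  constructor
  · intro h S hS
    obtain ⟨g, hg⟩ := tmod_of_sat h
    exact beh_of_tmod hg hS
  · intro h
    obtain ⟨β, h1, h2⟩ := h _ closed_rlz
    obtain ⟨g, hg⟩ := tmod_of_rlz h1 h2
    exact hg.sat

theorem valid_iff (φ : TForm) : TValid (fun p q : ℝ × ℝ => p ≤ q) φ ↔
    ∃ S, Closed (sysN (codeN (.neg φ))) S ∧ ∀ β, S β → ¬ BdN (codeN (.neg φ)) β := by
  have h := sat_iff (.neg φ)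
  have h' : TValid (fun p q : ℝ × ℝ => p ≤ q) φ ↔ ¬ TSatisfiable (fun p q : ℝ × ℝ => p ≤ q) (.neg φ) := by
    simp [TValid, TSatisfiable, TSat]
  rw [h', h]
  push Not
  rfl

end
end Temporal

namespace Temporal

/-! ### Primitive recursiveness of the concrete system -/
section
variable {α : Type} [Primcodable α]

theorem pImp {p q : α → Prop} (hp : PrimrecPred p) (hq : PrimrecPred q) : PrimrecPred fun a => p a → q a :=
  (hp.not.or hq).of_eq fun a => by tauto
theorem pIff {p q : α → Prop} (hp : PrimrecPred p) (hq : PrimrecPred q) : PrimrecPred fun a => (p a ↔ q a) :=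
  ((pImp hp hq).and (pImp hq hp)).of_eq fun a => by tauto

theorem pAllLt {P : α → ℕ → Prop} {f : α → ℕ} (hP : PrimrecPred fun p : α × ℕ => P p.1 p.2) (hf : Primrec f) :
    PrimrecPred fun a => ∀ x < f a, P a x := by
  have h : PrimrecRel (fun (x : ℕ) (a : α) => P a x) := hP.comp (Primrec.snd.pair Primrec.fst)
  exact (PrimrecRel.comp h.forall_mem_list (Primrec.list_range.comp hf) Primrec.id).of_eq fun a => by simp

theorem pExLt {P : α → ℕ → Prop} {f : α → ℕ} (hP : PrimrecPred fun p : α × ℕ => P p.1 p.2) (hf : Primrec f) :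
    PrimrecPred fun a => ∃ x, x < f a ∧ P a x := by
  have h : PrimrecRel (fun (x : ℕ) (a : α) => P a x) := hP.comp (Primrec.snd.pair Primrec.fst)
  exact (PrimrecRel.comp h.exists_mem_list (Primrec.list_range.comp hf) Primrec.id).of_eq fun a => by simp

theorem pAdd {f g : α → ℕ} (hf : Primrec f) (hg : Primrec g) : Primrec fun a => f a + g a := Primrec.nat_add.comp hf hg
theorem pMul {f g : α → ℕ} (hf : Primrec f) (hg : Primrec g) : Primrec fun a => f a * g a := Primrec.nat_mul.comp hf hg
theorem pDiv {f g : α → ℕ} (hf : Primrec f) (hg : Primrec g) : Primrec fun a => f a / g a := Primrec.nat_div.comp hf hg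
theorem pMod {f g : α → ℕ} (hf : Primrec f) (hg : Primrec g) : Primrec fun a => f a % g a := Primrec.nat_mod.comp hf hg
theorem pPow {f g : α → ℕ} (hf : Primrec f) (hg : Primrec g) : Primrec fun a => f a ^ g a :=
  (Primrec₂.unpaired'.1 Nat.Primrec.pow).comp hf hg
theorem pFst {β γ : Type} [Primcodable β] [Primcodable γ] {f : α → β × γ} (hf : Primrec f) : Primrec fun a => (f a).1 :=
  Primrec.fst.comp hf
theorem pSnd {β γ : Type} [Primcodable β] [Primcodable γ] {f : α → β × γ} (hf : Primrec f) : Primrec fun a => (f a).2 :=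
  Primrec.snd.comp hf
theorem pUnp {f : α → ℕ} (hf : Primrec f) : Primrec fun a => (f a).unpair := Primrec.unpair.comp hf
theorem pEq {f g : α → ℕ} (hf : Primrec f) (hg : Primrec g) : PrimrecPred fun a => f a = g a := Primrec.eq.comp hf hg
theorem pLt {f g : α → ℕ} (hf : Primrec f) (hg : Primrec g) : PrimrecPred fun a => f a < g a := Primrec.nat_lt.comp hf hg
theorem pLeq {f g : α → ℕ} (hf : Primrec f) (hg : Primrec g) : PrimrecPred fun a => f a ≤ g a := Primrec.nat_le.comp hf hg
theorem pBit {f g : α → ℕ} (hf : Primrec f) (hg : Primrec g) : PrimrecPred fun a => (f a).testBit (g a) = true :=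
  (pEq (pMod (pDiv hf (pPow (Primrec.const 2) hg)) (Primrec.const 2)) (Primrec.const 1)).of_eq fun a => by
    rw [Nat.testBit_eq_decide_div_mod_eq]; simp

variable {N x y z i : α → ℕ}

theorem pVal (hN : Primrec N) (hx : Primrec x) : PrimrecPred fun a => valN (N a) (x a) := by
  unfold valN
  refine (pBit hx hN).and (pAllLt ?_ (pAdd hN (Primrec.const 1)))
  have hx' : Primrec fun p : α × ℕ => x p.1 := hx.comp Primrec.fst
  have hi : Primrec fun p : α × ℕ => p.2 := Primrec.snd
  have h5 : Primrec fun p : α × ℕ => p.2 / 5 := pDiv hi (Primrec.const 5)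
  have hm : ∀ k, PrimrecPred fun p : α × ℕ => p.2 % 5 = k := fun k => pEq (pMod hi (Primrec.const 5)) (Primrec.const k)
  refine (pImp (hm 1) (pIff (pBit hx' hi) (pBit hx' h5).not)).and ((pImp (hm 2) (pIff (pBit hx' hi)
    ((pBit hx' (pFst (pUnp h5))).or (pBit hx' (pSnd (pUnp h5)))))).and (pImp ((hm 3).or (hm 4)) (pImp (pBit hx' h5) (pBit hx' hi))))

theorem pTop (hN : Primrec N) : Primrec fun a => 2 ^ (N a + 1) := pPow (Primrec.const 2) (pAdd hN (Primrec.const 1))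
theorem pMN (hN : Primrec N) : Primrec fun a => MN (N a) := pAdd (pTop hN) (Primrec.const 6)
theorem pVt (hN : Primrec N) (hx : Primrec x) : PrimrecPred fun a => vtN (N a) (x a) :=
  (pLt hx (pTop hN)).and (pVal hN hx)
theorem pOk (hN : Primrec N) (hx : Primrec x) : PrimrecPred fun a => okN (N a) (x a) :=
  pImp (pLt hx (pTop hN)) (pVal hN hx)
theorem pRk (hN : Primrec N) (hx : Primrec x) : Primrec fun a => rkN (N a) (x a) :=
  Primrec.ite (pLt hx (pTop hN)) (Primrec.const 2) (Primrec.ite (pEq hx (pTop hN)) (Primrec.const 0)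
    (Primrec.ite (pLeq hx (pAdd (pTop hN) (Primrec.const 2))) (Primrec.const 1)
      (Primrec.ite (pLeq hx (pAdd (pTop hN) (Primrec.const 4))) (Primrec.const 3) (Primrec.const 4))))
theorem pTle (hN : Primrec N) (hx : Primrec x) (hy : Primrec y) : PrimrecPred fun a => tleN (N a) (x a) (y a) := by
  unfold tleN
  have hx' : Primrec fun p : α × ℕ => x p.1 := hx.comp Primrec.fst
  have hy' : Primrec fun p : α × ℕ => y p.1 := hy.comp Primrec.fst
  have hi : Primrec fun p : α × ℕ => p.2 := Primrec.snd
  have hm : ∀ k, PrimrecPred fun p : α × ℕ => p.2 % 5 = k := fun k => pEq (pMod hi (Primrec.const 5)) (Primrec.const k)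
  exact pAllLt ((pImp (hm 3) (pImp (pBit hy' hi) (pBit hx' hi))).and (pImp (hm 4) (pImp (pBit hx' hi) (pBit hy' hi))))
    (pAdd hN (Primrec.const 1))
theorem pLeN (hN : Primrec N) (hx : Primrec x) (hy : Primrec y) : PrimrecPred fun a => leN (N a) (x a) (y a) :=
  (pEq hx hy).or (((pVt hN hx).and ((pVt hN hy).and (pTle hN hx hy))).or
    ((pOk hN hx).and ((pOk hN hy).and (pLt (pRk hN hx) (pRk hN hy)))))
theorem p5 (k : ℕ) (hx : Primrec x) : Primrec fun a => 5 * x a + k :=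
  pAdd (pMul (Primrec.const 5) hx) (Primrec.const k)
theorem pAN (hN : Primrec N) (hx : Primrec x) (hi : Primrec i) : PrimrecPred fun a => aN (N a) (x a) (i a) :=
  (pVt hN hx).and ((pLeq (p5 3 hi) hN).and (pBit hx (p5 3 hi)))
theorem pBN (hN : Primrec N) (hx : Primrec x) (hi : Primrec i) : PrimrecPred fun a => bN (N a) (x a) (i a) :=
  (pVt hN hx).and ((pLeq (p5 4 hi) hN).and (pBit hx (p5 4 hi)))
theorem pwFN (hN : Primrec N) (hx : Primrec x) (hi : Primrec i) : PrimrecPred fun a => wFN (N a) (x a) (i a) :=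
  (pVt hN hx).and ((pLeq (p5 3 hi) hN).and (pBit hx hi))
theorem pwPN (hN : Primrec N) (hx : Primrec x) (hi : Primrec i) : PrimrecPred fun a => wPN (N a) (x a) (i a) :=
  (pVt hN hx).and ((pLeq (p5 4 hi) hN).and (pBit hx hi))

/-! labels, behaviours and families as numbers -/

theorem MN_pos (N : ℕ) : 0 < MN N := Nat.succ_pos _

def lab (N x : ℕ) : Fin (MN N) := ⟨x % MN N, Nat.mod_lt _ (MN_pos N)⟩

theorem lab_val {N : ℕ} (x : Fin (MN N)) : lab N x = x := Fin.ext (Nat.mod_eq_of_lt x.2)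

def trD (N b e : ℕ) : Tr (Fin (MN N)) where
  pres l := b.testBit (e * MN N + l) = true
  nd l := b.testBit ((e + 1) * MN N + l) = true
  mn l := b.testBit ((e + 2) * MN N + l) = true
  mx l := b.testBit ((e + 3) * MN N + l) = true

def dec (N b : ℕ) : Beh (Fin (MN N)) (Fin (MN N)) where
  lf := trD N b 0
  rt := trD N b 4
  bt := trD N b 8
  tp := trD N b 12
  rF l := b.testBit (16 * MN N + l) = true
  rP l := b.testBit (17 * MN N + l) = true

def cmpT (N : ℕ) (T : Tr (Fin (MN N))) (k : ℕ) (l : Fin (MN N)) : Prop :=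
  if k = 0 then T.pres l else if k = 1 then T.nd l else if k = 2 then T.mn l else T.mx l

def cmp (N : ℕ) (β : Beh (Fin (MN N)) (Fin (MN N))) (k : ℕ) (l : Fin (MN N)) : Prop :=
  if k < 4 then cmpT N β.lf k l else if k < 8 then cmpT N β.rt (k - 4) l else if k < 12 then cmpT N β.bt (k - 8) l
  else if k < 16 then cmpT N β.tp (k - 12) l else if k = 16 then β.rF l else β.rP l

theorem dec_surj (N : ℕ) (β : Beh (Fin (MN N)) (Fin (MN N))) : ∃ b < 2 ^ (18 * MN N), dec N b = β := by
  obtain ⟨b, hb, h⟩ := bits_exist (fun j => cmp N β (j / MN N) (lab N j)) (18 * MN N)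
  have key : ∀ k, k < 18 → ∀ l : Fin (MN N), (b.testBit (k * MN N + l) = true ↔ cmp N β k l) := by
    intro k hk l
    have h1 : k * MN N + l < 18 * MN N := by
      have h2 : (k + 1) * MN N ≤ 18 * MN N := Nat.mul_le_mul_right _ hk
      have := l.2; rw [add_mul] at h2; omega
    have e1 : (k * MN N + l) / MN N = k := by
      rw [mul_comm, Nat.mul_add_div (MN_pos N), Nat.div_eq_of_lt l.2, add_zero]
    have e2 : lab N (k * MN N + l) = l := Fin.ext (by simp [lab, Nat.mod_eq_of_lt l.2])
    rw [h _ h1, e1, e2]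
  refine ⟨b, hb, ?_⟩
  have tT : ∀ e T, e + 3 < 18 → (∀ k, k < 4 → ∀ l, cmp N β (e + k) l ↔ cmpT N T k l) → trD N b e = T := by
    intro e T he hT
    refine Tr.ext ?_ ?_ ?_ ?_ <;> funext l <;> apply propext
    · exact (key e (by omega) l).trans (hT 0 (by omega) l)
    · exact (key (e + 1) (by omega) l).trans (hT 1 (by omega) l)
    · exact (key (e + 2) (by omega) l).trans (hT 2 (by omega) l)
    · exact (key (e + 3) (by omega) l).trans (hT 3 (by omega) l)
  refine Beh.ext ?_ ?_ ?_ ?_ ?_ ?_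
  · exact tT 0 _ (by omega) fun k hk l => by unfold cmp; rw [if_pos (by omega), zero_add]
  · exact tT 4 _ (by omega) fun k hk l => by
      unfold cmp; rw [if_neg (by omega), if_pos (by omega), Nat.add_sub_cancel_left]
  · exact tT 8 _ (by omega) fun k hk l => by
      unfold cmp; rw [if_neg (by omega), if_neg (by omega), if_pos (by omega), Nat.add_sub_cancel_left]
  · exact tT 12 _ (by omega) fun k hk l => by
      unfold cmp; rw [if_neg (by omega), if_neg (by omega), if_neg (by omega), if_pos (by omega), Nat.add_sub_cancel_left]
  · funext l; exact propext ((key 16 (by omega) l).trans (by simp [cmp]))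
  · funext l; exact propext ((key 17 (by omega) l).trans (by simp [cmp]))

def decS (N s : ℕ) (β : Beh (Fin (MN N)) (Fin (MN N))) : Prop :=
  ∃ b, b < 2 ^ (18 * MN N) ∧ s.testBit b = true ∧ dec N b = β

theorem decS_surj (N : ℕ) (S : Beh (Fin (MN N)) (Fin (MN N)) → Prop) : ∃ s < 2 ^ (2 ^ (18 * MN N)), decS N s = S := by
  obtain ⟨s, hs, h⟩ := bits_exist (fun b => S (dec N b)) (2 ^ (18 * MN N))
  refine ⟨s, hs, ?_⟩
  funext β
  apply propext
  constructor
  · rintro ⟨b, h1, h2, rfl⟩; exact (h b h1).1 h2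
  · intro hβ
    obtain ⟨b, h1, rfl⟩ := dec_surj N β
    exact ⟨b, h1, (h b h1).2 hβ, rfl⟩

/-! quantifiers -/

theorem pAllF {P : (a : α) → Fin (MN (N a)) → Prop} (hN : Primrec N)
    (hP : PrimrecPred fun p : α × ℕ => P p.1 (lab (N p.1) p.2)) : PrimrecPred fun a => ∀ x, P a x :=
  (pAllLt (P := fun a x => P a (lab (N a) x)) hP (pMN hN)).of_eq fun a =>
    ⟨fun h x => by have := h x.1 x.2; rwa [lab_val] at this, fun h x _ => h _⟩
theorem pExF {P : (a : α) → Fin (MN (N a)) → Prop} (hN : Primrec N)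
    (hP : PrimrecPred fun p : α × ℕ => P p.1 (lab (N p.1) p.2)) : PrimrecPred fun a => ∃ x, P a x :=
  (pExLt (P := fun a x => P a (lab (N a) x)) hP (pMN hN)).of_eq fun a =>
    ⟨fun ⟨x, _, h⟩ => ⟨_, h⟩, fun ⟨x, h⟩ => ⟨x.1, x.2, by rw [lab_val]; exact h⟩⟩
theorem pBB (hN : Primrec N) : Primrec fun a => 2 ^ (18 * MN (N a)) :=
  pPow (Primrec.const 2) (pMul (Primrec.const 18) (pMN hN))
theorem pAllB {P : (a : α) → Beh (Fin (MN (N a))) (Fin (MN (N a))) → Prop} (hN : Primrec N)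
    (hP : PrimrecPred fun p : α × ℕ => P p.1 (dec (N p.1) p.2)) : PrimrecPred fun a => ∀ x, P a x :=
  (pAllLt (P := fun a x => P a (dec (N a) x)) hP (pBB hN)).of_eq fun a =>
    ⟨fun h x => by obtain ⟨b, hb, rfl⟩ := dec_surj _ x; exact h b hb, fun h x _ => h _⟩
theorem pExB {P : (a : α) → Beh (Fin (MN (N a))) (Fin (MN (N a))) → Prop} (hN : Primrec N)
    (hP : PrimrecPred fun p : α × ℕ => P p.1 (dec (N p.1) p.2)) : PrimrecPred fun a => ∃ x, P a x :=
  (pExLt (P := fun a x => P a (dec (N a) x)) hP (pBB hN)).of_eq fun a =>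
    ⟨fun ⟨x, _, h⟩ => ⟨_, h⟩, fun ⟨x, h⟩ => by obtain ⟨b, hb, rfl⟩ := dec_surj _ x; exact ⟨b, hb, h⟩⟩
theorem pExS {P : (a : α) → (Beh (Fin (MN (N a))) (Fin (MN (N a))) → Prop) → Prop} (hN : Primrec N)
    (hP : PrimrecPred fun p : α × ℕ => P p.1 (decS (N p.1) p.2)) : PrimrecPred fun a => ∃ S, P a S :=
  (pExLt (P := fun a x => P a (decS (N a) x)) hP (pPow (Primrec.const 2) (pBB hN))).of_eq fun a =>
    ⟨fun ⟨x, _, h⟩ => ⟨_, h⟩, fun ⟨x, h⟩ => by obtain ⟨b, hb, rfl⟩ := decS_surj _ x; exact ⟨b, hb, h⟩⟩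

/-! atoms -/

theorem pLab (hN : Primrec N) (hx : Primrec x) : Primrec fun a => ((lab (N a) (x a) : Fin (MN (N a))) : ℕ) :=
  pMod hx (pMN hN)
theorem qEq (hN : Primrec N) (hx : Primrec x) (hy : Primrec y) : PrimrecPred fun a => lab (N a) (x a) = lab (N a) (y a) :=
  (pEq (pLab hN hx) (pLab hN hy)).of_eq fun a => Fin.ext_iff.symm
theorem qLe (hN : Primrec N) (hx : Primrec x) (hy : Primrec y) :
    PrimrecPred fun a => (sysN (N a)).le (lab (N a) (x a)) (lab (N a) (y a)) := pLeN hN (pLab hN hx) (pLab hN hy)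
theorem qA (hN : Primrec N) (hx : Primrec x) (hy : Primrec y) :
    PrimrecPred fun a => (sysN (N a)).A (lab (N a) (x a)) (lab (N a) (y a)) := pAN hN (pLab hN hx) (pLab hN hy)
theorem qB (hN : Primrec N) (hx : Primrec x) (hy : Primrec y) :
    PrimrecPred fun a => (sysN (N a)).B (lab (N a) (x a)) (lab (N a) (y a)) := pBN hN (pLab hN hx) (pLab hN hy)
theorem qwF (hN : Primrec N) (hx : Primrec x) (hy : Primrec y) :
    PrimrecPred fun a => (sysN (N a)).wF (lab (N a) (x a)) (lab (N a) (y a)) := pwFN hN (pLab hN hx) (pLab hN hy)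
theorem qwP (hN : Primrec N) (hx : Primrec x) (hy : Primrec y) :
    PrimrecPred fun a => (sysN (N a)).wP (lab (N a) (x a)) (lab (N a) (y a)) := pwPN hN (pLab hN hx) (pLab hN hy)
theorem qeqv (hN : Primrec N) (hx : Primrec x) (hy : Primrec y) :
    PrimrecPred fun a => (sysN (N a)).eqv (lab (N a) (x a)) (lab (N a) (y a)) := (qLe hN hx hy).and (qLe hN hy hx)
theorem qWF (hN : Primrec N) (hx : Primrec x) (hy : Primrec y) :
    PrimrecPred fun a => (sysN (N a)).WF (lab (N a) (x a)) (lab (N a) (y a)) :=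
  pExF hN ((qeqv (hN.comp Primrec.fst) (hx.comp Primrec.fst) Primrec.snd).and
    (qwF (hN.comp Primrec.fst) Primrec.snd (hy.comp Primrec.fst)))
theorem qWP (hN : Primrec N) (hx : Primrec x) (hy : Primrec y) :
    PrimrecPred fun a => (sysN (N a)).WP (lab (N a) (x a)) (lab (N a) (y a)) :=
  pExF hN ((qeqv (hN.comp Primrec.fst) (hx.comp Primrec.fst) Primrec.snd).and
    (qwP (hN.comp Primrec.fst) Primrec.snd (hy.comp Primrec.fst)))
theorem qrF (hN : Primrec N) (hx : Primrec x) (hy : Primrec y) :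
    PrimrecPred fun a => (dec (N a) (x a)).rF (lab (N a) (y a)) :=
  pBit hx (pAdd (pMul (Primrec.const 16) (pMN hN)) (pLab hN hy))
theorem qrP (hN : Primrec N) (hx : Primrec x) (hy : Primrec y) :
    PrimrecPred fun a => (dec (N a) (x a)).rP (lab (N a) (y a)) :=
  pBit hx (pAdd (pMul (Primrec.const 17) (pMN hN)) (pLab hN hy))

/-! traces -/

structure PTr (N : α → ℕ) (T : (a : α) → Tr (Fin (MN (N a)))) : Prop where
  pres : PrimrecPred fun p : α × ℕ => (T p.1).pres (lab (N p.1) p.2)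
  nd : PrimrecPred fun p : α × ℕ => (T p.1).nd (lab (N p.1) p.2)
  mn : PrimrecPred fun p : α × ℕ => (T p.1).mn (lab (N p.1) p.2)
  mx : PrimrecPred fun p : α × ℕ => (T p.1).mx (lab (N p.1) p.2)

theorem PTr.comp {γ : Type} [Primcodable γ] {T : (a : α) → Tr (Fin (MN (N a)))} (h : PTr N T) {f : γ → α}
    (hf : Primrec f) : PTr (fun c => N (f c)) (fun c => T (f c)) where
  pres := h.pres.comp (f := fun p : γ × ℕ => (f p.1, p.2)) ((hf.comp Primrec.fst).pair Primrec.snd)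
  nd := h.nd.comp (f := fun p : γ × ℕ => (f p.1, p.2)) ((hf.comp Primrec.fst).pair Primrec.snd)
  mn := h.mn.comp (f := fun p : γ × ℕ => (f p.1, p.2)) ((hf.comp Primrec.fst).pair Primrec.snd)
  mx := h.mx.comp (f := fun p : γ × ℕ => (f p.1, p.2)) ((hf.comp Primrec.fst).pair Primrec.snd)

theorem tD (e : ℕ) (hN : Primrec N) (hx : Primrec x) : PTr N fun a => trD (N a) (x a) e := by
  have hx' : Primrec fun p : α × ℕ => x p.1 := hx.comp Primrec.fst
  have hN' : Primrec fun p : α × ℕ => N p.1 := hN.comp Primrec.fst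
  have hl := pLab hN' (Primrec.snd (α := α) (β := ℕ))
  exact ⟨pBit hx' (pAdd (pMul (Primrec.const _) (pMN hN')) hl), pBit hx' (pAdd (pMul (Primrec.const _) (pMN hN')) hl),
    pBit hx' (pAdd (pMul (Primrec.const _) (pMN hN')) hl), pBit hx' (pAdd (pMul (Primrec.const _) (pMN hN')) hl)⟩
theorem tlf (hN : Primrec N) (hx : Primrec x) : PTr N fun a => (dec (N a) (x a)).lf := tD 0 hN hx
theorem trt (hN : Primrec N) (hx : Primrec x) : PTr N fun a => (dec (N a) (x a)).rt := tD 4 hN hx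
theorem tbt (hN : Primrec N) (hx : Primrec x) : PTr N fun a => (dec (N a) (x a)).bt := tD 8 hN hx
theorem ttp (hN : Primrec N) (hx : Primrec x) : PTr N fun a => (dec (N a) (x a)).tp := tD 12 hN hx
theorem tel (hN : Primrec N) (hx : Primrec x) (hy : Primrec y) (hz : Primrec z) :
    PTr N fun a => Tr.elem (sysN (N a)) (lab (N a) (x a)) (lab (N a) (y a)) (lab (N a) (z a)) := by
  have hN' : Primrec fun p : α × ℕ => N p.1 := hN.comp Primrec.fst
  have hx' : Primrec fun p : α × ℕ => x p.1 := hx.comp Primrec.fst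
  have hy' : Primrec fun p : α × ℕ => y p.1 := hy.comp Primrec.fst
  have hz' : Primrec fun p : α × ℕ => z p.1 := hz.comp Primrec.fst
  have hl : Primrec fun p : α × ℕ => p.2 := Primrec.snd
  exact ⟨(qeqv hN' hx' hl).or ((qeqv hN' hy' hl).or (qeqv hN' hz' hl)), qeqv hN' hy' hl,
    (qEq hN' hl hx').or ((qEq hN' hl hz').and ((qeqv hN' hz' hy').not.and (qeqv hN' hz' hx').not)),
    (qEq hN' hl hz').or ((qEq hN' hl hx').and ((qeqv hN' hx' hy').not.and (qeqv hN' hx' hz').not))⟩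
theorem tcc {T T' : (a : α) → Tr (Fin (MN (N a)))} (h : PTr N T) (h' : PTr N T') : PTr N fun a => Tr.conc (T a) (T' a) :=
  ⟨h.pres.or h'.pres, h.nd.or h'.nd, h.mn.or (h'.mn.and h.pres.not), h'.mx.or (h.mx.and h'.pres.not)⟩
theorem qTr {T T' : (a : α) → Tr (Fin (MN (N a)))} (hN : Primrec N) (h : PTr N T) (h' : PTr N T') :
    PrimrecPred fun a => T a = T' a := by
  refine ((pAllF hN (P := fun a l => ((T a).pres l ↔ (T' a).pres l)) (pIff h.pres h'.pres)).and
    ((pAllF hN (P := fun a l => ((T a).nd l ↔ (T' a).nd l)) (pIff h.nd h'.nd)).and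
    ((pAllF hN (P := fun a l => ((T a).mn l ↔ (T' a).mn l)) (pIff h.mn h'.mn)).and
    (pAllF hN (P := fun a l => ((T a).mx l ↔ (T' a).mx l)) (pIff h.mx h'.mx))))).of_eq fun a => ?_
  rw [Tr.ext_iff]
  simp only [funext_iff, eq_iff_iff]

theorem qBeh (hN : Primrec N) (hx : Primrec x) (hy : Primrec y) : PrimrecPred fun a => dec (N a) (x a) = dec (N a) (y a) := by
  have hN' : Primrec fun p : α × ℕ => N p.1 := hN.comp Primrec.fst
  have hx' : Primrec fun p : α × ℕ => x p.1 := hx.comp Primrec.fst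
  have hy' : Primrec fun p : α × ℕ => y p.1 := hy.comp Primrec.fst
  have hl : Primrec fun p : α × ℕ => p.2 := Primrec.snd
  refine ((qTr hN (tlf hN hx) (tlf hN hy)).and ((qTr hN (trt hN hx) (trt hN hy)).and ((qTr hN (tbt hN hx) (tbt hN hy)).and
    ((qTr hN (ttp hN hx) (ttp hN hy)).and ((pAllF hN (P := fun a l => ((dec (N a) (x a)).rF l ↔ (dec (N a) (y a)).rF l))
      (pIff (qrF hN' hx' hl) (qrF hN' hy' hl))).and (pAllF hN (P := fun a l => ((dec (N a) (x a)).rP l ↔ (dec (N a) (y a)).rP l))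
      (pIff (qrP hN' hx' hl) (qrP hN' hy' hl)))))))).of_eq fun a => ?_
  rw [Beh.ext_iff]
  simp only [funext_iff, eq_iff_iff]

theorem qS (hN : Primrec N) (hx : Primrec x) (hy : Primrec y) : PrimrecPred fun a => decS (N a) (x a) (dec (N a) (y a)) := by
  have hN' : Primrec fun p : α × ℕ => N p.1 := hN.comp Primrec.fst
  have hx' : Primrec fun p : α × ℕ => x p.1 := hx.comp Primrec.fst
  have hy' : Primrec fun p : α × ℕ => y p.1 := hy.comp Primrec.fst
  have hl : Primrec fun p : α × ℕ => p.2 := Primrec.snd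
  exact pExLt ((pBit hx' hl).and (qBeh hN' hl hy')) (pBB hN)

end
end Temporal

namespace Temporal

/-! ### Primitive recursiveness of the closure conditions -/
section
variable {α : Type} [Primcodable α] {N ll lr ul ur l r b t c i : α → ℕ}

theorem qBaseLe (hN : Primrec N) (h1 : Primrec ll) (h2 : Primrec lr) (h3 : Primrec ul) (h4 : Primrec ur)
    (h5 : Primrec l) (h6 : Primrec r) (h7 : Primrec b) (h8 : Primrec t) (h9 : Primrec c) :
    PrimrecPred fun a => BaseLe (sysN (N a)) (lab (N a) (ll a)) (lab (N a) (lr a)) (lab (N a) (ul a)) (lab (N a) (ur a))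
      (lab (N a) (l a)) (lab (N a) (r a)) (lab (N a) (b a)) (lab (N a) (t a)) (lab (N a) (c a)) := by
  unfold BaseLe
  repeat' first
    | assumption
    | with_reducible refine qLe ?_ ?_ ?_
    | with_reducible refine PrimrecPred.and ?_ ?_

theorem qBaseF (hN : Primrec N) (h1 : Primrec ll) (h2 : Primrec lr) (h3 : Primrec ul)
    (h5 : Primrec l) (h6 : Primrec r) (h7 : Primrec b) (h8 : Primrec t) (h9 : Primrec c) :
    PrimrecPred fun a => BaseF (sysN (N a)) (lab (N a) (ll a)) (lab (N a) (lr a)) (lab (N a) (ul a))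
      (lab (N a) (l a)) (lab (N a) (r a)) (lab (N a) (b a)) (lab (N a) (t a)) (lab (N a) (c a)) := by
  unfold BaseF
  apply pAllF hN
  have f : Primrec (Prod.fst : α × ℕ → α) := Primrec.fst
  have k0 := hN.comp f
  have k1 := h1.comp f
  have k2 := h2.comp f
  have k3 := h3.comp f
  have k5 := h5.comp f
  have k6 := h6.comp f
  have k7 := h7.comp f
  have k8 := h8.comp f
  have k9 := h9.comp f
  have k : Primrec (fun p : α × ℕ => p.2) := Primrec.snd
  repeat' first
    | assumption
    | with_reducible refine qA ?_ ?_ ?_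
    | with_reducible refine qwF ?_ ?_ ?_
    | with_reducible refine qWF ?_ ?_ ?_
    | with_reducible refine PrimrecPred.and ?_ ?_
    | with_reducible refine PrimrecPred.or ?_ ?_
    | with_reducible refine pImp ?_ ?_

theorem qBaseFd (hN : Primrec N) (h1 : Primrec ll) (h2 : Primrec lr) (h3 : Primrec ul)
    (h5 : Primrec l) (h6 : Primrec r) (h7 : Primrec b) (h8 : Primrec t) (h9 : Primrec c) :
    PrimrecPred fun a => BaseF (sysN (N a)).dual (lab (N a) (ll a)) (lab (N a) (lr a)) (lab (N a) (ul a))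
      (lab (N a) (l a)) (lab (N a) (r a)) (lab (N a) (b a)) (lab (N a) (t a)) (lab (N a) (c a)) := by
  unfold BaseF
  simp only [Sys.WF_dual]
  simp only [Sys.dual]
  apply pAllF hN
  have f : Primrec (Prod.fst : α × ℕ → α) := Primrec.fst
  have k0 := hN.comp f
  have k1 := h1.comp f
  have k2 := h2.comp f
  have k3 := h3.comp f
  have k5 := h5.comp f
  have k6 := h6.comp f
  have k7 := h7.comp f
  have k8 := h8.comp f
  have k9 := h9.comp f
  have k : Primrec (fun p : α × ℕ => p.2) := Primrec.snd
  repeat' first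
    | assumption
    | with_reducible refine qB ?_ ?_ ?_
    | with_reducible refine qwP ?_ ?_ ?_
    | with_reducible refine qWP ?_ ?_ ?_
    | with_reducible refine PrimrecPred.and ?_ ?_
    | with_reducible refine PrimrecPred.or ?_ ?_
    | with_reducible refine pImp ?_ ?_

theorem qBaseRes (hN : Primrec N) (h1 : Primrec ll) (h2 : Primrec lr) (h3 : Primrec ul) (h4 : Primrec ur)
    (h5 : Primrec l) (h6 : Primrec r) (h7 : Primrec b) (h8 : Primrec t) (h9 : Primrec c) (hi : Primrec i) :
    PrimrecPred fun a => BaseRes (sysN (N a)) (lab (N a) (ll a)) (lab (N a) (lr a)) (lab (N a) (ul a)) (lab (N a) (ur a))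
      (lab (N a) (l a)) (lab (N a) (r a)) (lab (N a) (b a)) (lab (N a) (t a)) (lab (N a) (c a)) (lab (N a) (i a)) := by
  unfold BaseRes
  repeat' first
    | assumption
    | with_reducible refine qwF ?_ ?_ ?_
    | with_reducible refine qWF ?_ ?_ ?_
    | with_reducible refine PrimrecPred.or ?_ ?_

theorem qBaseResd (hN : Primrec N) (h1 : Primrec ll) (h2 : Primrec lr) (h3 : Primrec ul) (h4 : Primrec ur)
    (h5 : Primrec l) (h6 : Primrec r) (h7 : Primrec b) (h8 : Primrec t) (h9 : Primrec c) (hi : Primrec i) :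
    PrimrecPred fun a => BaseRes (sysN (N a)).dual (lab (N a) (ll a)) (lab (N a) (lr a)) (lab (N a) (ul a)) (lab (N a) (ur a))
      (lab (N a) (l a)) (lab (N a) (r a)) (lab (N a) (b a)) (lab (N a) (t a)) (lab (N a) (c a)) (lab (N a) (i a)) := by
  unfold BaseRes
  simp only [Sys.WF_dual]
  simp only [Sys.dual]
  repeat' first
    | assumption
    | with_reducible refine qwP ?_ ?_ ?_
    | with_reducible refine qWP ?_ ?_ ?_
    | with_reducible refine PrimrecPred.or ?_ ?_

theorem qCE {T : (a : α) → Tr (Fin (MN (N a)))} (hN : Primrec N) (hT : PTr N T) (h9 : Primrec c) :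
    PrimrecPred fun a => CE (sysN (N a)) (T a) (lab (N a) (c a)) := by
  unfold CE
  apply pExF hN
  have k0 := hN.comp (Primrec.fst (α := α) (β := ℕ))
  refine pExF k0 (P := fun (p : α × ℕ) q => (sysN (N p.1)).eqv (lab (N p.1) p.2) (lab (N p.1) (c p.1)) ∧
    (sysN (N p.1)).eqv q (lab (N p.1) (c p.1)) ∧ T p.1 = Tr.elem (sysN (N p.1)) (lab (N p.1) p.2) (lab (N p.1) (c p.1)) q) ?_
  have f : Primrec (fun p : (α × ℕ) × ℕ => p.1.1) := pFst Primrec.fst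
  have kN := hN.comp f
  have kc := h9.comp f
  have kp : Primrec (fun p : (α × ℕ) × ℕ => p.1.2) := pSnd Primrec.fst
  have kq : Primrec (fun p : (α × ℕ) × ℕ => p.2) := Primrec.snd
  exact (qeqv kN kp kc).and ((qeqv kN kq kc).and (qTr kN (hT.comp f) (tel kN kp kc kq)))

variable {V E0 E1 c0 c1 : α → ℕ}

theorem qTile (hN : Primrec N) (h0 : Primrec c0) (h1 : Primrec c1) (hV : Primrec V) (hE0 : Primrec E0) (hE1 : Primrec E1) :
    PrimrecPred fun a => TileD (sysN (N a)) (lab (N a) (c0 a)) (lab (N a) (c1 a)) (dec (N a) (V a)) (dec (N a) (E0 a))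
      (dec (N a) (E1 a)) := by
  unfold TileD
  refine (qCE hN (tlf hN hE0) h0).and ((qCE hN (tbt hN hE0) h0).and ((qCE hN (tbt hN hV) h0).and ((qCE hN (ttp hN hV) h1).and
    ((qCE hN (trt hN hE1) h1).and ((qCE hN (ttp hN hE1) h1).and (.and ?_ ?_))))))
  all_goals
    apply pExF hN
    refine pExF (N := fun p : α × ℕ => N p.1) (hN.comp Primrec.fst) ?_
    refine pExF (N := fun p : (α × ℕ) × ℕ => N p.1.1) (hN.comp (pFst Primrec.fst)) ?_
    have f : Primrec (fun p : ((α × ℕ) × ℕ) × ℕ => p.1.1.1) := pFst (pFst Primrec.fst)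
    have k0 := hN.comp f
    have k1 := h0.comp f
    have k2 := h1.comp f
    have k3 := hV.comp f
    have k4 := hE0.comp f
    have k5 := hE1.comp f
    have kg : Primrec (fun p : ((α × ℕ) × ℕ) × ℕ => p.1.1.2) := pSnd (pFst Primrec.fst)
    have ka : Primrec (fun p : ((α × ℕ) × ℕ) × ℕ => p.1.2) := pSnd Primrec.fst
    have kb : Primrec (fun p : ((α × ℕ) × ℕ) × ℕ => p.2) := Primrec.snd
  · exact (qLe k0 k1 kg).and ((qLe k0 kg k2).and ((qeqv k0 ka k1).and ((qeqv k0 kb k2).and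
      ((qTr k0 (ttp k0 k4) (tel k0 ka k1 kg)).and (qTr k0 (tlf k0 k3) (tcc (trt k0 k4) (tel k0 kg k2 kb)))))))
  · exact (qLe k0 k1 kg).and ((qLe k0 kg k2).and ((qeqv k0 ka k1).and ((qeqv k0 kb k2).and
      ((qTr k0 (tbt k0 k5) (tel k0 kg k2 kb)).and (qTr k0 (trt k0 k3) (tcc (tel k0 ka k1 kg) (tlf k0 k5)))))))

variable {x s ts u k0 k1 : α → ℕ}

theorem qNeedF (hN : Primrec N) (h0 : Primrec c0) (h1 : Primrec c1) (ht : Primrec t) (hu : Primrec u) (hx : Primrec x)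
    (hi : Primrec i) :
    PrimrecPred fun a => NeedF (sysN (N a)) (lab (N a) (c0 a)) (lab (N a) (c1 a)) (lab (N a) (t a)) (lab (N a) (u a))
      (dec (N a) (x a)).rF (lab (N a) (i a)) :=
  ((qA hN h0 hi).and ((qWF hN h0 hi).not.and (qA hN h1 hi).not)).or ((qrF hN hx hi).and
    ((qWF hN h0 hi).or ((qWF hN h1 hi).or ((qwF hN ht hi).or (qwF hN hu hi)))).not)

theorem qNeedP (hN : Primrec N) (h0 : Primrec c0) (h1 : Primrec c1) (ht : Primrec t) (hu : Primrec u) (hx : Primrec x)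
    (hi : Primrec i) :
    PrimrecPred fun a => NeedF (sysN (N a)).dual (lab (N a) (c1 a)) (lab (N a) (c0 a)) (lab (N a) (t a)) (lab (N a) (u a))
      (dec (N a) (x a)).rP (lab (N a) (i a)) := by
  unfold NeedF
  simp only [Sys.WF_dual]
  simp only [Sys.dual]
  exact ((qB hN h1 hi).and ((qWP hN h1 hi).not.and (qB hN h0 hi).not)).or ((qrP hN hx hi).and
    ((qWP hN h1 hi).or ((qWP hN h0 hi).or ((qwP hN ht hi).or (qwP hN hu hi)))).not)

/-- existence of a tile triple in a family, with a further condition on the middle tile -/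
theorem qTri {Q : (a : α) → Beh (Fin (MN (N a))) (Fin (MN (N a))) → Prop} (hN : Primrec N) (h0 : Primrec c0) (h1 : Primrec c1)
    (hs : Primrec s) (hQ : PrimrecPred fun p : α × ℕ => Q p.1 (dec (N p.1) p.2)) :
    PrimrecPred fun a => ∃ V E0 E1, decS (N a) (s a) V ∧ decS (N a) (s a) E0 ∧ decS (N a) (s a) E1 ∧
      TileD (sysN (N a)) (lab (N a) (c0 a)) (lab (N a) (c1 a)) V E0 E1 ∧ Q a V := by
  apply pExB hN
  refine pExB (N := fun p : α × ℕ => N p.1) (hN.comp Primrec.fst) ?_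
  refine pExB (N := fun p : (α × ℕ) × ℕ => N p.1.1) (hN.comp (pFst Primrec.fst)) ?_
  have f : Primrec (fun p : ((α × ℕ) × ℕ) × ℕ => p.1.1.1) := pFst (pFst Primrec.fst)
  have k0 := hN.comp f
  have k1 := h0.comp f
  have k2 := h1.comp f
  have k3 := hs.comp f
  have kg : Primrec (fun p : ((α × ℕ) × ℕ) × ℕ => p.1.1.2) := pSnd (pFst Primrec.fst)
  have ka : Primrec (fun p : ((α × ℕ) × ℕ) × ℕ => p.1.2) := pSnd Primrec.fst
  have kb : Primrec (fun p : ((α × ℕ) × ℕ) × ℕ => p.2) := Primrec.snd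
  exact (qS k0 k3 kg).and ((qS k0 k3 ka).and ((qS k0 k3 kb).and ((qTile k0 k1 k2 kg ka kb).and
    (hQ.comp (f := fun p : ((α × ℕ) × ℕ) × ℕ => (p.1.1.1, p.1.1.2)) (f.pair kg)))))

theorem qShuf (hN : Primrec N) (hs : Primrec s) (h0 : Primrec c0) (h1 : Primrec c1) (hts : Primrec ts) (ht : Primrec t)
    (hu : Primrec u) (hk0 : Primrec k0) (hk1 : Primrec k1) (hx : Primrec x) :
    PrimrecPred fun a => ShufRule (sysN (N a)) (decS (N a) (s a)) (lab (N a) (c0 a)) (lab (N a) (c1 a)) (lab (N a) (ts a))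
      (lab (N a) (t a)) (lab (N a) (u a)) (lab (N a) (k0 a)) (lab (N a) (k1 a)) (dec (N a) (x a)) := by
  unfold ShufRule
  have f : Primrec (Prod.fst : α × ℕ → α) := Primrec.fst
  have hN' := hN.comp f
  have hs' := hs.comp f
  have h0' := h0.comp f
  have h1' := h1.comp f
  have hts' := hts.comp f
  have ht' := ht.comp f
  have hu' := hu.comp f
  have hx' := hx.comp f
  have hi : Primrec (fun p : α × ℕ => p.2) := Primrec.snd
  refine PrimrecPred.and ?_ (.and ?_ (.and ?_ (.and ?_ (.and ?_ (.and ?_ ?_)))))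
  · exact (qLe hN h0 hts).and ((qLe hN hts h1).and ((qLe hN h0 ht).and ((qLe hN ht h1).and ((qLe hN h0 hu).and
      ((qLe hN hu h1).and ((qLe hN h1 h0).not.and ((qeqv hN hk0 h0).and (qeqv hN hk1 h1))))))))
  · exact pAllF hN (pImp (qA hN' hts' hi) ((qwF hN' hts' hi).or (qA hN' h1' hi)))
  · exact pAllF hN (pImp (qB hN' hts' hi) ((qwP hN' hts' hi).or (qB hN' h0' hi)))
  · exact (qTr hN (tlf hN hx) (tel hN hk0 h0 ht)).and ((qTr hN (tbt hN hx) (tel hN hk0 h0 hu)).and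
      ((qTr hN (ttp hN hx) (tel hN ht h1 hk1)).and (qTr hN (trt hN hx) (tel hN hu h1 hk1))))
  · exact (qTri (Q := fun _ _ => 0 = 0) hN h0 h1 hs (pEq (Primrec.const 0) (Primrec.const 0))).of_eq fun a => by simp
  · refine pAllF hN (pImp (qNeedF hN' h0' h1' ht' hu' hx' hi) ?_)
    refine qTri (Q := fun (p : α × ℕ) V => V.rF (lab (N p.1) p.2)) hN' h0' h1' hs' ?_
    exact qrF (hN'.comp Primrec.fst) Primrec.snd (hi.comp Primrec.fst)
  · refine pAllF hN (pImp (qNeedP hN' h0' h1' ht' hu' hx' hi) ?_)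
    refine qTri (Q := fun (p : α × ℕ) V => V.rP (lab (N p.1) p.2)) hN' h0' h1' hs' ?_
    exact qrP (hN'.comp Primrec.fst) Primrec.snd (hi.comp Primrec.fst)

theorem qBase (hN : Primrec N) (h1 : Primrec ll) (h2 : Primrec lr) (h3 : Primrec ul) (h4 : Primrec ur)
    (h5 : Primrec l) (h6 : Primrec r) (h7 : Primrec b) (h8 : Primrec t) (h9 : Primrec c) (hx : Primrec x) :
    PrimrecPred fun a => BaseRule (sysN (N a)) (lab (N a) (ll a)) (lab (N a) (lr a)) (lab (N a) (ul a)) (lab (N a) (ur a))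
      (lab (N a) (l a)) (lab (N a) (r a)) (lab (N a) (b a)) (lab (N a) (t a)) (lab (N a) (c a)) (dec (N a) (x a)) := by
  unfold BaseRule
  have f : Primrec (Prod.fst : α × ℕ → α) := Primrec.fst
  have hi : Primrec (fun p : α × ℕ => p.2) := Primrec.snd
  refine (qBaseLe hN h1 h2 h3 h4 h5 h6 h7 h8 h9).and ((qBaseF hN h1 h2 h3 h5 h6 h7 h8 h9).and
    ((qBaseFd hN h4 h3 h2 h6 h5 h8 h7 h9).and ((qTr hN (tlf hN hx) (tel hN h1 h5 h3)).and
    ((qTr hN (trt hN hx) (tel hN h2 h6 h4)).and ((qTr hN (tbt hN hx) (tel hN h1 h7 h2)).and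
    ((qTr hN (ttp hN hx) (tel hN h3 h8 h4)).and (.and ?_ ?_)))))))
  · exact pAllF hN (pImp (qrF (hN.comp f) (hx.comp f) hi) (qBaseRes (hN.comp f) (h1.comp f) (h2.comp f) (h3.comp f) (h4.comp f)
      (h5.comp f) (h6.comp f) (h7.comp f) (h8.comp f) (h9.comp f) hi))
  · exact pAllF hN (pImp (qrP (hN.comp f) (hx.comp f) hi) (qBaseResd (hN.comp f) (h4.comp f) (h3.comp f) (h2.comp f) (h1.comp f)
      (h6.comp f) (h5.comp f) (h8.comp f) (h7.comp f) (h9.comp f) hi))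

variable {xa xb xg xq c' z e e' p p' p2 p3 p4 p5 : α → ℕ}

theorem qLim (hN : Primrec N) (ha : Primrec xa) (hb : Primrec xb) (hg : Primrec xg) (hq : Primrec xq) (hc : Primrec c)
    (hc' : Primrec c') (hz : Primrec z) (he : Primrec e) (he' : Primrec e') (hp : Primrec p) (hp' : Primrec p')
    (hp2 : Primrec p2) (hp3 : Primrec p3) (hp4 : Primrec p4) (hp5 : Primrec p5) :
    PrimrecPred fun a => LimRule (sysN (N a)) (dec (N a) (xa a)) (dec (N a) (xb a)) (dec (N a) (xg a)) (dec (N a) (xq a))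
      (lab (N a) (c a)) (lab (N a) (c' a)) (lab (N a) (z a)) (lab (N a) (e a)) (lab (N a) (e' a)) (lab (N a) (p a))
      (lab (N a) (p' a)) (lab (N a) (p2 a)) (lab (N a) (p3 a)) (lab (N a) (p4 a)) (lab (N a) (p5 a)) := by
  unfold LimRule
  have f : Primrec (Prod.fst : α × ℕ → α) := Primrec.fst
  have hi : Primrec (fun p : α × ℕ => p.2) := Primrec.snd
  have kN := hN.comp f
  refine PrimrecPred.and ?_ (.and ?_ (.and ?_ (.and ?_ (.and ?_ (.and ?_ (.and ?_ (.and ?_ ?_)))))))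
  · exact (qLe hN hc hz).and ((qLe hN hz hc').and ((qLe hN hc he').and (qLe hN he hc')))
  · exact (qeqv hN hp hc).and ((qeqv hN hp2 hc).and ((qeqv hN hp' hc').and ((qeqv hN hp3 hc').and ((qeqv hN hp4 he').and
      (qeqv hN hp5 he)))))
  · exact (qTr hN (tlf hN hq) (tel hN hp hc hz)).and ((qTr hN (ttp hN hq) (tel hN hz hc' hp')).and
      ((qTr hN (tlf hN hb) (tel hN hp hc hp2)).and (qTr hN (ttp hN hg) (tel hN hp3 hc' hp'))))
  · exact (qTr hN (ttp hN hb) (tbt hN hq)).and ((qTr hN (tlf hN hg) (trt hN hq)).and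
      ((qTr hN (trt hN hb) (tlf hN ha)).and (qTr hN (ttp hN ha) (tbt hN hg))))
  · exact (qTr hN (tbt hN hq) (tcc (tbt hN hb) (tbt hN ha))).and ((qTr hN (trt hN hq) (tcc (trt hN ha) (trt hN hg))).and
      ((qTr hN (tbt hN hb) (tel hN hp he' hp4)).and (qTr hN (trt hN hg) (tel hN hp5 he hp'))))
  · exact pAllF hN (pImp (qA kN (hc.comp f) hi) ((qWF kN (hc.comp f) hi).or ((qA kN (hz.comp f) hi).or ((qA kN (he.comp f) hi).or
      ((qrF kN (ha.comp f) hi).or ((qrF kN (hb.comp f) hi).or (qrF kN (hg.comp f) hi)))))))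
  · exact pAllF hN (pImp (qB kN (hc'.comp f) hi) ((qWP kN (hc'.comp f) hi).or ((qB kN (hz.comp f) hi).or ((qB kN (he'.comp f) hi).or
      ((qrP kN (ha.comp f) hi).or ((qrP kN (hb.comp f) hi).or (qrP kN (hg.comp f) hi)))))))
  · exact pAllF hN (pImp (qrF kN (hq.comp f) hi) ((qrF kN (ha.comp f) hi).or ((qrF kN (hb.comp f) hi).or
      ((qrF kN (hg.comp f) hi).or (qwF kN (hz.comp f) hi)))))
  · exact pAllF hN (pImp (qrP kN (hq.comp f) hi) ((qrP kN (ha.comp f) hi).or ((qrP kN (hb.comp f) hi).or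
      ((qrP kN (hg.comp f) hi).or (qwP kN (hz.comp f) hi)))))

theorem closed_iff {L ι : Type} {σ : Sys L ι} {S : Beh L ι → Prop} : Closed σ S ↔
    (∀ β β', S β → β'.lf = β.bt → β'.rt = β.tp → β'.bt = β.lf → β'.tp = β.rt → (∀ i, β'.rF i ↔ β.rF i) →
      (∀ i, β'.rP i ↔ β.rP i) → S β') ∧
    (∀ β β1 β2, S β1 → S β2 → β1.rt = β2.lf → β.lf = β1.lf → β.rt = β2.rt →
      β.bt = β1.bt.conc β2.bt → β.tp = β1.tp.conc β2.tp → (∀ i, β.rF i → β1.rF i ∨ β2.rF i) →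
      (∀ i, β.rP i → β1.rP i ∨ β2.rP i) → S β) ∧
    (∀ ll lr ul ur l r b t c β, BaseRule σ ll lr ul ur l r b t c β → S β) ∧
    (∀ c c' z e e' p p' p2 p3 p4 p5 α β γ q, LimRule σ α β γ q c c' z e e' p p' p2 p3 p4 p5 →
      S α → S β → S γ → S q) ∧
    (∀ c0 c1 ts t t' k0 k1 β, ShufRule σ S c0 c1 ts t t' k0 k1 β → S β) := by
  constructor
  · intro h
    refine ⟨fun β β' hβ h1 h2 h3 h4 h5 h6 => ?_, h.join, h.base, fun _ _ _ _ _ _ _ _ _ _ _ _ _ _ _ => h.lim _ _ _ _ _ _ _ _ _ _ _ _ _ _ _,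
      h.shuf⟩
    have e : β' = β.swap := Beh.ext h1 h2 h3 h4 (funext fun i => propext (h5 i)) (funext fun i => propext (h6 i))
    rw [e]; exact h.swap β hβ
  · rintro ⟨h1, h2, h3, h4, h5⟩
    exact ⟨fun β hβ => h1 β _ hβ rfl rfl rfl rfl (fun _ => Iff.rfl) (fun _ => Iff.rfl), h2, h3,
      fun _ _ _ _ _ _ _ _ _ _ _ _ _ _ _ => h4 _ _ _ _ _ _ _ _ _ _ _ _ _ _ _, h5⟩

theorem qSwap (hN : Primrec N) (hs : Primrec s) : PrimrecPred fun a => ∀ β β', decS (N a) (s a) β → β'.lf = β.bt →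
    β'.rt = β.tp → β'.bt = β.lf → β'.tp = β.rt → (∀ i, β'.rF i ↔ β.rF i) → (∀ i, β'.rP i ↔ β.rP i) → decS (N a) (s a) β' := by
  apply pAllB hN
  refine pAllB (N := fun p : α × ℕ => N p.1) (hN.comp Primrec.fst) ?_
  have f : Primrec (fun p : (α × ℕ) × ℕ => p.1.1) := pFst Primrec.fst
  have kN := hN.comp f
  have ks := hs.comp f
  have hb : Primrec (fun p : (α × ℕ) × ℕ => p.1.2) := pSnd Primrec.fst
  have hb' : Primrec (fun p : (α × ℕ) × ℕ => p.2) := Primrec.snd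
  have g : Primrec (Prod.fst : ((α × ℕ) × ℕ) × ℕ → (α × ℕ) × ℕ) := Primrec.fst
  have hi : Primrec (fun p : ((α × ℕ) × ℕ) × ℕ => p.2) := Primrec.snd
  exact pImp (qS kN ks hb) (pImp (qTr kN (tlf kN hb') (tbt kN hb)) (pImp (qTr kN (trt kN hb') (ttp kN hb))
    (pImp (qTr kN (tbt kN hb') (tlf kN hb)) (pImp (qTr kN (ttp kN hb') (trt kN hb))
    (pImp (pAllF kN (pIff (qrF (kN.comp g) (hb'.comp g) hi) (qrF (kN.comp g) (hb.comp g) hi)))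
    (pImp (pAllF kN (pIff (qrP (kN.comp g) (hb'.comp g) hi) (qrP (kN.comp g) (hb.comp g) hi))) (qS kN ks hb')))))))

theorem qJoin (hN : Primrec N) (hs : Primrec s) : PrimrecPred fun a => ∀ β β1 β2, decS (N a) (s a) β1 → decS (N a) (s a) β2 →
      β1.rt = β2.lf → β.lf = β1.lf → β.rt = β2.rt →
      β.bt = β1.bt.conc β2.bt → β.tp = β1.tp.conc β2.tp → (∀ i, β.rF i → β1.rF i ∨ β2.rF i) →
      (∀ i, β.rP i → β1.rP i ∨ β2.rP i) → decS (N a) (s a) β := by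
  apply pAllB hN
  refine pAllB (N := fun p : α × ℕ => N p.1) (hN.comp Primrec.fst) ?_
  refine pAllB (N := fun p : (α × ℕ) × ℕ => N p.1.1) (hN.comp (pFst Primrec.fst)) ?_
  have f : Primrec (fun p : ((α × ℕ) × ℕ) × ℕ => p.1.1.1) := pFst (pFst Primrec.fst)
  have kN := hN.comp f
  have ks := hs.comp f
  have hb : Primrec (fun p : ((α × ℕ) × ℕ) × ℕ => p.1.1.2) := pSnd (pFst Primrec.fst)
  have h1 : Primrec (fun p : ((α × ℕ) × ℕ) × ℕ => p.1.2) := pSnd Primrec.fst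
  have h2 : Primrec (fun p : ((α × ℕ) × ℕ) × ℕ => p.2) := Primrec.snd
  have g : Primrec (Prod.fst : (((α × ℕ) × ℕ) × ℕ) × ℕ → ((α × ℕ) × ℕ) × ℕ) := Primrec.fst
  have hi : Primrec (fun p : (((α × ℕ) × ℕ) × ℕ) × ℕ => p.2) := Primrec.snd
  exact pImp (qS kN ks h1) (pImp (qS kN ks h2) (pImp (qTr kN (trt kN h1) (tlf kN h2)) (pImp (qTr kN (tlf kN hb) (tlf kN h1))
    (pImp (qTr kN (trt kN hb) (trt kN h2)) (pImp (qTr kN (tbt kN hb) (tcc (tbt kN h1) (tbt kN h2)))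
    (pImp (qTr kN (ttp kN hb) (tcc (ttp kN h1) (ttp kN h2)))
    (pImp (pAllF kN (pImp (qrF (kN.comp g) (hb.comp g) hi) ((qrF (kN.comp g) (h1.comp g) hi).or (qrF (kN.comp g) (h2.comp g) hi))))
    (pImp (pAllF kN (pImp (qrP (kN.comp g) (hb.comp g) hi) ((qrP (kN.comp g) (h1.comp g) hi).or (qrP (kN.comp g) (h2.comp g) hi))))
    (qS kN ks hb)))))))))


theorem qBaseC : PrimrecPred fun a : ℕ × ℕ => ∀ ll lr ul ur l r b t c β, BaseRule (sysN a.1) ll lr ul ur l r b t c β →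
    decS a.1 a.2 β := by
  iterate 9
    apply pAllF
    · repeat first | with_reducible exact Primrec.fst | with_reducible apply pFst
  iterate 1
    apply pAllB
    · repeat first | with_reducible exact Primrec.fst | with_reducible apply pFst
  refine pImp (qBase ?_ ?_ ?_ ?_ ?_ ?_ ?_ ?_ ?_ ?_ ?_) (qS ?_ ?_ ?_)
  all_goals repeat first | with_reducible exact Primrec.fst | with_reducible exact Primrec.snd | with_reducible apply pFst | with_reducible apply pSnd

theorem qLimC : PrimrecPred fun a : ℕ × ℕ => ∀ c c' z e e' p p' p2 p3 p4 p5 α β γ q,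
    LimRule (sysN a.1) α β γ q c c' z e e' p p' p2 p3 p4 p5 → decS a.1 a.2 α → decS a.1 a.2 β → decS a.1 a.2 γ → decS a.1 a.2 q := by
  iterate 11
    apply pAllF
    · repeat first | with_reducible exact Primrec.fst | with_reducible apply pFst
  iterate 4
    apply pAllB
    · repeat first | with_reducible exact Primrec.fst | with_reducible apply pFst
  refine pImp (qLim ?_ ?_ ?_ ?_ ?_ ?_ ?_ ?_ ?_ ?_ ?_ ?_ ?_ ?_ ?_ ?_) (pImp (qS ?_ ?_ ?_) (pImp (qS ?_ ?_ ?_) (pImp (qS ?_ ?_ ?_) (qS ?_ ?_ ?_))))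
  all_goals repeat first | with_reducible exact Primrec.fst | with_reducible exact Primrec.snd | with_reducible apply pFst | with_reducible apply pSnd

theorem qShufC : PrimrecPred fun a : ℕ × ℕ => ∀ c0 c1 ts t t' k0 k1 β, ShufRule (sysN a.1) (decS a.1 a.2) c0 c1 ts t t' k0 k1 β →
    decS a.1 a.2 β := by
  iterate 7
    apply pAllF
    · repeat first | with_reducible exact Primrec.fst | with_reducible apply pFst
  iterate 1
    apply pAllB
    · repeat first | with_reducible exact Primrec.fst | with_reducible apply pFst
  refine pImp (qShuf ?_ ?_ ?_ ?_ ?_ ?_ ?_ ?_ ?_ ?_) (qS ?_ ?_ ?_)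
  all_goals repeat first | with_reducible exact Primrec.fst | with_reducible exact Primrec.snd | with_reducible apply pFst | with_reducible apply pSnd

theorem qClosed : PrimrecPred fun a : ℕ × ℕ => Closed (sysN a.1) (decS a.1 a.2) := by
  simp only [closed_iff]
  exact (qSwap Primrec.fst Primrec.snd).and ((qJoin Primrec.fst Primrec.snd).and (qBaseC.and (qLimC.and qShufC)))

theorem exN_lab (N k : ℕ) (h : k < 6) : exN N k h = lab N (2 ^ (N + 1) + k) :=
  (lab_val (exN N k h)).symm

theorem qBd : PrimrecPred fun a : ℕ × ℕ => BdN a.1 (dec a.1 a.2) := by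
  unfold BdN
  simp only [exN_lab]
  have hN : Primrec (fun a : ℕ × ℕ => a.1) := Primrec.fst
  have hx : Primrec (fun a : ℕ × ℕ => a.2) := Primrec.snd
  have h : ∀ k, Primrec (fun a : ℕ × ℕ => 2 ^ (a.1 + 1) + k) := fun k => pAdd (pTop hN) (Primrec.const k)
  exact (qTr hN (tlf hN hx) (tel hN (h 0) (h 1) (h 1))).and ((qTr hN (tbt hN hx) (tel hN (h 0) (h 2) (h 2))).and
    ((qTr hN (ttp hN hx) (tel hN (h 1) (h 3) (h 5))).and (qTr hN (trt hN hx) (tel hN (h 2) (h 4) (h 5)))))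

theorem qMain : PrimrecPred fun N : ℕ => ∃ S, Closed (sysN N) S ∧ ∀ β, S β → ¬ BdN N β := by
  refine pExS (N := fun N : ℕ => N) Primrec.id (qClosed.and ?_)
  refine pAllB (N := fun a : ℕ × ℕ => a.1) Primrec.fst (pImp ?_ ?_)
  · exact qS (N := fun p : (ℕ × ℕ) × ℕ => p.1.1) (pFst Primrec.fst) (pSnd Primrec.fst) Primrec.snd
  · exact (qBd.comp (f := fun p : (ℕ × ℕ) × ℕ => (p.1.1, p.2)) ((pFst Primrec.fst).pair Primrec.snd)).not

theorem codeN_primrec : Primrec fun φ : TForm => codeN (.neg φ) := by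
  have h : Primrec fun φ : TForm => encodeT φ := Primrec.encode
  exact p5 4 (p5 3 (p5 1 h))

theorem final_dec : ComputablePred (fun φ : TForm => TValid (fun p q : ℝ × ℝ => p ≤ q) φ) :=
  ((qMain.comp codeN_primrec).of_eq fun φ => (valid_iff φ).symm).computablePred

end
end Temporal

namespace Temporal

/-- The validity problem for temporal formulas over the frame `(ℝ², ≤)`, where `≤`
is the componentwise order on ℝ², is decidable. -/
theorem validity_R2_le_decidable :
    ComputablePred (fun φ : TForm =>
      TValid (fun p q : ℝ × ℝ => p ≤ q) φ) := by
  exact final_dec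

end Temporal
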